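/- Let n > 2k ≥ 2, θ ∈ (0,1), and let Ω ⊂ ℝⁿ be a C^{2k,θ}-smooth bounded domain with exterior unit normal ν. For every integer r with 0 ≤ r ≤ 2k there exists a constant C = C(Ω, r) > 0 such that for every R > 0, every pair of concentric open balls B_R ⊂ B_{2R} of radii R and 2R, and every function v ∈ C^{2k}(closure(B_{2R} ∩ Ω)) satisfying (−Δ)^k v = 0 in B_{2R} ∩ Ω and v = ∂_ν v = … = ∂_ν^{(k−1)} v = 0 on B_{2R} ∩ ∂Ω, one has ‖∇^r v‖_{L^∞(B_R ∩ Ω)} ≤ (C/R^r) ‖v‖_{L^∞(B_{2R} ∩ Ω)}, where ∇^r v denotes the array of all r-th order partial derivatives of v. -/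

import Mathlib

open Metric Set MeasureTheory Bornology Filter Pointwise

noncomputable section

/-- Euclidean space `ℝⁿ`. -/
abbrev Euc (n : ℕ) : Type := EuclideanSpace ℝ (Fin n)

/-- A `C^{m,θ}`-smooth bounded domain of `ℝⁿ`, described via a defining function `ρ`
of class `C^m` whose `m`-th derivative is `θ`-Hölder continuous, with nonvanishing
gradient on the boundary. -/
def IsHolderDomain (n m : ℕ) (θ : ℝ) (Ω : Set (Euc n)) : Prop :=
  IsOpen Ω ∧ IsBounded Ω ∧ IsConnected Ω ∧
  ∃ ρ : Euc n → ℝ, ContDiff ℝ m ρ ∧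
    (∃ C : ℝ, ∀ x y : Euc n,
      ‖iteratedFDeriv ℝ m ρ x - iteratedFDeriv ℝ m ρ y‖ ≤ C * ‖x - y‖ ^ θ) ∧
    Ω = {x | ρ x < 0} ∧ frontier Ω = {x | ρ x = 0} ∧
    ∀ x ∈ frontier Ω, fderiv ℝ ρ x ≠ 0

/-- The Euclidean Laplacian `Δ f`. -/
def eucLap {n : ℕ} (f : Euc n → ℝ) (x : Euc n) : ℝ :=
  ∑ i : Fin n, iteratedFDeriv ℝ 2 f x ![EuclideanSpace.single i 1, EuclideanSpace.single i 1]

/-- The polyharmonic operator `(−Δ)^k`. -/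
def polyLap {n : ℕ} (k : ℕ) (f : Euc n → ℝ) : Euc n → ℝ :=
  (fun g x => - eucLap g x)^[k] f

/-- `θ`-Hölder continuity on a set. -/
def HolderOn {n : ℕ} (θ : ℝ) (f : Euc n → ℝ) (s : Set (Euc n)) : Prop :=
  ∃ C : ℝ, ∀ x ∈ s, ∀ y ∈ s, |f x - f y| ≤ C * ‖x - y‖ ^ θ

/-- `u ∈ C^{2k,θ}(D̄)` solves the Dirichlet problem `(−Δ)^k u = f` in `D`,
`u = ∂_ν u = … = ∂_ν^{(k−1)} u = 0` on `∂D` (the boundary conditions being encoded as the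
vanishing of all derivatives of order `< k` on the boundary). -/
def IsDirichletSolution {n : ℕ} (k : ℕ) (θ : ℝ) (D : Set (Euc n)) (f u : Euc n → ℝ) : Prop :=
  ContDiffOn ℝ (2*k) u (closure D) ∧
  (∃ C : ℝ, ∀ x ∈ closure D, ∀ y ∈ closure D,
      ‖iteratedFDerivWithin ℝ (2*k) u (closure D) x -
        iteratedFDerivWithin ℝ (2*k) u (closure D) y‖ ≤ C * ‖x - y‖ ^ θ) ∧
  (∀ x ∈ D, polyLap k u x = f x) ∧
  (∀ i : ℕ, i < k → ∀ x ∈ frontier D, iteratedFDerivWithin ℝ i u (closure D) x = 0)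

/-- `G` is the Dirichlet Green function of `(−Δ)^k` on `D`: for every `f ∈ C^{0,θ}(D̄)`,
`x ↦ ∫_D G(x,y) f(y) dy` is the unique solution of the Dirichlet problem. -/
def IsGreenFunction {n : ℕ} (k : ℕ) (θ : ℝ) (D : Set (Euc n)) (G : Euc n → Euc n → ℝ) : Prop :=
  ∀ f : Euc n → ℝ, ContinuousOn f (closure D) → HolderOn θ f (closure D) →
    IsDirichletSolution k θ D f (fun x => ∫ y in D, G x y * f y) ∧
    ∀ u : Euc n → ℝ, IsDirichletSolution k θ D f u →
      ∀ x ∈ closure D, u x = ∫ y in D, G x y * f y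

/-- The inversion at the unit sphere, `inv(x) = x/|x|²`. -/
def invMap {n : ℕ} (x : Euc n) : Euc n := (‖x‖ ^ 2)⁻¹ • x

/-- `ω₀ := inv(ℝⁿ ∖ ω̄) ∪ {0}`. -/
def omegaZero {n : ℕ} (ω : Set (Euc n)) : Set (Euc n) :=
  (invMap '' (closure ω)ᶜ) ∪ {0}

/-- The exterior Green function
`G_{(εω)^c}(x,y) := ε^{n−2k} |x|^{2k−n} |y|^{2k−n} G₀(ε·inv(x), ε·inv(y))`,
where `G₀` is the Dirichlet Green function of `(−Δ)^k` on `ω₀`. -/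
def extGreen {n : ℕ} (k : ℕ) (G₀ : Euc n → Euc n → ℝ) (ε : ℝ) (x y : Euc n) : ℝ :=
  ε ^ ((n : ℝ) - 2*k) * ‖x‖ ^ (2*(k:ℝ) - n) * ‖y‖ ^ (2*(k:ℝ) - n) *
    G₀ (ε • invMap x) (ε • invMap y)

section PolyharmonicEstimates

open scoped ContDiff Topology

set_option linter.unusedSectionVars false

variable {E : Type*} [NormedAddCommGroup E] [InnerProductSpace ℝ E] [FiniteDimensional ℝ E]
  [MeasurableSpace E] [BorelSpace E]

section Basics

/-- Directional derivative of `f` along `v`. -/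
def dd (v : E) (f : E → ℝ) : E → ℝ := fun x => fderiv ℝ f x v

/-- The Laplacian computed in the orthonormal basis `b`. -/
def lap {ι : Type*} [Fintype ι] (b : OrthonormalBasis ι ℝ E) (f : E → ℝ) : E → ℝ :=
  fun x => ∑ i, dd (b i) (dd (b i) f) x

/-- Iterated directional derivatives along a list of vectors. -/
def dl : List E → (E → ℝ) → (E → ℝ)
  | [], f => f
  | v :: L, f => dl L (dd v f)

variable {U : Set E} {f g : E → ℝ} {m n : ℕ∞ω} {v : E}

theorem dd_contDiffOn (hU : IsOpen U) (hf : ContDiffOn ℝ n f U) (hmn : m + 1 ≤ n) (v : E) :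
    ContDiffOn ℝ m (dd v f) U :=
  (hf.fderiv_of_isOpen hU hmn).clm_apply contDiffOn_const

theorem dd_contDiffOn_infty (hU : IsOpen U) (hf : ContDiffOn ℝ ∞ f U) (v : E) :
    ContDiffOn ℝ ∞ (dd v f) U :=
  dd_contDiffOn hU hf (by simp) v

theorem dd_congr (hU : IsOpen U) (h : EqOn f g U) (v : E) : EqOn (dd v f) (dd v g) U := by
  intro x hx
  have : f =ᶠ[𝓝 x] g := h.eventuallyEq_of_mem (hU.mem_nhds hx)
  simp [dd, this.fderiv_eq]

theorem dl_contDiffOn (hU : IsOpen U) (hf : ContDiffOn ℝ ∞ f U) (L : List E) :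
    ContDiffOn ℝ ∞ (dl L f) U := by
  induction L generalizing f with
  | nil => exact hf
  | cons v L ih => exact ih (dd_contDiffOn_infty hU hf v)

theorem dl_congr (hU : IsOpen U) (h : EqOn f g U) (L : List E) : EqOn (dl L f) (dl L g) U := by
  induction L generalizing f g with
  | nil => exact h
  | cons v L ih => exact ih (dd_congr hU h v)

theorem dl_append (L M : List E) (f : E → ℝ) : dl (L ++ M) f = dl M (dl L f) := by
  induction L generalizing f with
  | nil => rfl
  | cons v L ih => exact ih _

theorem diffAt_of (hU : IsOpen U) (hf : ContDiffOn ℝ n f U) (hn : 1 ≤ n) {x : E} (hx : x ∈ U) :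
    DifferentiableAt ℝ f x :=
  ((hf.differentiableOn (by rintro rfl; simp at hn)) x hx).differentiableAt (hU.mem_nhds hx)

theorem dd_add {x : E} (hf : DifferentiableAt ℝ f x) (hg : DifferentiableAt ℝ g x) (v : E) :
    dd v (fun y => f y + g y) x = dd v f x + dd v g x := by
  simp [dd, fderiv_fun_add hf hg]

theorem dd_mul {x : E} (hf : DifferentiableAt ℝ f x) (hg : DifferentiableAt ℝ g x) (v : E) :
    dd v (fun y => f y * g y) x = dd v f x * g x + f x * dd v g x := by
  simp [dd, fderiv_fun_mul hf hg]; ring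

theorem dd_sum {ι : Type*} (s : Finset ι) {F : ι → E → ℝ} {x : E}
    (hF : ∀ i ∈ s, DifferentiableAt ℝ (F i) x) (v : E) :
    dd v (fun y => ∑ i ∈ s, F i y) x = ∑ i ∈ s, dd v (F i) x := by
  simp [dd, fderiv_fun_sum hF]

theorem dd_const_mul {x : E} (hf : DifferentiableAt ℝ f x) (c : ℝ) (v : E) :
    dd v (fun y => c * f y) x = c * dd v f x := by
  simp [dd, fderiv_const_mul hf]

theorem dd_const (c : ℝ) (v : E) : dd v (fun _ : E => c) = fun _ => 0 := by
  ext x; simp [dd]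

theorem dl_zero (L : List E) : dl L (fun _ : E => (0:ℝ)) = fun _ => 0 := by
  induction L with
  | nil => rfl
  | cons v L ih => rw [dl, dd_const, ih]

theorem dd_dd_apply {x : E} (hf : ContDiffAt ℝ 2 f x) (v w : E) :
    dd w (dd v f) x = fderiv ℝ (fderiv ℝ f) x w v := by
  have : DifferentiableAt ℝ (fderiv ℝ f) x :=
    (hf.fderiv_right (m := 1) (by norm_num)).differentiableAt (by norm_num)
  have e : dd v f = fun y => fderiv ℝ f y v := rfl
  rw [e, dd, fderiv_clm_apply this (differentiableAt_const v)]
  simp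

theorem dd_comm {x : E} (hf : ContDiffAt ℝ 2 f x) (v w : E) :
    dd w (dd v f) x = dd v (dd w f) x := by
  rw [dd_dd_apply hf, dd_dd_apply hf]
  exact (hf.isSymmSndFDerivAt (by simp)) w v

theorem dd_comm_on (hU : IsOpen U) (hf : ContDiffOn ℝ n f U) (hn : 2 ≤ n) (v w : E) :
    EqOn (dd w (dd v f)) (dd v (dd w f)) U := fun _ hx =>
  dd_comm ((hf.contDiffAt (hU.mem_nhds hx)).of_le hn) v w

variable {ι : Type*} [Fintype ι] (b : OrthonormalBasis ι ℝ E)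

theorem lap_contDiffOn (hU : IsOpen U) (hf : ContDiffOn ℝ n f U) (hmn : m + 1 + 1 ≤ n) :
    ContDiffOn ℝ m (lap b f) U :=
  ContDiffOn.sum fun i _ => dd_contDiffOn hU (dd_contDiffOn hU hf hmn (b i)) le_rfl (b i)

theorem lap_congr (hU : IsOpen U) (h : EqOn f g U) : EqOn (lap b f) (lap b g) U := by
  intro x hx
  simp only [lap]
  exact Finset.sum_congr rfl fun i _ => dd_congr hU (dd_congr hU h (b i)) (b i) hx

theorem lapI_congr (hU : IsOpen U) (h : EqOn f g U) (j : ℕ) :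
    EqOn ((lap b)^[j] f) ((lap b)^[j] g) U := by
  induction j generalizing f g with
  | zero => exact h
  | succ j ih => exact ih (lap_congr b hU h)

theorem lapI_contDiffOn (hU : IsOpen U) {m j N : ℕ} (hf : ContDiffOn ℝ N f U)
    (h : m + 2 * j ≤ N) : ContDiffOn ℝ m ((lap b)^[j] f) U := by
  induction j generalizing f N with
  | zero => exact hf.of_le (by exact_mod_cast h)
  | succ j ih =>
    refine ih (N := m + 2 * j) (lap_contDiffOn b hU hf ?_) le_rfl
    norm_cast

theorem lapI_contDiffOn_infty (hU : IsOpen U) (hf : ContDiffOn ℝ ∞ f U) (j : ℕ) :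
    ContDiffOn ℝ ∞ ((lap b)^[j] f) U := by
  induction j generalizing f with
  | zero => exact hf
  | succ j ih => exact ih (lap_contDiffOn b hU hf (by simp))

theorem lap_dd_comm (hU : IsOpen U) (hf : ContDiffOn ℝ n f U) (hn : 3 ≤ n) (v : E) :
    EqOn (lap b (dd v f)) (dd v (lap b f)) U := by
  intro x hx
  have h1 : ∀ w, ContDiffOn ℝ 2 (dd w f) U := fun w => dd_contDiffOn hU hf (by
    refine le_trans ?_ hn; norm_num) w
  have h0 : ContDiffOn ℝ 2 f U := hf.of_le (le_trans (by norm_num) hn)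
  have e : lap b f = fun y => ∑ i, dd (b i) (dd (b i) f) y := rfl
  rw [e, dd_sum _ fun i _ => diffAt_of hU (dd_contDiffOn (m := 1) hU (h1 (b i)) (by norm_num) _)
    le_rfl hx]
  refine Finset.sum_congr rfl fun i _ => ?_
  rw [dd_congr hU (dd_comm_on hU h0 le_rfl v (b i)) (b i) hx]
  exact dd_comm_on hU (h1 (b i)) le_rfl v (b i) hx

theorem lapI_dd_comm (hU : IsOpen U) (hf : ContDiffOn ℝ ∞ f U) (v : E) (j : ℕ) :
    EqOn ((lap b)^[j] (dd v f)) (dd v ((lap b)^[j] f)) U := by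
  induction j generalizing f with
  | zero => exact fun x _ => rfl
  | succ j ih =>
    intro x hx
    have h3 : EqOn (lap b (dd v f)) (dd v (lap b f)) U :=
      lap_dd_comm b hU hf (WithTop.coe_le_coe.2 (le_top : (3 : ℕ∞) ≤ ⊤)) v
    rw [Function.iterate_succ_apply, lapI_congr b hU h3 j hx,
      ih (lap_contDiffOn b hU hf (by simp)) hx]
    rfl

theorem lap_add {x : E} (hf : ContDiffAt ℝ 2 f x) (hg : ContDiffAt ℝ 2 g x) :
    lap b (fun y => f y + g y) x = lap b f x + lap b g x := by
  obtain ⟨U, hU, hx, hfU, hgU⟩ : ∃ U : Set E, IsOpen U ∧ x ∈ U ∧ ContDiffOn ℝ 2 f U ∧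
      ContDiffOn ℝ 2 g U := by
    obtain ⟨u, hu, hfu⟩ := hf.contDiffOn (m := 2) le_rfl (by simp)
    obtain ⟨w, hw, hgw⟩ := hg.contDiffOn (m := 2) le_rfl (by simp)
    obtain ⟨t, ht, hto, hxt⟩ := _root_.mem_nhds_iff.1 (inter_mem (by simpa using hu) (by simpa using hw))
    exact ⟨t, hto, hxt, hfu.mono fun y hy => (ht hy).1, hgw.mono fun y hy => (ht hy).2⟩
  simp only [lap, ← Finset.sum_add_distrib]
  refine Finset.sum_congr rfl fun i _ => ?_
  have e : EqOn (dd (b i) (fun y => f y + g y)) (fun y => dd (b i) f y + dd (b i) g y) U :=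
    fun y hy => dd_add (diffAt_of hU hfU (by norm_num) hy) (diffAt_of hU hgU (by norm_num) hy) _
  rw [dd_congr hU e _ hx, dd_add]
  · exact diffAt_of hU (dd_contDiffOn (m := 1) hU hfU (by norm_num) _) le_rfl hx
  · exact diffAt_of hU (dd_contDiffOn (m := 1) hU hgU (by norm_num) _) le_rfl hx

theorem lap_const_mul (c : ℝ) (f : E → ℝ) :
    lap b (fun y => c * f y) = fun y => c * lap b f y := by
  have : ∀ (v : E) (f : E → ℝ), dd v (fun y => c * f y) = fun y => c * dd v f y := by
    intro v f
    ext x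
    have : (fun y => c * f y) = c • f := rfl
    simp [dd, this, fderiv_const_smul_field]
  ext x
  simp [lap, this, Finset.mul_sum]

theorem lapI_const_mul (c : ℝ) (f : E → ℝ) (j : ℕ) :
    (lap b)^[j] (fun y => c * f y) = fun y => c * (lap b)^[j] f y := by
  induction j generalizing f with
  | zero => rfl
  | succ j ih => rw [Function.iterate_succ_apply, lap_const_mul, ih]; rfl

theorem lapI_add (hU : IsOpen U) {j : ℕ} (hf : ContDiffOn ℝ (2 * j : ℕ) f U)
    (hg : ContDiffOn ℝ (2 * j : ℕ) g U) :
    EqOn ((lap b)^[j] (fun y => f y + g y))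
      (fun y => (lap b)^[j] f y + (lap b)^[j] g y) U := by
  induction j generalizing f g with
  | zero => exact fun x _ => rfl
  | succ j ih =>
    intro x hx
    have h2 : ((2 : ℕ) : ℕ∞ω) ≤ ((2 * (j + 1) : ℕ) : ℕ∞ω) := by norm_cast; omega
    have e : EqOn (lap b (fun y => f y + g y)) (fun y => lap b f y + lap b g y) U := fun y hy =>
      lap_add b ((hf.contDiffAt (hU.mem_nhds hy)).of_le h2)
        ((hg.contDiffAt (hU.mem_nhds hy)).of_le h2)
    rw [Function.iterate_succ_apply, lapI_congr b hU e j hx,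
      ih (lap_contDiffOn b hU hf (by norm_cast)) (lap_contDiffOn b hU hg (by norm_cast)) hx]
    rfl

theorem lapI_sub (hU : IsOpen U) {j : ℕ} (hf : ContDiffOn ℝ (2 * j : ℕ) f U)
    (hg : ContDiffOn ℝ (2 * j : ℕ) g U) :
    EqOn ((lap b)^[j] (fun y => f y - g y))
      (fun y => (lap b)^[j] f y - (lap b)^[j] g y) U := by
  intro x hx
  have := lapI_add b hU hf (g := fun y => -1 * g y) (contDiffOn_const.mul hg) hx
  simp only [lapI_const_mul] at this
  simpa [sub_eq_add_neg] using this

theorem dd_comp_affine (f : E → ℝ) (x₀ : E) (t : ℝ) (v : E) :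
    dd v (fun y => f (x₀ + t • y)) = fun y => t * dd v f (x₀ + t • y) := by
  ext y
  have := fderiv_comp_smul (𝕜 := ℝ) (f := fun z => f (x₀ + z)) (x := y) t
  simp only [dd]
  rw [this, fderiv_comp_add_left]
  simp

theorem dl_comp_affine (f : E → ℝ) (x₀ : E) (t : ℝ) (L : List E) :
    dl L (fun y => f (x₀ + t • y)) = fun y => t ^ L.length * dl L f (x₀ + t • y) := by
  have hc : ∀ (c : ℝ) (L : List E) (f : E → ℝ), dl L (fun y => c * f y) =
      fun y => c * dl L f y := by
    intro c L
    induction L with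
    | nil => intro f; rfl
    | cons v L ih =>
      intro f
      have : dd v (fun y => c * f y) = fun y => c * dd v f y := by
        ext x
        have : (fun y => c * f y) = c • f := rfl
        simp [dd, this, fderiv_const_smul_field]
      rw [dl, this, ih]; rfl
  induction L generalizing f with
  | nil => simp [dl]
  | cons v L ih =>
    rw [dl, dd_comp_affine f x₀ t, hc, ih]
    ext y
    simp [dl, pow_succ]; ring

theorem lap_comp_affine (f : E → ℝ) (x₀ : E) (t : ℝ) :
    lap b (fun y => f (x₀ + t • y)) = fun y => t ^ 2 * lap b f (x₀ + t • y) := by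
  ext y
  have := fun v => congrFun (dl_comp_affine f x₀ t [v, v]) y
  simp only [dl, List.length] at this
  simp [lap, this, Finset.mul_sum]

theorem lapI_comp_affine (f : E → ℝ) (x₀ : E) (t : ℝ) (j : ℕ) :
    (lap b)^[j] (fun y => f (x₀ + t • y)) =
      fun y => t ^ (2 * j) * (lap b)^[j] f (x₀ + t • y) := by
  induction j generalizing f with
  | zero => simp
  | succ j ih =>
    rw [Function.iterate_succ_apply, lap_comp_affine b f x₀ t, lapI_const_mul, ih]
    ext y
    simp only [Function.iterate_succ_apply]
    ring

theorem lap_eq_lap {ι' : Type*} [Fintype ι']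
    (b' : OrthonormalBasis ι' ℝ E) (hU : IsOpen U)
    (hf : ContDiffOn ℝ 2 f U) : EqOn (lap b f) (lap b' f) U := by
  intro x hx
  have h1 := congrFun (InnerProductSpace.laplacian_eq_iteratedFDeriv_orthonormalBasis f b) x
  have h2 := congrFun (InnerProductSpace.laplacian_eq_iteratedFDeriv_orthonormalBasis f b') x
  have e2 : lap b' f x = ∑ i, iteratedFDeriv ℝ 2 f x ![b' i, b' i] := by
    refine Finset.sum_congr rfl fun i _ => ?_
    rw [dd_dd_apply (hf.contDiffAt (hU.mem_nhds hx)), iteratedFDeriv_two_apply]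
    simp
  have e1 : lap b f x = ∑ i, iteratedFDeriv ℝ 2 f x ![b i, b i] := by
    refine Finset.sum_congr rfl fun i _ => ?_
    rw [dd_dd_apply (hf.contDiffAt (hU.mem_nhds hx)), iteratedFDeriv_two_apply]
    simp
  rw [e1, e2, ← h1, ← h2]

theorem lapI_eq_lapI {ι' : Type*} [Fintype ι']
    (b' : OrthonormalBasis ι' ℝ E) (hU : IsOpen U) {j : ℕ}
    (hf : ContDiffOn ℝ (2 * j : ℕ) f U) : EqOn ((lap b)^[j] f) ((lap b')^[j] f) U := by
  induction j generalizing f with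
  | zero => exact fun x _ => rfl
  | succ j ih =>
    intro x hx
    have h2 : ((2 : ℕ) : ℕ∞ω) ≤ ((2 * (j + 1) : ℕ) : ℕ∞ω) := by norm_cast; omega
    rw [Function.iterate_succ_apply, Function.iterate_succ_apply,
      ← lapI_congr b' hU (lap_eq_lap b b' hU (hf.of_le h2)) j hx]
    exact ih (lap_contDiffOn b hU hf (by norm_cast)) hx

theorem iteratedFDeriv_apply_eq_dl (hU : IsOpen U) {r : ℕ} (hf : ContDiffOn ℝ r f U)
    (m : Fin r → E) :
    EqOn (fun x => iteratedFDeriv ℝ r f x m) (dl (List.ofFn m).reverse f) U := by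
  induction r generalizing f with
  | zero => intro x _; simp [dl]
  | succ r ih =>
    have hf' : ContDiffOn ℝ r (dd (m (Fin.last r)) f) U := dd_contDiffOn hU hf (by norm_cast) _
    intro x hx
    have he := ih hf' (Fin.init m) hx
    simp only at he
    rw [List.ofFn_succ', List.concat_eq_append, List.reverse_append, List.reverse_singleton,
      List.singleton_append, dl]
    have hd : ContDiffAt ℝ r (fderiv ℝ f) x :=
      (hf.fderiv_of_isOpen hU (by norm_cast)).contDiffAt (hU.mem_nhds hx)
    have h3 := ContinuousLinearMap.iteratedFDeriv_comp_left
      (ContinuousLinearMap.apply ℝ ℝ (m (Fin.last r))) hd (i := r) le_rfl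
    have e2 : (⇑(ContinuousLinearMap.apply ℝ ℝ (m (Fin.last r))) ∘ fderiv ℝ f)
      = dd (m (Fin.last r)) f := rfl
    rw [e2] at h3
    rw [h3] at he
    simp only
    rw [iteratedFDeriv_succ_apply_right]
    exact he

theorem norm_iteratedFDeriv_le_of_dl (hU : IsOpen U) {r : ℕ} (hf : ContDiffOn ℝ r f U) {x : E}
    (hx : x ∈ U) {C : ℝ} (hC : 0 ≤ C)
    (h : ∀ L : List E, L.length = r → |dl L f x| ≤ C * (L.map norm).prod) :
    ‖iteratedFDeriv ℝ r f x‖ ≤ C := by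
  refine ContinuousMultilinearMap.opNorm_le_bound hC fun m => ?_
  have he := iteratedFDeriv_apply_eq_dl hU hf m hx
  simp only at he
  rw [he]
  refine (h _ (by simp)).trans_eq ?_
  rw [List.map_reverse, List.prod_reverse, List.map_ofFn, List.prod_ofFn]
  rfl

end Basics

section Kernel

/-- A smooth profile on the line, positive on `(-∞, 1)` and vanishing on `[1, ∞)`. -/
structure IsProfile (h : ℝ → ℝ) : Prop where
  smooth : ContDiff ℝ ∞ h
  zero : ∀ s, 1 ≤ s → h s = 0
  pos : ∀ s, s < 1 → 0 < h s

/-- Half the primitive of `-h` vanishing at `1`. -/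
def profPrim (h : ℝ → ℝ) : ℝ → ℝ := fun s => (1 / 2) * ∫ τ in s..1, h τ

theorem IsProfile.hasDerivAt_prim {h : ℝ → ℝ} (hh : IsProfile h) (s : ℝ) :
    HasDerivAt (profPrim h) (-(h s) / 2) s := by
  have hc := hh.smooth.continuous
  have := (intervalIntegral.integral_hasDerivAt_left (hc.intervalIntegrable s 1)
    (hc.stronglyMeasurableAtFilter _ _) hc.continuousAt).const_mul (1 / 2 : ℝ)
  refine this.congr_deriv ?_
  ring

theorem IsProfile.prim {h : ℝ → ℝ} (hh : IsProfile h) : IsProfile (profPrim h) where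
  smooth := by
    rw [contDiff_infty_iff_deriv]
    refine ⟨fun s => (hh.hasDerivAt_prim s).differentiableAt, ?_⟩
    have : deriv (profPrim h) = fun s => -(h s) / 2 := funext fun s => (hh.hasDerivAt_prim s).deriv
    rw [this]
    exact (hh.smooth.neg).div_const 2
  zero := by
    intro s hs
    have : ∫ τ in s..1, h τ = 0 := by
      rw [intervalIntegral.integral_congr (g := fun _ => (0:ℝ)), intervalIntegral.integral_zero]
      intro τ hτ
      rw [uIcc_of_ge hs] at hτ
      exact hh.zero τ hτ.1
    simp [profPrim, this]
  pos := by
    intro s hs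
    have := intervalIntegral.intervalIntegral_pos_of_pos_on
      (hh.smooth.continuous.intervalIntegrable s 1) (fun x hx => hh.pos x hx.2) hs
    simp only [profPrim]
    linarith

theorem exists_profile : ∃ h : ℝ → ℝ, IsProfile h := by
  refine ⟨fun s => Real.smoothTransition (1 - s), ?_, ?_, ?_⟩
  · exact Real.smoothTransition.contDiff.comp (contDiff_const.sub contDiff_id)
  · intro s hs
    exact Real.smoothTransition.zero_of_nonpos (by linarith)
  · intro s hs
    exact Real.smoothTransition.pos_of_pos (by linarith)

/-- Radial mean of `V` at scale `t` around `x`. -/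
def rmean (V : E → ℝ) (h : ℝ → ℝ) (x : E) (t : ℝ) : ℝ :=
  ∫ y, V (x + t • y) * h (‖y‖ ^ 2)

theorem IsProfile.contDiff_radial {h : ℝ → ℝ} (hh : IsProfile h) :
    ContDiff ℝ ∞ (fun y : E => h (‖y‖ ^ 2)) :=
  hh.smooth.comp (contDiff_norm_sq ℝ)

theorem IsProfile.radial_eq_zero {h : ℝ → ℝ} (hh : IsProfile h) {y : E}
    (hy : y ∉ ball (0:E) 1) : h (‖y‖ ^ 2) = 0 := by
  apply hh.zero
  simp only [mem_ball, dist_zero_right, not_lt] at hy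
  nlinarith

theorem IsProfile.support_radial {h : ℝ → ℝ} (hh : IsProfile h) :
    Function.support (fun y : E => h (‖y‖ ^ 2)) ⊆ closedBall 0 1 := by
  intro y hy
  by_contra hy'
  exact hy (hh.radial_eq_zero fun h => hy' (ball_subset_closedBall h))

theorem IsProfile.compact_radial {h : ℝ → ℝ} (hh : IsProfile h) :
    HasCompactSupport (fun y : E => h (‖y‖ ^ 2)) :=
  HasCompactSupport.of_support_subset_isCompact (isCompact_closedBall 0 1) hh.support_radial

theorem IsProfile.integral_pos {h : ℝ → ℝ} (hh : IsProfile h) :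
    0 < ∫ y : E, h (‖y‖ ^ 2) := by
  refine hh.contDiff_radial.continuous.integral_pos_of_hasCompactSupport_nonneg_nonzero
    hh.compact_radial ?_ (x := 0) ?_
  · intro y
    simp only [Pi.zero_apply]
    rcases lt_or_ge (‖y‖ ^ 2) 1 with h1 | h1
    · exact (hh.pos _ h1).le
    · exact (hh.zero _ h1).ge
  · simpa using (hh.pos 0 zero_lt_one).ne'

theorem IsProfile.nonneg {h : ℝ → ℝ} (hh : IsProfile h) (s : ℝ) : 0 ≤ h s := by
  rcases lt_or_ge s 1 with h1 | h1
  · exact (hh.pos _ h1).le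
  · exact (hh.zero _ h1).ge

theorem integrable_mul_radial {g : E → ℝ} (hg : Continuous g) {h : ℝ → ℝ} (hh : IsProfile h) :
    Integrable (fun y => g y * h (‖y‖ ^ 2)) :=
  (hg.mul hh.contDiff_radial.continuous).integrable_of_hasCompactSupport
    hh.compact_radial.mul_left

theorem abs_rmean_le {V : E → ℝ} {h : ℝ → ℝ} (hh : IsProfile h) {x : E} {t F : ℝ}
    (ht : 0 ≤ t) (hF : ∀ y ∈ closedBall x t, |V y| ≤ F) :
    |rmean V h x t| ≤ F * ∫ y : E, h (‖y‖ ^ 2) := by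
  have hi : Integrable (fun y : E => F * h (‖y‖ ^ 2)) :=
    integrable_mul_radial (continuous_const (y := F)) hh
  have h1 : |rmean V h x t| ≤ ∫ y : E, F * h (‖y‖ ^ 2) := by
    rw [rmean, ← Real.norm_eq_abs]
    refine norm_integral_le_of_norm_le hi (Eventually.of_forall fun y => ?_)
    rw [norm_mul, Real.norm_eq_abs, Real.norm_of_nonneg (hh.nonneg _)]
    by_cases hy : y ∈ ball (0:E) 1
    · refine mul_le_mul_of_nonneg_right (hF _ ?_) (hh.nonneg _)
      simp only [mem_ball, dist_zero_right] at hy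
      simp only [mem_closedBall, dist_self_add_left, norm_smul, Real.norm_of_nonneg ht]
      nlinarith
    · simp [hh.radial_eq_zero hy]
  rwa [integral_const_mul] at h1

theorem dd_radial {h : ℝ → ℝ} (hh : IsProfile h) (v y : E) :
    fderiv ℝ (fun y : E => profPrim h (‖y‖ ^ 2)) y v = -(inner ℝ y v * h (‖y‖ ^ 2)) := by
  have h1 : HasFDerivAt (fun y : E => ‖y‖ ^ 2) (2 • (innerSL ℝ y)) y :=
    (hasStrictFDerivAt_norm_sq y).hasFDerivAt
  have := (hh.hasDerivAt_prim (‖y‖ ^ 2)).comp_hasFDerivAt y h1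
  have e : (fun y : E => profPrim h (‖y‖ ^ 2)) = profPrim h ∘ fun y : E => ‖y‖ ^ 2 := rfl
  rw [e, this.fderiv]
  simp
  ring

variable {ι : Type*} [Fintype ι] (b : OrthonormalBasis ι ℝ E)

theorem hasDerivAt_rmean {V : E → ℝ} (hV : ContDiff ℝ 2 V) {h : ℝ → ℝ} (hh : IsProfile h)
    (x : E) (t : ℝ) :
    HasDerivAt (rmean V h x) (t * rmean (lap b V) (profPrim h) x t) t := by
  have hV1 : Differentiable ℝ V := hV.differentiable (by norm_num)
  have hcf : Continuous (fderiv ℝ V) := hV.continuous_fderiv (by norm_num)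
  set F' : ℝ → E → ℝ := fun τ y => fderiv ℝ V (x + τ • y) y * h (‖y‖ ^ 2) with hF'
  have hcF' : Continuous (fun p : ℝ × E => F' p.1 p.2) := by
    refine Continuous.mul ?_ (hh.contDiff_radial.continuous.comp continuous_snd)
    exact (hcf.comp (by fun_prop)).clm_apply continuous_snd
  obtain ⟨K, hK⟩ := ((isCompact_closedBall t 1).prod (isCompact_closedBall (0:E) 1)).exists_bound_of_continuousOn
    hcF'.continuousOn
  have hd : HasDerivAt (rmean V h x) (∫ y, F' t y) t := by
    refine (hasDerivAt_integral_of_dominated_loc_of_deriv_le (s := ball t 1)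
      (bound := (closedBall (0:E) 1).indicator fun _ => K) (ball_mem_nhds t one_pos)
      (Eventually.of_forall fun τ => ?_) ?_ ?_ ?_ ?_ ?_).2
    · exact (integrable_mul_radial (g := fun y => V (x + τ • y))
        (hV.continuous.comp (by fun_prop)) hh).aestronglyMeasurable
    · exact integrable_mul_radial (g := fun y => V (x + t • y))
        (hV.continuous.comp (by fun_prop)) hh
    · exact (hcF'.comp (by fun_prop : Continuous fun y : E => (t, y))).aestronglyMeasurable
    · refine Eventually.of_forall fun y τ hτ => ?_
      by_cases hy : y ∈ closedBall (0:E) 1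
      · rw [indicator_of_mem hy]
        exact hK (τ, y) ⟨ball_subset_closedBall hτ, hy⟩
      · have : F' τ y = 0 := by
          simp [hF', hh.radial_eq_zero fun h => hy (ball_subset_closedBall h)]
        rw [indicator_of_notMem hy, this, norm_zero]
    · exact (integrable_indicator_iff measurableSet_closedBall).2
        (integrableOn_const (isCompact_closedBall _ _).measure_lt_top.ne)
    · refine Eventually.of_forall fun y τ _ => ?_
      have h1 : HasDerivAt (fun τ : ℝ => x + τ • y) y τ := by
        simpa using ((hasDerivAt_id τ).smul_const y).const_add x
      have := (hV1 (x + τ • y)).hasFDerivAt.comp_hasDerivAt τ h1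
      exact this.mul_const _
  convert hd using 1
  have hdd : ∀ i, ContDiff ℝ 1 (dd (b i) V) := fun i => by
    rw [← contDiffOn_univ]
    exact dd_contDiffOn isOpen_univ hV.contDiffOn (by norm_num) _
  have hdd2 : ∀ i, Continuous (dd (b i) (dd (b i) V)) := fun i => by
    rw [← contDiff_zero (𝕜 := ℝ), ← contDiffOn_univ]
    exact dd_contDiffOn isOpen_univ (hdd i).contDiffOn (by norm_num) _
  have hg : ∀ i, ContDiff ℝ 1 fun y => dd (b i) V (x + t • y) := fun i =>
    (hdd i).comp (by fun_prop)
  have e1 : ∀ y, F' t y = ∑ i, dd (b i) V (x + t • y) * (inner ℝ y (b i) * h (‖y‖ ^ 2)) := by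
    intro y
    have : fderiv ℝ V (x + t • y) y = ∑ i, inner ℝ y (b i) * dd (b i) V (x + t • y) := by
      have e := congrArg (fderiv ℝ V (x + t • y)) (b.sum_repr y)
      rw [← e]
      simp only [map_sum, map_smul, smul_eq_mul, b.repr_apply_apply, dd, real_inner_comm]
    simp only [hF', this, Finset.sum_mul]
    exact Finset.sum_congr rfl fun i _ => by ring
  have e2 : ∀ i, ∫ y, dd (b i) V (x + t • y) * (inner ℝ y (b i) * h (‖y‖ ^ 2)) =
      ∫ y, t * dd (b i) (dd (b i) V) (x + t • y) * profPrim h (‖y‖ ^ 2) := by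
    intro i
    have hcd : ∀ y, fderiv ℝ (fun y => dd (b i) V (x + t • y)) y (b i) =
        t * dd (b i) (dd (b i) V) (x + t • y) := fun y =>
      congrFun (dd_comp_affine (dd (b i) V) x t (b i)) y
    have := integral_mul_fderiv_eq_neg_fderiv_mul_of_integrable (μ := (volume : Measure E))
      (f := fun y => dd (b i) V (x + t • y)) (g := fun y => profPrim h (‖y‖ ^ 2)) (v := b i)
      ?_ ?_ ?_ ?_ ?_
    · simp only [dd_radial hh, hcd, mul_neg, integral_neg, neg_inj] at this
      exact this
    · simp only [hcd]
      exact integrable_mul_radial (g := fun y => t * dd (b i) (dd (b i) V) (x + t • y))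
        (continuous_const.mul ((hdd2 i).comp (by fun_prop))) hh.prim
    · simp only [dd_radial hh, mul_neg]
      have := integrable_mul_radial (g := fun y => dd (b i) V (x + t • y) * inner ℝ y (b i))
        ((hg i).continuous.mul (by fun_prop)) hh
      refine this.neg.congr (Eventually.of_forall fun y => ?_)
      simp only [Pi.neg_apply]; ring
    · exact integrable_mul_radial (hg i).continuous hh.prim
    · exact fun y _ => (hg i).differentiable (by norm_num) y
    · exact fun y _ => hh.prim.contDiff_radial.differentiable (by simp) y
  simp only [e1]
  rw [integral_finsetSum]
  · simp only [e2]
    rw [← integral_finsetSum]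
    · rw [rmean, ← integral_const_mul]
      congr 1
      ext y
      simp only [lap, Finset.sum_mul, Finset.mul_sum]
      exact Finset.sum_congr rfl fun i _ => by ring
    · intro i _
      exact integrable_mul_radial (g := fun y => t * dd (b i) (dd (b i) V) (x + t • y))
        (continuous_const.mul ((hdd2 i).comp (by fun_prop))) hh.prim
  · intro i _
    have := integrable_mul_radial (g := fun y => dd (b i) V (x + t • y) * inner ℝ y (b i))
        ((hg i).continuous.mul (by fun_prop)) hh
    refine this.congr (Eventually.of_forall fun y => ?_)
    simp only; ring

theorem rmean_zero (V : E → ℝ) (h : ℝ → ℝ) (x : E) :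
    rmean V h x 0 = V x * ∫ y : E, h (‖y‖ ^ 2) := by
  simp [rmean, integral_const_mul]

/-- Pizzetti-type expansion of radial means. -/
theorem rmean_expansion (k : ℕ) {h : ℝ → ℝ} (hh : IsProfile h) :
    ∃ c : ℕ → ℝ, ∃ C : ℝ, 0 ≤ C ∧ (∀ i, 0 < c i) ∧ ∀ (V : E → ℝ), ContDiff ℝ (2 * k : ℕ) V →
      ∀ (x : E) (t F : ℝ), 0 ≤ t → (∀ y ∈ closedBall x t, |(lap b)^[k] V y| ≤ F) →
      |rmean V h x t - ∑ i ∈ Finset.range k, c i * (lap b)^[i] V x * t ^ (2 * i)| ≤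
        C * F * t ^ (2 * k) := by
  induction k generalizing h with
  | zero =>
    refine ⟨fun _ => 1, ∫ y : E, h (‖y‖ ^ 2), hh.integral_pos.le, by simp, ?_⟩
    intro V _ x t F ht hF
    simpa [mul_comm] using abs_rmean_le hh ht hF
  | succ k ih =>
    obtain ⟨c, C, hC, hc, H⟩ := ih hh.prim
    refine ⟨fun i => if i = 0 then ∫ y : E, h (‖y‖ ^ 2) else c (i - 1) / (2 * i), C, hC, ?_, ?_⟩
    · intro i
      simp only
      split_ifs with h0
      · exact hh.integral_pos
      · have : (0:ℝ) < i := by exact_mod_cast Nat.pos_of_ne_zero h0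
        have := hc (i - 1)
        positivity
    intro V hV x t F ht hF
    have hV2 : ContDiff ℝ 2 V := hV.of_le (by norm_cast; omega)
    have hl : ContDiff ℝ (2 * k : ℕ) (lap b V) := by
      rw [← contDiffOn_univ]
      exact lap_contDiffOn b isOpen_univ hV.contDiffOn (by norm_cast)
    have hF0 : 0 ≤ F := (abs_nonneg _).trans (hF x (mem_closedBall_self ht))
    set φ : ℝ → ℝ := fun τ => rmean V h x τ -
      ∑ i ∈ Finset.range k, c i / (2 * (i + 1 : ℕ)) * (lap b)^[i + 1] V x * τ ^ (2 * (i + 1))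
      with hφ
    have hφd : ∀ τ, HasDerivAt φ (τ * (rmean (lap b V) (profPrim h) x τ -
        ∑ i ∈ Finset.range k, c i * (lap b)^[i] (lap b V) x * τ ^ (2 * i))) τ := by
      intro τ
      have h1 : HasDerivAt (fun τ : ℝ => ∑ i ∈ Finset.range k,
          c i / (2 * (i + 1 : ℕ)) * (lap b)^[i + 1] V x * τ ^ (2 * (i + 1)))
          (∑ i ∈ Finset.range k, c i / (2 * (i + 1 : ℕ)) * (lap b)^[i + 1] V x *
            ((2 * (i + 1) : ℕ) * τ ^ (2 * (i + 1) - 1))) τ :=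
        HasDerivAt.fun_sum fun i _ => (hasDerivAt_pow (2 * (i + 1)) τ).const_mul _
      have h2 := (hasDerivAt_rmean b hV2 hh x τ).sub h1
      refine h2.congr_deriv ?_
      rw [mul_sub, Finset.mul_sum]
      congr 1
      refine Finset.sum_congr rfl fun i _ => ?_
      have : 2 * (i + 1) - 1 = 2 * i + 1 := by omega
      rw [this, Function.iterate_succ_apply]
      push_cast
      field_simp
      ring
    have hb := norm_image_sub_le_of_norm_deriv_le_segment' (f := φ) (a := 0) (b := t)
      (C := C * F * t ^ (2 * k + 1)) (fun τ _ => (hφd τ).hasDerivWithinAt) (fun τ hτ => ?_) t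
      (right_mem_Icc.2 ht)
    · have h0 : φ 0 = V x * ∫ y : E, h (‖y‖ ^ 2) := by
        simp [hφ, rmean_zero]
      rw [Finset.sum_range_succ']
      rw [h0, Real.norm_eq_abs] at hb
      have e1 : C * F * t ^ (2 * k + 1) * (t - 0) = C * F * t ^ (2 * (k + 1)) := by ring
      rw [e1] at hb
      refine le_of_eq_of_le (congrArg abs ?_) hb
      simp [hφ]; ring
    · rw [norm_mul, Real.norm_eq_abs, Real.norm_eq_abs, abs_of_nonneg hτ.1]
      have := H (lap b V) hl x τ F hτ.1 (fun y hy => hF y (closedBall_subset_closedBall hτ.2.le hy))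
      calc _ ≤ τ * (C * F * τ ^ (2 * k)) := mul_le_mul_of_nonneg_left this hτ.1
        _ = C * F * τ ^ (2 * k + 1) := by ring
        _ ≤ C * F * t ^ (2 * k + 1) := by
          have := pow_le_pow_left₀ hτ.1 hτ.2.le (2 * k + 1)
          exact mul_le_mul_of_nonneg_left this (by positivity)

end Kernel

section Interior

/-- Nodes of the dilations used to build the reproducing kernel. -/
def node (l : ℕ) : ℝ := 1 / (l + 1)

theorem node_pos (l : ℕ) : 0 < node l := by unfold node; positivity

theorem node_le (l : ℕ) : node l ≤ 1 := by
  unfold node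
  rw [div_le_one (by positivity)]
  have : (0:ℝ) ≤ l := l.cast_nonneg
  linarith

theorem exists_node_coeff (N j : ℕ) : ∃ α : ℕ → ℝ, ∀ i < N,
    ∑ l ∈ Finset.range N, α l * node l ^ (2 * i) = if i = j then 1 else 0 := by
  classical
  refine ⟨fun l => (Lagrange.basis (Finset.range N) (fun l => node l ^ 2) l).coeff j, ?_⟩
  intro i hi
  have hinj : Set.InjOn (fun l => node l ^ 2) (Finset.range N : Set ℕ) := by
    intro a _ c _ h
    have h1 : node a = node c := by
      have := (pow_left_inj₀ (node_pos a).le (node_pos c).le (by norm_num : (2:ℕ) ≠ 0)).1 h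
      exact this
    unfold node at h1
    have h2 : (a : ℝ) + 1 = c + 1 := by
      have := congrArg (fun z => z⁻¹) h1
      simpa using this
    exact_mod_cast (by linarith : (a:ℝ) = c)
  have := Lagrange.eq_interpolate (f := (Polynomial.X ^ i : Polynomial ℝ)) hinj (by
    rw [Polynomial.degree_X_pow, Finset.card_range]
    exact_mod_cast hi)
  have h2 := congrArg (fun p : Polynomial ℝ => p.coeff j) this
  simp only [Polynomial.coeff_X_pow, Lagrange.interpolate_apply, Polynomial.finsetSum_coeff,
    Polynomial.coeff_C_mul, Polynomial.eval_pow, Polynomial.eval_X] at h2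
  have h3 : (if i = j then (1:ℝ) else 0) = if j = i then 1 else 0 := by simp only [eq_comm]
  rw [h3, h2]
  refine Finset.sum_congr rfl fun l _ => ?_
  rw [pow_mul]; ring

theorem exists_cutoff {V : E → ℝ} {x : E} {t T : ℝ} {N : ℕ∞ω} (hN : N ≤ ∞) (ht : 0 < t)
    (htT : t < T) (hV : ContDiffOn ℝ N V (ball x T)) :
    ∃ W : E → ℝ, ContDiff ℝ N W ∧ HasCompactSupport W ∧ EqOn W V (ball x t) := by
  let χ : ContDiffBump x := ⟨t, (t + T) / 2, ht, by linarith⟩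
  have hsub : tsupport χ ⊆ ball x T := by
    rw [χ.tsupport_eq]
    exact closedBall_subset_ball (by show (t + T) / 2 < T; linarith)
  refine ⟨fun y => χ y * V y, ?_, ?_, ?_⟩
  · rw [contDiff_iff_contDiffAt]
    intro y
    by_cases hy : y ∈ ball x T
    · exact (χ.contDiff.contDiffAt.of_le hN).mul (hV.contDiffAt (isOpen_ball.mem_nhds hy))
    · have hy' : y ∉ tsupport χ := fun h => hy (hsub h)
      have : (fun y => χ y * V y) =ᶠ[𝓝 y] fun _ => 0 := by
        filter_upwards [notMem_tsupport_iff_eventuallyEq.1 hy'] with z hz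
        simp [hz]
      exact contDiffAt_const.congr_of_eventuallyEq this
  · exact χ.hasCompactSupport.mul_right
  · intro y hy
    have : χ y = 1 := χ.one_of_mem_closedBall (ball_subset_closedBall hy)
    simp [this]

variable {ι : Type*} [Fintype ι] (b : OrthonormalBasis ι ℝ E)

/-- A kernel reproducing functions with bounded `k`-fold Laplacian up to order `2k`. -/
structure IsKer (k : ℕ) (φ : E → ℝ) (C : ℝ) : Prop where
  smooth : ContDiff ℝ ∞ φ
  supp : Function.support φ ⊆ closedBall 0 1
  nonneg : 0 ≤ C
  approx : ∀ (V : E → ℝ) (x : E) (t T F : ℝ), 0 < t → t < T →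
    ContDiffOn ℝ (2 * k : ℕ) V (ball x T) → (∀ y ∈ ball x T, |(lap b)^[k] V y| ≤ F) →
    |V x - ∫ y, V (x + t • y) * φ y| ≤ C * F * t ^ (2 * k)

theorem mem_ball_of_supp {φ : E → ℝ} (h : Function.support φ ⊆ closedBall 0 1) {x y : E} {t T : ℝ}
    (ht : 0 < t) (htT : t < T) (hy : φ y ≠ 0) : x + t • y ∈ ball x T := by
  have := h hy
  simp only [mem_closedBall, dist_zero_right] at this
  simp only [mem_ball, dist_self_add_left, norm_smul, Real.norm_of_nonneg ht.le]
  nlinarith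

/-- `rmean` at a dilated scale as a mean against a dilated kernel. -/
theorem rmean_dilate (V : E → ℝ) (h : ℝ → ℝ) (x : E) (t : ℝ) {s : ℝ} (hs : 0 < s) :
    rmean V h x (s * t) = ∫ y, V (x + t • y) *
      ((s ^ Module.finrank ℝ E)⁻¹ * h (‖s⁻¹ • y‖ ^ 2)) := by
  have := Measure.integral_comp_smul (volume : Measure E)
    (fun y => V (x + t • y) * h (‖s⁻¹ • y‖ ^ 2)) s
  simp only [smul_smul, inv_mul_cancel₀ hs.ne', one_smul] at this
  rw [rmean]
  simp only [mul_comm s t]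
  rw [this, abs_of_pos (by positivity), smul_eq_mul, ← integral_const_mul]
  congr 1
  ext y
  ring

theorem exists_ker (k : ℕ) (hk : 1 ≤ k) : ∃ φ C, IsKer b k φ C := by
  obtain ⟨h, hh⟩ := exists_profile
  obtain ⟨c, C, hC, hc, H⟩ := rmean_expansion b k hh
  obtain ⟨α, hα⟩ := exists_node_coeff k 0
  set d := Module.finrank ℝ E
  set ψ : ℕ → E → ℝ := fun l y => (node l ^ d)⁻¹ * h (‖(node l)⁻¹ • y‖ ^ 2) with hψ
  have hψs : ∀ l, ContDiff ℝ ∞ (ψ l) := fun l =>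
    contDiff_const.mul (hh.contDiff_radial.comp (contDiff_const_smul _))
  have hψ0 : ∀ l y, y ∉ closedBall (0:E) 1 → ψ l y = 0 := by
    intro l y hy
    have : (node l)⁻¹ • y ∉ ball (0:E) 1 := by
      simp only [mem_closedBall, dist_zero_right, not_le] at hy
      have h1 : 1 ≤ (node l)⁻¹ := (one_le_inv₀ (node_pos l)).2 (node_le l)
      simp only [mem_ball, dist_zero_right, norm_smul, not_lt, norm_inv,
        Real.norm_of_nonneg (node_pos l).le]
      nlinarith
    simp [hψ, hh.radial_eq_zero this]
  refine ⟨fun y => (c 0)⁻¹ * ∑ l ∈ Finset.range k, α l * ψ l y,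
    (c 0)⁻¹ * ∑ l ∈ Finset.range k, |α l| * C, ?_, ?_, ?_, ?_⟩
  · exact contDiff_const.mul (ContDiff.sum fun l _ => contDiff_const.mul (hψs l))
  · intro y hy
    by_contra hy'
    exact hy (by simp [hψ0 _ y hy'])
  · have := hc 0
    positivity
  · intro V x t T F ht htT hV hF
    have hF0 : 0 ≤ F := (abs_nonneg _).trans (hF x (mem_ball_self (ht.trans htT)))
    obtain ⟨W, hW, -, hWV⟩ := exists_cutoff (N := (2 * k : ℕ)) (t := (t + T) / 2)
      (by exact ENat.LEInfty.out) (by linarith) (by linarith) hV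
    have hlt : t < (t + T) / 2 := by linarith
    have e0 : V x = W x := (hWV (mem_ball_self (by linarith))).symm
    have hWF : ∀ y ∈ closedBall x t, |(lap b)^[k] W y| ≤ F := by
      intro y hy
      have hy' : y ∈ ball x ((t + T) / 2) := closedBall_subset_ball hlt hy
      rw [lapI_congr b isOpen_ball hWV k hy']
      exact hF y (ball_subset_ball (by linarith) hy')
    have hint : ∀ l, Integrable fun y => W (x + t • y) * ψ l y := fun l =>
      ((hW.continuous.comp (by fun_prop)).mul (hψs l).continuous).integrable_of_hasCompactSupport
        (HasCompactSupport.mul_left (HasCompactSupport.of_support_subset_isCompact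
          (isCompact_closedBall 0 1) fun y hy => by_contra fun h => hy (hψ0 l y h)))
    have e1 : ∫ y, V (x + t • y) * ((c 0)⁻¹ * ∑ l ∈ Finset.range k, α l * ψ l y) =
        (c 0)⁻¹ * ∑ l ∈ Finset.range k, α l * rmean W h x (node l * t) := by
      have e2 : ∀ y, V (x + t • y) * ((c 0)⁻¹ * ∑ l ∈ Finset.range k, α l * ψ l y) =
          (c 0)⁻¹ * ∑ l ∈ Finset.range k, α l * (W (x + t • y) * ψ l y) := by
        intro y
        by_cases hy : y ∈ closedBall (0:E) 1
        · have : x + t • y ∈ ball x ((t + T) / 2) := by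
            simp only [mem_closedBall, dist_zero_right] at hy
            simp only [mem_ball, dist_self_add_left, norm_smul, Real.norm_of_nonneg ht.le]
            nlinarith
          rw [hWV this, Finset.mul_sum, Finset.mul_sum, Finset.mul_sum]
          exact Finset.sum_congr rfl fun l _ => by ring
        · simp [hψ0 _ y hy]
      simp only [e2]
      rw [integral_const_mul, integral_finsetSum _ fun l _ => (hint l).const_mul _]
      congr 1
      refine Finset.sum_congr rfl fun l _ => ?_
      rw [integral_const_mul, rmean_dilate W h x t (node_pos l)]
    rw [e1, e0]
    have e3 : W x = (c 0)⁻¹ * ∑ l ∈ Finset.range k, α l *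
        ∑ i ∈ Finset.range k, c i * (lap b)^[i] W x * (node l * t) ^ (2 * i) := by
      have : ∀ l, α l * ∑ i ∈ Finset.range k, c i * (lap b)^[i] W x * (node l * t) ^ (2 * i) =
          ∑ i ∈ Finset.range k, (c i * (lap b)^[i] W x * t ^ (2 * i)) *
            (α l * node l ^ (2 * i)) := by
        intro l
        rw [Finset.mul_sum]
        exact Finset.sum_congr rfl fun i _ => by rw [mul_pow]; ring
      simp only [this]
      rw [Finset.sum_comm]
      have h0 : 0 ∈ Finset.range k := Finset.mem_range.2 hk
      rw [Finset.sum_congr rfl fun i hi => by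
        rw [← Finset.mul_sum, hα i (Finset.mem_range.1 hi)]]
      simp only [mul_ite, mul_one, mul_zero, Finset.sum_ite_eq', h0, if_true]
      have := (hc 0).ne'
      simp
      field_simp
    rw [e3, ← mul_sub, ← Finset.sum_sub_distrib, abs_mul, abs_of_pos (inv_pos.2 (hc 0)),
      mul_assoc, mul_assoc]
    refine mul_le_mul_of_nonneg_left ?_ (inv_pos.2 (hc 0)).le
    refine (Finset.abs_sum_le_sum_abs _ _).trans ?_
    rw [Finset.sum_mul]
    refine Finset.sum_le_sum fun l _ => ?_
    rw [← mul_sub, abs_mul, abs_sub_comm, mul_assoc]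
    refine mul_le_mul_of_nonneg_left ?_ (abs_nonneg _)
    have h1 : node l * t ≤ t := by
      have := node_le l
      nlinarith
    have h2 : 0 ≤ node l * t := (mul_pos (node_pos l) ht).le
    refine (H W hW x (node l * t) F h2
      fun y hy => hWF y (closedBall_subset_closedBall h1 hy)).trans ?_
    rw [← mul_assoc]
    exact mul_le_mul_of_nonneg_left (pow_le_pow_left₀ h2 h1 _) (by positivity)

variable {b}

theorem IsKer.compact {k : ℕ} {φ : E → ℝ} {C : ℝ} (h : IsKer b k φ C) : HasCompactSupport φ :=
  HasCompactSupport.of_support_subset_isCompact (isCompact_closedBall 0 1) h.supp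

theorem IsKer.integral_congr {k : ℕ} {φ : E → ℝ} {C : ℝ} (h : IsKer b k φ C) {V W : E → ℝ}
    {x : E} {t T : ℝ} (ht : 0 < t) (htT : t < T) (hVW : EqOn V W (ball x T)) :
    ∫ y, V (x + t • y) * φ y = ∫ y, W (x + t • y) * φ y := by
  congr 1
  ext y
  by_cases hy : φ y = 0
  · simp [hy]
  · rw [hVW (mem_ball_of_supp h.supp ht htT hy)]

/-- Functions reproduced by the kernel are smooth. -/
theorem IsKer.smooth_of_mean {k : ℕ} {φ : E → ℝ} {C : ℝ} (h : IsKer b k φ C) {w : E → ℝ} {x₀ : E}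
    {r t T : ℝ} (ht : 0 < t) (hr : 0 < r) (hrt : r + t < T) (hw : ContinuousOn w (ball x₀ T))
    (hm : ∀ x ∈ ball x₀ r, w x = ∫ y, w (x + t • y) * φ y) : ContDiffOn ℝ ∞ w (ball x₀ r) := by
  obtain ⟨W, hW, -, hWw⟩ := exists_cutoff (N := 0) (t := (r + t + T) / 2) (by simp)
    (by linarith) (by linarith) (contDiffOn_zero.2 hw)
  have hWc : Continuous W := hW.continuous
  let g : E → ℝ := fun y => φ (-y)
  have hg : ContDiff ℝ ∞ g := h.smooth.comp contDiff_neg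
  have hgc : HasCompactSupport g := by
    refine HasCompactSupport.of_support_subset_isCompact (isCompact_closedBall 0 1) ?_
    intro y hy
    have := h.supp (show -y ∈ Function.support φ from hy)
    simpa using this
  let Wt : E → ℝ := fun y => W (x₀ + t • y)
  have hconv : ContDiff ℝ ∞ (convolution Wt g (ContinuousLinearMap.mul ℝ ℝ) volume) :=
    hgc.contDiff_convolution_right _ (by
      exact (hWc.comp (by fun_prop : Continuous fun y : E => x₀ + t • y)).locallyIntegrable) hg
  have hcomp : ContDiff ℝ ∞ (fun x => convolution Wt g (ContinuousLinearMap.mul ℝ ℝ) volume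
      (t⁻¹ • (x - x₀))) := hconv.comp ((contDiff_id.sub contDiff_const).const_smul _)
  refine hcomp.contDiffOn.congr fun x hx => ?_
  have hx' := mem_ball.1 hx
  rw [hm x hx, convolution_def]
  have e1 : ∫ y, w (x + t • y) * φ y = ∫ y, W (x + t • y) * φ y := by
    refine h.integral_congr ht (T := (r + t + T) / 2 - r) (by linarith) ?_
    intro z hz
    refine (hWw ?_).symm
    have := mem_ball.1 hz
    have := dist_triangle z x x₀
    exact mem_ball.2 (by linarith)
  rw [e1, ← integral_add_right_eq_self (fun y => (ContinuousLinearMap.mul ℝ ℝ) (Wt y) _)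
    (t⁻¹ • (x - x₀))]
  congr 1
  ext y
  simp only [Wt, g, ContinuousLinearMap.mul_apply']
  congr 2
  · rw [smul_add, smul_smul, mul_inv_cancel₀ ht.ne', one_smul]; abel
  · abel

variable (b)

theorem smooth_of_polyharmonic {k : ℕ} {U : Set E} (hU : IsOpen U) {V : E → ℝ}
    (hV : ContDiffOn ℝ (2 * k : ℕ) V U) (h0 : ∀ x ∈ U, (lap b)^[k] V x = 0) :
    ContDiffOn ℝ ∞ V U := by
  rcases Nat.eq_zero_or_pos k with rfl | hk
  · exact contDiffOn_const.congr (f₁ := V) (f := fun _ => 0) h0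
  obtain ⟨φ, C, hφ⟩ := exists_ker b k hk
  intro x hx
  obtain ⟨T, hT, hTU⟩ := Metric.isOpen_iff.1 hU x hx
  refine ((hφ.smooth_of_mean (t := T / 3) (r := T / 3) (T := T) (by linarith) (by linarith)
    (by linarith) (hV.continuousOn.mono hTU) ?_).contDiffAt
    (ball_mem_nhds x (by linarith))).contDiffWithinAt
  intro y hy
  have hsub : ball y (2 * T / 3) ⊆ U := by
    refine Subset.trans (fun z hz => ?_) hTU
    have := mem_ball.1 hz
    have := mem_ball.1 hy
    have := dist_triangle z y x
    exact mem_ball.2 (by linarith)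
  have := hφ.approx V y (T / 3) (2 * T / 3) 0 (by linarith) (by linarith) (hV.mono hsub)
    fun z hz => by rw [h0 z (hsub hz), abs_zero]
  simp only [mul_zero, zero_mul] at this
  linarith [abs_nonpos_iff.1 this]

/-- Oscillation estimate for functions with bounded `k`-fold Laplacian. -/
theorem exists_osc (k : ℕ) (hk : 1 ≤ k) : ∃ C, 0 ≤ C ∧ ∀ (V : E → ℝ) (x y : E) (t T S F : ℝ),
    0 < t → 2 * t < T → ContDiffOn ℝ (2 * k : ℕ) V (ball x T) →
    (∀ y ∈ ball x T, |V y| ≤ S) → (∀ y ∈ ball x T, |(lap b)^[k] V y| ≤ F) → ‖y - x‖ ≤ t →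
    |V y - V x| ≤ C * S * (‖y - x‖ / t) + C * F * t ^ (2 * k) := by
  obtain ⟨φ, C, hφ⟩ := exists_ker b k hk
  obtain ⟨K, hK⟩ := hφ.smooth.lipschitzWith_of_hasCompactSupport hφ.compact (by simp)
  set v := volume.real (closedBall (0:E) 2)
  have hC := hφ.nonneg
  refine ⟨max (K * v) (2 * C), by positivity, ?_⟩
  intro V x y t T S F ht htT hV hS hF hy
  have hT : 0 < T := by linarith
  have hS0 : 0 ≤ S := (abs_nonneg _).trans (hS x (mem_ball_self hT))
  have hF0 : 0 ≤ F := (abs_nonneg _).trans (hF x (mem_ball_self hT))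
  have hsub : ball y (T - t) ⊆ ball x T := ball_subset_ball' (by
    rw [dist_eq_norm]; linarith)
  have h1 := hφ.approx V x t T F ht (by linarith) hV hF
  have h2 := hφ.approx V y t (T - t) F ht (by linarith) (hV.mono hsub)
    fun z hz => hF z (hsub hz)
  obtain ⟨W, hW, -, hWV⟩ := exists_cutoff (N := (2 * k : ℕ)) (t := (2 * t + T) / 2)
      (by exact ENat.LEInfty.out) (by linarith) (by linarith) hV
  rw [← hφ.integral_congr (T := (2 * t + T) / 2) ht (by linarith) hWV] at h1
  rw [← hφ.integral_congr (T := (2 * t + T) / 2 - t) ht (by linarith)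
    (hWV.mono (ball_subset_ball' (by rw [dist_eq_norm]; linarith)))] at h2
  set e := t⁻¹ • (y - x) with he
  have hnorm_e : ‖e‖ = ‖y - x‖ / t := by
    rw [he, norm_smul, norm_inv, Real.norm_of_nonneg ht.le]; field_simp
  have he1 : ‖e‖ ≤ 1 := by rw [hnorm_e]; exact (div_le_one ht).2 hy
  have hshift : ∫ z, W (y + t • z) * φ z = ∫ z, W (x + t • z) * φ (z - e) := by
    rw [← integral_sub_right_eq_self (fun z => W (y + t • z) * φ z) e]
    congr 1
    ext z
    congr 2
    rw [he, smul_sub, smul_smul, mul_inv_cancel₀ ht.ne', one_smul]; abel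
  have hi1 : Integrable fun z => W (x + t • z) * φ z :=
    ((hW.continuous.comp (by fun_prop)).mul hφ.smooth.continuous).integrable_of_hasCompactSupport
      hφ.compact.mul_left
  have hcomp2 : HasCompactSupport fun z => φ (z - e) := by
    refine HasCompactSupport.of_support_subset_isCompact (isCompact_closedBall 0 2) ?_
    intro z hz
    have h3 := hφ.supp (show z - e ∈ Function.support φ from hz)
    simp only [mem_closedBall, dist_zero_right] at h3 ⊢
    have := norm_sub_norm_le z e
    linarith
  have hi2 : Integrable fun z => W (x + t • z) * φ (z - e) :=
    ((hW.continuous.comp (by fun_prop)).mul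
      (hφ.smooth.continuous.comp (by fun_prop))).integrable_of_hasCompactSupport hcomp2.mul_left
  have h3 : |(∫ z, W (y + t • z) * φ z) - ∫ z, W (x + t • z) * φ z| ≤ S * (K * ‖e‖) * v := by
    rw [hshift, ← integral_sub hi2 hi1, ← Real.norm_eq_abs]
    have hb : ∀ z, ‖W (x + t • z) * φ (z - e) - W (x + t • z) * φ z‖ ≤
        (closedBall (0:E) 2).indicator (fun _ => S * (K * ‖e‖)) z := by
      intro z
      rw [← mul_sub, norm_mul, Real.norm_eq_abs]
      by_cases hz : z ∈ closedBall (0:E) 2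
      · rw [indicator_of_mem hz]
        have hz' : x + t • z ∈ ball x ((2 * t + T) / 2) := by
          simp only [mem_closedBall, dist_zero_right] at hz
          simp only [mem_ball, dist_self_add_left, norm_smul, Real.norm_of_nonneg ht.le]
          nlinarith
        refine mul_le_mul ?_ ?_ (norm_nonneg _) hS0
        · rw [hWV hz']
          exact hS _ (ball_subset_ball (by linarith) hz')
        · have := hK.dist_le_mul (z - e) z
          simpa [dist_eq_norm] using this
      · rw [indicator_of_notMem hz]
        have a1 : φ z = 0 := by
          by_contra h
          have := hφ.supp h
          exact hz (closedBall_subset_closedBall (by norm_num) this)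
        have a2 : φ (z - e) = 0 := by
          by_contra h
          have := hφ.supp (show z - e ∈ Function.support φ from h)
          simp only [mem_closedBall, dist_zero_right, not_le] at hz this
          have := norm_sub_norm_le z e
          linarith
        simp [a1, a2]
    refine (norm_integral_le_of_norm_le ?_ (Eventually.of_forall hb)).trans ?_
    · exact (integrable_indicator_iff measurableSet_closedBall).2
        (integrableOn_const (isCompact_closedBall _ _).measure_lt_top.ne)
    · rw [integral_indicator measurableSet_closedBall, setIntegral_const, smul_eq_mul, mul_comm]
  have h4 : |V y - V x| ≤ S * (K * ‖e‖) * v + 2 * (C * F * t ^ (2 * k)) := by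
    have e1 : V y - V x = (V y - ∫ z, W (y + t • z) * φ z) - (V x - ∫ z, W (x + t • z) * φ z) +
      ((∫ z, W (y + t • z) * φ z) - ∫ z, W (x + t • z) * φ z) := by ring
    rw [e1]
    refine (abs_add_le _ _).trans ?_
    have := abs_sub (V y - ∫ z, W (y + t • z) * φ z) (V x - ∫ z, W (x + t • z) * φ z)
    linarith
  rw [hnorm_e] at h4
  have m1 : K * v * S * (‖y - x‖ / t) ≤ max (K * v) (2 * C) * S * (‖y - x‖ / t) := by
    gcongr; exact le_max_left _ _
  have m2 : 2 * C * F * t ^ (2 * k) ≤ max (K * v) (2 * C) * F * t ^ (2 * k) := by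
    gcongr; exact le_max_right _ _
  linarith

/-- Interior derivative estimates for polyharmonic functions. -/
theorem exists_interior (k : ℕ) (hk : 1 ≤ k) : ∃ C : ℕ → ℝ, (∀ m, 0 ≤ C m) ∧
    ∀ (m : ℕ) (V : E → ℝ) (x : E) (T S : ℝ), 0 < T → ContDiffOn ℝ (2 * k : ℕ) V (ball x T) →
    (∀ y ∈ ball x T, (lap b)^[k] V y = 0) → (∀ y ∈ ball x T, |V y| ≤ S) →
    ∀ L : List E, L.length = m → |dl L V x| ≤ C m * (S / T ^ m) * (L.map norm).prod := by
  obtain ⟨C₁, hC₁, H⟩ := exists_osc b k hk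
  have hd : ∀ (V : E → ℝ) (x : E) (T S : ℝ), 0 < T → ContDiffOn ℝ (2 * k : ℕ) V (ball x T) →
      (∀ y ∈ ball x T, (lap b)^[k] V y = 0) → (∀ y ∈ ball x T, |V y| ≤ S) →
      ∀ v, |dd v V x| ≤ 3 * C₁ * (S / T) * ‖v‖ := by
    intro V x T S hT hV h0 hS v
    have hS0 : 0 ≤ S := (abs_nonneg _).trans (hS x (mem_ball_self hT))
    have : ‖fderiv ℝ V x‖ ≤ 3 * C₁ * (S / T) := by
      refine norm_fderiv_le_of_lip' ℝ (by positivity) ?_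
      filter_upwards [closedBall_mem_nhds x (show 0 < T / 3 by linarith)] with y hy
      rw [mem_closedBall, dist_eq_norm] at hy
      have := H V x y (T / 3) T S 0 (by linarith) (by linarith) hV hS
        (fun z hz => by rw [h0 z hz, abs_zero]) hy
      rw [Real.norm_eq_abs]
      refine this.trans (le_of_eq ?_)
      field_simp
      ring
    calc |dd v V x| = ‖fderiv ℝ V x v‖ := rfl
      _ ≤ ‖fderiv ℝ V x‖ * ‖v‖ := ContinuousLinearMap.le_opNorm _ _
      _ ≤ _ := mul_le_mul_of_nonneg_right this (norm_nonneg _)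
  refine ⟨fun m => (3 * C₁ * 2) ^ m * 2 ^ (m * m), fun m => by positivity, ?_⟩
  intro m
  induction m with
  | zero =>
    intro V x T S hT _ _ hS L hL
    rw [List.length_eq_zero_iff] at hL
    subst hL
    simpa [dl] using hS x (mem_ball_self hT)
  | succ m ih =>
    intro V x T S hT hV h0 hS L hL
    have hS0 : 0 ≤ S := (abs_nonneg _).trans (hS x (mem_ball_self hT))
    obtain ⟨v, L, rfl⟩ := List.exists_cons_of_length_eq_add_one hL
    have hsm := smooth_of_polyharmonic b isOpen_ball hV h0
    have hss : ball x (T / 2) ⊆ ball x T := ball_subset_ball (by linarith)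
    have := ih (dd v V) x (T / 2) (3 * C₁ * (S / (T / 2)) * ‖v‖) (by linarith)
      (((dd_contDiffOn_infty isOpen_ball hsm v).mono hss).of_le (by exact ENat.LEInfty.out))
      (fun y hy => ?_) (fun y hy => ?_) L (by simpa using hL)
    · refine this.trans ?_
      rw [List.map_cons, List.prod_cons]
      have hP : 0 ≤ (L.map norm).prod := List.prod_nonneg (by simp)
      have e : (3 * C₁ * 2) ^ m * 2 ^ (m * m) * (3 * C₁ * (S / (T / 2)) * ‖v‖ / (T / 2) ^ m) *
          (L.map norm).prod = (3 * C₁ * 2) ^ (m + 1) * 2 ^ (m * m + m) * (S / T ^ (m + 1)) *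
          (‖v‖ * (L.map norm).prod) := by
        rw [pow_add _ (m * m), div_pow]
        field_simp
        ring
      rw [e]
      have : (2:ℝ) ^ (m * m + m) ≤ 2 ^ ((m + 1) * (m + 1)) :=
        pow_le_pow_right₀ (by norm_num) (by nlinarith)
      simp only
      gcongr
    · rw [lapI_dd_comm b isOpen_ball hsm v k (hss hy)]
      have e : EqOn ((lap b)^[k] V) (fun _ => 0) (ball x T) := fun z hz => h0 z hz
      rw [dd_congr isOpen_ball e v (hss hy), dd_const]
    · have hy' : ball y (T / 2) ⊆ ball x T := ball_subset_ball' (by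
        have := mem_ball.1 hy; linarith)
      exact hd V y (T / 2) S (by linarith) (hV.mono hy') (fun z hz => h0 z (hy' hz))
        (fun z hz => hS z (hy' hz)) v

end Interior

section Limit

theorem integrable_dilate_mul {V φ : E → ℝ} {x : E} {t : ℝ} (ht : 0 ≤ t)
    (hV : ContinuousOn V (closedBall x t)) (hφ : Continuous φ)
    (hs : Function.support φ ⊆ closedBall 0 1) : Integrable fun y => V (x + t • y) * φ y := by
  have h1 : IntegrableOn (fun y => V (x + t • y) * φ y) (closedBall (0:E) 1) := by
    refine ContinuousOn.integrableOn_compact (isCompact_closedBall 0 1) ?_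
    refine (hV.comp (by fun_prop) fun y hy => ?_).mul hφ.continuousOn
    simp only [mem_closedBall, dist_zero_right] at hy
    simp only [mem_closedBall, dist_self_add_left, norm_smul, Real.norm_of_nonneg ht]
    nlinarith
  refine (integrableOn_iff_integrable_of_support_subset fun y hy => hs ?_).1 h1
  exact right_ne_zero_of_mul hy

theorem rmean_congr {V W : E → ℝ} {h : ℝ → ℝ} (hh : IsProfile h) {x : E} {t T : ℝ} (ht : 0 ≤ t)
    (htT : t < T) (hVW : EqOn V W (ball x T)) : rmean V h x t = rmean W h x t := by
  unfold rmean
  congr 1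
  ext y
  by_cases hy : y ∈ ball (0:E) 1
  · rw [hVW]
    simp only [mem_ball, dist_zero_right] at hy
    simp only [mem_ball, dist_self_add_left, norm_smul, Real.norm_of_nonneg ht]
    nlinarith
  · simp [hh.radial_eq_zero hy]

variable {ι : Type*} [Fintype ι] (b : OrthonormalBasis ι ℝ E)

theorem rmean_expansion_on (k : ℕ) {h : ℝ → ℝ} (hh : IsProfile h) : ∃ (c : ℕ → ℝ) (C : ℝ),
    0 ≤ C ∧ (∀ i, 0 < c i) ∧ ∀ (V : E → ℝ) (x : E) (t T F : ℝ), 0 ≤ t → t < T →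
    ContDiffOn ℝ (2 * k : ℕ) V (ball x T) → (∀ y ∈ ball x T, |(lap b)^[k] V y| ≤ F) →
    |rmean V h x t - ∑ i ∈ Finset.range k, c i * (lap b)^[i] V x * t ^ (2 * i)| ≤
      C * F * t ^ (2 * k) := by
  obtain ⟨c, C, hC, hc, H⟩ := rmean_expansion b k hh
  refine ⟨c, C, hC, hc, ?_⟩
  intro V x t T F ht htT hV hF
  obtain ⟨W, hW, -, hWV⟩ := exists_cutoff (N := (2 * k : ℕ)) (t := (t + T) / 2)
    (by exact ENat.LEInfty.out) (by linarith) (by linarith) hV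
  have hlap : ∀ i, EqOn ((lap b)^[i] W) ((lap b)^[i] V) (ball x ((t + T) / 2)) := fun i =>
    lapI_congr b isOpen_ball hWV i
  rw [← rmean_congr hh ht (by linarith) hWV]
  simp only [← hlap _ (mem_ball_self (show 0 < (t + T) / 2 by linarith))]
  refine H W hW x t F ht fun y hy => ?_
  have hy' : y ∈ ball x ((t + T) / 2) := closedBall_subset_ball (by linarith) hy
  rw [hlap k hy']
  exact hF y (ball_subset_ball (by linarith) hy')

theorem Ultrafilter.exists_tendsto_of_eventually_abs_le (𝒰 : Ultrafilter ℕ) {a : ℕ → ℝ} {S : ℝ}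
    (h : ∀ᶠ j in 𝒰, |a j| ≤ S) : ∃ l, Tendsto a 𝒰 (𝓝 l) := by
  obtain ⟨l, -, hl⟩ := (isCompact_Icc (a := -S) (b := S)).ultrafilter_le_nhds (𝒰.map a) (by
    rw [le_principal_iff]
    show a ⁻¹' Icc (-S) S ∈ (𝒰 : Filter ℕ)
    filter_upwards [h] with j hj
    exact abs_le.1 hj)
  exact ⟨l, hl⟩

/-- A continuously convergent family along an ultrafilter converges uniformly on compact sets. -/
theorem Ultrafilter.uniform_of_continuous_convergence {X : Type*} [TopologicalSpace X]
    (𝒰 : Ultrafilter ℕ) {w : ℕ → X → ℝ} {u : X → ℝ} {K : Set X} (hK : IsCompact K)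
    (h : ∀ x ∈ K, ∀ y : ℕ → X, Tendsto y 𝒰 (𝓝 x) → Tendsto (fun j => w j (y j)) 𝒰 (𝓝 (u x)))
    (hu : ∀ x ∈ K, ContinuousAt u x) {ε : ℝ} (hε : 0 < ε) :
    ∀ᶠ j in 𝒰, ∀ y ∈ K, |w j y - u y| < ε := by
  by_contra hn
  rw [← Ultrafilter.eventually_not] at hn
  push Not at hn
  rcases K.eq_empty_or_nonempty with rfl | ⟨x0, -⟩
  · obtain ⟨j, y, hy, -⟩ := hn.exists
    exact hy
  have : ∀ j, ∃ y, (∃ y ∈ K, ε ≤ |w j y - u y|) → y ∈ K ∧ ε ≤ |w j y - u y| := by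
    intro j
    by_cases hj : ∃ y ∈ K, ε ≤ |w j y - u y|
    · obtain ⟨y, hy⟩ := hj
      exact ⟨y, fun _ => hy⟩
    · exact ⟨x0, fun h => absurd h hj⟩
  choose y hy using this
  obtain ⟨x, hx, hxy⟩ := hK.ultrafilter_le_nhds (𝒰.map y) (by
    rw [le_principal_iff]
    show y ⁻¹' K ∈ (𝒰 : Filter ℕ)
    filter_upwards [hn] with j hj
    exact (hy j hj).1)
  have hxy' : Tendsto y 𝒰 (𝓝 x) := hxy
  have h1 := ((h x hx y hxy').sub ((hu x hx).tendsto.comp hxy')).abs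
  simp only [sub_self, abs_zero] at h1
  obtain ⟨j, hj1, hj2⟩ := (hn.and (h1.eventually_lt_const hε)).exists
  exact absurd (hy j hj1).2 (not_le.2 hj2)

/-- Locally bounded sequences with `k`-fold Laplacian tending to zero converge along ultrafilters
to polyharmonic functions. -/
theorem exists_limit (k : ℕ) (hk : 1 ≤ k) (𝒰 : Ultrafilter ℕ) {w : ℕ → E → ℝ} {H : Set E}
    (hH : IsOpen H) (hw : ∀ x ∈ H, ∃ T > 0, ∃ (S : ℝ) (δ : ℕ → ℝ), Tendsto δ 𝒰 (𝓝 0) ∧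
      ∀ᶠ j in 𝒰, ContDiffOn ℝ (2 * k : ℕ) (w j) (ball x T) ∧
        (∀ y ∈ ball x T, |w j y| ≤ S) ∧ ∀ y ∈ ball x T, |(lap b)^[k] (w j) y| ≤ δ j) :
    ∃ u : E → ℝ, ContDiffOn ℝ ∞ u H ∧ (∀ x ∈ H, (lap b)^[k] u x = 0) ∧
      ∀ x ∈ H, ∀ y : ℕ → E, Tendsto y 𝒰 (𝓝 x) → Tendsto (fun j => w j (y j)) 𝒰 (𝓝 (u x)) := by
  obtain ⟨C₁, hC₁, hosc⟩ := exists_osc b k hk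
  have hlim : ∀ x, ∃ l, x ∈ H → Tendsto (fun j => w j x) 𝒰 (𝓝 l) := by
    intro x
    by_cases hx : x ∈ H
    · obtain ⟨T, hT, S, δ, -, h⟩ := hw x hx
      obtain ⟨l, hl⟩ := 𝒰.exists_tendsto_of_eventually_abs_le
        (h.mono fun j hj => hj.2.1 x (mem_ball_self hT))
      exact ⟨l, fun _ => hl⟩
    · exact ⟨0, fun h => absurd h hx⟩
  choose u hu using hlim
  have hcc : ∀ x ∈ H, ∀ y : ℕ → E, Tendsto y 𝒰 (𝓝 x) →
      Tendsto (fun j => w j (y j)) 𝒰 (𝓝 (u x)) := by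
    intro x hx y hy
    obtain ⟨T, hT, S, δ, hδ, h⟩ := hw x hx
    have h1 : Tendsto (fun j => w j (y j) - w j x) 𝒰 (𝓝 0) := by
      have hn : Tendsto (fun j => ‖y j - x‖) 𝒰 (𝓝 0) := tendsto_iff_norm_sub_tendsto_zero.1 hy
      have h2 : Tendsto (fun j => C₁ * S * (‖y j - x‖ / (T / 3)) + C₁ * δ j * (T / 3) ^ (2 * k)) 𝒰
          (𝓝 (C₁ * S * (0 / (T / 3)) + C₁ * 0 * (T / 3) ^ (2 * k))) :=
        ((hn.div_const _).const_mul _).add ((hδ.const_mul _).mul_const _)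
      simp only [zero_div, mul_zero, zero_mul, add_zero] at h2
      refine squeeze_zero_norm' ?_ h2
      filter_upwards [h, hn.eventually_lt_const (show 0 < T / 3 by linarith)] with j hj hj2
      exact hosc (w j) x (y j) (T / 3) T S (δ j) (by linarith) (by linarith) hj.1 hj.2.1 hj.2.2
        hj2.le
    have := h1.add (hu x hx)
    simpa using this
  have hcont : ∀ x ∈ H, ContinuousAt u x := by
    intro x hx
    obtain ⟨T, hT, S, δ, hδ, h⟩ := hw x hx
    obtain ⟨T', hT', hTH⟩ := Metric.isOpen_iff.1 hH x hx
    have h3 : ∀ y ∈ ball x (min (T / 3) T'), |u y - u x| ≤ C₁ * S * (‖y - x‖ / (T / 3)) := by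
      intro y hy
      have hy1 := mem_ball.1 hy
      have hyH : y ∈ H := hTH (ball_subset_ball (min_le_right _ _) hy)
      have ht := ((hu y hyH).sub (hu x hx)).abs
      have h2 : Tendsto (fun j => C₁ * S * (‖y - x‖ / (T / 3)) + C₁ * δ j * (T / 3) ^ (2 * k)) 𝒰
          (𝓝 (C₁ * S * (‖y - x‖ / (T / 3)) + C₁ * 0 * (T / 3) ^ (2 * k))) :=
        tendsto_const_nhds.add ((hδ.const_mul _).mul_const _)
      simp only [mul_zero, zero_mul, add_zero] at h2
      refine le_of_tendsto_of_tendsto ht h2 ?_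
      filter_upwards [h] with j hj
      refine hosc (w j) x y (T / 3) T S (δ j) (by linarith) (by linarith) hj.1 hj.2.1 hj.2.2 ?_
      rw [← dist_eq_norm]
      exact hy1.le.trans (min_le_left _ _)
    rw [ContinuousAt, tendsto_iff_norm_sub_tendsto_zero]
    have h4 : Tendsto (fun y => C₁ * S * (‖y - x‖ / (T / 3))) (𝓝 x) (𝓝 0) := by
      have : Continuous fun y => C₁ * S * (‖y - x‖ / (T / 3)) := by fun_prop
      simpa using this.tendsto x
    refine squeeze_zero' (Eventually.of_forall fun _ => norm_nonneg _) ?_ h4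
    filter_upwards [ball_mem_nhds x (show 0 < min (T / 3) T' by positivity)] with y hy
    exact h3 y hy
  have hint : ∀ (φ : E → ℝ), Continuous φ → HasCompactSupport φ →
      Function.support φ ⊆ closedBall 0 1 → ∀ (x : E) (t : ℝ),
      0 ≤ t → closedBall x t ⊆ H → (∀ᶠ j in 𝒰, ContinuousOn (w j) (closedBall x t)) →
      Tendsto (fun j => ∫ y, w j (x + t • y) * φ y) 𝒰 (𝓝 (∫ y, u (x + t • y) * φ y)) := by
    intro φ hφ hφc hφs x t ht hxt hwc
    have hφi : Integrable φ := hφ.integrable_of_hasCompactSupport hφc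
    rw [Metric.tendsto_nhds]
    intro ε hε
    set A := ∫ y, |φ y|
    have hA : 0 ≤ A := integral_nonneg fun _ => abs_nonneg _
    have hun := 𝒰.uniform_of_continuous_convergence (isCompact_closedBall x t)
      (fun z hz => hcc z (hxt hz)) (fun z hz => hcont z (hxt hz))
      (show 0 < ε / (A + 1) by positivity)
    filter_upwards [hun, hwc] with j hj hwj
    have hi1 := integrable_dilate_mul ht hwj hφ hφs
    have hi2 := integrable_dilate_mul ht
      (fun z hz => (hcont z (hxt hz)).continuousWithinAt) hφ hφs
    rw [dist_eq_norm, ← integral_sub hi1 hi2]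
    have hb : ∀ y, ‖w j (x + t • y) * φ y - u (x + t • y) * φ y‖ ≤ ε / (A + 1) * |φ y| := by
      intro y
      rw [← sub_mul, norm_mul, Real.norm_eq_abs, Real.norm_eq_abs]
      by_cases hy : φ y = 0
      · simp [hy]
      · refine mul_le_mul_of_nonneg_right (hj _ ?_).le (abs_nonneg _)
        have hy := hφs hy
        simp only [mem_closedBall, dist_zero_right] at hy
        simp only [mem_closedBall, dist_self_add_left, norm_smul, Real.norm_of_nonneg ht]
        nlinarith
    refine (norm_integral_le_of_norm_le (hφi.abs.const_mul _) (Eventually.of_forall hb)).trans_lt ?_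
    rw [integral_const_mul]
    calc ε / (A + 1) * A < ε / (A + 1) * (A + 1) := by
          have : 0 < ε / (A + 1) := by positivity
          nlinarith
      _ = ε := by field_simp
  have hsm : ContDiffOn ℝ ∞ u H := by
    obtain ⟨φ, C, hφ⟩ := exists_ker b k hk
    intro x hx
    obtain ⟨T₀, hT₀, S, δ, hδ, h⟩ := hw x hx
    obtain ⟨T', hT', hTH⟩ := Metric.isOpen_iff.1 hH x hx
    set T := min T₀ T'
    have hT : 0 < T := by positivity
    have hTT₀ : T ≤ T₀ := min_le_left _ _
    have hTH' : ball x T ⊆ H := (ball_subset_ball (min_le_right _ _)).trans hTH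
    refine ((hφ.smooth_of_mean (t := T / 3) (r := T / 3) (T := T) (by linarith) (by linarith)
      (by linarith) (fun y hy => (hcont y (hTH' hy)).continuousWithinAt) ?_).contDiffAt
      (ball_mem_nhds x (by linarith))).contDiffWithinAt
    intro y hy
    have hsub : ball y (2 * T / 3) ⊆ ball x T := ball_subset_ball' (by
      have := mem_ball.1 hy; linarith)
    have hcb : closedBall y (T / 3) ⊆ ball x T :=
      (closedBall_subset_ball (by linarith)).trans hsub
    have hsub0 := ball_subset_ball (x := x) hTT₀
    have t1 := hint φ hφ.smooth.continuous hφ.compact hφ.supp y (T / 3) (by linarith)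
      (hcb.trans hTH') (h.mono fun j hj => hj.1.continuousOn.mono (hcb.trans hsub0))
    have t2 := (((hu y (hTH' (hsub (mem_ball_self (by linarith))))).sub t1).abs)
    have t3 : Tendsto (fun j => C * δ j * (T / 3) ^ (2 * k)) 𝒰 (𝓝 (C * 0 * (T / 3) ^ (2 * k))) :=
      (hδ.const_mul _).mul_const _
    have := le_of_tendsto_of_tendsto t2 t3 (by
      filter_upwards [h] with j hj
      exact hφ.approx (w j) y (T / 3) (2 * T / 3) (δ j) (by linarith) (by linarith)
        (hj.1.mono (hsub.trans hsub0)) fun z hz => hj.2.2 z (hsub0 (hsub hz)))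
    simp only [mul_zero, zero_mul] at this
    linarith [abs_nonpos_iff.1 this]
  refine ⟨u, hsm, ?_, hcc⟩
  intro x hx
  obtain ⟨T₀, hT₀, S, δ, hδ, h⟩ := hw x hx
  obtain ⟨T', hT', hTH⟩ := Metric.isOpen_iff.1 hH x hx
  obtain ⟨p, hp⟩ := exists_profile
  obtain ⟨c, C, hC, hc, hexp⟩ := rmean_expansion_on b k hp
  obtain ⟨c', C', hC', hc', hexp'⟩ := rmean_expansion_on b (k + 1) hp
  obtain ⟨α, hα⟩ := exists_node_coeff (k + 1) k
  set T := min T₀ T' / 2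
  have hm : 0 < min T₀ T' := by positivity
  have hT : 0 < T := by positivity
  have hTT₀ : T < T₀ := by have := min_le_left T₀ T'; simp only [T]; linarith
  have hTT' : T < T' := by have := min_le_right T₀ T'; simp only [T]; linarith
  have hTH' : closedBall x T ⊆ H := (closedBall_subset_ball hTT').trans hTH
  have comb : ∀ (N : ℕ) (c : ℕ → ℝ) (V : E → ℝ) (τ F C : ℝ), 0 ≤ C * F * τ ^ (2 * N) →
      0 < τ → N ≤ k + 1 →
      (∀ l, |rmean V p x (node l * τ) - ∑ i ∈ Finset.range N, c i * (lap b)^[i] V x *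
        (node l * τ) ^ (2 * i)| ≤ C * F * (node l * τ) ^ (2 * N)) →
      |∑ l ∈ Finset.range (k + 1), α l * rmean V p x (node l * τ) -
        ∑ i ∈ Finset.range N, c i * (lap b)^[i] V x * τ ^ (2 * i) * if i = k then 1 else 0| ≤
        (∑ l ∈ Finset.range (k + 1), |α l|) * (C * F * τ ^ (2 * N)) := by
    intro N c V τ F C hF hτ hN hr
    have e : ∑ i ∈ Finset.range N, c i * (lap b)^[i] V x * τ ^ (2 * i) * (if i = k then 1 else 0) =
        ∑ l ∈ Finset.range (k + 1), α l * ∑ i ∈ Finset.range N, c i * (lap b)^[i] V x *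
          (node l * τ) ^ (2 * i) := by
      simp only [Finset.mul_sum]
      rw [Finset.sum_comm]
      refine Finset.sum_congr rfl fun i hi => ?_
      rw [← hα i ((Finset.mem_range.1 hi).trans_le hN), Finset.mul_sum]
      refine Finset.sum_congr rfl fun l _ => ?_
      rw [mul_pow]; ring
    rw [e, ← Finset.sum_sub_distrib, Finset.sum_mul]
    refine (Finset.abs_sum_le_sum_abs _ _).trans (Finset.sum_le_sum fun l _ => ?_)
    rw [← mul_sub, abs_mul]
    refine mul_le_mul_of_nonneg_left ((hr l).trans ?_) (abs_nonneg _)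
    rw [mul_pow, mul_left_comm]
    exact mul_le_of_le_one_left hF (pow_le_one₀ (node_pos l).le (node_le l))
  have hnl : ∀ l τ, 0 < τ → node l * τ ≤ τ := fun l τ hτ =>
    mul_le_of_le_one_left hτ.le (node_le l)
  have zero : ∀ τ, 0 < τ → τ < T →
      ∑ l ∈ Finset.range (k + 1), α l * rmean u p x (node l * τ) = 0 := by
    intro τ hτ hτT
    have t1 : Tendsto (fun j => |∑ l ∈ Finset.range (k + 1), α l * rmean (w j) p x (node l * τ)|) 𝒰
        (𝓝 |∑ l ∈ Finset.range (k + 1), α l * rmean u p x (node l * τ)|) := by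
      refine (tendsto_finsetSum _ fun l _ => Tendsto.const_mul _ ?_).abs
      have hs : closedBall x (node l * τ) ⊆ closedBall x T :=
        closedBall_subset_closedBall ((hnl l τ hτ).trans hτT.le)
      refine hint (fun y => p (‖y‖ ^ 2)) hp.contDiff_radial.continuous hp.compact_radial
        (fun y hy => ?_) x _ (mul_pos (node_pos l) hτ).le (hs.trans hTH') ?_
      · by_contra hy'
        exact hy (hp.radial_eq_zero fun h => hy' (ball_subset_closedBall h))
      · exact h.mono fun j hj => hj.1.continuousOn.mono (hs.trans (closedBall_subset_ball hTT₀))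
    have t2 : Tendsto (fun j => (∑ l ∈ Finset.range (k + 1), |α l|) * (C * δ j * τ ^ (2 * k))) 𝒰
        (𝓝 ((∑ l ∈ Finset.range (k + 1), |α l|) * (C * 0 * τ ^ (2 * k)))) :=
      ((hδ.const_mul _).mul_const _).const_mul _
    simp only [mul_zero, zero_mul] at t2
    refine abs_nonpos_iff.1 (le_of_tendsto_of_tendsto t1 t2 ?_)
    filter_upwards [h] with j hj
    have hδ0 : 0 ≤ δ j := (abs_nonneg _).trans (hj.2.2 x (mem_ball_self hT₀))
    have := comb k c (w j) τ (δ j) C (by positivity) hτ (by omega) fun l =>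
      hexp (w j) x (node l * τ) T₀ (δ j) (mul_pos (node_pos l) hτ).le
        (((hnl l τ hτ).trans_lt hτT).trans hTT₀) hj.1 hj.2.2
    rwa [Finset.sum_eq_zero (s := Finset.range k), sub_zero] at this
    intro i hi
    have := (Finset.mem_range.1 hi).ne
    simp [this]
  have hsm' : ContDiffOn ℝ ∞ u (ball x T') := hsm.mono hTH
  obtain ⟨F, hF⟩ := (isCompact_closedBall x T).exists_bound_of_continuousOn
    (((lapI_contDiffOn_infty b hH hsm (k + 1)).continuousOn).mono hTH')
  have hF0 : 0 ≤ F := (norm_nonneg _).trans (hF x (mem_closedBall_self hT.le))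
  set A := ∑ l ∈ Finset.range (k + 1), |α l|
  have key : ∀ τ, 0 < τ → τ < T → |c' k * (lap b)^[k] u x| ≤ A * (C' * F) * τ ^ 2 := by
    intro τ hτ hτT
    have := comb (k + 1) c' u τ F C' (by positivity) hτ le_rfl fun l =>
      hexp' u x (node l * τ) T F (mul_pos (node_pos l) hτ).le ((hnl l τ hτ).trans_lt hτT)
        ((hsm.mono (ball_subset_closedBall.trans hTH')).of_le (by exact ENat.LEInfty.out))
        fun y hy => hF y (ball_subset_closedBall hy)
    rw [zero τ hτ hτT] at this
    simp only [mul_ite, mul_one, mul_zero, Finset.sum_ite_eq', Finset.mem_range,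
      Nat.lt_succ_self, if_true, zero_sub, abs_neg] at this
    rw [abs_mul, abs_of_pos (pow_pos hτ (2 * k))] at this
    refine le_of_mul_le_mul_right (this.trans (le_of_eq ?_)) (pow_pos hτ (2 * k))
    ring
  have t4 : Tendsto (fun τ : ℝ => A * (C' * F) * τ ^ 2) (𝓝[>] 0) (𝓝 (A * (C' * F) * 0 ^ 2)) :=
    ((continuous_const.mul (continuous_pow 2)).tendsto 0).mono_left nhdsWithin_le_nhds
  have := ge_of_tendsto t4 (by
    filter_upwards [Ioo_mem_nhdsGT hT] with τ hτ
    exact key τ hτ.1 hτ.2)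
  simp only [ne_eq, OfNat.ofNat_ne_zero, not_false_eq_true, zero_pow, mul_zero] at this
  have h0 := abs_nonpos_iff.1 this
  exact (mul_eq_zero.1 h0).resolve_left (hc' k).ne'

end Limit

section Parts

theorem exists_bound_deriv_smoothTransition : ∃ M, 0 ≤ M ∧
    (∀ s, |deriv Real.smoothTransition s| ≤ M) ∧
    ∀ s, s ∉ Icc (0:ℝ) 1 → deriv Real.smoothTransition s = 0 := by
  have h0 : ∀ s, s ∉ Icc (0:ℝ) 1 → deriv Real.smoothTransition s = 0 := by
    intro s hs
    rcases lt_or_ge s 0 with h | h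
    · have : Real.smoothTransition =ᶠ[𝓝 s] fun _ => 0 := by
        filter_upwards [Iio_mem_nhds h] with z hz
        exact Real.smoothTransition.zero_of_nonpos (le_of_lt hz)
      simp [this.deriv_eq]
    · have h1 : 1 < s := by
        by_contra h2
        exact hs ⟨h, not_lt.1 h2⟩
      have : Real.smoothTransition =ᶠ[𝓝 s] fun _ => 1 := by
        filter_upwards [Ioi_mem_nhds h1] with z hz
        exact Real.smoothTransition.one_of_one_le (le_of_lt hz)
      simp [this.deriv_eq]
  have hc : Continuous (deriv Real.smoothTransition) :=
    (Real.smoothTransition.contDiff (n := 1)).continuous_deriv le_rfl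
  obtain ⟨M, hM⟩ := (isCompact_Icc (a := (0:ℝ)) (b := 1)).exists_bound_of_continuousOn
    hc.continuousOn
  have hM0 : 0 ≤ M := (norm_nonneg _).trans (hM 0 (by simp))
  refine ⟨M, hM0, fun s => ?_, h0⟩
  by_cases hs : s ∈ Icc (0:ℝ) 1
  · exact hM s hs
  · rw [h0 s hs]; simpa using hM0

/-- Integration by parts on `{0 < σ}` for functions that are `O(σ)` against an integrable
function. -/
theorem integral_dd_eq_zero {σ : E → ℝ} (hσ : ContDiff ℝ 1 σ) {G : Set E} (hG : G = {x | 0 < σ x})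
    {K : ℝ} (hK : ∀ x ∈ G, ‖fderiv ℝ σ x‖ ≤ K) {F Z : E → ℝ} (hF : ContDiffOn ℝ 1 F G)
    (hZ : IntegrableOn Z G) (hFZ : ∀ x ∈ G, |F x| ≤ Z x * σ x) (hFi : IntegrableOn F G) (v : E)
    (hdF : IntegrableOn (dd v F) G) : ∫ x in G, dd v F x = 0 := by
  obtain ⟨M, hM0, hM, hM'⟩ := exists_bound_deriv_smoothTransition
  have hGo : IsOpen G := by rw [hG]; exact isOpen_lt continuous_const hσ.continuous
  have hGm := hGo.measurableSet
  have hpos : ∀ x ∈ G, 0 < σ x := fun x hx => by rw [hG] at hx; exact hx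
  have hS : ContDiff ℝ 1 Real.smoothTransition := Real.smoothTransition.contDiff
  let P : ℕ → E → ℝ := fun j x => Real.smoothTransition (j * σ x - 1) * F x
  let D : ℕ → E → ℝ := fun j x => Real.smoothTransition (j * σ x - 1) * dd v F x +
    deriv Real.smoothTransition (j * σ x - 1) * (j * dd v σ x) * F x
  have hSσ : ∀ j : ℕ, ContDiff ℝ 1 fun x => Real.smoothTransition (j * σ x - 1) := fun j =>
    hS.comp ((contDiff_const.mul hσ).sub contDiff_const)
  have hPz : ∀ (j : ℕ) x, x ∉ G → P j =ᶠ[𝓝 x] fun _ => 0 := by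
    intro j x hx
    have hx' : σ x ≤ 0 := by
      rw [hG] at hx; exact not_lt.1 hx
    have : ∀ᶠ y in 𝓝 x, j * σ y - 1 < 0 := by
      have hc : ContinuousAt (fun y => j * σ y - 1) x := by
        have := hσ.continuous
        fun_prop
      refine hc.eventually_lt_const ?_
      have : (j:ℝ) * σ x ≤ 0 := mul_nonpos_of_nonneg_of_nonpos j.cast_nonneg hx'
      linarith
    filter_upwards [this] with y hy
    simp [P, Real.smoothTransition.zero_of_nonpos hy.le]
  have hPd : ∀ j, Differentiable ℝ (P j) := by
    intro j x
    by_cases hx : x ∈ G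
    · exact ((hSσ j).differentiable (by norm_num) x).mul (diffAt_of hGo hF le_rfl hx)
    · exact (hPz j x hx).differentiableAt_iff.2 (differentiableAt_const _)
  have hPD : ∀ j, ∀ x ∈ G, dd v (P j) x = D j x := by
    intro j x hx
    have h1 : HasFDerivAt (fun x => Real.smoothTransition (j * σ x - 1))
        (deriv Real.smoothTransition (j * σ x - 1) • ((j:ℝ) • fderiv ℝ σ x)) x := by
      have a1 : HasFDerivAt (fun x => j * σ x - 1) ((j:ℝ) • fderiv ℝ σ x) x :=
        ((hσ.differentiable (by norm_num) x).hasFDerivAt.const_mul _).sub_const _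
      exact (hS.differentiable (by norm_num) _).hasDerivAt.comp_hasFDerivAt x a1
    have := h1.mul (diffAt_of hGo hF le_rfl hx).hasFDerivAt
    have h2 : fderiv ℝ (P j) x = _ := this.fderiv
    simp only [D, dd]
    rw [h2]
    simp
    ring
  have hPD0 : ∀ j x, x ∉ G → dd v (P j) x = 0 := by
    intro j x hx
    simp [dd, (hPz j x hx).fderiv_eq]
  have hK0 : ∀ x ∈ G, 0 ≤ K := fun x hx => (norm_nonneg _).trans (hK x hx)
  have hDb : ∀ j, ∀ x ∈ G, ‖D j x‖ ≤ |dd v F x| + 2 * M * K * ‖v‖ * Z x := by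
    intro j x hx
    have hs := hpos x hx
    have hZ0 : 0 ≤ Z x := by
      have := (abs_nonneg _).trans (hFZ x hx)
      exact nonneg_of_mul_nonneg_left this hs
    have hKx := hK0 x hx
    refine (norm_add_le _ _).trans (add_le_add ?_ ?_)
    · rw [norm_mul, Real.norm_eq_abs, Real.norm_eq_abs,
        abs_of_nonneg (Real.smoothTransition.nonneg _)]
      exact mul_le_of_le_one_left (abs_nonneg _) (Real.smoothTransition.le_one _)
    · by_cases hI : j * σ x - 1 ∈ Icc (0:ℝ) 1
      · have h1 : |dd v σ x| ≤ K * ‖v‖ :=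
          ((fderiv ℝ σ x).le_opNorm v).trans (mul_le_mul_of_nonneg_right (hK x hx) (norm_nonneg _))
        have h2 : (j:ℝ) * σ x ≤ 2 := by linarith [hI.2]
        rw [norm_mul, norm_mul, norm_mul, Real.norm_eq_abs, Real.norm_eq_abs, Real.norm_eq_abs,
          Real.norm_eq_abs, abs_of_nonneg (Nat.cast_nonneg (α := ℝ) j)]
        calc |deriv Real.smoothTransition (j * σ x - 1)| * (j * |dd v σ x|) * |F x|
            ≤ M * (j * (K * ‖v‖)) * (Z x * σ x) := by
              gcongr
              · exact hM _
              · exact hFZ x hx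
          _ = (M * K * ‖v‖ * Z x) * (j * σ x) := by ring
          _ ≤ (M * K * ‖v‖ * Z x) * 2 := by gcongr
          _ = _ := by ring
      · rw [hM' _ hI]
        simp only [zero_mul, norm_zero]
        positivity
  have hbi : IntegrableOn (fun x => |dd v F x| + 2 * M * K * ‖v‖ * Z x) G :=
    hdF.abs.add (hZ.const_mul _)
  have hDm : ∀ j, AEStronglyMeasurable (D j) (volume.restrict G) := by
    intro j
    refine ContinuousOn.aestronglyMeasurable ?_ hGm
    have c1 : ContinuousOn (dd v F) G :=
      (dd_contDiffOn (m := 0) hGo hF (by norm_num) v).continuousOn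
    have c2 : Continuous (dd v σ) :=
      (hσ.continuous_fderiv (by norm_num)).clm_apply continuous_const
    have c3 : Continuous fun x => deriv Real.smoothTransition (j * σ x - 1) :=
      (hS.continuous_deriv le_rfl).comp
        ((continuous_const.mul hσ.continuous).sub continuous_const)
    exact ((hSσ j).continuous.continuousOn.mul c1).add
      ((c3.mul (continuous_const.mul c2)).continuousOn.mul hF.continuousOn)
  have hDi : ∀ j, IntegrableOn (D j) G := fun j =>
    hbi.mono' (hDm j) ((ae_restrict_iff' hGm).2 (Eventually.of_forall (hDb j)))
  have hP0 : ∀ j, ∫ x in G, D j x = 0 := by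
    intro j
    have e1 : ∫ x in G, D j x = ∫ x, dd v (P j) x := by
      rw [← setIntegral_eq_integral_of_forall_compl_eq_zero (s := G) (f := dd v (P j))
        (fun x hx => hPD0 j x hx)]
      exact setIntegral_congr_fun hGm fun x hx => (hPD j x hx).symm
    have i1 : Integrable (dd v (P j)) := by
      refine (integrableOn_iff_integrable_of_support_subset (s := G) fun x hx => ?_).1
        ((hDi j).congr_fun (fun x hx => (hPD j x hx).symm) hGm)
      by_contra h
      exact hx (hPD0 j x h)
    have i2 : Integrable (P j) := by
      refine (integrableOn_iff_integrable_of_support_subset (s := G) fun x hx => ?_).1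
        (Integrable.mono hFi ?_ ((ae_restrict_iff' hGm).2 (Eventually.of_forall fun x hx => ?_)))
      · by_contra h
        exact hx (hPz j x h).self_of_nhds
      · exact (hPd j).continuous.aestronglyMeasurable
      · simp only [P]
        rw [norm_mul, Real.norm_eq_abs, abs_of_nonneg (Real.smoothTransition.nonneg _)]
        exact mul_le_of_le_one_left (norm_nonneg _) (Real.smoothTransition.le_one _)
    rw [e1]
    have := integral_mul_fderiv_eq_neg_fderiv_mul_of_integrable (μ := (volume : Measure E))
      (f := fun _ => (1:ℝ)) (g := P j) (v := v) (by simp) (by simp only [one_mul]; exact i1) (by simpa using i2)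
      (fun x _ => differentiableAt_const _) (fun x _ => hPd j x)
    simpa [dd] using this
  have hlim : Tendsto (fun j => ∫ x in G, D j x) atTop (𝓝 (∫ x in G, dd v F x)) := by
    refine tendsto_integral_of_dominated_convergence _ hDm hbi
      (fun j => (ae_restrict_iff' hGm).2 (Eventually.of_forall (hDb j)))
      ((ae_restrict_iff' hGm).2 (Eventually.of_forall fun x hx => ?_))
    refine tendsto_const_nhds.congr' ?_
    have : Tendsto (fun j : ℕ => j * σ x) atTop atTop :=
      tendsto_natCast_atTop_atTop.atTop_mul_const (hpos x hx)
    filter_upwards [this.eventually_gt_atTop 2] with j hj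
    have : j * σ x - 1 ∉ Icc (0:ℝ) 1 := fun h => by linarith [h.2]
    simp only [D]
    rw [hM' _ this, Real.smoothTransition.one_of_one_le (by linarith)]
    ring
  simp only [hP0] at hlim
  exact (tendsto_nhds_unique hlim tendsto_const_nhds)

theorem dl_add {U : Set E} (hU : IsOpen U) {f g : E → ℝ} (hf : ContDiffOn ℝ ∞ f U)
    (hg : ContDiffOn ℝ ∞ g U) (L : List E) :
    EqOn (dl L (fun y => f y + g y)) (fun y => dl L f y + dl L g y) U := by
  induction L generalizing f g with
  | nil => exact fun _ _ => rfl
  | cons v L ih =>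
    have e : EqOn (dd v fun y => f y + g y) (fun y => dd v f y + dd v g y) U := fun y hy =>
      dd_add (diffAt_of hU hf (by simp) hy) (diffAt_of hU hg (by simp) hy) v
    exact (dl_congr hU e L).trans
      (ih (dd_contDiffOn_infty hU hf v) (dd_contDiffOn_infty hU hg v))

theorem dl_const_mul (c : ℝ) (f : E → ℝ) (L : List E) :
    dl L (fun y => c * f y) = fun y => c * dl L f y := by
  induction L generalizing f with
  | nil => rfl
  | cons v L ih =>
    have e : dd v (fun y => c * f y) = fun y => c * dd v f y := by
      ext y
      have : (fun y => c * f y) = c • f := rfl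
      simp [dd, this, fderiv_const_smul_field]
    rw [dl, e, ih]; rfl

/-- Smooth functions on `U` whose derivatives of order `j` are `O(τ ^ j * W)`. -/
structure DB (U : Set E) (τ W f : E → ℝ) : Prop where
  smooth : ContDiffOn ℝ ∞ f U
  bound : ∀ L : List E, ∃ C, 0 ≤ C ∧ ∀ x ∈ U, |dl L f x| ≤ C * (τ x ^ L.length * W x)

section DBlemmas

variable {U : Set E} {τ W W' f g : E → ℝ}

theorem DB.dd (hU : IsOpen U) (h : DB U τ W f) (v : E) : DB U τ (τ * W) (dd v f) := by
  refine ⟨dd_contDiffOn_infty hU h.smooth v, fun L => ?_⟩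
  obtain ⟨C, hC, hb⟩ := h.bound (v :: L)
  refine ⟨C, hC, fun x hx => (hb x hx).trans (le_of_eq ?_)⟩
  simp only [List.length_cons, Pi.mul_apply, pow_succ]
  ring

theorem DB.add (hU : IsOpen U) (hf : DB U τ W f) (hg : DB U τ W g) :
    DB U τ W (fun y => f y + g y) := by
  refine ⟨hf.smooth.add hg.smooth, fun L => ?_⟩
  obtain ⟨C, hC, hb⟩ := hf.bound L
  obtain ⟨C', hC', hb'⟩ := hg.bound L
  refine ⟨C + C', by positivity, fun x hx => ?_⟩
  rw [dl_add hU hf.smooth hg.smooth L hx, add_mul]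
  exact (abs_add_le _ _).trans (add_le_add (hb x hx) (hb' x hx))

theorem DB.zero : DB U τ W fun _ => 0 := by
  refine ⟨contDiffOn_const, fun L => ⟨0, le_rfl, fun x hx => ?_⟩⟩
  rw [dl_zero]; simp

theorem DB.sum (hU : IsOpen U) {ι : Type*} (s : Finset ι) {f : ι → E → ℝ}
    (hf : ∀ i ∈ s, DB U τ W (f i)) :
    DB U τ W (fun y => ∑ i ∈ s, f i y) := by
  classical
  induction s using Finset.induction_on with
  | empty => simpa using DB.zero
  | insert i s hi ih =>
    simp only [Finset.sum_insert hi]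
    exact DB.add hU (hf i (by simp)) (ih fun j hj => hf j (by simp [hj]))

theorem DB.mul (hU : IsOpen U) (hτ : ∀ x ∈ U, 0 ≤ τ x) (hW : ∀ x ∈ U, 0 ≤ W x)
    (hW' : ∀ x ∈ U, 0 ≤ W' x) (hf : DB U τ W f) (hg : DB U τ W' g) :
    DB U τ (W * W') (fun y => f y * g y) := by
  refine ⟨hf.smooth.mul hg.smooth, fun L => ?_⟩
  induction L generalizing f g W W' with
  | nil =>
    obtain ⟨C, hC, hb⟩ := hf.bound []
    obtain ⟨C', hC', hb'⟩ := hg.bound []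
    refine ⟨C * C', by positivity, fun x hx => ?_⟩
    have h1 := hb x hx
    have h2 := hb' x hx
    simp only [dl, List.length_nil, pow_zero, one_mul, Pi.mul_apply] at h1 h2 ⊢
    rw [abs_mul]
    calc |f x| * |g x| ≤ (C * W x) * (C' * W' x) :=
          mul_le_mul h1 h2 (abs_nonneg _) ((abs_nonneg _).trans h1)
      _ = _ := by ring
  | cons v L ih =>
    have hτW : ∀ x ∈ U, 0 ≤ (τ * W) x := fun x hx => mul_nonneg (hτ x hx) (hW x hx)
    have hτW' : ∀ x ∈ U, 0 ≤ (τ * W') x := fun x hx => mul_nonneg (hτ x hx) (hW' x hx)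
    obtain ⟨C, hC, hb⟩ := ih hτW hW' (hf.dd hU v) hg
    obtain ⟨C', hC', hb'⟩ := ih hW hτW' hf (hg.dd hU v)
    refine ⟨C + C', by positivity, fun x hx => ?_⟩
    have e : EqOn (_root_.dd v fun y => f y * g y)
        (fun y => (_root_.dd v f y * g y) + (f y * _root_.dd v g y)) U := fun y hy =>
      dd_mul (diffAt_of hU hf.smooth (by simp) hy) (diffAt_of hU hg.smooth (by simp) hy) v
    rw [dl, dl_congr hU e L hx, dl_add hU
      ((dd_contDiffOn_infty hU hf.smooth v).mul hg.smooth)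
      (hf.smooth.mul (dd_contDiffOn_infty hU hg.smooth v)) L hx]
    refine (abs_add_le _ _).trans ((add_le_add (hb x hx) (hb' x hx)).trans (le_of_eq ?_))
    simp only [List.length_cons, Pi.mul_apply, pow_succ]
    ring

end DBlemmas

end Parts

section Forms

variable {ι : Type*} [Fintype ι] (b : OrthonormalBasis ι ℝ E)

/-- The scalar product of the arrays of `j`-th derivatives. -/
def BB : ℕ → (E → ℝ) → (E → ℝ) → E → ℝ
  | 0, f, g => fun x => f x * g x
  | j + 1, f, g => fun x => ∑ i, BB j (dd (b i) f) (dd (b i) g) x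

/-- The `ℓ¹` norm of the array of `j`-th derivatives. -/
def NN : ℕ → (E → ℝ) → E → ℝ
  | 0, f => fun x => |f x|
  | j + 1, f => fun x => ∑ i, NN j (dd (b i) f) x

/-- Sum of the `ℓ¹` norms of the derivatives of order less than `j`. -/
def NS (j : ℕ) (f : E → ℝ) (x : E) : ℝ := ∑ l ∈ Finset.range j, NN b l f x

theorem NN_nonneg (j : ℕ) (f : E → ℝ) (x : E) : 0 ≤ NN b j f x := by
  induction j generalizing f with
  | zero => exact abs_nonneg _
  | succ j ih => exact Finset.sum_nonneg fun i _ => ih _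

theorem NS_nonneg (j : ℕ) (f : E → ℝ) (x : E) : 0 ≤ NS b j f x :=
  Finset.sum_nonneg fun _ _ => NN_nonneg b _ _ _

theorem sum_mul_le_of_nonneg {a c : ι → ℝ} (ha : ∀ i, 0 ≤ a i) (hc : ∀ i, 0 ≤ c i) :
    ∑ i, a i * c i ≤ (∑ i, a i) * ∑ i, c i := by
  rw [Finset.sum_mul]
  refine Finset.sum_le_sum fun i _ => mul_le_mul_of_nonneg_left ?_ (ha i)
  exact Finset.single_le_sum (fun i _ => hc i) (Finset.mem_univ i)

theorem abs_BB_le (j : ℕ) (f g : E → ℝ) (x : E) :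
    |BB b j f g x| ≤ NN b j f x * NN b j g x := by
  induction j generalizing f g with
  | zero => exact (abs_mul _ _).le
  | succ j ih =>
    refine (Finset.abs_sum_le_sum_abs _ _).trans ((Finset.sum_le_sum fun i _ => ih _ _).trans ?_)
    exact sum_mul_le_of_nonneg (fun i => NN_nonneg b _ _ _) fun i => NN_nonneg b _ _ _

theorem NN_sq_le (j : ℕ) (f : E → ℝ) (x : E) :
    NN b j f x ^ 2 ≤ (Fintype.card ι + 1 : ℝ) ^ j * BB b j f f x := by
  induction j generalizing f with
  | zero => simp [NN, BB, sq]
  | succ j ih =>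
    have h1 := sq_sum_le_card_mul_sum_sq (s := Finset.univ) (f := fun i => NN b j (dd (b i) f) x)
    have h2 : ∑ i, NN b j (dd (b i) f) x ^ 2 ≤
        (Fintype.card ι + 1 : ℝ) ^ j * BB b (j + 1) f f x := by
      simp only [BB]
      rw [Finset.mul_sum]
      exact Finset.sum_le_sum fun i _ => ih _
    calc NN b (j + 1) f x ^ 2 ≤ (Fintype.card ι : ℝ) * ∑ i, NN b j (dd (b i) f) x ^ 2 := h1
      _ ≤ (Fintype.card ι + 1 : ℝ) * ∑ i, NN b j (dd (b i) f) x ^ 2 := by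
          exact mul_le_mul_of_nonneg_right (by linarith)
            (Finset.sum_nonneg fun i _ => sq_nonneg _)
      _ ≤ (Fintype.card ι + 1 : ℝ) * ((Fintype.card ι + 1 : ℝ) ^ j * BB b (j + 1) f f x) := by
          gcongr
      _ = _ := by rw [pow_succ]; ring

theorem BB_self_nonneg (j : ℕ) (f : E → ℝ) (x : E) : 0 ≤ BB b j f f x := by
  induction j generalizing f with
  | zero => exact mul_self_nonneg _
  | succ j ih => exact Finset.sum_nonneg fun i _ => ih _

theorem BB_comm (j : ℕ) (f g : E → ℝ) : BB b j f g = BB b j g f := by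
  induction j generalizing f g with
  | zero => ext x; exact mul_comm _ _
  | succ j ih => ext x; simp only [BB]; exact Finset.sum_congr rfl fun i _ => by rw [ih]

variable {U : Set E} {f g h : E → ℝ}

theorem BB_congr (hU : IsOpen U) (hfg : EqOn f g U) (j : ℕ) (p : E → ℝ) :
    EqOn (BB b j f p) (BB b j g p) U := by
  induction j generalizing f g p with
  | zero => intro x hx; simp only [BB]; rw [hfg hx]
  | succ j ih =>
    intro x hx
    simp only [BB]
    exact Finset.sum_congr rfl fun i _ => ih (dd_congr hU hfg _) _ hx

theorem NN_congr (hU : IsOpen U) (hfg : EqOn f g U) (j : ℕ) : EqOn (NN b j f) (NN b j g) U := by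
  induction j generalizing f g with
  | zero => intro x hx; simp only [NN]; rw [hfg hx]
  | succ j ih =>
    intro x hx
    simp only [NN]
    exact Finset.sum_congr rfl fun i _ => ih (dd_congr hU hfg _) hx

theorem BB_add_left (hU : IsOpen U) (hf : ContDiffOn ℝ ∞ f U) (hg : ContDiffOn ℝ ∞ g U) (j : ℕ)
    (p : E → ℝ) : EqOn (BB b j (fun y => f y + g y) p) (fun y => BB b j f p y + BB b j g p y) U := by
  induction j generalizing f g p with
  | zero => intro x _; simp only [BB]; ring
  | succ j ih =>
    intro x hx
    simp only [BB]
    rw [← Finset.sum_add_distrib]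
    refine Finset.sum_congr rfl fun i _ => ?_
    have e : EqOn (dd (b i) fun y => f y + g y) (fun y => dd (b i) f y + dd (b i) g y) U :=
      fun y hy => dd_add (diffAt_of hU hf (by simp) hy) (diffAt_of hU hg (by simp) hy) _
    rw [BB_congr b hU e j _ hx]
    exact ih (dd_contDiffOn_infty hU hf _) (dd_contDiffOn_infty hU hg _) _ hx

theorem NN_add_le (hU : IsOpen U) (hf : ContDiffOn ℝ ∞ f U) (hg : ContDiffOn ℝ ∞ g U) (j : ℕ)
    {x : E} (hx : x ∈ U) : NN b j (fun y => f y + g y) x ≤ NN b j f x + NN b j g x := by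
  induction j generalizing f g with
  | zero => exact abs_add_le _ _
  | succ j ih =>
    simp only [NN]
    rw [← Finset.sum_add_distrib]
    refine Finset.sum_le_sum fun i _ => ?_
    have e : EqOn (dd (b i) fun y => f y + g y) (fun y => dd (b i) f y + dd (b i) g y) U :=
      fun y hy => dd_add (diffAt_of hU hf (by simp) hy) (diffAt_of hU hg (by simp) hy) _
    rw [NN_congr b hU e j hx]
    exact ih (dd_contDiffOn_infty hU hf _) (dd_contDiffOn_infty hU hg _)

theorem BB_sum_left (hU : IsOpen U) {κ : Type*} (s : Finset κ) {F : κ → E → ℝ}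
    (hF : ∀ i ∈ s, ContDiffOn ℝ ∞ (F i) U) (j : ℕ) (p : E → ℝ) :
    EqOn (BB b j (fun y => ∑ i ∈ s, F i y) p) (fun y => ∑ i ∈ s, BB b j (F i) p y) U := by
  classical
  induction s using Finset.induction_on with
  | empty =>
    intro x _
    have : |BB b j (fun _ => 0) p x| ≤ 0 := by
      refine (abs_BB_le b j _ _ x).trans ?_
      have : NN b j (fun _ => (0:ℝ)) x = 0 := by
        clear hF
        induction j with
        | zero => simp [NN]
        | succ j ih => simp [NN, dd_const, ih]
      rw [this, zero_mul]
    simpa using abs_nonpos_iff.1 this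
  | insert i s hi ih =>
    intro x hx
    simp only [Finset.sum_insert hi]
    have h1 := BB_add_left b hU (hF i (by simp))
      (ContDiffOn.sum fun l hl => hF l (by simp [hl]) : ContDiffOn ℝ ∞ (fun y => ∑ l ∈ s, F l y) U)
      j p hx
    have h2 := ih (fun l hl => hF l (by simp [hl])) hx
    dsimp only at h1 h2
    rw [h1, h2]

theorem BB_contDiffOn (hU : IsOpen U) (hf : ContDiffOn ℝ ∞ f U) (hg : ContDiffOn ℝ ∞ g U)
    (j : ℕ) : ContDiffOn ℝ ∞ (BB b j f g) U := by
  induction j generalizing f g with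
  | zero => exact hf.mul hg
  | succ j ih =>
    exact ContDiffOn.sum fun i _ => ih (dd_contDiffOn_infty hU hf _) (dd_contDiffOn_infty hU hg _)

theorem dd_BB (hU : IsOpen U) (hf : ContDiffOn ℝ ∞ f U) (hg : ContDiffOn ℝ ∞ g U) (j : ℕ) (v : E) :
    EqOn (dd v (BB b j f g)) (fun y => BB b j (dd v f) g y + BB b j f (dd v g) y) U := by
  induction j generalizing f g with
  | zero =>
    intro x hx
    exact dd_mul (diffAt_of hU hf (by simp) hx) (diffAt_of hU hg (by simp) hx) v
  | succ j ih =>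
    intro x hx
    have hD := fun i => dd_contDiffOn_infty hU hf (b i)
    have hD' := fun i => dd_contDiffOn_infty hU hg (b i)
    simp only [BB]
    rw [dd_sum _ fun i _ => diffAt_of hU (BB_contDiffOn b hU (hD i) (hD' i) j) (by simp) hx,
      ← Finset.sum_add_distrib]
    refine Finset.sum_congr rfl fun i _ => ?_
    have h2 : (2 : WithTop ℕ∞) ≤ ∞ := ENat.LEInfty.out
    rw [ih (hD i) (hD' i) hx]
    dsimp only
    rw [BB_congr b hU (dd_comm_on hU hf h2 (b i) v) j _ hx,
      BB_comm b j _ (dd v (dd (b i) g)), BB_congr b hU (dd_comm_on hU hg h2 (b i) v) j _ hx,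
      BB_comm b j _ (dd (b i) f)]

theorem sum_dd_BB (hU : IsOpen U) (hf : ContDiffOn ℝ ∞ f U) (hg : ContDiffOn ℝ ∞ g U) (j : ℕ) :
    EqOn (fun x => ∑ i, dd (b i) (BB b j (dd (b i) f) g) x)
      (fun x => BB b (j + 1) f g x + BB b j (lap b f) g x) U := by
  intro x hx
  have hD := fun i => dd_contDiffOn_infty hU hf (b i)
  have e : BB b j (lap b f) g x = ∑ i, BB b j (dd (b i) (dd (b i) f)) g x :=
    BB_sum_left b hU Finset.univ (fun i _ => dd_contDiffOn_infty hU (hD i) (b i)) j g hx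
  simp only
  rw [e]
  simp only [BB]
  rw [← Finset.sum_add_distrib]
  refine Finset.sum_congr rfl fun i _ => ?_
  rw [dd_BB b hU (hD i) hg j (b i) hx, add_comm]

theorem NS_succ_eq (j : ℕ) (f : E → ℝ) (x : E) :
    ∑ i, NS b j (dd (b i) f) x ≤ NS b (j + 1) f x := by
  unfold NS
  rw [Finset.sum_comm, Finset.sum_range_succ']
  exact le_add_of_nonneg_right (NN_nonneg b _ _ _)

theorem NS_mono {j j' : ℕ} (h : j ≤ j') (f : E → ℝ) (x : E) : NS b j f x ≤ NS b j' f x :=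
  Finset.sum_le_sum_of_subset_of_nonneg (Finset.range_mono h) fun _ _ _ => NN_nonneg b _ _ _

variable {μ : E → ℝ}

theorem NN_mul_le (hμ0 : ∀ x, 0 ≤ μ x) (j : ℕ) {w : E → ℝ} (hw : DB univ 1 μ w) :
    ∃ C, 0 ≤ C ∧ ∀ (U : Set E) (f : E → ℝ), IsOpen U → ContDiffOn ℝ ∞ f U → ∀ x ∈ U,
      NN b j (fun y => f y * w y) x ≤ C * (NS b (j + 1) f x * μ x) := by
  induction j generalizing w with
  | zero =>
    obtain ⟨C, hC, hb⟩ := hw.bound []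
    refine ⟨C, hC, fun U f hU hf x hx => ?_⟩
    have := hb x (mem_univ x)
    simp only [dl, List.length_nil, pow_zero, one_mul] at this
    simp only [NN, NS, Finset.range_one, Finset.sum_singleton, zero_add]
    rw [abs_mul]
    calc |f x| * |w x| ≤ |f x| * (C * μ x) := by gcongr
      _ = _ := by ring
  | succ j ih =>
    obtain ⟨C, hC, hb⟩ := ih hw
    have hd : ∀ i, DB univ 1 μ (dd (b i) w) := fun i => by
      simpa using hw.dd isOpen_univ (b i)
    choose D hD hDb using fun i => ih (hd i)
    refine ⟨C + ∑ i, D i, add_nonneg hC (Finset.sum_nonneg fun i _ => hD i),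
      fun U f hU hf x hx => ?_⟩
    have hwU := hw.smooth.mono (subset_univ U)
    have hdw := fun i => (hd i).smooth.mono (subset_univ U)
    have hdf := fun i => dd_contDiffOn_infty hU hf (b i)
    have h1 : ∀ i, NN b j (dd (b i) fun y => f y * w y) x ≤
        C * (NS b (j + 1) (dd (b i) f) x * μ x) + D i * (NS b (j + 1) f x * μ x) := by
      intro i
      have e : EqOn (dd (b i) fun y => f y * w y)
          (fun y => dd (b i) f y * w y + f y * dd (b i) w y) U :=
        fun y hy => dd_mul (diffAt_of hU hf (by simp) hy) (diffAt_of hU hwU (by simp) hy) _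
      rw [NN_congr b hU e j hx]
      exact (NN_add_le b hU ((hdf i).mul hwU) (hf.mul (hdw i)) j hx).trans
        (add_le_add (hb U _ hU (hdf i) x hx) (hDb i U f hU hf x hx))
    calc NN b (j + 1) (fun y => f y * w y) x
        ≤ ∑ i, (C * (NS b (j + 1) (dd (b i) f) x * μ x) + D i * (NS b (j + 1) f x * μ x)) :=
          Finset.sum_le_sum fun i _ => h1 i
      _ = C * ((∑ i, NS b (j + 1) (dd (b i) f) x) * μ x) +
          (∑ i, D i) * (NS b (j + 1) f x * μ x) := by
          rw [Finset.sum_add_distrib, Finset.sum_mul, Finset.sum_mul, Finset.mul_sum]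
      _ ≤ C * (NS b (j + 1 + 1) f x * μ x) + (∑ i, D i) * (NS b (j + 1 + 1) f x * μ x) := by
          have := hμ0 x
          have h2 : 0 ≤ ∑ i, D i := Finset.sum_nonneg fun i _ => hD i
          gcongr
          · exact NS_succ_eq b _ _ _
          · exact NS_mono b (by omega) _ _
      _ = _ := by ring

theorem BB_mul_err (hμ0 : ∀ x, 0 ≤ μ x) (j : ℕ) {w : E → ℝ} (hw : DB univ 1 μ w) :
    ∃ C, 0 ≤ C ∧ ∀ (U : Set E) (f g : E → ℝ), IsOpen U → ContDiffOn ℝ ∞ f U →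
      ContDiffOn ℝ ∞ g U → ∀ x ∈ U,
      |BB b j g (fun y => f y * w y) x - BB b j g f x * w x| ≤
        C * (NN b j g x * NS b j f x * μ x) := by
  induction j with
  | zero =>
    refine ⟨0, le_rfl, fun U f g hU hf hg x hx => ?_⟩
    simp only [BB]
    rw [mul_assoc, sub_self]; simp
  | succ j ih =>
    obtain ⟨C, hC, hb⟩ := ih
    have hd : ∀ i, DB univ 1 μ (dd (b i) w) := fun i => by
      simpa using hw.dd isOpen_univ (b i)
    choose D hD hDb using fun i => NN_mul_le b hμ0 j (hd i)
    have hD0 : 0 ≤ ∑ i, D i := Finset.sum_nonneg fun i _ => hD i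
    refine ⟨C + ∑ i, D i, add_nonneg hC hD0, fun U f g hU hf hg x hx => ?_⟩
    have hwU := hw.smooth.mono (subset_univ U)
    have hdw := fun i => (hd i).smooth.mono (subset_univ U)
    have hdf := fun i => dd_contDiffOn_infty hU hf (b i)
    have hdg := fun i => dd_contDiffOn_infty hU hg (b i)
    have hx0 := hμ0 x
    have h1 : ∀ i, |BB b j (dd (b i) g) (dd (b i) fun y => f y * w y) x -
        BB b j (dd (b i) g) (dd (b i) f) x * w x| ≤
        C * (NN b j (dd (b i) g) x * NS b (j + 1) f x * μ x) + (∑ i, D i) *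
          (NN b j (dd (b i) g) x * NS b (j + 1) f x * μ x) -
          C * (NN b j (dd (b i) g) x * (NS b (j + 1) f x - NS b j (dd (b i) f) x) * μ x) := by
      intro i
      have e : EqOn (dd (b i) fun y => f y * w y)
          (fun y => dd (b i) f y * w y + f y * dd (b i) w y) U :=
        fun y hy => dd_mul (diffAt_of hU hf (by simp) hy) (diffAt_of hU hwU (by simp) hy) _
      rw [BB_comm b j _ (dd (b i) fun y => f y * w y), BB_congr b hU e j _ hx,
        BB_add_left b hU ((hdf i).mul hwU) (hf.mul (hdw i)) j _ hx, BB_comm b j _ (dd (b i) g),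
        BB_comm b j _ (dd (b i) g), add_sub_right_comm]
      refine (abs_add_le _ _).trans ?_
      have h2 := hb U _ _ hU (hdf i) (hdg i) x hx
      have h3 := abs_BB_le b j (dd (b i) g) (fun y => f y * dd (b i) w y) x
      have h4 := hDb i U f hU hf x hx
      have h5 : D i ≤ ∑ i, D i := Finset.single_le_sum (fun i _ => hD i) (Finset.mem_univ i)
      have h6 : |BB b j (dd (b i) g) (fun y => f y * dd (b i) w y) x| ≤
          (∑ i, D i) * (NN b j (dd (b i) g) x * NS b (j + 1) f x * μ x) := by
        refine h3.trans ((mul_le_mul_of_nonneg_left h4 (NN_nonneg b _ _ _)).trans ?_)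
        rw [show NN b j (dd (b i) g) x * (D i * (NS b (j + 1) f x * μ x)) =
          D i * (NN b j (dd (b i) g) x * NS b (j + 1) f x * μ x) by ring]
        have := NN_nonneg b j (dd (b i) g) x
        have := NS_nonneg b (j + 1) f x
        gcongr
      linarith
    have h7 : ∀ i, NS b j (dd (b i) f) x ≤ NS b (j + 1) f x := fun i =>
      (Finset.single_le_sum (f := fun i => NS b j (dd (b i) f) x)
        (fun i _ => NS_nonneg b _ _ _) (Finset.mem_univ i)).trans (NS_succ_eq b j f x)
    calc |BB b (j + 1) g (fun y => f y * w y) x - BB b (j + 1) g f x * w x|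
        = |∑ i, (BB b j (dd (b i) g) (dd (b i) fun y => f y * w y) x -
          BB b j (dd (b i) g) (dd (b i) f) x * w x)| := by
          simp only [BB]
          rw [Finset.sum_sub_distrib, Finset.sum_mul]
      _ ≤ ∑ i, (C + ∑ i, D i) * (NN b j (dd (b i) g) x * NS b (j + 1) f x * μ x) := by
          refine (Finset.abs_sum_le_sum_abs _ _).trans (Finset.sum_le_sum fun i _ => ?_)
          refine (h1 i).trans ?_
          have : 0 ≤ C * (NN b j (dd (b i) g) x * (NS b (j + 1) f x - NS b j (dd (b i) f) x) *
            μ x) := mul_nonneg hC (mul_nonneg (mul_nonneg (NN_nonneg b _ _ _)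
              (sub_nonneg.2 (h7 i))) hx0)
          linarith
      _ = _ := by
          simp only [NN]
          rw [← Finset.mul_sum, Finset.sum_mul, Finset.sum_mul]

theorem DB.BB {τ W W' : E → ℝ} (hU : IsOpen U) (hτ : ∀ x ∈ U, 0 ≤ τ x)
    (hW : ∀ x ∈ U, 0 ≤ W x) (hW' : ∀ x ∈ U, 0 ≤ W' x) (hf : DB U τ W f) (hg : DB U τ W' g)
    (j : ℕ) : DB U τ (τ ^ (2 * j) * (W * W')) (_root_.BB b j f g) := by
  induction j generalizing f g W W' with
  | zero =>
    have := hf.mul hU hτ hW hW' hg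
    rw [mul_zero, pow_zero, one_mul]
    exact this
  | succ j ih =>
    refine DB.sum hU _ fun i _ => ?_
    have := ih (W := τ * W) (W' := τ * W') (fun x hx => mul_nonneg (hτ x hx) (hW x hx))
      (fun x hx => mul_nonneg (hτ x hx) (hW' x hx)) (hf.dd hU (b i)) (hg.dd hU (b i))
    rwa [show τ ^ (2 * j) * (τ * W * (τ * W')) = τ ^ (2 * (j + 1)) * (W * W') by ring] at this

theorem DB.lap {τ W : E → ℝ} (hU : IsOpen U) (hf : DB U τ W f) :
    DB U τ (τ ^ 2 * W) (_root_.lap b f) := by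
  refine DB.sum hU _ fun i _ => ?_
  rw [show τ ^ 2 * W = τ * (τ * W) by ring]
  exact (hf.dd hU (b i)).dd hU (b i)

end Forms

section Caccioppoli

theorem exists_interpolation (k : ℕ) (hk : 1 ≤ k) (A : ℝ) (hA : 0 ≤ A) (B : ℝ → ℝ)
    (hB : ∀ η, 0 ≤ B η) : ∃ C, 0 ≤ C ∧ ∀ a : ℕ → ℝ, (∀ j ≤ k, 0 ≤ a j) →
      a k ≤ A * ∑ i ∈ Finset.range k, a i →
      (∀ η > 0, ∀ j, j + 2 ≤ k → a (j + 1) ≤ η * a (j + 2) + B η * a j) → a 1 ≤ C * a 0 := by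
  have step : ∀ m, ∀ η > 0, ∃ C, 0 ≤ C ∧ ∀ a : ℕ → ℝ, (∀ j ≤ k, 0 ≤ a j) →
      (∀ η > 0, ∀ j, j + 2 ≤ k → a (j + 1) ≤ η * a (j + 2) + B η * a j) → m + 1 ≤ k →
      a m ≤ η * a (m + 1) + C * a 0 := by
    intro m
    induction m with
    | zero =>
      intro η hη
      refine ⟨1, zero_le_one, fun a ha _ hm => ?_⟩
      have := mul_nonneg hη.le (ha (0 + 1) hm)
      linarith
    | succ m ih =>
      intro η hη
      have hB1 : 0 < B (η / 2) + 1 := by linarith [hB (η / 2)]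
      obtain ⟨C, hC, h⟩ := ih (1 / (2 * (B (η / 2) + 1))) (by positivity)
      refine ⟨2 * (B (η / 2) + 1) * C, by positivity, fun a ha hs hm => ?_⟩
      have h1 := hs (η / 2) (by positivity) m hm
      have h2 := h a ha hs (by omega)
      have h3 : (B (η / 2) + 1) * a m ≤ a (m + 1) / 2 + (B (η / 2) + 1) * C * a 0 := by
        calc (B (η / 2) + 1) * a m ≤ (B (η / 2) + 1) *
            (1 / (2 * (B (η / 2) + 1)) * a (m + 1) + C * a 0) := by gcongr
          _ = _ := by field_simp
      have h4 := ha m (by omega)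
      have h5 : m + 1 + 1 = m + 2 := rfl
      rw [h5]
      nlinarith
  have down : ∀ d m, m + d + 1 = k → ∀ η > 0, ∃ C, 0 ≤ C ∧ ∀ a : ℕ → ℝ, (∀ j ≤ k, 0 ≤ a j) →
      (∀ η > 0, ∀ j, j + 2 ≤ k → a (j + 1) ≤ η * a (j + 2) + B η * a j) →
      a m ≤ η * a k + C * a 0 := by
    intro d
    induction d with
    | zero =>
      intro m hm η hη
      obtain ⟨C, hC, h⟩ := step m η hη
      exact ⟨C, hC, fun a ha hs => by simpa [← hm] using h a ha hs (by omega)⟩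
    | succ d ih =>
      intro m hm η hη
      obtain ⟨C, hC, h⟩ := step m η hη
      obtain ⟨C', hC', h'⟩ := ih (m + 1) (by omega) 1 one_pos
      refine ⟨η * C' + C, by positivity, fun a ha hs => ?_⟩
      have h1 := h a ha hs (by omega)
      have h2 := mul_le_mul_of_nonneg_left (h' a ha hs) hη.le
      linarith
  have hη : 0 < 1 / (2 * (A * k + 1)) := by positivity
  have : ∀ m, ∃ C, 0 ≤ C ∧ (m < k → ∀ a : ℕ → ℝ, (∀ j ≤ k, 0 ≤ a j) →
      (∀ η > 0, ∀ j, j + 2 ≤ k → a (j + 1) ≤ η * a (j + 2) + B η * a j) →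
      a m ≤ 1 / (2 * (A * k + 1)) * a k + C * a 0) := by
    intro m
    by_cases hm : m < k
    · obtain ⟨C, hC, h⟩ := down (k - 1 - m) m (by omega) _ hη
      exact ⟨C, hC, fun _ => h⟩
    · exact ⟨0, le_rfl, fun h => absurd h hm⟩
  choose C hC h using this
  have hS : 0 ≤ ∑ i ∈ Finset.range k, C i := Finset.sum_nonneg fun i _ => hC i
  have top : ∀ a : ℕ → ℝ, (∀ j ≤ k, 0 ≤ a j) → a k ≤ A * ∑ i ∈ Finset.range k, a i →
      (∀ η > 0, ∀ j, j + 2 ≤ k → a (j + 1) ≤ η * a (j + 2) + B η * a j) →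
      a k ≤ 2 * A * (∑ i ∈ Finset.range k, C i) * a 0 := by
    intro a ha hk' hs
    have h1 : ∑ i ∈ Finset.range k, a i ≤
        k * (1 / (2 * (A * k + 1)) * a k) + (∑ i ∈ Finset.range k, C i) * a 0 := by
      calc _ ≤ ∑ i ∈ Finset.range k, (1 / (2 * (A * k + 1)) * a k + C i * a 0) :=
            Finset.sum_le_sum fun i hi => h i (Finset.mem_range.1 hi) a ha hs
        _ = _ := by simp [Finset.sum_add_distrib, Finset.sum_mul]
    have h2 : A * (k * (1 / (2 * (A * k + 1)) * a k)) ≤ a k / 2 := by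
      have := ha k le_rfl
      rw [show A * (k * (1 / (2 * (A * k + 1)) * a k)) = (A * k / (A * k + 1)) * (a k / 2) by
        field_simp]
      have h3 : A * k / (A * k + 1) ≤ 1 := by
        rw [div_le_one (by positivity)]; linarith
      calc _ ≤ 1 * (a k / 2) := by gcongr
        _ = _ := one_mul _
    have h3 := mul_le_mul_of_nonneg_left h1 hA
    nlinarith
  refine ⟨2 * A * (∑ i ∈ Finset.range k, C i) + C 1, by have := hC 1; positivity,
    fun a ha hk' hs => ?_⟩
  have h1 := top a ha hk' hs
  have h0 := mul_nonneg (hC 1) (ha 0 (by omega))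
  rcases Nat.lt_or_ge 1 k with hk1 | hk1
  · have h2 := h 1 hk1 a ha hs
    have h3 : 1 / (2 * (A * k + 1)) * a k ≤ 1 * a k := by
      have := ha k le_rfl
      gcongr
      rw [div_le_one (by positivity)]
      have : 0 ≤ A * k := by positivity
      linarith
    linarith
  · have : k = 1 := by omega
    subst this
    linarith

variable {ι : Type*} [Fintype ι] (b : OrthonormalBasis ι ℝ E)

/-- The data that make integration by parts on `G` with the weight `μ` legitimate for functions
whose derivatives of order `l` are `O(τ ^ l * W)`. -/
structure Adm (k : ℕ) (G : Set E) (σ τ W μ : E → ℝ) : Prop where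
  smooth : ContDiff ℝ 1 σ
  eq : G = {x | 0 < σ x}
  grad : ∃ K, ∀ x ∈ G, ‖fderiv ℝ σ x‖ ≤ K
  one_le : ∀ x ∈ G, 1 ≤ τ x * σ x
  one_le_const : ∃ c, ∀ x ∈ G, 1 ≤ c * τ x
  nonneg : ∀ x ∈ G, 0 ≤ W x
  nonneg_weight : ∀ x, 0 ≤ μ x
  weight : DB univ 1 μ μ
  int : IntegrableOn (fun x => τ x ^ (2 * k) * (W x * W x * μ x)) G

variable {k : ℕ} {G : Set E} {σ τ W μ : E → ℝ}

theorem Adm.isOpen (h : Adm k G σ τ W μ) : IsOpen G := by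
  rw [h.eq]; exact isOpen_lt continuous_const h.smooth.continuous

theorem Adm.pos (h : Adm k G σ τ W μ) {x : E} (hx : x ∈ G) : 0 < σ x := by
  rw [h.eq] at hx; exact hx

theorem Adm.tau_pos (h : Adm k G σ τ W μ) {x : E} (hx : x ∈ G) : 0 < τ x := by
  by_contra hh
  have := h.one_le x hx
  nlinarith [h.pos hx]

theorem Adm.exists_pow_le (h : Adm k G σ τ W μ) {m : ℕ} (hm : m ≤ 2 * k) :
    ∃ c, 0 ≤ c ∧ ∀ x ∈ G, τ x ^ m ≤ c * τ x ^ (2 * k) := by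
  obtain ⟨c, hc⟩ := h.one_le_const
  refine ⟨|c| ^ (2 * k - m), by positivity, fun x hx => ?_⟩
  have h1 : 1 ≤ |c| * τ x := (hc x hx).trans
    (mul_le_mul_of_nonneg_right (le_abs_self c) (h.tau_pos hx).le)
  have h2 := h.tau_pos hx
  calc τ x ^ m = 1 * τ x ^ m := (one_mul _).symm
    _ ≤ (|c| * τ x) ^ (2 * k - m) * τ x ^ m := by gcongr; exact one_le_pow₀ h1
    _ = |c| ^ (2 * k - m) * (τ x ^ (2 * k - m + m)) := by rw [mul_pow, pow_add, mul_assoc]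
    _ = _ := by rw [Nat.sub_add_cancel hm]

theorem Adm.integrableOn (h : Adm k G σ τ W μ) {m : ℕ} (hm : m ≤ 2 * k) {F : E → ℝ}
    (hF : DB G τ (τ ^ m * (W * (W * μ))) F) : IntegrableOn F G := by
  obtain ⟨c, hc, hcb⟩ := h.exists_pow_le hm
  obtain ⟨C, hC, hb⟩ := hF.bound []
  refine Integrable.mono' (h.int.const_mul (C * c))
    (hF.smooth.continuousOn.aestronglyMeasurable h.isOpen.measurableSet) ?_
  refine (ae_restrict_iff' h.isOpen.measurableSet).2 (Eventually.of_forall fun x hx => ?_)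
  have h1 := hb x hx
  simp only [dl, List.length_nil, pow_zero, one_mul, Pi.mul_apply, Pi.pow_apply] at h1
  have h2 := hcb x hx
  have h3 := h.nonneg x hx
  have h4 := h.nonneg_weight x
  rw [Real.norm_eq_abs]
  calc |F x| ≤ C * (τ x ^ m * (W x * (W x * μ x))) := h1
    _ ≤ C * (c * τ x ^ (2 * k) * (W x * (W x * μ x))) := by gcongr
    _ = _ := by ring

theorem Adm.integral_dd (h : Adm k G σ τ W μ) {m : ℕ} (hm : m + 1 ≤ 2 * k) {F : E → ℝ}
    (hF : DB G τ (τ ^ m * (W * (W * μ))) F) (v : E) : IntegrableOn (dd v F) G ∧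
      ∫ x in G, dd v F x = 0 := by
  have hd : IntegrableOn (dd v F) G := by
    refine h.integrableOn hm ?_
    have := hF.dd h.isOpen v
    rwa [show τ * (τ ^ m * (W * (W * μ))) = τ ^ (m + 1) * (W * (W * μ)) by ring] at this
  refine ⟨hd, ?_⟩
  obtain ⟨c, hc, hcb⟩ := h.exists_pow_le hm
  obtain ⟨C, hC, hb⟩ := hF.bound []
  obtain ⟨K, hK⟩ := h.grad
  refine integral_dd_eq_zero h.smooth h.eq hK (hF.smooth.of_le (by simp))
    (h.int.const_mul (C * c)) (fun x hx => ?_) (h.integrableOn (by omega) hF) v hd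
  have h1 := hb x hx
  simp only [dl, List.length_nil, pow_zero, one_mul, Pi.mul_apply, Pi.pow_apply] at h1
  have h2 := hcb x hx
  have h3 := h.nonneg x hx
  have h4 := h.nonneg_weight x
  have h5 := h.tau_pos hx
  have h6 := h.pos hx
  calc |F x| ≤ C * (τ x ^ m * (W x * (W x * μ x))) := h1
    _ = 1 * (C * (τ x ^ m * (W x * (W x * μ x)))) := (one_mul _).symm
    _ ≤ (τ x * σ x) * (C * (τ x ^ m * (W x * (W x * μ x)))) := by
        gcongr; exact h.one_le x hx
    _ = C * (τ x ^ (m + 1) * (W x * (W x * μ x))) * σ x := by ring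
    _ ≤ C * (c * τ x ^ (2 * k) * (W x * (W x * μ x))) * σ x := by gcongr
    _ = _ := by ring

theorem Adm.nonneg_tau (h : Adm k G σ τ W μ) : ∀ x ∈ G, 0 ≤ τ x := fun _ hx => (h.tau_pos hx).le

theorem Adm.db_weight (h : Adm k G σ τ W μ) : DB G τ μ μ := by
  refine ⟨h.weight.smooth.mono (subset_univ _), fun L => ?_⟩
  obtain ⟨C, hC, hb⟩ := h.weight.bound L
  obtain ⟨c, hc⟩ := h.one_le_const
  refine ⟨C * |c| ^ L.length, by positivity, fun x hx => (hb x (mem_univ x)).trans ?_⟩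
  have h1 : 1 ≤ |c| * τ x := (hc x hx).trans
    (mul_le_mul_of_nonneg_right (le_abs_self c) (h.tau_pos hx).le)
  have h2 := h.nonneg_weight x
  have h3 : 1 ≤ (|c| * τ x) ^ L.length := one_le_pow₀ h1
  simp only [Pi.one_apply, one_pow, one_mul]
  calc C * μ x = C * (1 * μ x) := by ring
    _ ≤ C * ((|c| * τ x) ^ L.length * μ x) := by gcongr
    _ = _ := by rw [mul_pow]; ring

theorem Adm.db_BB (h : Adm k G σ τ W μ) {f g : E → ℝ} {a : ℕ} (hf : DB G τ (τ ^ a * W) f)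
    (hg : DB G τ (W * μ) g) (j : ℕ) : DB G τ (τ ^ (2 * j + a) * (W * (W * μ))) (BB b j f g) := by
  have := DB.BB b h.isOpen h.nonneg_tau (W := τ ^ a * W) (W' := W * μ)
    (fun x hx => mul_nonneg (pow_nonneg (h.nonneg_tau x hx) _) (h.nonneg x hx))
    (fun x hx => mul_nonneg (h.nonneg x hx) (h.nonneg_weight x)) hf hg j
  rwa [show τ ^ (2 * j) * (τ ^ a * W * (W * μ)) = τ ^ (2 * j + a) * (W * (W * μ)) by ring] at this

theorem Adm.integral_BB_eq_zero (h : Adm k G σ τ W μ) {g : E → ℝ} (hg : DB G τ (W * μ) g) (j : ℕ) :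
    ∀ (a : ℕ) (f : E → ℝ), a + 2 * j ≤ 2 * k → DB G τ (τ ^ a * W) f →
      (∀ x ∈ G, (lap b)^[j] f x = 0) → ∫ x in G, BB b j f g x = 0 := by
  induction j with
  | zero =>
    intro a f _ _ h0
    refine setIntegral_eq_zero_of_forall_eq_zero fun x hx => ?_
    have := h0 x hx
    simp only [Function.iterate_zero, id] at this
    simp [BB, this]
  | succ j ih =>
    intro a f ha hf h0
    have hW : ∀ x ∈ G, 0 ≤ (τ ^ a * W) x := fun x hx =>
      mul_nonneg (pow_nonneg (h.nonneg_tau x hx) _) (h.nonneg x hx)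
    have hlap : DB G τ (τ ^ (a + 2) * W) (lap b f) := by
      have := hf.lap b h.isOpen
      rwa [show τ ^ 2 * (τ ^ a * W) = τ ^ (a + 2) * W by ring] at this
    have hd : ∀ i, DB G τ (τ ^ (a + 1) * W) (dd (b i) f) := fun i => by
      have := hf.dd h.isOpen (b i)
      rwa [show τ * (τ ^ a * W) = τ ^ (a + 1) * W by ring] at this
    have h1 := ih (a + 2) (lap b f) (by omega) hlap fun x hx => by
      rw [← Function.iterate_succ_apply]; exact h0 x hx
    have h2 := h.integrableOn (by omega) (h.db_BB b hlap hg j)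
    have h3 := fun i => h.integral_dd (by omega) (h.db_BB b (hd i) hg j) (b i)
    have e : EqOn (BB b (j + 1) f g) (fun x => ∑ i, dd (b i) (BB b j (dd (b i) f) g) x -
        BB b j (lap b f) g x) G := fun x hx => by
      have := sum_dd_BB b h.isOpen hf.smooth hg.smooth j hx
      dsimp only at this ⊢
      rw [this]; ring
    rw [setIntegral_congr_fun h.isOpen.measurableSet e, integral_sub
      (integrable_finsetSum _ fun i _ => (h3 i).1) h2, integral_finsetSum _ fun i _ => (h3 i).1, h1]
    simp [fun i => (h3 i).2]

theorem exists_mul_le (A η : ℝ) (hη : 0 < η) : ∃ C, 0 ≤ C ∧ ∀ p q : ℝ,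
    A * (p * q) ≤ η * p ^ 2 + C * q ^ 2 := by
  refine ⟨A ^ 2 / (4 * η), by positivity, fun p q => ?_⟩
  have : η * p ^ 2 + A ^ 2 / (4 * η) * q ^ 2 - A * (p * q) = η * (p - A / (2 * η) * q) ^ 2 := by
    field_simp; ring
  nlinarith [mul_nonneg hη.le (sq_nonneg (p - A / (2 * η) * q))]

theorem NS_sq_le (j : ℕ) (f : E → ℝ) (x : E) :
    NS b j f x ^ 2 ≤ j * (Fintype.card ι + 1 : ℝ) ^ j * ∑ l ∈ Finset.range j, BB b l f f x := by
  have h1 := sq_sum_le_card_mul_sum_sq (s := Finset.range j) (f := fun l => NN b l f x)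
  rw [Finset.card_range] at h1
  rw [mul_assoc]
  refine h1.trans (mul_le_mul_of_nonneg_left ?_ (Nat.cast_nonneg _))
  rw [Finset.mul_sum]
  refine Finset.sum_le_sum fun l hl => (NN_sq_le b l f x).trans ?_
  refine mul_le_mul_of_nonneg_right ?_ (BB_self_nonneg b l f x)
  have : (0:ℝ) ≤ Fintype.card ι := Nat.cast_nonneg _
  exact pow_le_pow_right₀ (by linarith) (Finset.mem_range.1 hl).le

theorem exists_pointwise_top (k : ℕ) (hμ0 : ∀ x, 0 ≤ μ x) (hμ : DB univ 1 μ μ) :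
    ∃ A, 0 ≤ A ∧ ∀ (U : Set E) (u : E → ℝ), IsOpen U → ContDiffOn ℝ ∞ u U → ∀ x ∈ U,
      BB b k u u x * μ x ≤ 2 * BB b k u (fun y => u y * μ y) x +
        A * ∑ i ∈ Finset.range k, BB b i u u x * μ x := by
  obtain ⟨C, hC, hb⟩ := BB_mul_err b hμ0 k hμ
  set N : ℝ := (Fintype.card ι + 1 : ℝ) ^ k
  have hN : 0 < N := by positivity
  obtain ⟨D, hD, hDb⟩ := exists_mul_le C (1 / (2 * N)) (by positivity)
  refine ⟨2 * (D * (k * N)), by positivity, fun U u hU hu x hx => ?_⟩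
  have h1 := (abs_le.1 (hb U u u hU hu hu x hx)).1
  have h2 := hDb (NN b k u x) (NS b k u x)
  have h3 := NN_sq_le b k u x
  have h4 := NS_sq_le b k u x
  have h5 : 1 / (2 * N) * NN b k u x ^ 2 ≤ BB b k u u x / 2 := by
    calc _ ≤ 1 / (2 * N) * (N * BB b k u u x) := by gcongr
      _ = _ := by field_simp
  have h6 := mul_le_mul_of_nonneg_left h4 hD
  have h7 : C * (NN b k u x * NS b k u x) ≤ BB b k u u x / 2 +
    D * (k * N * ∑ l ∈ Finset.range k, BB b l u u x) := by linarith
  have h8 := mul_le_mul_of_nonneg_right h7 (hμ0 x)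
  rw [← Finset.sum_mul]
  nlinarith

theorem exists_pointwise_mid (j : ℕ) (hμ0 : ∀ x, 0 ≤ μ x) (hμ : DB univ 1 μ μ) (η : ℝ)
    (hη : 0 < η) :
    ∃ A, 0 ≤ A ∧ ∀ (U : Set E) (u : E → ℝ), IsOpen U → ContDiffOn ℝ ∞ u U → ∀ x ∈ U,
      BB b (j + 1) u u x * μ x ≤
        2 * (∑ i, dd (b i) (fun y => BB b j (dd (b i) u) u y * μ y) x) +
        η * (BB b (j + 2) u u x * μ x) + A * (BB b j u u x * μ x) := by
  choose D hD hDb using fun i => hμ.bound [b i]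
  have hS : 0 ≤ ∑ i, D i := Finset.sum_nonneg fun i _ => hD i
  set N : ℝ := Fintype.card ι + 1
  have hN : 0 < N := by positivity
  obtain ⟨C₁, hC₁, h1⟩ := exists_mul_le 1 (η / (2 * N ^ (j + 2))) (by positivity)
  obtain ⟨C₂, hC₂, h2⟩ := exists_mul_le (∑ i, D i) (1 / (2 * N ^ (j + 1))) (by positivity)
  refine ⟨2 * ((C₁ + C₂) * N ^ j), by positivity, fun U u hU hu x hx => ?_⟩
  have hdu := fun i => dd_contDiffOn_infty hU hu (b i)
  have hμU := hμ.smooth.mono (subset_univ U)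
  have e1 : ∀ i, dd (b i) (fun y => BB b j (dd (b i) u) u y * μ y) x =
      dd (b i) (BB b j (dd (b i) u) u) x * μ x + BB b j (dd (b i) u) u x * dd (b i) μ x :=
    fun i => dd_mul (diffAt_of hU (BB_contDiffOn b hU (hdu i) hu j) (by simp) hx)
      (diffAt_of hU hμU (by simp) hx) _
  have e2 := sum_dd_BB b hU hu hu j hx
  have e3 : BB b j (lap b u) u x = ∑ i, BB b j (dd (b i) (dd (b i) u)) u x :=
    BB_sum_left b hU Finset.univ (fun i _ => dd_contDiffOn_infty hU (hdu i) (b i)) j u hx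
  have e4 : |BB b j (lap b u) u x| ≤ NN b (j + 2) u x * NN b j u x := by
    rw [e3]
    refine (Finset.abs_sum_le_sum_abs _ _).trans ?_
    simp only [NN]
    rw [Finset.sum_mul]
    refine Finset.sum_le_sum fun i _ => (abs_BB_le b _ _ _ _).trans
      (mul_le_mul_of_nonneg_right ?_ (NN_nonneg b _ _ _))
    exact Finset.single_le_sum (f := fun l => NN b j (dd (b l) (dd (b i) u)) x)
      (fun l _ => NN_nonneg b _ _ _) (Finset.mem_univ i)
  have e5 : |∑ i, BB b j (dd (b i) u) u x * dd (b i) μ x| ≤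
      (∑ i, D i) * (NN b (j + 1) u x * NN b j u x) * μ x := by
    refine (Finset.abs_sum_le_sum_abs _ _).trans ?_
    have : ∀ i, |BB b j (dd (b i) u) u x * dd (b i) μ x| ≤
        (∑ i, D i) * (NN b j (dd (b i) u) x * NN b j u x) * μ x := by
      intro i
      rw [abs_mul]
      have h3 := abs_BB_le b j (dd (b i) u) u x
      have h4 := hDb i x (mem_univ x)
      simp only [dl, Pi.one_apply, one_pow, one_mul] at h4
      have h5 : D i ≤ ∑ i, D i := Finset.single_le_sum (fun i _ => hD i) (Finset.mem_univ i)
      have h6 := hμ0 x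
      have h7 := NN_nonneg b j (dd (b i) u) x
      have h8 := NN_nonneg b j u x
      calc _ ≤ (NN b j (dd (b i) u) x * NN b j u x) * (D i * μ x) := by gcongr
        _ ≤ (NN b j (dd (b i) u) x * NN b j u x) * ((∑ i, D i) * μ x) := by gcongr
        _ = _ := by ring
    refine (Finset.sum_le_sum fun i _ => this i).trans (le_of_eq ?_)
    simp only [NN]
    rw [← Finset.sum_mul, ← Finset.mul_sum, ← Finset.sum_mul]
  have e6 : ∑ i, dd (b i) (fun y => BB b j (dd (b i) u) u y * μ y) x =
      (BB b (j + 1) u u x + BB b j (lap b u) u x) * μ x +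
        ∑ i, BB b j (dd (b i) u) u x * dd (b i) μ x := by
    rw [Finset.sum_congr rfl fun i _ => e1 i, Finset.sum_add_distrib, ← Finset.sum_mul]
    dsimp only at e2
    rw [e2]
  have f1 := h1 (NN b (j + 2) u x) (NN b j u x)
  have f2 := h2 (NN b (j + 1) u x) (NN b j u x)
  have f3 : η / (2 * N ^ (j + 2)) * NN b (j + 2) u x ^ 2 ≤ η / 2 * BB b (j + 2) u u x := by
    calc _ ≤ η / (2 * N ^ (j + 2)) * (N ^ (j + 2) * BB b (j + 2) u u x) := by
          gcongr; exact NN_sq_le b _ _ _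
      _ = _ := by field_simp
  have f4 : 1 / (2 * N ^ (j + 1)) * NN b (j + 1) u x ^ 2 ≤ BB b (j + 1) u u x / 2 := by
    calc _ ≤ 1 / (2 * N ^ (j + 1)) * (N ^ (j + 1) * BB b (j + 1) u u x) := by
          gcongr; exact NN_sq_le b _ _ _
      _ = _ := by field_simp
  have f5 : (C₁ + C₂) * NN b j u x ^ 2 ≤ (C₁ + C₂) * (N ^ j * BB b j u u x) := by
    gcongr; exact NN_sq_le b _ _ _
  have g1 := (abs_le.1 e4).1
  have g2 := (abs_le.1 e5).1
  have g3 : NN b (j + 2) u x * NN b j u x + (∑ i, D i) * (NN b (j + 1) u x * NN b j u x) ≤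
      η / 2 * BB b (j + 2) u u x + BB b (j + 1) u u x / 2 + (C₁ + C₂) * (N ^ j * BB b j u u x) := by
    linarith
  have g4 := mul_le_mul_of_nonneg_right g3 (hμ0 x)
  have g5 := mul_le_mul_of_nonneg_right g1 (hμ0 x)
  rw [e6]
  nlinarith

theorem exists_caccioppoli (k : ℕ) (hk : 1 ≤ k) (hμ0 : ∀ x, 0 ≤ μ x) (hμ : DB univ 1 μ μ) :
    ∃ C, 0 ≤ C ∧ ∀ (G : Set E) (σ τ W : E → ℝ), Adm k G σ τ W μ → ∀ u, DB G τ W u →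
      (∀ x ∈ G, (lap b)^[k] u x = 0) →
      IntegrableOn (fun x => BB b 1 u u x * μ x) G ∧ IntegrableOn (fun x => u x * u x * μ x) G ∧
      ∫ x in G, BB b 1 u u x * μ x ≤ C * ∫ x in G, u x * u x * μ x := by
  obtain ⟨A, hA, hAb⟩ := exists_pointwise_top b k hμ0 hμ
  have := fun (j : ℕ) (η : ℝ) (hη : 0 < η) => exists_pointwise_mid b j hμ0 hμ η hη
  choose! B hB hBb using this
  obtain ⟨C, hC, hCb⟩ := exists_interpolation k hk A hA
    (fun η => ∑ j ∈ Finset.range k, |B j η|) fun η => Finset.sum_nonneg fun j _ => abs_nonneg _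
  refine ⟨C, hC, fun G σ τ W h u hu h0 => ?_⟩
  have hu0 : DB G τ (τ ^ 0 * W) u := by simpa using hu
  have hd : ∀ i, DB G τ (τ ^ 1 * W) (dd (b i) u) := fun i => by
    rw [pow_one]; exact hu.dd h.isOpen (b i)
  have huμ : DB G τ (W * μ) (fun y => u y * μ y) :=
    hu.mul h.isOpen h.nonneg_tau h.nonneg (fun x _ => h.nonneg_weight x) h.db_weight
  have hBBμ : ∀ {f : E → ℝ} {a : ℕ} (_ : DB G τ (τ ^ a * W) f) (j : ℕ),
      DB G τ (τ ^ (2 * j + a) * (W * (W * μ))) (fun x => BB b j f u x * μ x) := by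
    intro f a hf j
    have h1 := DB.BB b h.isOpen h.nonneg_tau (W := τ ^ a * W)
      (fun x hx => mul_nonneg (pow_nonneg (h.nonneg_tau x hx) a) (h.nonneg x hx))
      h.nonneg hf hu j
    have h2 := h1.mul h.isOpen h.nonneg_tau (W' := μ) (fun x hx => ?_)
      (fun x _ => h.nonneg_weight x) h.db_weight
    · rwa [show τ ^ (2 * j) * (τ ^ a * W * W) * μ = τ ^ (2 * j + a) * (W * (W * μ)) by ring] at h2
    · have := h.nonneg_tau x hx
      have := h.nonneg x hx
      simp only [Pi.mul_apply, Pi.pow_apply]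
      positivity
  have hint : ∀ j ≤ k, IntegrableOn (fun x => BB b j u u x * μ x) G := fun j hj =>
    h.integrableOn (by omega) (hBBμ hu0 j)
  have main := hCb (fun j => ∫ x in G, BB b j u u x * μ x)
    (fun j _ => setIntegral_nonneg h.isOpen.measurableSet fun x _ =>
      mul_nonneg (BB_self_nonneg b _ _ _) (h.nonneg_weight x)) ?_ ?_
  · exact ⟨hint 1 hk, hint 0 (by omega), main⟩
  · have i1 := h.integral_BB_eq_zero b huμ k 0 u (by omega) hu0 h0
    have i2 := h.integrableOn (by omega) (h.db_BB b hu0 huμ k)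
    have i3 : IntegrableOn (fun x => ∑ i ∈ Finset.range k, BB b i u u x * μ x) G :=
      integrable_finsetSum _ fun i hi => hint i (Finset.mem_range.1 hi).le
    calc ∫ x in G, BB b k u u x * μ x ≤ ∫ x in G, (2 * BB b k u (fun y => u y * μ y) x +
          A * ∑ i ∈ Finset.range k, BB b i u u x * μ x) :=
          setIntegral_mono_on (hint k le_rfl) ((i2.const_mul 2).add (i3.const_mul A))
            h.isOpen.measurableSet (hAb G u h.isOpen hu.smooth)
      _ = 2 * (∫ x in G, BB b k u (fun y => u y * μ y) x) +
          A * ∫ x in G, ∑ i ∈ Finset.range k, BB b i u u x * μ x := by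
          rw [integral_add (i2.const_mul 2) (i3.const_mul A), integral_const_mul,
            integral_const_mul]
      _ = _ := by
          rw [i1, integral_finsetSum _ fun i hi => hint i (Finset.mem_range.1 hi).le]
          ring
  · intro η hη j hj
    have i1 := fun i => h.integral_dd (by omega) (hBBμ (hd i) j) (b i)
    have i2 : IntegrableOn (fun x => ∑ i, dd (b i) (fun y => BB b j (dd (b i) u) u y * μ y) x) G :=
      integrable_finsetSum _ fun i _ => (i1 i).1
    have i3 : ∫ x in G, ∑ i, dd (b i) (fun y => BB b j (dd (b i) u) u y * μ y) x = 0 := by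
      rw [integral_finsetSum _ fun i _ => (i1 i).1]
      simp [fun i => (i1 i).2]
    have i4 := (hint (j + 2) hj).const_mul η
    have i6 : IntegrableOn (fun x => 2 * (∑ i, dd (b i) (fun y => BB b j (dd (b i) u) u y * μ y) x) +
        η * (BB b (j + 2) u u x * μ x)) G := (i2.const_mul 2).add i4
    have i5 := (hint j (by omega)).const_mul (B j η)
    have hBle : B j η ≤ ∑ j ∈ Finset.range k, |B j η| :=
      (le_abs_self _).trans (Finset.single_le_sum (f := fun j => |B j η|)
        (fun j _ => abs_nonneg _) (Finset.mem_range.2 (by omega)))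
    have hn : 0 ≤ ∫ x in G, BB b j u u x * μ x :=
      setIntegral_nonneg h.isOpen.measurableSet fun x _ =>
        mul_nonneg (BB_self_nonneg b _ _ _) (h.nonneg_weight x)
    calc ∫ x in G, BB b (j + 1) u u x * μ x ≤
        ∫ x in G, (2 * (∑ i, dd (b i) (fun y => BB b j (dd (b i) u) u y * μ y) x) +
        η * (BB b (j + 2) u u x * μ x) + B j η * (BB b j u u x * μ x)) :=
          setIntegral_mono_on (hint (j + 1) (by omega)) (((i2.const_mul 2).add i4).add i5)
            h.isOpen.measurableSet (hBb j η hη G u h.isOpen hu.smooth)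
      _ = η * (∫ x in G, BB b (j + 2) u u x * μ x) + B j η * ∫ x in G, BB b j u u x * μ x := by
          rw [integral_add i6 i5, integral_add (i2.const_mul 2) i4,
            integral_const_mul, integral_const_mul, integral_const_mul, i3]
          ring
      _ ≤ _ := by gcongr

end Caccioppoli

section HalfSpaceWeights

/-- Polynomially decaying weights. -/
def wt (E : Type*) [NormedAddCommGroup E] (m : ℕ) (x : E) : ℝ := ((1 + ‖x‖ ^ 2)⁻¹) ^ m

theorem wt_pos (m : ℕ) (x : E) : 0 < wt E m x := by unfold wt; positivity

/-- The bounded functions generated by the logarithmic derivatives of the weights. -/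
def wtAlg (E : Type*) [NormedAddCommGroup E] [InnerProductSpace ℝ E] : Subalgebra ℝ (E → ℝ) :=
  Algebra.adjoin ℝ ({fun x => (1 + ‖x‖ ^ 2)⁻¹} ∪
    range fun v : E => fun x => inner ℝ x v * (1 + ‖x‖ ^ 2)⁻¹)

theorem dd_norm_sq (w x : E) : dd w (fun y => 1 + ‖y‖ ^ 2) x = 2 * inner ℝ x w := by
  unfold dd
  rw [fderiv_const_add, fderiv_norm_sq_apply]
  simp

theorem contDiff_inv_norm_sq : ContDiff ℝ ∞ fun x : E => (1 + ‖x‖ ^ 2)⁻¹ :=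
  ContDiff.inv (contDiff_const.add (contDiff_norm_sq ℝ)) fun x => by positivity

theorem dd_inv_norm_sq (w x : E) : dd w (fun y => (1 + ‖y‖ ^ 2)⁻¹) x =
    -2 * (inner ℝ x w * (1 + ‖x‖ ^ 2)⁻¹) * (1 + ‖x‖ ^ 2)⁻¹ := by
  have h : HasFDerivAt (fun y : E => 1 + ‖y‖ ^ 2) (fderiv ℝ (fun y : E => 1 + ‖y‖ ^ 2) x) x :=
    ((contDiff_const.add (contDiff_norm_sq ℝ) : ContDiff ℝ 1 fun y : E => 1 + ‖y‖ ^ 2).differentiable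
      (by simp) x).hasFDerivAt
  have hp : (1 + ‖x‖ ^ 2) ≠ 0 := by positivity
  have h1 := (hasDerivAt_inv hp).comp_hasFDerivAt x h
  have h2 := dd_norm_sq w x
  unfold dd at h2 ⊢
  rw [show (fun y : E => (1 + ‖y‖ ^ 2)⁻¹) = (fun y => y⁻¹) ∘ fun y : E => 1 + ‖y‖ ^ 2 from rfl,
    h1.fderiv]
  simp only [_root_.smul_apply, smul_eq_mul]
  rw [h2]
  field_simp

theorem wtAlg_spec {f : E → ℝ} (hf : f ∈ wtAlg E) : ContDiff ℝ ∞ f ∧ (∃ C, ∀ x, |f x| ≤ C) ∧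
    ∀ w, dd w f ∈ wtAlg E := by
  have hq : (fun x : E => (1 + ‖x‖ ^ 2)⁻¹) ∈ wtAlg E := Algebra.subset_adjoin (by simp)
  have hθ : ∀ v : E, (fun x : E => inner ℝ x v * (1 + ‖x‖ ^ 2)⁻¹) ∈ wtAlg E := fun v =>
    Algebra.subset_adjoin (Or.inr ⟨v, rfl⟩)
  have hq1 : ∀ x : E, (1 + ‖x‖ ^ 2)⁻¹ ≤ 1 := fun x => inv_le_one_of_one_le₀ (by nlinarith [norm_nonneg x])
  have hin : ∀ v : E, ContDiff ℝ ∞ fun x : E => inner ℝ x v := fun v =>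
    contDiff_id.inner ℝ contDiff_const
  induction hf using Algebra.adjoin_induction with
  | mem f hf =>
    rcases hf with hf | ⟨v, rfl⟩
    · rw [mem_singleton_iff] at hf
      subst hf
      refine ⟨contDiff_inv_norm_sq, ⟨1, fun x => ?_⟩, fun w => ?_⟩
      · rw [abs_of_nonneg (by positivity)]; exact hq1 x
      · have : dd w (fun x : E => (1 + ‖x‖ ^ 2)⁻¹) = (-2 : ℝ) •
            ((fun x : E => inner ℝ x w * (1 + ‖x‖ ^ 2)⁻¹) * fun x : E => (1 + ‖x‖ ^ 2)⁻¹) := by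
          ext x
          rw [dd_inv_norm_sq]
          simp only [Pi.smul_apply, Pi.mul_apply, smul_eq_mul]; ring
        rw [this]
        exact (wtAlg E).smul_mem ((wtAlg E).mul_mem (hθ w) hq) _
    · refine ⟨(hin v).mul contDiff_inv_norm_sq, ⟨‖v‖, fun x => ?_⟩, fun w => ?_⟩
      · rw [abs_mul, abs_of_nonneg (show 0 ≤ (1 + ‖x‖ ^ 2)⁻¹ by positivity), ← div_eq_mul_inv,
          div_le_iff₀ (by positivity)]
        have h1 := abs_real_inner_le_norm x v
        have h2 : ‖x‖ ≤ 1 + ‖x‖ ^ 2 := by nlinarith [sq_nonneg (‖x‖ - 1)]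
        nlinarith [norm_nonneg v]
      · have : dd w (fun x : E => inner ℝ x v * (1 + ‖x‖ ^ 2)⁻¹) =
            (inner ℝ w v : ℝ) • (fun x : E => (1 + ‖x‖ ^ 2)⁻¹) + (-2 : ℝ) •
            ((fun x : E => inner ℝ x v * (1 + ‖x‖ ^ 2)⁻¹) *
              fun x : E => inner ℝ x w * (1 + ‖x‖ ^ 2)⁻¹) := by
          ext x
          rw [dd_mul ((hin v).differentiable (by simp) x)
            (contDiff_inv_norm_sq.differentiable (by simp) x), dd_inv_norm_sq]
          have : dd w (fun x : E => inner ℝ x v) x = inner ℝ w v := by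
            unfold dd
            rw [fderiv_inner_apply ℝ (by fun_prop) (by fun_prop)]
            simp
          rw [this]
          simp only [Pi.smul_apply, Pi.mul_apply, Pi.add_apply, smul_eq_mul]; ring
        rw [this]
        exact (wtAlg E).add_mem ((wtAlg E).smul_mem hq _)
          ((wtAlg E).smul_mem ((wtAlg E).mul_mem (hθ v) (hθ w)) _)
  | algebraMap r =>
    refine ⟨contDiff_const, ⟨|r|, fun x => le_rfl⟩, fun w => ?_⟩
    have : dd w (algebraMap ℝ (E → ℝ) r) = 0 := by
      ext x
      exact congrFun (dd_const r w) x
    rw [this]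
    exact (wtAlg E).zero_mem
  | add f g hf hg ihf ihg =>
    obtain ⟨f1, ⟨C, f2⟩, f3⟩ := ihf
    obtain ⟨g1, ⟨D, g2⟩, g3⟩ := ihg
    refine ⟨f1.add g1, ⟨C + D, fun x => (abs_add_le _ _).trans (add_le_add (f2 x) (g2 x))⟩,
      fun w => ?_⟩
    have : dd w (f + g) = dd w f + dd w g := by
      ext x
      exact dd_add (f1.differentiable (by simp) x) (g1.differentiable (by simp) x) w
    rw [this]
    exact (wtAlg E).add_mem (f3 w) (g3 w)
  | mul f g hf hg ihf ihg =>
    obtain ⟨f1, ⟨C, f2⟩, f3⟩ := ihf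
    obtain ⟨g1, ⟨D, g2⟩, g3⟩ := ihg
    refine ⟨f1.mul g1, ⟨C * D, fun x => ?_⟩, fun w => ?_⟩
    · simp only [Pi.mul_apply]
      rw [abs_mul]
      exact mul_le_mul (f2 x) (g2 x) (abs_nonneg _) ((abs_nonneg _).trans (f2 x))
    · have : dd w (f * g) = dd w f * g + f * dd w g := by
        ext x
        exact dd_mul (f1.differentiable (by simp) x) (g1.differentiable (by simp) x) w
      rw [this]
      exact (wtAlg E).add_mem ((wtAlg E).mul_mem (f3 w) hg) ((wtAlg E).mul_mem hf (g3 w))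

theorem contDiff_wt (m : ℕ) : ContDiff ℝ ∞ (wt E m) := contDiff_inv_norm_sq.pow m

theorem dd_wt (m : ℕ) (w x : E) :
    dd w (wt E m) x = -2 * m * (inner ℝ x w * (1 + ‖x‖ ^ 2)⁻¹) * wt E m x := by
  induction m with
  | zero =>
    have : wt E 0 = fun _ => 1 := by ext x; simp [wt]
    rw [this, dd_const]; simp
  | succ m ih =>
    have : wt E (m + 1) = fun x => wt E m x * (1 + ‖x‖ ^ 2)⁻¹ := by ext x; simp [wt, pow_succ]
    rw [this, dd_mul ((contDiff_wt m).differentiable (by simp) x)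
      (contDiff_inv_norm_sq.differentiable (by simp) x), ih, dd_inv_norm_sq]
    push_cast
    ring

theorem db_wt (m : ℕ) : DB univ 1 (wt E m) (wt E m) := by
  refine ⟨(contDiff_wt m).contDiffOn, fun L => ?_⟩
  have key : ∀ (L : List E) (f : E → ℝ), f ∈ wtAlg E →
      ∃ g ∈ wtAlg E, dl L (fun x => f x * wt E m x) = fun x => g x * wt E m x := by
    intro L
    induction L with
    | nil => exact fun f hf => ⟨f, hf, rfl⟩
    | cons w L ih =>
      intro f hf
      have hθ : (fun x : E => inner ℝ x w * (1 + ‖x‖ ^ 2)⁻¹) ∈ wtAlg E :=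
        Algebra.subset_adjoin (Or.inr ⟨w, rfl⟩)
      have e : dd w (fun x => f x * wt E m x) = fun x => (dd w f + (-2 * m : ℝ) •
          (f * fun x : E => inner ℝ x w * (1 + ‖x‖ ^ 2)⁻¹)) x * wt E m x := by
        ext x
        rw [dd_mul ((wtAlg_spec hf).1.differentiable (by simp) x)
          ((contDiff_wt m).differentiable (by simp) x), dd_wt]
        simp only [Pi.smul_apply, Pi.mul_apply, Pi.add_apply, smul_eq_mul]; ring
      simp only [dl]
      rw [e]
      exact ih _ ((wtAlg E).add_mem ((wtAlg_spec hf).2.2 w)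
        ((wtAlg E).smul_mem ((wtAlg E).mul_mem hf hθ) _))
  obtain ⟨g, hg, e⟩ := key L (fun _ => 1) (wtAlg E).one_mem
  obtain ⟨C, hC⟩ := (wtAlg_spec hg).2.1
  have e1 : (fun x => (fun _ => (1:ℝ)) x * wt E m x) = wt E m := by ext x; simp
  rw [e1] at e
  refine ⟨|C|, abs_nonneg _, fun x _ => ?_⟩
  rw [e, abs_mul, abs_of_pos (wt_pos m x)]
  simp only [Pi.one_apply, one_pow, one_mul]
  exact mul_le_mul_of_nonneg_right ((hC x).trans (le_abs_self C)) (wt_pos m x).le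

theorem wt_le_of_norm_le (m : ℕ) (x z : E) (hz : ‖z‖ ≤ 1) : wt E m x ≤ 3 ^ m * wt E m (x + z) := by
  unfold wt
  rw [← mul_pow]
  refine pow_le_pow_left₀ (by positivity) ?_ m
  rw [← div_eq_mul_inv, inv_eq_one_div, div_le_div_iff₀ (by positivity) (by positivity)]
  have h1 := norm_add_le x z
  have h2 := norm_nonneg (x + z)
  nlinarith [norm_nonneg x, norm_nonneg z, sq_nonneg (‖x‖ - 1)]

theorem wt_le_rpow (m : ℕ) (x : E) : wt E m x ≤ 2 ^ m * ((1 + ‖x‖) ^ (2 * m))⁻¹ := by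
  unfold wt
  rw [pow_mul, ← inv_pow, ← mul_pow]
  refine pow_le_pow_left₀ (by positivity) ?_ m
  rw [← div_eq_mul_inv, inv_eq_one_div, div_le_div_iff₀ (by positivity) (by positivity)]
  nlinarith [sq_nonneg (‖x‖ - 1)]

theorem wt_smul_le (m : ℕ) {R : ℝ} (hR : 1 ≤ R) (x : E) : wt E m (R • x) ≤ wt E m x := by
  unfold wt
  refine pow_le_pow_left₀ (by positivity) ?_ m
  refine inv_anti₀ (by positivity) ?_
  rw [norm_smul, mul_pow, Real.norm_eq_abs, sq_abs]
  nlinarith [mul_nonneg (sub_nonneg.2 (one_le_pow₀ hR : 1 ≤ R ^ 2)) (sq_nonneg ‖x‖)]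

variable {ι : Type*} [Fintype ι] (b : OrthonormalBasis ι ℝ E)

theorem db_of_ball (k : ℕ) (hk : 1 ≤ k) {U : Set E} {d W u : E → ℝ}
    (hd : ∀ x ∈ U, 0 < d x) (hdU : ∀ x ∈ U, ball x (d x) ⊆ U) (hu : ContDiffOn ℝ ∞ u U)
    (h0 : ∀ x ∈ U, (lap b)^[k] u x = 0) (hW0 : ∀ x ∈ U, 0 ≤ W x) {c : ℝ}
    (hW : ∀ x ∈ U, ∀ y ∈ ball x (d x), |u y| ≤ c * W x) : DB U (fun x => (d x)⁻¹) W u := by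
  refine ⟨hu, fun L => ?_⟩
  obtain ⟨C, hC, hCb⟩ := exists_interior b k hk
  have hL : 0 ≤ (L.map norm).prod := List.prod_nonneg fun a ha => by
    obtain ⟨v, _, rfl⟩ := List.mem_map.1 ha
    exact norm_nonneg v
  refine ⟨C L.length * (|c| * (L.map norm).prod), by have := hC L.length; positivity,
    fun x hx => ?_⟩
  have h := hCb L.length u x (d x) (c * W x) (hd x hx) (((hu.mono (hdU x hx)).of_le (by
    exact_mod_cast ENat.LEInfty.out))) (fun y hy => h0 y (hdU x hx hy)) (hW x hx) L rfl
  refine h.trans ?_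
  have h1 := hW0 x hx
  have h2 := hd x hx
  have h3 := hC L.length
  calc _ ≤ C L.length * (|c| * W x / d x ^ L.length) * (L.map norm).prod := by
        gcongr; exact le_abs_self c
    _ = _ := by rw [div_eq_mul_inv, inv_pow]; ring

variable [DecidableEq ι] (i₀ : ι)

/-- The open half-space bounded by the hyperplane orthogonal to a vector of the basis. -/
def hs : Set E := {x | 0 < inner ℝ (b i₀) x}

theorem isOpen_hs : IsOpen (hs b i₀) :=
  isOpen_lt continuous_const (continuous_const.inner continuous_id)

theorem integrable_rpow_neg_half : IntegrableOn (fun t : ℝ => t ^ (-(1/2) : ℝ) * (1 + |t|) ^ (-2 : ℝ))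
    (Ioi 0) := by
  rw [← Ioc_union_Ioi_eq_Ioi zero_le_one]
  have hm : Measurable fun t : ℝ => t ^ (-(1/2) : ℝ) * (1 + |t|) ^ (-2 : ℝ) := by fun_prop
  refine IntegrableOn.union ?_ ?_
  · have h := (intervalIntegral.intervalIntegrable_rpow' (a := 0) (b := 1) (r := -(1/2))
      (by norm_num)).1
    refine Integrable.mono' h hm.aestronglyMeasurable ?_
    refine (ae_restrict_iff' measurableSet_Ioc).2 (Eventually.of_forall fun t ht => ?_)
    have h1 : 0 ≤ t ^ (-(1/2) : ℝ) := Real.rpow_nonneg ht.1.le _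
    have h2 : (1 + |t|) ^ (-2 : ℝ) ≤ 1 := Real.rpow_le_one_of_one_le_of_nonpos
      (by linarith [abs_nonneg t]) (by norm_num)
    rw [Real.norm_eq_abs, abs_of_nonneg (by positivity)]
    exact mul_le_of_le_one_right h1 h2
  · refine Integrable.mono' (integrableOn_Ioi_rpow_of_lt (a := -2) (by norm_num) one_pos)
      hm.aestronglyMeasurable ?_
    refine (ae_restrict_iff' measurableSet_Ioi).2 (Eventually.of_forall fun t ht => ?_)
    have ht0 : (0:ℝ) < t := one_pos.trans ht
    have h1 : t ^ (-(1/2) : ℝ) ≤ 1 := Real.rpow_le_one_of_one_le_of_nonpos (le_of_lt ht) (by norm_num)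
    have h2 : (1 + |t|) ^ (-2 : ℝ) ≤ t ^ (-2 : ℝ) := by
      refine Real.rpow_le_rpow_of_nonpos ht0 ?_ (by norm_num)
      rw [abs_of_pos ht0]; linarith
    have h3 : 0 ≤ t ^ (-(1/2) : ℝ) := Real.rpow_nonneg ht0.le _
    have h4 : 0 ≤ (1 + |t|) ^ (-2 : ℝ) := by positivity
    rw [Real.norm_eq_abs, abs_of_nonneg (by positivity)]
    calc _ ≤ 1 * t ^ (-2 : ℝ) := by gcongr
      _ = _ := one_mul _

theorem integrableOn_hs : IntegrableOn (fun x : E => (inner ℝ (b i₀) x : ℝ) ^ (-(1/2) : ℝ) *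
    ((1 + ‖x‖) ^ (2 * Fintype.card ι))⁻¹) (hs b i₀) := by
  let f : ι → ℝ → ℝ := fun i t => if i = i₀ then
    (Ioi 0).indicator (fun t : ℝ => t ^ (-(1/2) : ℝ) * (1 + |t|) ^ (-2 : ℝ)) t
      else (1 + ‖t‖) ^ (-2 : ℝ)
  have hf : ∀ i, Integrable (f i) := by
    intro i
    by_cases hi : i = i₀
    · simp only [f, hi, if_true]
      exact (integrable_indicator_iff measurableSet_Ioi).2 integrable_rpow_neg_half
    · simp only [f, hi, if_false]
      exact integrable_one_add_norm (by simp)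
  have h1 := Integrable.fintype_prod hf
  have h2 : Integrable (fun x : EuclideanSpace ℝ ι => ∏ i, f i (x i)) :=
    ((PiLp.volume_preserving_ofLp ι).integrable_comp h1.aestronglyMeasurable).2 h1
  have h3 := (b.measurePreserving_repr.integrable_comp h2.aestronglyMeasurable).2 h2
  have hm : Measurable fun x : E => (inner ℝ (b i₀) x : ℝ) ^ (-(1/2) : ℝ) *
    ((1 + ‖x‖) ^ (2 * Fintype.card ι))⁻¹ := by fun_prop
  refine Integrable.mono' h3.integrableOn hm.aestronglyMeasurable ?_
  refine (ae_restrict_iff' (isOpen_hs b i₀).measurableSet).2 (Eventually.of_forall fun x hx => ?_)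
  have hx0 : 0 < inner ℝ (b i₀) x := hx
  have hn : ∀ i, |(inner ℝ (b i) x : ℝ)| ≤ ‖x‖ := fun i => by
    have := abs_real_inner_le_norm (b i) x
    rwa [b.norm_eq_one, one_mul] at this
  have hle : ∀ i, ((1 + ‖x‖) ^ 2)⁻¹ ≤ (1 + |(inner ℝ (b i) x : ℝ)|) ^ (-2 : ℝ) := fun i => by
    rw [Real.rpow_neg (by positivity)]
    have := hn i
    norm_cast
    gcongr
  simp only [Function.comp_apply, f, b.repr_apply_apply]
  rw [← Finset.mul_prod_erase _ _ (Finset.mem_univ i₀), if_pos rfl, indicator_of_mem (mem_Ioi.2 hx0),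
    Real.norm_eq_abs, abs_of_nonneg (by positivity)]
  rw [mul_assoc]
  refine mul_le_mul_of_nonneg_left ?_ (Real.rpow_nonneg hx0.le _)
  calc ((1 + ‖x‖) ^ (2 * Fintype.card ι))⁻¹ = ∏ _i : ι, ((1 + ‖x‖) ^ 2)⁻¹ := by
        rw [Finset.prod_const, Finset.card_univ, pow_mul, inv_pow]
    _ = ((1 + ‖x‖) ^ 2)⁻¹ * ∏ _i ∈ Finset.univ.erase i₀, ((1 + ‖x‖) ^ 2)⁻¹ :=
        (Finset.mul_prod_erase _ _ (Finset.mem_univ i₀)).symm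
    _ ≤ _ := by
        refine mul_le_mul (hle i₀) (Finset.prod_le_prod (fun i _ => by positivity) fun i hi => ?_)
          (Finset.prod_nonneg fun i _ => by positivity) (by positivity)
        rw [if_neg (Finset.ne_of_mem_erase hi)]
        exact hle i

end HalfSpaceWeights

section HalfSpaceEnergy

variable {ι : Type*} [Fintype ι] [DecidableEq ι] (b : OrthonormalBasis ι ℝ E) (i₀ : ι)

/-- Polyharmonic functions on a half-space with polynomial growth that almost satisfy the
Dirichlet conditions. -/
structure HsSol (k M : ℕ) (u : E → ℝ) : Prop where
  smooth : ContDiffOn ℝ ∞ u (hs b i₀)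
  eq : ∀ x ∈ hs b i₀, (lap b)^[k] u x = 0
  bound : ∃ C, 0 ≤ C ∧ ∀ x ∈ hs b i₀,
    |u x| ≤ C * ((inner ℝ (b i₀) x : ℝ) ^ (k - 1/4 : ℝ) * (1 + ‖x‖) ^ M)

variable {b i₀} {k M : ℕ} {u v : E → ℝ}

theorem abs_inner_basis_le (x : E) : |(inner ℝ (b i₀) x : ℝ)| ≤ ‖x‖ := by
  have := abs_real_inner_le_norm (b i₀) x
  rwa [b.norm_eq_one, one_mul] at this

theorem HsSol.sub (hu : HsSol b i₀ k M u) (hv : HsSol b i₀ k M v) :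
    HsSol b i₀ k M (fun x => u x - v x) := by
  refine ⟨hu.smooth.sub hv.smooth, fun x hx => ?_, ?_⟩
  · rw [lapI_sub b (isOpen_hs b i₀) (hu.smooth.of_le (by exact_mod_cast ENat.LEInfty.out))
      (hv.smooth.of_le (by exact_mod_cast ENat.LEInfty.out)) hx]
    simp [hu.eq x hx, hv.eq x hx]
  · obtain ⟨C, hC, h⟩ := hu.bound
    obtain ⟨D, hD, h'⟩ := hv.bound
    refine ⟨C + D, by positivity, fun x hx => ?_⟩
    rw [add_mul]
    exact (abs_sub _ _).trans (add_le_add (h x hx) (h' x hx))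

theorem HsSol.translate (hu : HsSol b i₀ k M u) {h : E} (hh : inner ℝ (b i₀) h = (0:ℝ)) :
    HsSol b i₀ k M (fun x => u (x + h)) := by
  have hm : ∀ x ∈ hs b i₀, x + h ∈ hs b i₀ := fun x hx => by
    simp only [hs, mem_ofPred_eq, inner_add_right, hh, add_zero] at hx ⊢; exact hx
  refine ⟨hu.smooth.comp (by fun_prop) hm, fun x hx => ?_, ?_⟩
  · have := congrFun (lapI_comp_affine b u h 1 k) x
    simp only [one_smul, one_pow, one_mul, add_comm h] at this
    rw [this]
    exact hu.eq _ (hm x hx)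
  · obtain ⟨C, hC, hb⟩ := hu.bound
    refine ⟨C * (1 + ‖h‖) ^ M, by positivity, fun x hx => (hb _ (hm x hx)).trans ?_⟩
    rw [inner_add_right, hh, add_zero]
    have h1 : 1 + ‖x + h‖ ≤ (1 + ‖h‖) * (1 + ‖x‖) := by
      nlinarith [norm_add_le x h, norm_nonneg x, norm_nonneg h,
        mul_nonneg (norm_nonneg x) (norm_nonneg h)]
    have h2 : 0 ≤ (inner ℝ (b i₀) x : ℝ) ^ (k - 1/4 : ℝ) := Real.rpow_nonneg (le_of_lt hx) _
    calc _ ≤ C * ((inner ℝ (b i₀) x : ℝ) ^ (k - 1/4 : ℝ) * ((1 + ‖h‖) * (1 + ‖x‖)) ^ M) := by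
          gcongr
      _ = _ := by rw [mul_pow]; ring

theorem HsSol.scale (hu : HsSol b i₀ k M u) {R : ℝ} (hR : 1 ≤ R) :
    HsSol b i₀ k M (fun x => u (R • x)) := by
  have hR0 : 0 < R := by linarith
  have hm : ∀ x ∈ hs b i₀, R • x ∈ hs b i₀ := fun x hx => by
    simp only [hs, mem_ofPred_eq, inner_smul_right] at hx ⊢; positivity
  refine ⟨hu.smooth.comp (by fun_prop) hm, fun x hx => ?_, ?_⟩
  · have := congrFun (lapI_comp_affine b u 0 R k) x
    simp only [zero_add] at this
    rw [this, hu.eq _ (hm x hx), mul_zero]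
  · obtain ⟨C, hC, hb⟩ := hu.bound
    refine ⟨C * (R ^ (k - 1/4 : ℝ) * R ^ M), by positivity, fun x hx => (hb _ (hm x hx)).trans ?_⟩
    have hx0 : (0:ℝ) < inner ℝ (b i₀) x := hx
    rw [inner_smul_right, norm_smul, Real.norm_eq_abs, abs_of_pos hR0,
      Real.mul_rpow hR0.le hx0.le]
    have h1 : 1 + R * ‖x‖ ≤ R * (1 + ‖x‖) := by nlinarith
    calc _ ≤ C * (R ^ (k - 1/4 : ℝ) * (inner ℝ (b i₀) x : ℝ) ^ (k - 1/4 : ℝ) *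
          (R * (1 + ‖x‖)) ^ M) := by gcongr
      _ = _ := by rw [mul_pow]; ring

theorem ball_subset_hs {x : E} : ball x (inner ℝ (b i₀) x / 2) ⊆ hs b i₀ := fun y hy => by
  rw [mem_ball, dist_eq_norm] at hy
  have h1 := abs_inner_basis_le (b := b) (i₀ := i₀) (y - x)
  rw [inner_sub_right] at h1
  have h2 := (abs_le.1 h1).1
  have h3 := norm_nonneg (y - x)
  simp only [hs, mem_ofPred_eq]
  linarith

theorem norm_le_of_mem_ball {x y : E} (hy : y ∈ ball x (inner ℝ (b i₀) x / 2)) :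
    1 + ‖y‖ ≤ 2 * (1 + ‖x‖) ∧ (inner ℝ (b i₀) y : ℝ) ≤ 2 * inner ℝ (b i₀) x := by
  rw [mem_ball, dist_eq_norm] at hy
  have h1 := abs_inner_basis_le (b := b) (i₀ := i₀) (y - x)
  rw [inner_sub_right] at h1
  have h2 := (abs_le.1 h1).2
  have h3 := norm_nonneg (y - x)
  have h4 := (abs_le.1 (abs_inner_basis_le (b := b) (i₀ := i₀) x)).2
  have h5 := norm_le_norm_add_norm_sub' y x
  constructor <;> linarith

theorem HsSol.db_inv (hk : 1 ≤ k) (hu : HsSol b i₀ k M u) :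
    DB (hs b i₀) (fun x => (inner ℝ (b i₀) x / 2 : ℝ)⁻¹)
      (fun x => (inner ℝ (b i₀) x : ℝ) ^ (k - 1/4 : ℝ) * (1 + ‖x‖) ^ M) u := by
  obtain ⟨C, hC, hb⟩ := hu.bound
  have hs0 : (0:ℝ) ≤ k - 1/4 := by
    have : (1:ℝ) ≤ k := by exact_mod_cast hk
    linarith
  refine db_of_ball b k hk (fun x hx => half_pos hx) (fun x _ => ball_subset_hs)
    hu.smooth hu.eq (c := C * (2 ^ (k - 1/4 : ℝ) * 2 ^ M))
    (fun x hx => by have := Real.rpow_nonneg (le_of_lt hx) (k - 1/4 : ℝ); positivity)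
    fun x hx y hy => (hb y (ball_subset_hs hy)).trans ?_
  obtain ⟨h1, h2⟩ := norm_le_of_mem_ball hy
  have hy0 : (0:ℝ) < inner ℝ (b i₀) y := ball_subset_hs hy
  have hx0 : (0:ℝ) < inner ℝ (b i₀) x := hx
  calc C * ((inner ℝ (b i₀) y : ℝ) ^ (k - 1/4 : ℝ) * (1 + ‖y‖) ^ M) ≤
      C * ((2 * inner ℝ (b i₀) x : ℝ) ^ (k - 1/4 : ℝ) * (2 * (1 + ‖x‖)) ^ M) := by
        gcongr
    _ = _ := by rw [mul_pow, Real.mul_rpow (by norm_num) hx0.le]; ring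

theorem HsSol.db (hk : 1 ≤ k) (hu : HsSol b i₀ k M u) :
    DB (hs b i₀) (fun x => (1 + ‖x‖) * (inner ℝ (b i₀) x : ℝ)⁻¹)
      (fun x => (inner ℝ (b i₀) x : ℝ) ^ (k - 1/4 : ℝ) * (1 + ‖x‖) ^ M) u := by
  refine ⟨hu.smooth, fun L => ?_⟩
  obtain ⟨C, hC, hb⟩ := (hu.db_inv hk).bound L
  refine ⟨C * 2 ^ L.length, by positivity, fun x hx => (hb x hx).trans ?_⟩
  have hx0 : (0:ℝ) < inner ℝ (b i₀) x := hx
  have h1 : (inner ℝ (b i₀) x / 2 : ℝ)⁻¹ ≤ 2 * ((1 + ‖x‖) * (inner ℝ (b i₀) x : ℝ)⁻¹) := by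
    rw [inv_div, div_eq_mul_inv]
    have : 0 < (inner ℝ (b i₀) x : ℝ)⁻¹ := by positivity
    nlinarith [mul_nonneg (norm_nonneg x) this.le]
  have h2 : 0 ≤ (inner ℝ (b i₀) x : ℝ) ^ (k - 1/4 : ℝ) := Real.rpow_nonneg (le_of_lt hx) _
  calc _ ≤ C * ((2 * ((1 + ‖x‖) * (inner ℝ (b i₀) x : ℝ)⁻¹)) ^ L.length *
        ((inner ℝ (b i₀) x : ℝ) ^ (k - 1/4 : ℝ) * (1 + ‖x‖) ^ M)) := by gcongr
    _ = _ := by rw [mul_pow]; ring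

variable (b i₀)

theorem hs_weight_le {m : ℕ} (hm : k + M + Fintype.card ι ≤ m) (j : ℕ) (hj : j ≤ k) {x : E}
    (hx : x ∈ hs b i₀) :
    ((1 + ‖x‖) * (inner ℝ (b i₀) x : ℝ)⁻¹) ^ (2 * j) *
      (((inner ℝ (b i₀) x : ℝ) ^ (k - 1/4 : ℝ) * (1 + ‖x‖) ^ M) *
      ((inner ℝ (b i₀) x : ℝ) ^ (k - 1/4 : ℝ) * (1 + ‖x‖) ^ M) * wt E m x) ≤
    2 ^ m * ((inner ℝ (b i₀) x : ℝ) ^ (-(1/2) : ℝ) * ((1 + ‖x‖) ^ (2 * Fintype.card ι))⁻¹) := by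
  have hx0 : (0:ℝ) < inner ℝ (b i₀) x := hx
  set σ : ℝ := inner ℝ (b i₀) x
  have hσ : σ ≤ 1 + ‖x‖ := by
    have := (abs_le.1 (abs_inner_basis_le (b := b) (i₀ := i₀) x)).2
    linarith
  have h1 : 1 ≤ (1 + ‖x‖) * σ⁻¹ := by
    rw [← div_eq_mul_inv, le_div_iff₀ hx0]; linarith
  have h2 : σ ^ (k - 1/4 : ℝ) * σ ^ (k - 1/4 : ℝ) * (σ⁻¹) ^ (2 * k) = σ ^ (-(1/2) : ℝ) := by
    rw [inv_pow, ← Real.rpow_natCast, ← Real.rpow_neg hx0.le, ← Real.rpow_add hx0,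
      ← Real.rpow_add hx0]
    congr 1
    push_cast
    ring
  have h3 : 0 < σ ^ (-(1/2) : ℝ) := Real.rpow_pos_of_pos hx0 _
  have hw := wt_pos m x
  have hx1 : 1 ≤ 1 + ‖x‖ := by linarith [norm_nonneg x]
  calc _ ≤ ((1 + ‖x‖) * σ⁻¹) ^ (2 * k) * ((σ ^ (k - 1/4 : ℝ) * (1 + ‖x‖) ^ M) *
      (σ ^ (k - 1/4 : ℝ) * (1 + ‖x‖) ^ M) * wt E m x) := by gcongr
    _ = (σ ^ (k - 1/4 : ℝ) * σ ^ (k - 1/4 : ℝ) * (σ⁻¹) ^ (2 * k)) *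
        ((1 + ‖x‖) ^ (2 * k + 2 * M) * wt E m x) := by
        rw [mul_pow, pow_add, pow_mul' _ 2 M]; ring
    _ ≤ σ ^ (-(1/2) : ℝ) * ((1 + ‖x‖) ^ (2 * k + 2 * M) *
        (2 ^ m * ((1 + ‖x‖) ^ (2 * m))⁻¹)) := by
        rw [h2]; gcongr; exact wt_le_rpow m x
    _ ≤ σ ^ (-(1/2) : ℝ) * ((1 + ‖x‖) ^ (2 * k + 2 * M) *
        (2 ^ m * ((1 + ‖x‖) ^ (2 * k + 2 * M + 2 * Fintype.card ι))⁻¹)) := by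
        gcongr
        omega
    _ = _ := by
        rw [pow_add _ (2 * k + 2 * M)]
        field_simp

theorem adm_hs {m : ℕ} (hm : k + M + Fintype.card ι ≤ m) :
    Adm k (hs b i₀) (fun x => inner ℝ (b i₀) x)
      (fun x => (1 + ‖x‖) * (inner ℝ (b i₀) x : ℝ)⁻¹)
      (fun x => (inner ℝ (b i₀) x : ℝ) ^ (k - 1/4 : ℝ) * (1 + ‖x‖) ^ M) (wt E m) where
  smooth := contDiff_const.inner ℝ contDiff_id
  eq := rfl
  grad := ⟨1, fun x _ => by
    have : (fun x : E => (inner ℝ (b i₀) x : ℝ)) = innerSL ℝ (b i₀) := rfl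
    rw [this, ContinuousLinearMap.fderiv, innerSL_apply_norm, b.norm_eq_one]⟩
  one_le x hx := by
    have hx0 : (0:ℝ) < inner ℝ (b i₀) x := hx
    rw [mul_assoc, inv_mul_cancel₀ hx0.ne', mul_one]
    linarith [norm_nonneg x]
  one_le_const := ⟨1, fun x hx => by
    have hx0 : (0:ℝ) < inner ℝ (b i₀) x := hx
    have := (abs_le.1 (abs_inner_basis_le (b := b) (i₀ := i₀) x)).2
    rw [one_mul, ← div_eq_mul_inv, le_div_iff₀ hx0]; linarith⟩
  nonneg x hx := by
    have := Real.rpow_nonneg (le_of_lt hx) (k - 1/4 : ℝ)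
    positivity
  nonneg_weight x := (wt_pos m x).le
  weight := db_wt m
  int := by
    have hmeas : Measurable (wt E m) := (contDiff_wt m).continuous.measurable
    refine Integrable.mono' ((integrableOn_hs b i₀).const_mul (2 ^ m))
      (Measurable.aestronglyMeasurable (by fun_prop)) ?_
    refine (ae_restrict_iff' (isOpen_hs b i₀).measurableSet).2 (Eventually.of_forall fun x hx => ?_)
    have hx0 : (0:ℝ) < inner ℝ (b i₀) x := hx
    have hw := wt_pos m x
    rw [Real.norm_eq_abs, abs_of_nonneg (by positivity)]
    exact hs_weight_le b i₀ hm k le_rfl hx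

/-- The weighted energy of the dilated function. -/
def hsEnergy (m : ℕ) (u : E → ℝ) (R : ℝ) : ℝ :=
  ∫ x in hs b i₀, u (R • x) * u (R • x) * wt E m x

theorem HsSol.energy_le {m : ℕ} (hm : k + M + Fintype.card ι ≤ m) (hu : HsSol b i₀ k M u) :
    ∃ C, 0 ≤ C ∧ ∀ R, 1 ≤ R → hsEnergy b i₀ m u R ≤ C * R ^ (2 * (k + M)) := by
  obtain ⟨C, hC, hb⟩ := hu.bound
  let Z : E → ℝ := fun x => 2 ^ m * ((inner ℝ (b i₀) x : ℝ) ^ (-(1/2) : ℝ) *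
    ((1 + ‖x‖) ^ (2 * Fintype.card ι))⁻¹)
  have hZ : IntegrableOn Z (hs b i₀) := (integrableOn_hs b i₀).const_mul (2 ^ m)
  have hZ0 : 0 ≤ ∫ x in hs b i₀, Z x :=
    setIntegral_nonneg (isOpen_hs b i₀).measurableSet fun x hx => by
      have := Real.rpow_nonneg (le_of_lt hx) (-(1/2) : ℝ)
      simp only [Z]; positivity
  refine ⟨C ^ 2 * ∫ x in hs b i₀, Z x, by positivity, fun R hR => ?_⟩
  have hR0 : 0 < R := by linarith
  have hpt : ∀ x ∈ hs b i₀, u (R • x) * u (R • x) * wt E m x ≤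
      R ^ (2 * (k + M)) * C ^ 2 * Z x := by
    intro x hx
    have hx0 : (0:ℝ) < inner ℝ (b i₀) x := hx
    have hRx : R • x ∈ hs b i₀ := by
      simp only [hs, mem_ofPred_eq, inner_smul_right]; positivity
    have h1 := hb _ hRx
    rw [inner_smul_right, norm_smul, Real.norm_eq_abs, abs_of_pos hR0,
      Real.mul_rpow hR0.le hx0.le] at h1
    have h2 : 1 + R * ‖x‖ ≤ R * (1 + ‖x‖) := by nlinarith
    have h3 : R ^ (k - 1/4 : ℝ) ≤ R ^ k := by
      rw [← Real.rpow_natCast]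
      exact Real.rpow_le_rpow_of_exponent_le hR (by linarith)
    have h4 : |u (R • x)| ≤ C * R ^ (k + M) * ((inner ℝ (b i₀) x : ℝ) ^ (k - 1/4 : ℝ) *
        (1 + ‖x‖) ^ M) := by
      refine h1.trans ?_
      calc _ ≤ C * (R ^ k * (inner ℝ (b i₀) x : ℝ) ^ (k - 1/4 : ℝ) * (R * (1 + ‖x‖)) ^ M) := by
            gcongr
        _ = _ := by rw [mul_pow, pow_add]; ring
    have h5 := hs_weight_le b i₀ hm 0 (Nat.zero_le k) hx
    rw [mul_zero, pow_zero, one_mul] at h5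
    have hw := wt_pos m x
    calc u (R • x) * u (R • x) * wt E m x = |u (R • x)| * |u (R • x)| * wt E m x := by
          rw [abs_mul_abs_self]
      _ ≤ (C * R ^ (k + M) * ((inner ℝ (b i₀) x : ℝ) ^ (k - 1/4 : ℝ) * (1 + ‖x‖) ^ M)) *
          (C * R ^ (k + M) * ((inner ℝ (b i₀) x : ℝ) ^ (k - 1/4 : ℝ) * (1 + ‖x‖) ^ M)) *
          wt E m x := by gcongr
      _ = R ^ (2 * (k + M)) * C ^ 2 * (((inner ℝ (b i₀) x : ℝ) ^ (k - 1/4 : ℝ) * (1 + ‖x‖) ^ M) *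
          ((inner ℝ (b i₀) x : ℝ) ^ (k - 1/4 : ℝ) * (1 + ‖x‖) ^ M) * wt E m x) := by
          rw [mul_comm 2 (k + M), pow_mul]; ring
      _ ≤ _ := by gcongr
  calc hsEnergy b i₀ m u R ≤ ∫ x in hs b i₀, R ^ (2 * (k + M)) * C ^ 2 * Z x :=
        integral_mono_of_nonneg ((ae_restrict_iff' (isOpen_hs b i₀).measurableSet).2
          (Eventually.of_forall fun x _ => mul_nonneg (mul_self_nonneg _) (wt_pos m x).le))
          (hZ.const_mul _) ((ae_restrict_iff' (isOpen_hs b i₀).measurableSet).2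
          (Eventually.of_forall hpt))
    _ = _ := by rw [integral_const_mul]; ring

theorem sq_integral_le_integral_sq {f : ℝ → ℝ} (hf : Continuous f) :
    (∫ t in (0:ℝ)..1, f t) ^ 2 ≤ ∫ t in (0:ℝ)..1, f t ^ 2 := by
  set c := ∫ t in (0:ℝ)..1, f t
  have h : 0 ≤ ∫ t in (0:ℝ)..1, (f t - c) ^ 2 :=
    intervalIntegral.integral_nonneg zero_le_one fun t _ => sq_nonneg _
  have e : ∫ t in (0:ℝ)..1, (f t - c) ^ 2 = (∫ t in (0:ℝ)..1, f t ^ 2) - c ^ 2 := by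
    have i1 : IntervalIntegrable (fun t => f t ^ 2) volume 0 1 := (hf.pow 2).intervalIntegrable _ _
    have i2 : IntervalIntegrable (fun t => 2 * c * f t) volume 0 1 :=
      (hf.const_mul (2 * c)).intervalIntegrable _ _
    have i3 : IntervalIntegrable (fun _ : ℝ => c ^ 2) volume 0 1 := intervalIntegrable_const
    have : (fun t => (f t - c) ^ 2) = fun t => f t ^ 2 - 2 * c * f t + c ^ 2 := by ext t; ring
    rw [this, intervalIntegral.integral_add (i1.sub i2) i3, intervalIntegral.integral_sub i1 i2,
      intervalIntegral.integral_const_mul, intervalIntegral.integral_const]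
    simp only [sub_zero, smul_eq_mul, one_mul]
    ring
  linarith

theorem sq_dd_le (e : E) (v : E → ℝ) (x : E) : dd e v x ^ 2 ≤ ‖e‖ ^ 2 * BB b 1 v v x := by
  have h1 : dd e v x = ∑ i, inner ℝ (b i) e * dd (b i) v x := by
    unfold dd
    conv_lhs => rw [← b.sum_repr' e]
    rw [map_sum]
    simp
  have h2 : ‖e‖ ^ 2 = ∑ i, (inner ℝ (b i) e : ℝ) ^ 2 := by
    rw [← b.sum_sq_norm_inner_right e]
    simp
  rw [h1, h2]
  refine (Finset.sum_mul_sq_le_sq_mul_sq _ _ _).trans (le_of_eq ?_)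
  congr 1
  simp only [BB]
  exact Finset.sum_congr rfl fun i _ => sq _

theorem exists_energy_diff_le (hk : 1 ≤ k) {m : ℕ} (hm : k + M + Fintype.card ι ≤ m) :
    ∃ C, 0 ≤ C ∧ ∀ u, HsSol b i₀ k M u → ∀ h, inner ℝ (b i₀) h = (0:ℝ) → ‖h‖ ≤ 1 → ∀ R, 1 ≤ R →
      hsEnergy b i₀ m (fun x => u (x + h) - u x) R ≤ C * (R ^ 2)⁻¹ * hsEnergy b i₀ m u R := by
  obtain ⟨C, hC, hcb⟩ := exists_caccioppoli b k hk (fun x => (wt_pos m x).le)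
    (db_wt (E := E) m)
  refine ⟨3 ^ m * C, by positivity, fun u hu h hh hh1 R hR => ?_⟩
  have hR0 : 0 < R := by linarith
  obtain ⟨v, hv⟩ : ∃ v : E → ℝ, v = fun x => u (R • x) := ⟨_, rfl⟩
  have hvs : HsSol b i₀ k M v := hv ▸ hu.scale hR
  obtain ⟨i1, i2, hle⟩ := hcb _ _ _ _ (adm_hs b i₀ hm) v (hvs.db hk) hvs.eq
  set e : E := R⁻¹ • h with he
  have hen : ‖e‖ ≤ R⁻¹ := by
    rw [he, norm_smul, Real.norm_eq_abs, abs_of_pos (inv_pos.2 hR0)]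
    exact mul_le_of_le_one_right (inv_pos.2 hR0).le hh1
  have he1 : ‖e‖ ≤ 1 := hen.trans (inv_le_one_of_one_le₀ hR)
  have hei : inner ℝ (b i₀) e = (0:ℝ) := by rw [he, inner_smul_right, hh, mul_zero]
  have hmem : ∀ x ∈ hs b i₀, ∀ t : ℝ, x + t • e ∈ hs b i₀ := fun x hx t => by
    simp only [hs, mem_ofPred_eq, inner_add_right, inner_smul_right, hei, mul_zero, add_zero] at hx ⊢
    exact hx
  have hHm := (isOpen_hs b i₀).measurableSet
  let F : E → ℝ := fun y => ‖e‖ ^ 2 * 3 ^ m * (BB b 1 v v y * wt E m y)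
  have hF0 : ∀ y, 0 ≤ F y := fun y => mul_nonneg (by positivity)
    (mul_nonneg (BB_self_nonneg b 1 v y) (wt_pos m y).le)
  have hFc : ContinuousOn F (hs b i₀) :=
    continuousOn_const.mul ((BB_contDiffOn b (isOpen_hs b i₀) hvs.smooth hvs.smooth
      1).continuousOn.mul (contDiff_wt m).continuous.continuousOn)
  have hFi : IntegrableOn F (hs b i₀) := i1.const_mul _
  let Φ : E → ENNReal := fun y => ENNReal.ofReal ((hs b i₀).indicator F y)
  have hΦ : Measurable Φ := by
    refine ENNReal.measurable_ofReal.comp ?_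
    classical
    rw [← piecewise_eq_indicator]
    exact hFc.measurable_piecewise continuousOn_const hHm
  have hpt : ∀ x ∈ hs b i₀, ENNReal.ofReal ((v (x + e) - v x) * (v (x + e) - v x) * wt E m x) ≤
      ∫⁻ t in Ioc (0:ℝ) 1, Φ (x + t • e) := by
    intro x hx
    have hder : ∀ t : ℝ, HasDerivAt (fun t : ℝ => v (x + t • e)) (dd e v (x + t • e)) t := fun t => by
      have h1 := (diffAt_of (isOpen_hs b i₀) hvs.smooth (by simp) (hmem x hx t)).hasFDerivAt
      have h2 : HasDerivAt (fun t : ℝ => x + t • e) e t := by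
        simpa using ((hasDerivAt_id t).smul_const e).const_add x
      exact HasFDerivAt.comp_hasDerivAt (l := v) (f := fun t : ℝ => x + t • e) t h1 h2
    have hcont : Continuous fun t : ℝ => x + t • e := by fun_prop
    have hdc : Continuous fun t : ℝ => dd e v (x + t • e) :=
      continuousOn_univ.1 ((dd_contDiffOn_infty (isOpen_hs b i₀) hvs.smooth e).continuousOn.comp
        hcont.continuousOn fun t _ => hmem x hx t)
    have hFc1 : Continuous fun t : ℝ => F (x + t • e) :=
      continuousOn_univ.1 (hFc.comp hcont.continuousOn fun t _ => hmem x hx t)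
    have hftc : ∫ t in (0:ℝ)..1, dd e v (x + t • e) = v (x + e) - v x := by
      rw [intervalIntegral.integral_eq_sub_of_hasDerivAt (fun t _ => hder t)
        (hdc.intervalIntegrable _ _)]
      simp
    have h1 : (v (x + e) - v x) * (v (x + e) - v x) * wt E m x ≤
        ∫ t in (0:ℝ)..1, F (x + t • e) := by
      rw [← sq, ← hftc]
      calc _ ≤ (∫ t in (0:ℝ)..1, dd e v (x + t • e) ^ 2) * wt E m x :=
            mul_le_mul_of_nonneg_right (sq_integral_le_integral_sq hdc) (wt_pos m x).le
        _ = ∫ t in (0:ℝ)..1, dd e v (x + t • e) ^ 2 * wt E m x :=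
            (intervalIntegral.integral_mul_const _ _).symm
        _ ≤ _ := by
            refine intervalIntegral.integral_mono_on zero_le_one
              (((hdc.pow 2).mul_const _).intervalIntegrable _ _) (hFc1.intervalIntegrable _ _)
              fun t ht => ?_
            have h2 := sq_dd_le b e v (x + t • e)
            have h3 := wt_le_of_norm_le m x (t • e) (by
              rw [norm_smul, Real.norm_eq_abs, abs_of_nonneg ht.1]
              exact mul_le_one₀ ht.2 (norm_nonneg _) he1)
            have h4 := BB_self_nonneg b 1 v (x + t • e)
            have h5 := wt_pos m x
            calc _ ≤ (‖e‖ ^ 2 * BB b 1 v v (x + t • e)) * (3 ^ m * wt E m (x + t • e)) := by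
                  gcongr
              _ = _ := by simp only [F]; ring
    refine (ENNReal.ofReal_le_ofReal h1).trans (le_of_eq ?_)
    rw [intervalIntegral.integral_of_le zero_le_one, ofReal_integral_eq_lintegral_ofReal
      (hFc1.intervalIntegrable 0 1).1 (Eventually.of_forall fun t => hF0 _)]
    refine lintegral_congr fun t => ?_
    simp only [Φ]
    rw [indicator_of_mem (hmem x hx t)]
  have hvv : IntegrableOn (fun x => (v (x + e) - v x) * (v (x + e) - v x) * wt E m x) (hs b i₀) :=
    (hcb _ _ _ _ (adm_hs b i₀ hm) _ (((hvs.translate hei).sub hvs).db hk)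
      ((hvs.translate hei).sub hvs).eq).2.1
  have hlin : ∫⁻ x in hs b i₀, ENNReal.ofReal ((v (x + e) - v x) * (v (x + e) - v x) * wt E m x) ≤
      ∫⁻ x in hs b i₀, ENNReal.ofReal (F x) := by
    calc _ ≤ ∫⁻ x in hs b i₀, ∫⁻ t in Ioc (0:ℝ) 1, Φ (x + t • e) := setLIntegral_mono' hHm hpt
      _ ≤ ∫⁻ x, ∫⁻ t in Ioc (0:ℝ) 1, Φ (x + t • e) := setLIntegral_le_lintegral _ _
      _ = ∫⁻ t in Ioc (0:ℝ) 1, ∫⁻ x, Φ (x + t • e) := by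
          refine lintegral_lintegral_swap (Measurable.aemeasurable ?_)
          exact hΦ.comp (by fun_prop)
      _ = ∫⁻ t in Ioc (0:ℝ) 1, ∫⁻ x, Φ x := by
          refine lintegral_congr fun t => lintegral_add_right_eq_self Φ (t • e)
      _ = ∫⁻ x, Φ x := by simp
      _ = _ := by
          rw [← lintegral_indicator hHm]
          refine lintegral_congr fun x => ?_
          by_cases hx : x ∈ hs b i₀
          · simp [Φ, indicator_of_mem, hx]
          · simp [Φ, indicator_of_notMem, hx]
  have hreal : ∫ x in hs b i₀, (v (x + e) - v x) * (v (x + e) - v x) * wt E m x ≤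
      ∫ x in hs b i₀, F x := by
    rw [← ofReal_integral_eq_lintegral_ofReal hvv (Eventually.of_forall fun x =>
      mul_nonneg (mul_self_nonneg _) (wt_pos m x).le), ← ofReal_integral_eq_lintegral_ofReal hFi
      (Eventually.of_forall hF0)] at hlin
    exact (ENNReal.ofReal_le_ofReal_iff (integral_nonneg hF0)).1 hlin
  have hE : hsEnergy b i₀ m (fun x => u (x + h) - u x) R =
      ∫ x in hs b i₀, (v (x + e) - v x) * (v (x + e) - v x) * wt E m x := by
    unfold hsEnergy
    have : ∀ x : E, R • (x + e) = R • x + h := fun x => by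
      rw [smul_add, he, smul_smul, mul_inv_cancel₀ hR0.ne', one_smul]
    simp only [hv, this]
  have hint : 0 ≤ ∫ x in hs b i₀, BB b 1 v v x * wt E m x :=
    integral_nonneg fun x => mul_nonneg (BB_self_nonneg b 1 v x) (wt_pos m x).le
  have hE' : hsEnergy b i₀ m u R = ∫ x in hs b i₀, v x * v x * wt E m x := by rw [hv]; rfl
  rw [hE, hE']
  calc _ ≤ ∫ x in hs b i₀, F x := hreal
    _ = ‖e‖ ^ 2 * 3 ^ m * ∫ x in hs b i₀, BB b 1 v v x * wt E m x := integral_const_mul _ _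
    _ ≤ R⁻¹ ^ 2 * 3 ^ m * (C * ∫ x in hs b i₀, v x * v x * wt E m x) := by
        gcongr
    _ = _ := by rw [inv_pow]; ring

end HalfSpaceEnergy

section PolynomialLines

theorem Polynomial.exists_derivative_eq (p : Polynomial ℝ) : ∃ P, Polynomial.derivative P = p := by
  induction p using Polynomial.induction_on' with
  | add p q hp hq =>
    obtain ⟨P, rfl⟩ := hp
    obtain ⟨Q, rfl⟩ := hq
    exact ⟨P + Q, Polynomial.derivative_add⟩
  | monomial n a =>
    refine ⟨Polynomial.monomial (n + 1) (a / (n + 1)), ?_⟩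
    rw [Polynomial.derivative_monomial]
    have : (n + 1 : ℝ) ≠ 0 := by positivity
    simp [this]

theorem Polynomial.iterate_derivative_of_X_pow_mul {N k : ℕ} {q : Polynomial ℝ}
    (h : Polynomial.derivative^[N] (Polynomial.X ^ k * q) = 0) :
    Polynomial.derivative^[N] q = 0 := by
  ext m
  have h1 := congrArg (fun p => Polynomial.coeff p (m + k)) h
  simp only [Polynomial.coeff_iterate_derivative, Polynomial.coeff_zero, nsmul_eq_mul,
    mul_eq_zero] at h1 ⊢
  rcases h1 with h1 | h1
  · exfalso
    have : (m + k + N).descFactorial N ≠ 0 := by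
      rw [Ne, Nat.descFactorial_eq_zero_iff_lt]; omega
    exact this (by exact_mod_cast h1)
  · right
    rwa [add_right_comm, mul_comm, Polynomial.coeff_mul_X_pow] at h1

theorem Polynomial.X_pow_dvd_of_abs_le {p : Polynomial ℝ} {C s : ℝ}
    (h : ∀ t ∈ Ioo (0:ℝ) 1, |p.eval t| ≤ C * t ^ s) (j : ℕ) (hj : (j:ℝ) - 1 < s) :
    Polynomial.X ^ j ∣ p := by
  induction j with
  | zero => simp
  | succ j ih =>
    push_cast at hj
    obtain ⟨q, rfl⟩ := ih (by linarith)
    rw [pow_succ]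
    refine mul_dvd_mul_left _ (Polynomial.X_dvd_iff.2 ?_)
    rw [Polynomial.coeff_zero_eq_eval_zero]
    have h1 : Tendsto (fun t : ℝ => q.eval t) (𝓝[>] 0) (𝓝 (q.eval 0)) :=
      (q.continuous.tendsto 0).mono_left nhdsWithin_le_nhds
    have h2 : Tendsto (fun t : ℝ => C * t ^ (s - j)) (𝓝[>] 0) (𝓝 0) := by
      have : Tendsto (fun t : ℝ => t ^ (s - j)) (𝓝 0) (𝓝 ((0:ℝ) ^ (s - j))) :=
        (Real.continuousAt_rpow_const _ _ (Or.inr (by linarith))).tendsto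
      rw [Real.zero_rpow (by linarith)] at this
      simpa using (this.mono_left nhdsWithin_le_nhds).const_mul C
    refine tendsto_nhds_unique h1 (squeeze_zero_norm' ?_ h2)
    filter_upwards [Ioo_mem_nhdsGT (zero_lt_one' ℝ)] with t ht
    have h3 := h t ht
    have ht0 : 0 < t := ht.1
    rw [Polynomial.eval_mul, Polynomial.eval_pow, Polynomial.eval_X, abs_mul,
      abs_of_pos (pow_pos ht0 j)] at h3
    rw [Real.rpow_sub ht0, Real.rpow_natCast, Real.norm_eq_abs, ← mul_div_assoc,
      le_div_iff₀ (pow_pos ht0 j)]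
    linarith

variable {ι : Type*} [Fintype ι] [DecidableEq ι] (b : OrthonormalBasis ι ℝ E) (i₀ : ι)

/-- The point of height `t` on the normal line through `x`. -/
def lineAt (x : E) (t : ℝ) : E := x + (t - inner ℝ (b i₀) x) • b i₀

variable {b i₀} {f g : E → ℝ}

theorem inner_lineAt (x : E) (t : ℝ) : (inner ℝ (b i₀) (lineAt b i₀ x t) : ℝ) = t := by
  have : (inner ℝ (b i₀) (b i₀) : ℝ) = 1 := by
    rw [real_inner_self_eq_norm_sq, b.norm_eq_one, one_pow]
  rw [lineAt, inner_add_right, inner_smul_right, this]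
  ring

theorem lineAt_mem (x : E) {t : ℝ} (ht : 0 < t) : lineAt b i₀ x t ∈ hs b i₀ := by
  show 0 < (inner ℝ (b i₀) (lineAt b i₀ x t) : ℝ)
  rwa [inner_lineAt]

theorem lineAt_self (x : E) : lineAt b i₀ x (inner ℝ (b i₀) x) = x := by simp [lineAt]

theorem hasDerivAt_lineAt (hf : ContDiffOn ℝ ∞ f (hs b i₀)) (x : E) {t : ℝ} (ht : 0 < t) :
    HasDerivAt (fun t => f (lineAt b i₀ x t)) (dd (b i₀) f (lineAt b i₀ x t)) t := by
  have h1 := (diffAt_of (isOpen_hs b i₀) hf (by simp) (lineAt_mem x ht)).hasFDerivAt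
  have h2 : HasDerivAt (fun t : ℝ => lineAt b i₀ x t) (b i₀) t := by
    simpa [lineAt] using
      (((hasDerivAt_id t).sub_const (inner ℝ (b i₀) x : ℝ)).smul_const (b i₀)).const_add x
  exact HasFDerivAt.comp_hasDerivAt (l := f) (f := fun t : ℝ => lineAt b i₀ x t) t h1 h2

theorem exists_polynomial_of_dl_eq_zero (N : ℕ) (hf : ContDiffOn ℝ ∞ f (hs b i₀))
    (h : ∀ x ∈ hs b i₀, dl (List.replicate N (b i₀)) f x = 0) (x : E) :
    ∃ p : Polynomial ℝ, Polynomial.derivative^[N] p = 0 ∧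
      ∀ t, 0 < t → f (lineAt b i₀ x t) = p.eval t := by
  induction N generalizing f with
  | zero => exact ⟨0, rfl, fun t ht => by simpa [dl] using h _ (lineAt_mem x ht)⟩
  | succ N ih =>
    obtain ⟨p, hp, hpt⟩ := ih (dd_contDiffOn_infty (isOpen_hs b i₀) hf (b i₀)) h
    obtain ⟨P, rfl⟩ := Polynomial.exists_derivative_eq p
    have hd : ∀ t ∈ Ioi (0:ℝ), HasDerivAt (fun t => f (lineAt b i₀ x t) - P.eval t) 0 t := by
      intro t ht
      have := (hasDerivAt_lineAt hf x ht).sub (P.hasDerivAt t)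
      rwa [hpt t ht, sub_self] at this
    obtain ⟨c, hc⟩ := isOpen_Ioi.exists_is_const_of_deriv_eq_zero
      (convex_Ioi (0:ℝ)).isPreconnected
      (fun t ht => (hd t ht).differentiableAt.differentiableWithinAt) fun t ht => (hd t ht).deriv
    refine ⟨P + Polynomial.C c, ?_, fun t ht => ?_⟩
    · rw [Function.iterate_succ_apply]
      simpa using hp
    · have := hc t ht
      simp only [Polynomial.eval_add, Polynomial.eval_C]
      linarith

theorem dl_eq_zero_of_polynomial (N : ℕ) (hf : ContDiffOn ℝ ∞ f (hs b i₀))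
    (h : ∀ x ∈ hs b i₀, ∃ p : Polynomial ℝ, Polynomial.derivative^[N] p = 0 ∧
      ∀ t, 0 < t → f (lineAt b i₀ x t) = p.eval t) :
    ∀ x ∈ hs b i₀, dl (List.replicate N (b i₀)) f x = 0 := by
  induction N generalizing f with
  | zero =>
    intro x hx
    obtain ⟨p, hp, hpt⟩ := h x hx
    have := hpt _ hx
    rw [lineAt_self] at this
    simp only [Function.iterate_zero, id_eq] at hp
    simp [dl, this, hp]
  | succ N ih =>
    refine ih (dd_contDiffOn_infty (isOpen_hs b i₀) hf (b i₀)) fun x hx => ?_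
    obtain ⟨p, hp, hpt⟩ := h x hx
    refine ⟨Polynomial.derivative p, hp, fun t ht => ?_⟩
    refine (hasDerivAt_lineAt hf x ht).unique ((p.hasDerivAt t).congr_of_eventuallyEq ?_)
    filter_upwards [lt_mem_nhds ht] with s hs using hpt s hs

theorem dl_dd_comm {U : Set E} (hU : IsOpen U) (hf : ContDiffOn ℝ ∞ f U) (L : List E) (v : E) :
    EqOn (dl L (dd v f)) (dd v (dl L f)) U := by
  induction L generalizing f with
  | nil => exact fun _ _ => rfl
  | cons w L ih =>
    intro x hx
    rw [dl, dl, ← ih (dd_contDiffOn_infty hU hf w) hx]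
    exact dl_congr hU (dd_comm_on hU hf (by exact_mod_cast ENat.LEInfty.out) v w) L hx

theorem lapI_dl_comm {U : Set E} (hU : IsOpen U) (hf : ContDiffOn ℝ ∞ f U) (L : List E) (j : ℕ) :
    EqOn ((lap b)^[j] (dl L f)) (dl L ((lap b)^[j] f)) U := by
  induction L generalizing f with
  | nil => exact fun _ _ => rfl
  | cons w L ih =>
    intro x hx
    rw [dl, dl, ih (dd_contDiffOn_infty hU hf w) hx]
    exact dl_congr hU (lapI_dd_comm b hU hf w j) L hx

theorem dl_dl_comm {U : Set E} (hU : IsOpen U) (hf : ContDiffOn ℝ ∞ f U) (L M : List E) :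
    EqOn (dl L (dl M f)) (dl M (dl L f)) U := by
  induction M generalizing f with
  | nil => exact fun _ _ => rfl
  | cons w M ih =>
    intro x hx
    rw [dl, dl, ih (dd_contDiffOn_infty hU hf w) hx]
    exact dl_congr hU (dl_dd_comm hU hf L w) M hx

/-- A polyharmonic function which is annihilated by all tangential derivatives of high order is
a polynomial in the normal variable. -/
theorem dl_normal_eq_zero (k p : ℕ) (hf : ContDiffOn ℝ ∞ f (hs b i₀))
    (h0 : ∀ x ∈ hs b i₀, (lap b)^[k] f x = 0)
    (h : ∀ L : List E, L.length = p → (∀ v ∈ L, ∃ i, i ≠ i₀ ∧ v = b i) →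
      ∀ x ∈ hs b i₀, dl L f x = 0) :
    ∀ x ∈ hs b i₀, dl (List.replicate (2 * k * p) (b i₀)) f x = 0 := by
  have hU := isOpen_hs b i₀
  induction p generalizing f with
  | zero => exact fun x hx => h [] rfl (by simp) x hx
  | succ p ih =>
    set g := dl (List.replicate (2 * k * p) (b i₀)) f with hg
    have hgs : ContDiffOn ℝ ∞ g (hs b i₀) := dl_contDiffOn hU hf _
    have hgt : ∀ i, i ≠ i₀ → ∀ x ∈ hs b i₀, dd (b i) g x = 0 := fun i hi x hx => by
      rw [hg, ← dl_dd_comm hU hf _ _ hx]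
      refine ih (dd_contDiffOn_infty hU hf (b i)) (fun y hy => ?_) (fun L hL hLt y hy => ?_) x hx
      · rw [lapI_dd_comm b hU hf _ _ hy]
        exact (dd_congr hU (fun y hy => h0 y hy : EqOn _ (fun _ => (0:ℝ)) _) _ hy).trans
          (by rw [dd_const])
      · exact h (b i :: L) (by simp [hL]) (by
          intro v hv
          rcases List.mem_cons.1 hv with rfl | hv
          exacts [⟨i, hi, rfl⟩, hLt v hv]) y hy
    have hg0 : ∀ x ∈ hs b i₀, (lap b)^[k] g x = 0 := fun x hx => by
      rw [hg, lapI_dl_comm hU hf _ _ hx]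
      exact (dl_congr hU (fun y hy => h0 y hy : EqOn _ (fun _ => (0:ℝ)) _) _ hx).trans
        (by rw [dl_zero])
    have key : ∀ j (g : E → ℝ), ContDiffOn ℝ ∞ g (hs b i₀) →
        (∀ i, i ≠ i₀ → ∀ x ∈ hs b i₀, dd (b i) g x = 0) →
        EqOn ((lap b)^[j] g) (dl (List.replicate (2 * j) (b i₀)) g) (hs b i₀) := by
      intro j
      induction j with
      | zero => exact fun g _ _ x _ => rfl
      | succ j ihj =>
        intro g hg ht x hx
        have e1 : EqOn (lap b g) (dd (b i₀) (dd (b i₀) g)) (hs b i₀) := fun y hy => by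
          rw [lap, Finset.sum_eq_single i₀ (fun i _ hi => ?_) (by simp)]
          exact (dd_congr hU (fun z hz => ht i hi z hz : EqOn _ (fun _ => (0:ℝ)) _) _ hy).trans
            (by rw [dd_const])
        rw [Function.iterate_succ_apply, lapI_congr b hU e1 j hx, ihj _
          (dd_contDiffOn_infty hU (dd_contDiffOn_infty hU hg _) _) (fun i hi y hy => ?_) hx]
        · rw [show 2 * (j + 1) = 2 * j + 1 + 1 by ring, List.replicate_succ, List.replicate_succ]
          rfl
        · have := dl_dd_comm hU hg [b i₀, b i₀] (b i) hy
          simp only [dl] at this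
          rw [← this]
          exact (dl_congr hU (fun z hz => ht i hi z hz : EqOn _ (fun _ => (0:ℝ)) _)
            [b i₀, b i₀] hy).trans (by rw [dl_zero])
    intro x hx
    rw [show 2 * k * (p + 1) = 2 * k * p + 2 * k by ring, List.replicate_add, dl_append, ← hg,
      ← key k g hgs hgt hx, hg0 x hx]

end PolynomialLines

section Liouville

/-- Iterated finite differences. -/
def dfl : List E → (E → ℝ) → E → ℝ
  | [], u => u
  | h :: L, u => dfl L (fun x => u (x + h) - u x)

variable {ι : Type*} [Fintype ι] [DecidableEq ι] {b : OrthonormalBasis ι ℝ E} {i₀ : ι}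
  {k M : ℕ} {u : E → ℝ}

theorem HsSol.dfl (hu : HsSol b i₀ k M u) (L : List E)
    (hL : ∀ h ∈ L, inner ℝ (b i₀) h = (0:ℝ)) : HsSol b i₀ k M (dfl L u) := by
  induction L generalizing u with
  | nil => exact hu
  | cons h L ih =>
    exact ih ((hu.translate (hL h (by simp))).sub hu) fun w hw => hL w (by simp [hw])

theorem HsSol.eq_zero_of_energy (hk : 1 ≤ k) {m : ℕ} (hm : k + M + Fintype.card ι ≤ m)
    (hu : HsSol b i₀ k M u) {C : ℝ}
    (h : ∀ R, 1 ≤ R → hsEnergy b i₀ m u R * R ^ (Module.finrank ℝ E + 1) ≤ C) :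
    ∀ x ∈ hs b i₀, u x = 0 := by
  obtain ⟨D, hD, hcb⟩ := exists_caccioppoli b k hk (fun x => (wt_pos m x).le)
    (db_wt (E := E) m)
  have hint : IntegrableOn (fun x => u x * u x * wt E m x) (hs b i₀) :=
    (hcb _ _ _ _ (adm_hs b i₀ hm) u (hu.db hk) hu.eq).2.1
  have hHm := (isOpen_hs b i₀).measurableSet
  have hnn : ∀ x, 0 ≤ u x * u x * wt E m x := fun x =>
    mul_nonneg (mul_self_nonneg _) (wt_pos m x).le
  have hI : ∀ R, 1 ≤ R → (∫ x in hs b i₀, u x * u x * wt E m x) * R ≤ C := by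
    intro R hR
    have hR0 : 0 < R := by linarith
    have hRH : R • hs b i₀ = hs b i₀ := by
      ext x
      rw [mem_smul_set_iff_inv_smul_mem₀ hR0.ne']
      simp only [hs, mem_ofPred_eq, inner_smul_right]
      constructor <;> intro h
      · exact pos_of_mul_pos_right h (inv_pos.2 hR0).le
      · positivity
    have e := Measure.setIntegral_comp_smul_of_pos (volume : Measure E)
      (fun x => u x * u x * wt E m x) (hs b i₀) hR0
    rw [hRH, smul_eq_mul] at e
    have hi2 : IntegrableOn (fun x => u (R • x) * u (R • x) * wt E m x) (hs b i₀) :=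
      (hcb _ _ _ _ (adm_hs b i₀ hm) _ ((hu.scale hR).db hk) (hu.scale hR).eq).2.1
    have h1 : ∫ x in hs b i₀, u (R • x) * u (R • x) * wt E m (R • x) ≤ hsEnergy b i₀ m u R :=
      integral_mono_of_nonneg (Eventually.of_forall fun x => hnn (R • x)) hi2
        (Eventually.of_forall fun x =>
          mul_le_mul_of_nonneg_left (wt_smul_le m hR x) (mul_self_nonneg _))
    rw [e] at h1
    have h2 := h R hR
    have hp : 0 < R ^ Module.finrank ℝ E := by positivity
    rw [inv_mul_le_iff₀ hp] at h1
    calc _ ≤ R ^ Module.finrank ℝ E * hsEnergy b i₀ m u R * R := by gcongr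
      _ = hsEnergy b i₀ m u R * R ^ (Module.finrank ℝ E + 1) := by ring
      _ ≤ C := h2
  have hI0 : ∫ x in hs b i₀, u x * u x * wt E m x = 0 := by
    refine le_antisymm (le_of_not_gt fun hpos => ?_) (integral_nonneg hnn)
    obtain ⟨R, hR⟩ := exists_gt (max 1 (C / ∫ x in hs b i₀, u x * u x * wt E m x))
    have h1 := hI R ((le_max_left _ _).trans hR.le)
    have h2 := (le_max_right _ _).trans_lt hR
    rw [div_lt_iff₀ hpos] at h2
    linarith
  have hae := (integral_eq_zero_iff_of_nonneg hnn hint).1 hI0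
  have := Measure.eqOn_open_of_ae_eq hae (isOpen_hs b i₀)
    ((hu.smooth.continuousOn.mul hu.smooth.continuousOn).mul
      (contDiff_wt m).continuous.continuousOn) continuousOn_const
  intro x hx
  have h3 := this hx
  simp only [Pi.zero_apply, mul_eq_zero, or_self] at h3
  exact h3.resolve_right (wt_pos m x).ne'

theorem HsSol.dfl_eq_zero (hk : 1 ≤ k) (hu : HsSol b i₀ k M u) (L : List E)
    (hL : ∀ h ∈ L, inner ℝ (b i₀) h = (0:ℝ)) (hL1 : ∀ h ∈ L, ‖h‖ ≤ 1)
    (hlen : 2 * (k + M) + Module.finrank ℝ E + 1 ≤ 2 * L.length) :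
    ∀ x ∈ hs b i₀, _root_.dfl L u x = 0 := by
  obtain ⟨C, hC, hd⟩ := exists_energy_diff_le b i₀ hk (le_refl (k + M + Fintype.card ι))
  have key : ∀ (L : List E) (u : E → ℝ), HsSol b i₀ k M u → (∀ h ∈ L, inner ℝ (b i₀) h = (0:ℝ)) →
      (∀ h ∈ L, ‖h‖ ≤ 1) → ∀ R, 1 ≤ R → hsEnergy b i₀ (k + M + Fintype.card ι) (_root_.dfl L u) R ≤
        (C * (R ^ 2)⁻¹) ^ L.length * hsEnergy b i₀ (k + M + Fintype.card ι) u R := by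
    intro L
    induction L with
    | nil => intro u _ _ _ R _; simp [_root_.dfl]
    | cons h L ih =>
      intro u hu h1 h2 R hR
      have h3 := ih _ ((hu.translate (h1 h (by simp))).sub hu)
        (fun w hw => h1 w (by simp [hw])) (fun w hw => h2 w (by simp [hw])) R hR
      refine h3.trans ?_
      rw [List.length_cons, pow_succ (C * (R ^ 2)⁻¹), mul_assoc]
      exact mul_le_mul_of_nonneg_left (hd u hu h (h1 h (by simp)) (h2 h (by simp)) R hR)
        (by positivity)
  obtain ⟨D, hD, he⟩ := hu.energy_le b i₀ (le_refl (k + M + Fintype.card ι))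
  refine (hu.dfl L hL).eq_zero_of_energy hk le_rfl (C := C ^ L.length * D) fun R hR => ?_
  have hR0 : 0 < R := by linarith
  calc _ ≤ (C * (R ^ 2)⁻¹) ^ L.length * (D * R ^ (2 * (k + M))) *
        R ^ (Module.finrank ℝ E + 1) := by
        refine mul_le_mul_of_nonneg_right ((key L u hu hL hL1 R hR).trans ?_) (by positivity)
        exact mul_le_mul_of_nonneg_left (he R hR) (by positivity)
    _ = C ^ L.length * D * (R ^ (2 * (k + M) + Module.finrank ℝ E + 1) *
        (R ^ (2 * L.length))⁻¹) := by
        rw [mul_pow, inv_pow, ← pow_mul, add_assoc, pow_add]; ring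
    _ ≤ C ^ L.length * D * 1 := by
        gcongr
        rw [← div_eq_mul_inv, div_le_one (by positivity)]
        exact pow_le_pow_right₀ hR hlen
    _ = _ := mul_one _

theorem dl_eq_zero_of_dfl (N : ℕ) (hu : ContDiffOn ℝ ∞ u (hs b i₀))
    (h : ∀ L : List E, L.length = N → (∀ h ∈ L, inner ℝ (b i₀) h = (0:ℝ)) → (∀ h ∈ L, ‖h‖ ≤ 1) →
      ∀ x ∈ hs b i₀, dfl L u x = 0) (L : List E) (hl : L.length = N)
      (hL : ∀ h ∈ L, inner ℝ (b i₀) h = (0:ℝ)) (hL1 : ∀ h ∈ L, ‖h‖ ≤ 1) :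
      ∀ x ∈ hs b i₀, dl L u x = 0 := by
  have hU := isOpen_hs b i₀
  induction N generalizing u L with
  | zero =>
    rw [List.length_eq_zero_iff] at hl
    subst hl
    exact h [] rfl (by simp) (by simp)
  | succ N ih =>
    obtain ⟨e, L, rfl⟩ : ∃ e L', L = e :: L' := List.exists_of_length_succ L hl
    intro x hx
    have hin : ∀ t : ℝ, ∀ x ∈ hs b i₀, x + t • e ∈ hs b i₀ := fun t x hx => by
      have : inner ℝ (b i₀) e = (0:ℝ) := hL e (by simp)
      simp only [hs, mem_ofPred_eq, inner_add_right, inner_smul_right, this, mul_zero,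
        add_zero] at hx ⊢
      exact hx
    rw [dl, dl_dd_comm hU hu L e hx]
    have hinv : ∀ t ∈ Icc (0:ℝ) 1, dl L u (x + t • e) = dl L u x := by
      intro t ht
      have hte : ∀ y ∈ hs b i₀, t • e + (1:ℝ) • y ∈ hs b i₀ := fun y hy => by
        rw [one_smul, add_comm]; exact hin t y hy
      have hus : ContDiffOn ℝ ∞ (fun y => u (t • e + (1:ℝ) • y)) (hs b i₀) :=
        hu.comp (by fun_prop) hte
      have h1 := ih (u := fun y => u (t • e + (1:ℝ) • y) + (-1) * u y)
        (hus.add (contDiffOn_const.mul hu)) (fun L' hl' hL' hL1' y hy => ?_) L (by simpa using hl)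
        (fun w hw => hL w (by simp [hw])) (fun w hw => hL1 w (by simp [hw])) x hx
      · rw [dl_add hU hus (contDiffOn_const.mul hu) L hx] at h1
        dsimp only at h1
        rw [dl_const_mul, dl_comp_affine] at h1
        simp only [one_pow, one_smul, one_mul] at h1
        rw [add_comm x]
        linarith
      · have h2 := h (t • e :: L') (by simp [hl']) (by
          intro w hw
          rcases List.mem_cons.1 hw with rfl | hw
          · rw [inner_smul_right, hL e (by simp), mul_zero]
          · exact hL' w hw) (by
          intro w hw
          rcases List.mem_cons.1 hw with rfl | hw
          · rw [norm_smul, Real.norm_eq_abs, abs_of_nonneg ht.1]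
            exact mul_le_one₀ ht.2 (norm_nonneg _) (hL1 e (by simp))
          · exact hL1' w hw) y hy
        simp only [dfl] at h2
        simp only [one_smul, neg_mul, one_mul, ← sub_eq_add_neg, add_comm (t • e)]
        exact h2
    have hder : HasDerivAt (fun t : ℝ => dl L u (x + t • e)) (dd e (dl L u) x) 0 := by
      have h1 := (diffAt_of hU (dl_contDiffOn hU hu L) (by simp) (hin 0 x hx)).hasFDerivAt
      have h2 : HasDerivAt (fun t : ℝ => x + t • e) e 0 := by
        simpa using ((hasDerivAt_id (0:ℝ)).smul_const e).const_add x
      have := HasFDerivAt.comp_hasDerivAt (l := dl L u) (f := fun t : ℝ => x + t • e) 0 h1 h2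
      rw [zero_smul, add_zero] at this
      exact this
    refine ((uniqueDiffOn_Icc zero_lt_one) (0:ℝ) (left_mem_Icc.2 zero_le_one)).eq_deriv _
      hder.hasDerivWithinAt ?_
    exact (hasDerivWithinAt_const (0:ℝ) _ (dl L u x)).congr hinv (by simp)

theorem exists_dl_sigma_inv (L : List E) (j : ℕ) : ∃ c : ℝ,
    EqOn (dl L (fun x => ((inner ℝ (b i₀) x : ℝ)⁻¹) ^ j))
      (fun x => c * ((inner ℝ (b i₀) x : ℝ)⁻¹) ^ (j + L.length)) (hs b i₀) := by
  have hU := isOpen_hs b i₀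
  induction L generalizing j with
  | nil => exact ⟨1, fun x _ => by simp [dl]⟩
  | cons v L ih =>
    obtain ⟨c, hc⟩ := ih (j + 1)
    have e : EqOn (dd v (fun x => ((inner ℝ (b i₀) x : ℝ)⁻¹) ^ j))
        (fun x => (-j * inner ℝ (b i₀) v) * ((inner ℝ (b i₀) x : ℝ)⁻¹) ^ (j + 1)) (hs b i₀) := by
      intro x hx
      have hx0 : (inner ℝ (b i₀) x : ℝ) ≠ 0 := (show (0:ℝ) < inner ℝ (b i₀) x from hx).ne'
      have h1 : HasFDerivAt (fun x => (inner ℝ (b i₀) x : ℝ)) (innerSL ℝ (b i₀)) x :=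
        (innerSL ℝ (b i₀)).hasFDerivAt
      have h2 := (((hasDerivAt_inv hx0).pow j).comp_hasFDerivAt x h1).fderiv
      rw [dd, show (fun x => ((inner ℝ (b i₀) x : ℝ)⁻¹) ^ j) =
        ((Inv.inv ^ j : ℝ → ℝ) ∘ fun x => (inner ℝ (b i₀) x : ℝ)) from rfl, h2]
      simp only [_root_.smul_apply, innerSL_apply_apply, smul_eq_mul]
      rcases j with - | j
      · simp
      · simp only [Nat.add_sub_cancel]
        rw [← inv_pow]
        push_cast
        ring
    refine ⟨(-j * inner ℝ (b i₀) v) * c, fun x hx => ?_⟩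
    rw [dl, dl_congr hU e L hx, dl_const_mul]
    dsimp only
    rw [hc hx, List.length_cons]
    dsimp only
    rw [← add_assoc, add_right_comm]
    ring

theorem contDiffOn_sigma_inv (k : ℕ) :
    ContDiffOn ℝ ∞ (fun x => ((inner ℝ (b i₀) x : ℝ)⁻¹) ^ k) (hs b i₀) :=
  (ContDiffOn.inv (innerSL ℝ (b i₀)).contDiff.contDiffOn fun x hx => (show (0:ℝ) < inner ℝ (b i₀) x from hx).ne').pow k

theorem HsSol.liouville (hk : 1 ≤ k) (hu : HsSol b i₀ k M u) {g : ℝ} {l : ℕ} (hg0 : 0 ≤ g)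
    (hg : g < k + l) {C : ℝ} (hb : ∀ x ∈ hs b i₀, |u x| ≤ C * (1 + ‖x‖) ^ g) :
    ∃ q : E → ℝ, ContDiffOn ℝ ∞ q (hs b i₀) ∧
      (∀ x ∈ hs b i₀, u x = (inner ℝ (b i₀) x : ℝ) ^ k * q x) ∧
      ∀ L : List E, L.length = l → ∀ x ∈ hs b i₀, dl L q x = 0 := by
  have hU := isOpen_hs b i₀
  obtain ⟨N, hN⟩ : ∃ N : ℕ, N = 2 * (k + M) + Module.finrank ℝ E + 1 := ⟨_, rfl⟩
  have htan : ∀ i, i ≠ i₀ → inner ℝ (b i₀) (b i) = (0:ℝ) := fun i hi =>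
    b.orthonormal.2 (Ne.symm hi)
  have h1 := dl_normal_eq_zero k N hu.smooth hu.eq fun L hl hL =>
    dl_eq_zero_of_dfl N hu.smooth (fun L hl hL hL1 => hu.dfl_eq_zero hk L hL hL1 (by omega)) L hl
      (fun v hv => by obtain ⟨i, hi, rfl⟩ := hL v hv; exact htan i hi)
      (fun v hv => by obtain ⟨i, hi, rfl⟩ := hL v hv; exact (b.norm_eq_one i).le)
  set P := 2 * k * N
  set q : E → ℝ := fun x => u x * ((inner ℝ (b i₀) x : ℝ)⁻¹) ^ k with hq
  have hqs : ContDiffOn ℝ ∞ q (hs b i₀) := hu.smooth.mul (contDiffOn_sigma_inv k)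
  obtain ⟨Cu, hCu, hub⟩ := hu.bound
  have hqp : ∀ x ∈ hs b i₀, dl (List.replicate P (b i₀)) q x = 0 := by
    refine dl_eq_zero_of_polynomial P hqs fun x hx => ?_
    obtain ⟨p, hp, hpt⟩ := exists_polynomial_of_dl_eq_zero P hu.smooth h1 x
    obtain ⟨r, rfl⟩ : Polynomial.X ^ k ∣ p := by
      refine Polynomial.X_pow_dvd_of_abs_le (s := k - 1/4)
        (C := Cu * (1 + ‖x‖ + (1 + |(inner ℝ (b i₀) x : ℝ)|)) ^ M) (fun t ht => ?_) k (by linarith)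
      have ht0 : 0 < t := ht.1
      rw [← hpt t ht0]
      refine (hub _ (lineAt_mem x ht0)).trans ?_
      rw [inner_lineAt]
      have : ‖lineAt b i₀ x t‖ ≤ ‖x‖ + (1 + |(inner ℝ (b i₀) x : ℝ)|) := by
        refine (norm_add_le _ _).trans ?_
        rw [norm_smul, b.norm_eq_one, mul_one, Real.norm_eq_abs]
        gcongr
        refine (abs_sub _ _).trans ?_
        gcongr
        rw [abs_of_pos ht0]; exact ht.2.le
      have h3 := Real.rpow_nonneg ht0.le (k - 1/4 : ℝ)
      calc _ ≤ Cu * (t ^ (k - 1/4 : ℝ) * (1 + (‖x‖ + (1 + |(inner ℝ (b i₀) x : ℝ)|))) ^ M) := by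
            gcongr
        _ = _ := by rw [← add_assoc]; ring
    refine ⟨r, Polynomial.iterate_derivative_of_X_pow_mul hp, fun t ht => ?_⟩
    simp only [hq]
    rw [hpt t ht, inner_lineAt]
    simp only [Polynomial.eval_mul, Polynomial.eval_pow, Polynomial.eval_X]
    rw [mul_right_comm, ← mul_pow, mul_inv_cancel₀ ht.ne', one_pow, one_mul]
  refine ⟨q, hqs, fun x hx => ?_, fun L hL x hx => ?_⟩
  · have hx0 : (inner ℝ (b i₀) x : ℝ) ≠ 0 := (show (0:ℝ) < inner ℝ (b i₀) x from hx).ne'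
    simp only [hq]
    rw [mul_left_comm, ← mul_pow, mul_inv_cancel₀ hx0, one_pow, mul_one]
  have hd1 : DB (hs b i₀) (fun x => (inner ℝ (b i₀) x / 2 : ℝ)⁻¹) (fun x => (1 + ‖x‖) ^ g) u := by
    refine db_of_ball b k hk (fun x hx => half_pos hx) (fun x _ => ball_subset_hs)
      hu.smooth hu.eq (c := |C| * 2 ^ g) (fun x hx => by positivity)
      fun x hx y hy => (hb y (ball_subset_hs hy)).trans ?_
    calc C * (1 + ‖y‖) ^ g ≤ |C| * (2 * (1 + ‖x‖)) ^ g := by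
          gcongr
          · exact le_abs_self C
          · exact (norm_le_of_mem_ball hy).1
      _ = _ := by rw [Real.mul_rpow (by norm_num) (by positivity)]; ring
  have hd2 : DB (hs b i₀) (fun x => (inner ℝ (b i₀) x / 2 : ℝ)⁻¹)
      (fun x => ((inner ℝ (b i₀) x : ℝ)⁻¹) ^ k) (fun x => ((inner ℝ (b i₀) x : ℝ)⁻¹) ^ k) := by
    refine ⟨contDiffOn_sigma_inv k, fun L => ?_⟩
    obtain ⟨c, hc⟩ := exists_dl_sigma_inv (b := b) (i₀ := i₀) L k
    refine ⟨|c|, abs_nonneg _, fun x hx => ?_⟩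
    have hx0 : 0 < (inner ℝ (b i₀) x : ℝ) := hx
    rw [hc hx]
    dsimp only
    rw [abs_mul, abs_of_pos (pow_pos (inv_pos.2 hx0) _), pow_add, mul_comm (_ ^ k)]
    gcongr
    linarith
  have hpos : ∀ x ∈ hs b i₀, 0 < (inner ℝ (b i₀) x : ℝ) := fun x hx => hx
  obtain ⟨D, hD, hDb⟩ := (DB.mul hU (fun x hx => by have := hpos x hx; positivity)
    (fun x _ => by positivity) (fun x hx => by have := hpos x hx; positivity) hd1 hd2).bound L
  have hz : ∀ y ∈ hs b i₀, dl (List.replicate P (b i₀)) (dl L q) y = 0 := fun y hy => by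
    rw [dl_dl_comm hU hqs _ _ hy]
    exact (dl_congr hU (fun y hy => hqp y hy : EqOn _ (fun _ => (0:ℝ)) _) _ hy).trans
      (by rw [dl_zero])
  obtain ⟨p, -, hpt⟩ := exists_polynomial_of_dl_eq_zero P (dl_contDiffOn hU hqs L) hz x
  have hp0 : Tendsto (fun t => p.eval t) atTop (𝓝 0) := by
    obtain ⟨A, hA⟩ : ∃ A, A = 1 + ‖x‖ + |(inner ℝ (b i₀) x : ℝ)| := ⟨_, rfl⟩
    have hA0 : 0 ≤ A := by rw [hA]; positivity
    have hlim : Tendsto (fun t : ℝ => D * 2 ^ l * 2 ^ g * t ^ (-(k + l - g : ℝ))) atTop (𝓝 0) := by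
      simpa using (tendsto_rpow_neg_atTop (show (0:ℝ) < k + l - g by linarith)).const_mul
        (D * 2 ^ l * 2 ^ g)
    refine squeeze_zero_norm' ?_ hlim
    filter_upwards [eventually_gt_atTop 0, eventually_ge_atTop A] with t ht0 htA
    have h3 := hDb _ (lineAt_mem (b := b) (i₀ := i₀) x ht0)
    rw [Real.norm_eq_abs, ← hpt t ht0]
    refine h3.trans ?_
    simp only [Pi.mul_apply]
    rw [inner_lineAt, hL]
    have h4 : 1 + ‖lineAt b i₀ x t‖ ≤ 2 * t := by
      have : ‖lineAt b i₀ x t‖ ≤ ‖x‖ + (t + |(inner ℝ (b i₀) x : ℝ)|) := by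
        refine (norm_add_le _ _).trans ?_
        rw [norm_smul, b.norm_eq_one, mul_one, Real.norm_eq_abs]
        gcongr
        refine (abs_sub _ _).trans ?_
        rw [abs_of_pos ht0]
      linarith
    have h5 : t ^ (-(k + l - g : ℝ)) = t ^ g * (t⁻¹) ^ k * (t⁻¹) ^ l := by
      rw [inv_pow, inv_pow, ← Real.rpow_natCast, ← Real.rpow_natCast, ← Real.rpow_neg ht0.le,
        ← Real.rpow_neg ht0.le, ← Real.rpow_add ht0, ← Real.rpow_add ht0]
      congr 1; ring
    calc D * ((t / 2)⁻¹ ^ l * ((1 + ‖lineAt b i₀ x t‖) ^ g * t⁻¹ ^ k)) ≤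
        D * ((t / 2)⁻¹ ^ l * ((2 * t) ^ g * t⁻¹ ^ k)) := by gcongr
      _ = _ := by
        rw [h5, Real.mul_rpow (by norm_num) ht0.le, inv_div, div_eq_mul_inv, mul_pow]; ring
  have hp : p = 0 := by
    rw [Polynomial.tendsto_nhds_iff] at hp0
    exact Polynomial.leadingCoeff_eq_zero.1 hp0.1
  have := hpt _ hx
  rw [lineAt_self] at this
  rw [this, hp, Polynomial.eval_zero]

/-- Liouville theorem for polyharmonic functions on a half-space with Dirichlet conditions. -/
theorem liouville_halfspace {κ : Type*} [Fintype κ] (e : OrthonormalBasis κ ℝ E) (k M : ℕ)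
    (hk : 1 ≤ k) {a : E} (ha : a ≠ 0) (c : ℝ) {u : E → ℝ}
    (hu : ContDiffOn ℝ ∞ u {x | 0 < inner ℝ a x + c})
    (h0 : ∀ x, 0 < inner ℝ a x + c → (lap e)^[k] u x = 0) {C : ℝ}
    (hC : ∀ x, 0 < inner ℝ a x + c →
      |u x| ≤ C * ((inner ℝ a x + c : ℝ) ^ (k - 1/4 : ℝ) * (1 + ‖x‖) ^ M))
    {g : ℝ} {l : ℕ} (hg0 : 0 ≤ g) (hg : g < k + l) {D : ℝ}
    (hD : ∀ x, 0 < inner ℝ a x + c → |u x| ≤ D * (1 + ‖x‖) ^ g) :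
    ∃ q : E → ℝ, ContDiffOn ℝ ∞ q {x | 0 < inner ℝ a x + c} ∧
      (∀ x, 0 < inner ℝ a x + c → u x = (inner ℝ a x + c : ℝ) ^ k * q x) ∧
      ∀ L : List E, L.length = l → ∀ x, 0 < inner ℝ a x + c → dl L q x = 0 := by
  classical
  have hn : 0 < ‖a‖ := norm_pos_iff.2 ha
  have : Nontrivial E := ⟨a, 0, ha⟩
  have hfr : 0 < Module.finrank ℝ E := Module.finrank_pos
  let i₀ : Fin (Module.finrank ℝ E) := ⟨0, hfr⟩
  obtain ⟨b, hb⟩ := Orthonormal.exists_orthonormalBasis_extension_of_card_eq (𝕜 := ℝ) (E := E)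
    (ι := Fin (Module.finrank ℝ E)) (by simp) (v := fun _ => ‖a‖⁻¹ • a) (s := {i₀}) (by
      refine ⟨fun i => ?_, fun i j hij => (hij (Subsingleton.elim i j)).elim⟩
      simp [norm_smul, hn.ne'])
  have hbi : b i₀ = ‖a‖⁻¹ • a := hb i₀ rfl
  have hab : a = ‖a‖ • b i₀ := by rw [hbi, smul_smul, mul_inv_cancel₀ hn.ne', one_smul]
  set z : E := (-(c / ‖a‖ ^ 2)) • a with hz
  have hiz : ∀ x : E, (inner ℝ a (z + (1:ℝ) • x) + c : ℝ) = ‖a‖ * inner ℝ (b i₀) x := fun x => by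
    rw [one_smul, inner_add_right, hz, inner_smul_right, real_inner_self_eq_norm_sq, hbi,
      real_inner_smul_left]
    field_simp
    ring
  have hiz' : ∀ x : E, (inner ℝ a x + c : ℝ) = ‖a‖ * inner ℝ (b i₀) (x - z) := fun x => by
    rw [← hiz, one_smul, add_sub_cancel]
  have hmem : ∀ x ∈ hs b i₀, 0 < (inner ℝ a (z + (1:ℝ) • x) + c : ℝ) := fun x hx => by
    rw [hiz]; exact mul_pos hn hx
  have hmem' : ∀ x, 0 < (inner ℝ a x + c : ℝ) → x - z ∈ hs b i₀ := fun x hx => by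
    rw [hiz'] at hx; exact pos_of_mul_pos_right hx hn.le
  have hnorm : ∀ x : E, 1 + ‖z + (1:ℝ) • x‖ ≤ (1 + ‖z‖) * (1 + ‖x‖) := fun x => by
    rw [one_smul]
    nlinarith [norm_add_le z x, mul_nonneg (norm_nonneg z) (norm_nonneg x)]
  have hopen : IsOpen {x : E | 0 < (inner ℝ a x + c : ℝ)} :=
    isOpen_lt continuous_const (by fun_prop)
  have hsm : ContDiffOn ℝ ∞ (fun x => u (z + (1:ℝ) • x)) (hs b i₀) := hu.comp (by fun_prop) hmem
  have hsol : HsSol b i₀ k M (fun x => u (z + (1:ℝ) • x)) := by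
    refine ⟨hsm, fun x hx => ?_, ⟨|C| * ‖a‖ ^ (k - 1/4 : ℝ) * (1 + ‖z‖) ^ M, by positivity,
      fun x hx => ?_⟩⟩
    · rw [lapI_comp_affine]
      dsimp only
      rw [one_pow, one_mul, lapI_eq_lapI b e (j := k) hopen
        (hu.of_le (by exact_mod_cast ENat.LEInfty.out)) (hmem x hx), h0 _ (hmem x hx)]
    · have hx0 : 0 < (inner ℝ (b i₀) x : ℝ) := hx
      refine (hC _ (hmem x hx)).trans ?_
      rw [hiz, Real.mul_rpow hn.le hx0.le]
      calc _ ≤ |C| * (‖a‖ ^ (k - 1/4 : ℝ) * (inner ℝ (b i₀) x : ℝ) ^ (k - 1/4 : ℝ) *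
            ((1 + ‖z‖) * (1 + ‖x‖)) ^ M) := by
            gcongr
            · exact le_abs_self C
            · exact hnorm x
        _ = _ := by rw [mul_pow]; ring
  obtain ⟨q, hq, huq, hql⟩ := hsol.liouville hk hg0 hg (C := |D| * (1 + ‖z‖) ^ g) fun x hx => by
    refine (hD _ (hmem x hx)).trans ?_
    calc _ ≤ |D| * ((1 + ‖z‖) * (1 + ‖x‖)) ^ g := by
          gcongr
          · exact le_abs_self D
          · exact hnorm x
      _ = _ := by rw [Real.mul_rpow (by positivity) (by positivity)]; ring
  refine ⟨fun x => (‖a‖⁻¹) ^ k * q (-z + (1:ℝ) • x),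
    contDiffOn_const.mul (hq.comp (by fun_prop) fun x hx => ?_), fun x hx => ?_,
    fun L hL x hx => ?_⟩
  · rw [one_smul, neg_add_eq_sub]; exact hmem' x hx
  · have h1 := huq _ (hmem' x hx)
    rw [one_smul, add_sub_cancel] at h1
    dsimp only
    rw [h1, hiz', one_smul, neg_add_eq_sub, mul_pow, inv_pow]
    field_simp
  · rw [dl_const_mul, dl_comp_affine]
    dsimp only
    rw [one_smul, neg_add_eq_sub, hql L hL _ (hmem' x hx), mul_zero, mul_zero]

end Liouville

section BoundaryDecay

/-- Nondegenerate functions on the unit ball with Lipschitz gradient. -/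
structure NiceDef (Λ : ℝ) (σ : E → ℝ) : Prop where
  diff : ∀ x ∈ ball (0:E) 1, DifferentiableAt ℝ σ x
  le : ∀ x ∈ ball (0:E) 1, ‖fderiv ℝ σ x‖ ≤ Λ
  ge : ∀ x ∈ ball (0:E) 1, Λ⁻¹ ≤ ‖fderiv ℝ σ x‖
  lip : ∀ x ∈ ball (0:E) 1, ∀ y ∈ ball (0:E) 1, ‖fderiv ℝ σ x - fderiv ℝ σ y‖ ≤ Λ * ‖x - y‖

variable {Λ : ℝ} {σ V : E → ℝ}

theorem NiceDef.taylor (hΛ : 0 ≤ Λ) (h : NiceDef Λ σ) {x y : E} (hx : x ∈ ball (0:E) 1)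
    (hy : y ∈ ball (0:E) 1) : |σ y - σ x - fderiv ℝ σ x (y - x)| ≤ Λ * ‖y - x‖ ^ 2 := by
  have hseg : segment ℝ x y ⊆ ball (0:E) 1 := (convex_ball 0 1).segment_subset hx hy
  have := (convex_segment x y).norm_image_sub_le_of_norm_hasFDerivWithin_le' (f := σ)
    (f' := fderiv ℝ σ) (φ := fderiv ℝ σ x) (C := Λ * ‖y - x‖)
    (fun z hz => (h.diff z (hseg hz)).hasFDerivAt.hasFDerivWithinAt) (fun z hz => by
      refine (h.lip z (hseg hz) x hx).trans (mul_le_mul_of_nonneg_left ?_ hΛ)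
      obtain ⟨t, ht, rfl⟩ := (mem_segment_iff_sameRay.1 hz |> fun _ =>
        (segment_eq_image' ℝ x y ▸ hz : z ∈ (fun t : ℝ => x + t • (y - x)) '' Icc 0 1))
      simp only [add_sub_cancel_left, norm_smul, Real.norm_eq_abs, abs_of_nonneg ht.1]
      exact mul_le_of_le_one_left (norm_nonneg _) ht.2)
    (left_mem_segment ℝ x y) (right_mem_segment ℝ x y)
  rw [Real.norm_eq_abs] at this
  calc _ ≤ _ := this
    _ = _ := by ring

theorem NiceDef.scale (h : NiceDef Λ σ) (hΛ : 0 ≤ Λ) {R : ℝ} (hR : 0 < R) (hR1 : R ≤ 1) :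
    NiceDef Λ (fun y => R⁻¹ * σ (R • y)) := by
  have hm : ∀ y ∈ ball (0:E) 1, R • y ∈ ball (0:E) 1 := fun y hy => by
    rw [mem_ball_zero_iff] at hy ⊢
    rw [norm_smul, Real.norm_eq_abs, abs_of_pos hR]
    nlinarith [norm_nonneg y]
  have hf : ∀ y ∈ ball (0:E) 1, HasFDerivAt (fun y => R⁻¹ * σ (R • y)) (fderiv ℝ σ (R • y)) y := by
    intro y hy
    have h1 := (h.diff _ (hm y hy)).hasFDerivAt
    have h2 : HasFDerivAt (fun y : E => R • y) (R • ContinuousLinearMap.id ℝ E) y :=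
      (hasFDerivAt_id y).const_smul R
    have h3 : HasFDerivAt (fun y => R⁻¹ * σ (R • y))
        (R⁻¹ • (fderiv ℝ σ (R • y)).comp (R • ContinuousLinearMap.id ℝ E)) y :=
      (h1.comp y h2).const_mul R⁻¹
    refine h3.congr_fderiv ?_
    ext v
    simp [hR.ne']
  refine ⟨fun y hy => (hf y hy).differentiableAt, fun y hy => ?_, fun y hy => ?_,
    fun x hx y hy => ?_⟩
  · rw [(hf y hy).fderiv]; exact h.le _ (hm y hy)
  · rw [(hf y hy).fderiv]; exact h.ge _ (hm y hy)
  · rw [(hf y hy).fderiv, (hf x hx).fderiv]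
    refine (h.lip _ (hm x hx) _ (hm y hy)).trans ?_
    rw [← smul_sub, norm_smul, Real.norm_eq_abs, abs_of_pos hR]
    gcongr
    exact mul_le_of_le_one_left (norm_nonneg _) hR1

variable {ι : Type*} [Fintype ι] (b : OrthonormalBasis ι ℝ E)

/-- Almost polyharmonic functions near the boundary, vanishing qualitatively to order `k - 1/4`. -/
structure BdryFun (k : ℕ) (Λ : ℝ) (σ V : E → ℝ) (S F : ℝ) : Prop where
  nice : NiceDef Λ σ
  smooth : ContDiffOn ℝ (2 * k : ℕ) V (ball (0:E) 1 ∩ {x | 0 < σ x})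
  bound : ∀ x ∈ ball (0:E) 1, 0 < σ x → |V x| ≤ S
  lap_bound : ∀ x ∈ ball (0:E) 1, 0 < σ x → |(lap b)^[k] V x| ≤ F
  decay : ∃ C, ∀ x ∈ ball (0:E) 1, 0 < σ x → |V x| ≤ C * σ x ^ (k - 1/4 : ℝ)

variable {b} {k : ℕ} {S F : ℝ}

theorem BdryFun.isOpen (h : BdryFun b k Λ σ V S F) : IsOpen (ball (0:E) 1 ∩ {x | 0 < σ x}) :=
  ContinuousOn.isOpen_inter_preimage
    (fun x hx => (h.nice.diff x hx).continuousAt.continuousWithinAt) isOpen_ball isOpen_Ioi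

theorem BdryFun.exists_blowup (hk : 1 ≤ k) (hΛ : 1 ≤ Λ) (h : BdryFun b k Λ σ V S F) {N : ℝ}
    (hN : 2 * 2 ^ (k - 1/4 : ℝ) ≤ N) {z : E} (hz : z ∈ ball (0:E) (1/2)) (hσz : 0 < σ z)
    (hV : N * (S + F) * σ z ^ (k - 1/4 : ℝ) < |V z|) :
    ∃ (W σ' : E → ℝ) (ℓ : E →L[ℝ] ℝ) (τ P : ℝ), 0 < τ ∧ 0 < P ∧ 2 * (τ * P) ≤ 1 ∧
      N ≤ 2 * 4 ^ (k - 1/4 : ℝ) * P ^ (k - 1/4 : ℝ) ∧ ‖ℓ‖ ≤ Λ ∧ Λ⁻¹ ≤ ‖ℓ‖ ∧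
      (∀ y, ‖y‖ < P → |σ' y - 1 - ℓ y| ≤ Λ * τ * ‖y‖ ^ 2) ∧
      ContDiffOn ℝ (2 * k : ℕ) W (ball (0:E) P ∩ {y | 0 < σ' y}) ∧
      (∀ y, ‖y‖ < P → 0 < σ' y → |W y| ≤ 2 * 2 ^ (k - 1/4 : ℝ) * σ' y ^ (k - 1/4 : ℝ)) ∧
      (∀ y, ‖y‖ < P → 0 < σ' y → |(lap b)^[k] W y| ≤ 2 * 2 ^ (k - 1/4 : ℝ) / N) ∧
      |W 0| = 1 := by
  have hk1 : (1:ℝ) ≤ k := by exact_mod_cast hk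
  obtain ⟨s, hs⟩ : ∃ s : ℝ, s = k - 1/4 := ⟨_, rfl⟩
  have hs0 : 0 < s := by rw [hs]; linarith
  have hs2 : 0 ≤ 2 * k - s := by rw [hs]; linarith
  obtain ⟨D, hD⟩ := h.decay
  rw [← hs] at hN hV hD ⊢
  have h2s : (0:ℝ) < 2 ^ s := by positivity
  have hN0 : 0 < N := by linarith
  obtain ⟨U, hU⟩ : ∃ U, U = ball (0:E) 1 ∩ {x | 0 < σ x} := ⟨_, rfl⟩
  have hUo : IsOpen U := hU ▸ h.isOpen
  obtain ⟨Φ, hΦ⟩ : ∃ Φ : E → ℝ, ∀ x, Φ x = |V x| * ((1 - ‖x‖) / σ x) ^ s := ⟨_, fun _ => rfl⟩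
  have hz1 : z ∈ ball (0:E) 1 := ball_subset_ball (by norm_num) hz
  have hzU : z ∈ U := by rw [hU]; exact ⟨hz1, hσz⟩
  have hS0 : 0 ≤ S := (abs_nonneg _).trans (h.bound z hz1 hσz)
  have hF0 : 0 ≤ F := (abs_nonneg _).trans (h.lap_bound z hz1 hσz)
  have hbdd : BddAbove (Φ '' U) := by
    refine ⟨|D|, ?_⟩
    rintro _ ⟨x, hx, rfl⟩
    rw [hU] at hx
    obtain ⟨hx1, hx2⟩ := hx
    have hx2 : 0 < σ x := hx2
    rw [mem_ball_zero_iff] at hx1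
    rw [hΦ, Real.div_rpow (by linarith) hx2.le, ← mul_div_assoc,
      div_le_iff₀ (Real.rpow_pos_of_pos hx2 s)]
    have h1 : (1 - ‖x‖) ^ s ≤ 1 := Real.rpow_le_one (by linarith)
      (by linarith [norm_nonneg x]) hs0.le
    calc _ ≤ |V x| * 1 := by gcongr
      _ ≤ D * σ x ^ s := by rw [mul_one]; exact hD x (by simpa using hx1) hx2
      _ ≤ _ := by gcongr; exact le_abs_self D
  have hΦz : N * (S + F) / 2 ^ s < Φ z := by
    rw [mem_ball_zero_iff] at hz
    rw [hΦ, div_lt_iff₀ h2s, mul_assoc, ← Real.mul_rpow (by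
      exact div_nonneg (by linarith) hσz.le) (by norm_num)]
    have h1 : (σ z)⁻¹ ^ s ≤ ((1 - ‖z‖) / σ z * 2) ^ s := by
      refine Real.rpow_le_rpow (inv_nonneg.2 hσz.le) ?_ hs0.le
      rw [inv_eq_one_div, div_mul_eq_mul_div]
      gcongr
      linarith
    refine lt_of_lt_of_le ?_ (mul_le_mul_of_nonneg_left h1 (abs_nonneg _))
    rw [Real.inv_rpow hσz.le, ← div_eq_mul_inv, lt_div_iff₀ (Real.rpow_pos_of_pos hσz s)]
    exact hV
  have hQ : 0 ≤ N * (S + F) / 2 ^ s := by positivity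
  obtain ⟨M, hM⟩ : ∃ M, M = sSup (Φ '' U) := ⟨_, rfl⟩
  have hΦM : ∀ x ∈ U, Φ x ≤ M := fun x hx => hM ▸ le_csSup hbdd (mem_image_of_mem _ hx)
  have hzM := hΦz.trans_le (hΦM z hzU)
  have hM0 : 0 < M := hQ.trans_lt hzM
  obtain ⟨_, ⟨x, hx, rfl⟩, hxM⟩ := exists_lt_of_lt_csSup (⟨_, mem_image_of_mem Φ hzU⟩ :
    (Φ '' U).Nonempty) (show M / 2 < sSup (Φ '' U) by rw [← hM]; linarith)
  have hxU := hx
  rw [hU] at hx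
  obtain ⟨hx1, hx2⟩ := hx
  obtain ⟨τ, hτ⟩ : ∃ τ, τ = σ x := ⟨_, rfl⟩
  obtain ⟨w, hw⟩ : ∃ w, w = 1 - ‖x‖ := ⟨_, rfl⟩
  have hτ0 : 0 < τ := hτ ▸ hx2
  have hxn : ‖x‖ < 1 := by simpa using hx1
  have hw0 : 0 < w := by rw [hw]; linarith
  have hw1 : w ≤ 1 := by rw [hw]; linarith [norm_nonneg x]
  have hwt : 0 < (w / τ) ^ s := Real.rpow_pos_of_pos (div_pos hw0 hτ0) s
  rw [hΦ, ← hτ, ← hw] at hxM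
  have hVx : 0 < |V x| := by
    by_contra hc
    have : |V x| = 0 := le_antisymm (not_lt.1 hc) (abs_nonneg _)
    rw [this, zero_mul] at hxM
    linarith
  have hVx0 : V x ≠ 0 := abs_pos.1 hVx
  have hVS := h.bound x hx1 hx2
  have hbig : N * (S + F) < 2 * 2 ^ s * (|V x| * (w / τ) ^ s) := by
    rw [div_lt_iff₀ h2s] at hzM
    nlinarith
  have hNw : N < 2 * 2 ^ s * (w / τ) ^ s := by
    have h1 : N * |V x| ≤ N * (S + F) := by gcongr; linarith
    have h2 : N * |V x| < (2 * 2 ^ s * (w / τ) ^ s) * |V x| := by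
      refine h1.trans_lt (hbig.trans_eq (by ring))
    exact lt_of_mul_lt_mul_right h2 hVx.le
  have hτw : τ < w := by
    by_contra hc
    have : (w / τ) ^ s ≤ 1 := Real.rpow_le_one (by positivity)
      ((div_le_one hτ0).2 (not_lt.1 hc)) hs0.le
    nlinarith
  have hmem : ∀ y : E, ‖y‖ < w / (2 * τ) → ‖x + τ • y‖ ≤ 1 - w / 2 := by
    intro y hy
    rw [lt_div_iff₀ (by positivity)] at hy
    have := norm_add_le x (τ • y)
    rw [norm_smul, Real.norm_eq_abs, abs_of_pos hτ0] at this
    nlinarith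
  have hmem1 : ∀ y : E, ‖y‖ < w / (2 * τ) → x + τ • y ∈ ball (0:E) 1 := fun y hy => by
    rw [mem_ball_zero_iff]
    linarith [hmem y hy]
  have hpos : ∀ y : E, 0 < τ⁻¹ * σ (x + τ • y) → 0 < σ (x + τ • y) := fun y hy =>
    pos_of_mul_pos_right hy (inv_nonneg.2 hτ0.le)
  have hsub : MapsTo (fun y : E => x + τ • y)
      (ball (0:E) (w / (2 * τ)) ∩ {y | 0 < τ⁻¹ * σ (x + τ • y)}) U := fun y hy => by
    rw [hU]
    exact ⟨hmem1 y (by simpa using hy.1), hpos y hy.2⟩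
  refine ⟨fun y => (V x)⁻¹ * V (x + τ • y), fun y => τ⁻¹ * σ (x + τ • y), fderiv ℝ σ x, τ,
    w / (2 * τ), hτ0, by positivity, ?_, ?_, h.nice.le x hx1, h.nice.ge x hx1,
    fun y hy => ?_, ?_, fun y hy hy2 => ?_, fun y hy hy2 => ?_, ?_⟩
  · field_simp; linarith
  · rw [mul_assoc, ← Real.mul_rpow (by norm_num) (by positivity)]
    have h1 : 4 * (w / (2 * τ)) = 2 * (w / τ) := by field_simp; norm_num
    rw [h1, Real.mul_rpow (by norm_num) (by positivity), ← mul_assoc]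
    exact hNw.le
  · have h1 := h.nice.taylor (by linarith) hx1 (hmem1 y hy)
    simp only [add_sub_cancel_left, map_smul, norm_smul, Real.norm_eq_abs, abs_of_pos hτ0,
      smul_eq_mul, ← hτ] at h1
    have h2 : τ⁻¹ * σ (x + τ • y) - 1 - fderiv ℝ σ x y =
        τ⁻¹ * (σ (x + τ • y) - τ - τ * fderiv ℝ σ x y) := by field_simp
    rw [h2, abs_mul, abs_of_pos (inv_pos.2 hτ0), inv_mul_le_iff₀ hτ0]
    exact h1.trans_eq (by ring)
  · exact contDiffOn_const.mul ((hU ▸ h.smooth).comp (by fun_prop) hsub)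
  · have hy' := hpos y hy2
    have h1 := hΦM _ (hsub ⟨by simpa using hy, hy2⟩)
    rw [hΦ] at h1
    have h3 := hmem y hy
    have h2 : (w / 2 / σ (x + τ • y)) ^ s ≤ ((1 - ‖x + τ • y‖) / σ (x + τ • y)) ^ s := by
      refine Real.rpow_le_rpow (by positivity) ?_ hs0.le
      gcongr
      linarith
    have h4 : |V (x + τ • y)| * (w / 2 / σ (x + τ • y)) ^ s < 2 * (|V x| * (w / τ) ^ s) :=
      ((mul_le_mul_of_nonneg_left h2 (abs_nonneg _)).trans h1).trans_lt (by linarith)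
    have h5 : 2 * (τ⁻¹ * σ (x + τ • y)) * (w / 2 / σ (x + τ • y)) = w / τ := by
      field_simp
    rw [← h5, Real.mul_rpow (by positivity) (by positivity),
      Real.mul_rpow (by positivity) (by positivity)] at h4
    have h6 : 0 < (w / 2 / σ (x + τ • y)) ^ s := by positivity
    rw [abs_mul, abs_inv, inv_mul_le_iff₀ hVx]
    refine le_of_mul_le_mul_right (h4.le.trans_eq (by ring)) h6
  · rw [lapI_const_mul, lapI_comp_affine]
    dsimp only
    have h1 := h.lap_bound _ (hmem1 y hy) (hpos y hy2)
    rw [abs_mul, abs_inv, abs_mul, abs_of_pos (pow_pos hτ0 _), inv_mul_le_iff₀ hVx,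
      ← mul_div_assoc, le_div_iff₀ hN0]
    have h2 : N * F ≤ 2 * 2 ^ s * (|V x| * (w / τ) ^ s) := by
      refine le_trans ?_ hbig.le
      gcongr
      linarith
    have h3 : τ ^ (2 * k) * (w / τ) ^ s ≤ 1 := by
      rw [Real.div_rpow hw0.le hτ0.le, mul_div_assoc', div_le_one (Real.rpow_pos_of_pos hτ0 s)]
      have h4 : τ ^ (2 * k) ≤ τ ^ s := by
        rw [← Real.rpow_natCast]
        exact Real.rpow_le_rpow_of_exponent_ge hτ0 (by linarith) (by push_cast; linarith)
      calc _ ≤ τ ^ s * 1 := by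
            gcongr
            exact Real.rpow_le_one hw0.le hw1 hs0.le
        _ = _ := mul_one _
    calc τ ^ (2 * k) * |(lap b)^[k] V (x + τ • y)| * N ≤ τ ^ (2 * k) * (N * F) := by
          rw [mul_assoc, mul_comm N]
          gcongr
      _ ≤ τ ^ (2 * k) * (2 * 2 ^ s * (|V x| * (w / τ) ^ s)) := by gcongr
      _ = (2 * 2 ^ s * |V x|) * (τ ^ (2 * k) * (w / τ) ^ s) := by ring
      _ ≤ (2 * 2 ^ s * |V x|) * 1 := by gcongr
      _ = _ := by ring
  · simp [hVx0]

variable (b)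

theorem exists_tendsto_linear (𝒰 : Ultrafilter ℕ) {Λ : ℝ} {ℓ : ℕ → E →L[ℝ] ℝ}
    (hℓ : ∀ j, ‖ℓ j‖ ≤ Λ) : ∃ ℓ₀, Tendsto ℓ 𝒰 (𝓝 ℓ₀) ∧
      ∀ {τ P : ℕ → ℝ} {σ : ℕ → E → ℝ} {c : ℝ}, 0 ≤ Λ → (∀ j, 0 ≤ τ j) → Tendsto τ 𝒰 (𝓝 0) →
        (∀ T, ∀ᶠ j in (𝒰 : Filter ℕ), T < P j) →
        (∀ j y, ‖y‖ < P j → |σ j y - c - ℓ j y| ≤ Λ * τ j * ‖y‖ ^ 2) →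
        ∀ T ε : ℝ, 0 < ε → ∀ᶠ j in (𝒰 : Filter ℕ), T < P j ∧
          ∀ y, ‖y‖ ≤ T → |σ j y - c - ℓ₀ y| < ε := by
  obtain ⟨ℓ₀, -, hℓ₀⟩ := (isCompact_closedBall (0 : E →L[ℝ] ℝ) Λ).ultrafilter_le_nhds
    (𝒰.map ℓ) (by
      rw [le_principal_iff]
      show ℓ ⁻¹' (closedBall 0 Λ) ∈ (𝒰 : Filter ℕ)
      exact Eventually.of_forall fun j => by simpa using hℓ j)
  have hℓt : Tendsto ℓ 𝒰 (𝓝 ℓ₀) := hℓ₀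
  refine ⟨ℓ₀, hℓt, fun {τ P σ c} hΛ hτ hτt hPt hσ T ε hε => ?_⟩
  have hlim : Tendsto (fun j => Λ * τ j * T ^ 2 + ‖ℓ j - ℓ₀‖ * |T|) 𝒰 (𝓝 0) := by
    have h1 := (hτt.const_mul Λ).mul_const (T ^ 2)
    have h2 := ((tendsto_iff_norm_sub_tendsto_zero.1 hℓt).mul_const |T|)
    simpa using h1.add h2
  filter_upwards [hPt T, hlim (gt_mem_nhds hε)] with j hj hj2
  refine ⟨hj, fun y hy => lt_of_le_of_lt ?_ hj2⟩
  have h1 := hσ j y (hy.trans_lt hj)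
  have h2 : |(ℓ j - ℓ₀) y| ≤ ‖ℓ j - ℓ₀‖ * ‖y‖ := (ℓ j - ℓ₀).le_opNorm y
  have h3 : σ j y - c - ℓ₀ y = (σ j y - c - ℓ j y) + (ℓ j - ℓ₀) y := by
    rw [_root_.sub_apply]; ring
  rw [h3]
  have := hτ j
  refine (abs_add_le _ _).trans (add_le_add (h1.trans (by gcongr)) (h2.trans ?_))
  gcongr
  exact hy.trans (le_abs_self T)

/-- Quantitative decay at the boundary. -/
theorem exists_decay (k : ℕ) (hk : 1 ≤ k) {Λ : ℝ} (hΛ : 1 ≤ Λ) :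
    ∃ C, 0 ≤ C ∧ ∀ (σ V : E → ℝ) (S F : ℝ), BdryFun b k Λ σ V S F →
      ∀ z ∈ ball (0:E) (1/2), 0 < σ z → |V z| ≤ C * (S + F) * σ z ^ (k - 1/4 : ℝ) := by
  by_contra hcon
  push Not at hcon
  have hΛ0 : 0 < Λ := by linarith
  have hs0 : (0:ℝ) < k - 1/4 := by
    have : (1:ℝ) ≤ k := by exact_mod_cast hk
    linarith
  obtain ⟨s, hs⟩ : ∃ s : ℝ, s = k - 1/4 := ⟨_, rfl⟩
  have hex : ∀ j : ℕ, ∃ (W σ' : E → ℝ) (ℓ : E →L[ℝ] ℝ) (τ P : ℝ), 0 < τ ∧ 0 < P ∧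
      2 * (τ * P) ≤ 1 ∧ (j + 2 * 2 ^ s : ℝ) ≤ 2 * 4 ^ s * P ^ s ∧ ‖ℓ‖ ≤ Λ ∧ Λ⁻¹ ≤ ‖ℓ‖ ∧
      (∀ y, ‖y‖ < P → |σ' y - 1 - ℓ y| ≤ Λ * τ * ‖y‖ ^ 2) ∧
      ContDiffOn ℝ (2 * k : ℕ) W (ball (0:E) P ∩ {y | 0 < σ' y}) ∧
      (∀ y, ‖y‖ < P → 0 < σ' y → |W y| ≤ 2 * 2 ^ s * σ' y ^ s) ∧
      (∀ y, ‖y‖ < P → 0 < σ' y → |(lap b)^[k] W y| ≤ 2 * 2 ^ s / (j + 2 * 2 ^ s : ℝ)) ∧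
      |W 0| = 1 := by
    intro j
    obtain ⟨σ, V, S, F, hB, z, hz, hσz, hlt⟩ := hcon (j + 2 * 2 ^ s) (by positivity)
    rw [hs] at hlt ⊢
    exact hB.exists_blowup hk hΛ (by linarith [Nat.cast_nonneg (α := ℝ) j]) hz hσz hlt
  rw [← hs] at hs0
  choose W σ' ℓ τ P hτ hP hτP hNP hℓΛ hℓge hσ hW hWb hWl hW0 using hex
  let 𝒰 : Ultrafilter ℕ := hyperfilter ℕ
  have h𝒰 : (𝒰 : Filter ℕ) ≤ atTop := Nat.hyperfilter_le_atTop
  obtain ⟨ℓ₀, hℓt, hlim⟩ := exists_tendsto_linear 𝒰 hℓΛ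
  have hℓ0 : Λ⁻¹ ≤ ‖ℓ₀‖ := ge_of_tendsto hℓt.norm (Eventually.of_forall hℓge)
  have hPt : ∀ T : ℝ, ∀ᶠ j in (𝒰 : Filter ℕ), T < P j := by
    intro T
    obtain ⟨m, hm⟩ := exists_nat_gt (2 * 4 ^ s * (max T 0) ^ s)
    filter_upwards [h𝒰 (eventually_ge_atTop m)] with j hj
    by_contra hcon
    have hj' : (m:ℝ) ≤ j := by exact_mod_cast hj
    have h1 : P j ^ s ≤ (max T 0) ^ s :=
      Real.rpow_le_rpow (hP j).le ((not_lt.1 hcon).trans (le_max_left _ _)) hs0.le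
    have h2 : (2:ℝ) * 4 ^ s * P j ^ s ≤ 2 * 4 ^ s * (max T 0) ^ s := by gcongr
    have h3 : (0:ℝ) < 2 * 2 ^ s := by positivity
    linarith [hNP j]
  have hτt : Tendsto τ 𝒰 (𝓝 0) := by
    refine (Metric.tendsto_nhds.2 fun ε hε => ?_)
    filter_upwards [hPt ε⁻¹] with j hj
    rw [Real.dist_eq, sub_zero, abs_of_pos (hτ j)]
    have h1 : τ j * ε⁻¹ < τ j * P j := mul_lt_mul_of_pos_left hj (hτ j)
    have h2 : τ j * ε⁻¹ < 1 := by
      have := mul_pos (hτ j) (hP j)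
      linarith [hτP j]
    rwa [← div_eq_mul_inv, div_lt_one hε] at h2
  have hunif := hlim hΛ0.le (fun j => (hτ j).le) hτt hPt hσ
  let H : Set E := {y | 0 < 1 + ℓ₀ y}
  have hH : IsOpen H := isOpen_lt continuous_const (by fun_prop)
  obtain ⟨u, hus, hu0, hut⟩ := exists_limit b k hk 𝒰 (w := W) hH (by
    intro x hx
    obtain ⟨ε, hε⟩ : ∃ ε, ε = (1 + ℓ₀ x) / 3 := ⟨_, rfl⟩
    have hε0 : 0 < ε := by rw [hε]; exact div_pos hx (by norm_num)
    obtain ⟨T, hT, hTb⟩ := Metric.continuousAt_iff.1 (ℓ₀.continuous.continuousAt (x := x)) ε hε0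
    refine ⟨T, hT, 2 * 2 ^ s * (5 * ε) ^ s,
      fun j => 2 * 2 ^ s / (j + 2 * 2 ^ s : ℝ), ?_, ?_⟩
    · exact ((tendsto_atTop_add_const_right _ _ tendsto_natCast_atTop_atTop).const_div_atTop
        _).mono_left h𝒰
    · filter_upwards [hunif (‖x‖ + T) ε hε0] with j ⟨hj1, hj2⟩
      have hy : ∀ y ∈ ball x T, ‖y‖ < P j ∧ 0 < σ' j y ∧ σ' j y ≤ 5 * ε := by
        intro y hy
        have h1 : ‖y‖ ≤ ‖x‖ + T := by
          have := norm_le_norm_add_norm_sub' y x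
          rw [mem_ball, dist_eq_norm] at hy
          linarith
        have h2 := abs_lt.1 (hj2 y h1)
        have h3 := hTb hy
        rw [Real.dist_eq] at h3
        have h4 := abs_lt.1 h3
        exact ⟨h1.trans_lt hj1, by linarith, by linarith⟩
      refine ⟨(hW j).mono fun y hyb => ⟨by simpa using (hy y hyb).1, (hy y hyb).2.1⟩,
        fun y hyb => ?_, fun y hyb => hWl j y (hy y hyb).1 (hy y hyb).2.1⟩
      refine (hWb j y (hy y hyb).1 (hy y hyb).2.1).trans ?_
      have := (hy y hyb).2.1
      gcongr
      exact (hy y hyb).2.2)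
  have hub : ∀ y ∈ H, |u y| ≤ 2 * 2 ^ s * (1 + ℓ₀ y) ^ s := by
    intro y hy
    have h1 := (hut y hy (fun _ => y) tendsto_const_nhds).abs
    have h2 : Tendsto (fun j => σ' j y) 𝒰 (𝓝 (1 + ℓ₀ y)) := by
      refine Metric.tendsto_nhds.2 fun ε hε => ?_
      filter_upwards [hunif ‖y‖ ε hε] with j hj
      rw [Real.dist_eq, ← sub_sub]
      exact hj.2 y le_rfl
    have h3 : Tendsto (fun j => 2 * 2 ^ s * σ' j y ^ s) 𝒰 (𝓝 (2 * 2 ^ s * (1 + ℓ₀ y) ^ s)) :=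
      (h2.rpow_const (Or.inr hs0.le)).const_mul _
    refine le_of_tendsto_of_tendsto h1 h3 ?_
    filter_upwards [hPt ‖y‖, h2 (lt_mem_nhds hy)] with j hj1 hj2
    exact hWb j y hj1 hj2
  have hu1 : |u 0| = 1 := by
    have h1 := (hut 0 (by simp [H]) (fun _ => 0) tendsto_const_nhds).abs
    simp only [hW0] at h1
    exact tendsto_nhds_unique h1 tendsto_const_nhds
  let a : E := (InnerProductSpace.toDual ℝ E).symm ℓ₀
  have hal : ∀ y, (inner ℝ a y : ℝ) = ℓ₀ y := fun y => InnerProductSpace.toDual_symm_apply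
  have ha : a ≠ 0 := fun h0 => by
    have h1 : ‖a‖ = ‖ℓ₀‖ := LinearIsometryEquiv.norm_map _ _
    rw [h0, norm_zero] at h1
    rw [← h1] at hℓ0
    exact absurd hℓ0 (not_le.2 (inv_pos.2 hΛ0))
  have hHa : ∀ y, 0 < (inner ℝ a y + 1 : ℝ) ↔ y ∈ H := fun y => by
    rw [hal, add_comm]; rfl
  obtain ⟨q, -, huq, hq⟩ := liouville_halfspace b k 0 hk ha 1 (u := u)
    (hus.mono fun y hy => (hHa y).1 hy) (fun y hy => hu0 y ((hHa y).1 hy))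
    (C := 2 * 2 ^ s) (fun y hy => by
      rw [pow_zero, mul_one, hal, add_comm, ← hs]
      exact hub y ((hHa y).1 hy)) (g := s) (l := 0) hs0.le (by rw [hs]; simp)
    (D := 2 * 2 ^ s * (1 + ‖ℓ₀‖) ^ s) (fun y hy => by
      refine (hub y ((hHa y).1 hy)).trans ?_
      have h1 : 1 + ℓ₀ y ≤ (1 + ‖ℓ₀‖) * (1 + ‖y‖) := by
        have := (le_abs_self _).trans (ℓ₀.le_opNorm y)
        nlinarith [norm_nonneg ℓ₀, norm_nonneg y]
      have h2 : 0 < 1 + ℓ₀ y := (hHa y).1 hy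
      calc _ ≤ 2 * 2 ^ s * ((1 + ‖ℓ₀‖) * (1 + ‖y‖)) ^ s := by gcongr
        _ = _ := by rw [Real.mul_rpow (by positivity) (by positivity)]; ring)
  have h0 : 0 < (inner ℝ a (0:E) + 1 : ℝ) := by simp
  have := huq 0 h0
  have hq0 := hq [] rfl 0 h0
  simp only [dl] at hq0
  rw [hq0, mul_zero] at this
  rw [this] at hu1
  simp at hu1

end BoundaryDecay

section TaylorPolynomials

variable {U : Set E} {f g : E → ℝ}

theorem dl_perm (hU : IsOpen U) {L M : List E} (h : L.Perm M) (hf : ContDiffOn ℝ L.length f U) :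
    EqOn (dl L f) (dl M f) U := by
  induction h generalizing f with
  | nil => exact fun _ _ => rfl
  | cons v _ ih => exact ih (dd_contDiffOn hU hf (by simp) v)
  | swap v w L =>
    exact dl_congr hU (dd_comm_on hU hf (by simp only [List.length_cons]; norm_cast; omega) w v) L
  | trans h1 _ ih1 ih2 => exact (ih1 hf).trans (ih2 (h1.length_eq ▸ hf))

theorem iteratedFDeriv_comp_perm_of_contDiffOn (hU : IsOpen U) {r : ℕ} (hf : ContDiffOn ℝ r f U)
    {x : E} (hx : x ∈ U) (v : Fin r → E) (p : Equiv.Perm (Fin r)) :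
    iteratedFDeriv ℝ r f x (v ∘ p) = iteratedFDeriv ℝ r f x v := by
  have h1 := iteratedFDeriv_apply_eq_dl hU hf (v ∘ p) hx
  have h2 := iteratedFDeriv_apply_eq_dl hU hf v hx
  simp only at h1 h2
  rw [h1, h2]
  exact dl_perm hU (((List.reverse_perm _).trans (p.ofFn_comp_perm v)).trans
    (List.reverse_perm _).symm) (by simpa using hf) hx

/-- Polynomials of degree at most `d`. -/
structure IsPol (d : ℕ) (q : E → ℝ) : Prop where
  smooth : ContDiff ℝ ∞ q
  zero : ∀ x, iteratedFDeriv ℝ (d + 1) q x = 0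

variable {d : ℕ} {q : E → ℝ}

theorem IsPol.contDiff (h : IsPol d q) (m : ℕ) : ContDiff ℝ m q :=
  h.smooth.of_le ENat.LEInfty.out

theorem IsPol.eq_zero (h : IsPol d q) {m : ℕ} (hm : d < m) (x : E) :
    iteratedFDeriv ℝ m q x = 0 := by
  induction m, hm using Nat.le_induction generalizing x with
  | base => exact h.zero x
  | succ m _ ih =>
    rw [← norm_eq_zero, ← norm_fderiv_iteratedFDeriv,
      show iteratedFDeriv ℝ m q = fun _ => 0 from funext ih, fderiv_fun_const, Pi.zero_apply]
    exact norm_zero (E := E →L[ℝ] E [×m]→L[ℝ] ℝ)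

theorem IsPol.zero' : IsPol d (fun _ : E => 0) :=
  ⟨contDiff_const, fun x => by rw [iteratedFDeriv_const_of_ne (by omega)]; rfl⟩

theorem IsPol.const (c : ℝ) : IsPol d (fun _ : E => c) :=
  ⟨contDiff_const, fun x => by rw [iteratedFDeriv_const_of_ne (by omega)]; rfl⟩

theorem IsPol.add {p : E → ℝ} (hp : IsPol d p) (hq : IsPol d q) : IsPol d (fun x => p x + q x) :=
  ⟨hp.smooth.add hq.smooth, fun x => by
    rw [fun_iteratedFDeriv_add_apply (hp.contDiff _).contDiffAt (hq.contDiff _).contDiffAt,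
      hp.zero, hq.zero, add_zero]⟩

theorem IsPol.sub {p : E → ℝ} (hp : IsPol d p) (hq : IsPol d q) : IsPol d (fun x => p x - q x) :=
  ⟨hp.smooth.sub hq.smooth, fun x => by
    rw [fun_iteratedFDeriv_sub_apply (hp.contDiff _).contDiffAt (hq.contDiff _).contDiffAt,
      hp.zero, hq.zero, sub_zero]⟩

theorem IsPol.mul {p : E → ℝ} {d' : ℕ} (hp : IsPol d p) (hq : IsPol d' q) :
    IsPol (d + d') (fun x => p x * q x) := by
  refine ⟨hp.smooth.mul hq.smooth, fun x => ?_⟩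
  rw [← norm_le_zero_iff]
  refine (norm_iteratedFDeriv_mul_le (hp.contDiff _) (hq.contDiff _) x le_rfl).trans
    (Finset.sum_nonpos fun i hi => ?_)
  rcases lt_or_ge d i with h | h
  · simp [hp.eq_zero h]
  · simp [hq.eq_zero (show d' < d + d' + 1 - i by omega)]

/-- Taylor polynomials. -/
theorem exists_taylor (hU : IsOpen U) {N : ℕ} (hf : ContDiffOn ℝ N f U) {x₀ : E} (hx : x₀ ∈ U) :
    ∃ P, IsPol N P ∧ ∀ m ≤ N, iteratedFDeriv ℝ m P x₀ = iteratedFDeriv ℝ m f x₀ := by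
  let p : FormalMultilinearSeries ℝ E ℝ := fun m =>
    if m ≤ N then ((m.factorial : ℝ)⁻¹) • iteratedFDeriv ℝ m f x₀ else 0
  have hp := p.hasFiniteFPowerSeriesOnBall_of_finite (n := N + 1) (fun m hm => by
    simp only [p]; rw [if_neg (by omega)])
  have hP := hp.comp_sub x₀
  rw [zero_add] at hP
  refine ⟨fun z => p.sum (z - x₀), ⟨?_, fun x => ?_⟩, fun m hm => ?_⟩
  · rw [contDiff_iff_contDiffAt]
    intro x
    have h1 := hP.changeOrigin (y := x - x₀) (by simp)
    rw [add_sub_cancel] at h1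
    exact h1.toHasFPowerSeriesOnBall.analyticAt.contDiffAt
  · have h1 := hP.changeOrigin (y := x - x₀) (by simp)
    rw [add_sub_cancel] at h1
    ext v
    rw [h1.toHasFPowerSeriesOnBall.iteratedFDeriv_eq_sum_of_completeSpace]
    simp [h1.finite (N + 1) le_rfl]
  · ext v
    rw [hP.toHasFPowerSeriesOnBall.iteratedFDeriv_eq_sum_of_completeSpace]
    simp only [p, if_pos hm]
    have h2 : ∀ s : Equiv.Perm (Fin m), iteratedFDeriv ℝ m f x₀ (fun i => v (s i)) =
        iteratedFDeriv ℝ m f x₀ v := fun s =>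
      iteratedFDeriv_comp_perm_of_contDiffOn hU (hf.of_le (by exact_mod_cast hm)) hx v s
    simp only [_root_.smul_apply, h2, Finset.sum_const, Finset.card_univ, smul_eq_mul,
      Fintype.card_perm, Fintype.card_fin, nsmul_eq_mul]
    field_simp

theorem norm_iteratedFDeriv_sub_le (hU : IsOpen U) {m : ℕ} (hf : ContDiffOn ℝ (m + 1 : ℕ) f U)
    {x y : E} (hs : segment ℝ x y ⊆ U) {B : ℝ}
    (hB : ∀ z ∈ segment ℝ x y, ‖iteratedFDeriv ℝ (m + 1) f z‖ ≤ B) :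
    ‖iteratedFDeriv ℝ m f y - iteratedFDeriv ℝ m f x‖ ≤ B * ‖y - x‖ := by
  refine (convex_segment x y).norm_image_sub_le_of_norm_fderiv_le (𝕜 := ℝ) (fun z hz => ?_)
    (fun z hz => (norm_fderiv_iteratedFDeriv).trans_le (hB z hz))
    (left_mem_segment ℝ x y) (right_mem_segment ℝ x y)
  exact (hf.contDiffAt (hU.mem_nhds (hs hz))).differentiableAt_iteratedFDeriv
    (by norm_cast; omega)

/-- Functions all of whose derivatives vanish at the origin. -/
theorem norm_iteratedFDeriv_le_rpow {N : ℕ} {θ B : ℝ} (hθ : 0 < θ) (hB : 0 ≤ B)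
    (hg : ContDiffOn ℝ N g (ball 0 1)) (h0 : ∀ m ≤ N, iteratedFDeriv ℝ m g 0 = 0)
    (hN : ∀ x ∈ ball (0:E) 1, ‖iteratedFDeriv ℝ N g x‖ ≤ B * ‖x‖ ^ θ) {m : ℕ} (hm : m ≤ N) :
    ∀ x ∈ ball (0:E) 1, ‖iteratedFDeriv ℝ m g x‖ ≤ B * ‖x‖ ^ (N - m + θ : ℝ) := by
  induction hm using Nat.decreasingInduction with
  | self => intro x hx; rw [sub_self, zero_add]; exact hN x hx
  | of_succ m hm ih =>
    intro x hx
    have hseg : segment ℝ 0 x ⊆ ball (0:E) 1 :=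
      (convex_ball 0 1).segment_subset (mem_ball_self one_pos) hx
    have he : (0:ℝ) ≤ N - (m + 1 : ℕ) + θ := by
      have : ((m + 1 : ℕ) : ℝ) ≤ N := by exact_mod_cast hm
      linarith
    have h1 := norm_iteratedFDeriv_sub_le isOpen_ball (hg.of_le (by exact_mod_cast hm)) hseg
      (B := B * ‖x‖ ^ (N - (m + 1 : ℕ) + θ : ℝ)) (fun z hz => by
        refine (ih z (hseg hz)).trans ?_
        have : ‖z‖ ≤ ‖x‖ := by
          obtain ⟨t, ht, rfl⟩ := (segment_eq_image' ℝ 0 x ▸ hz :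
            z ∈ (fun t : ℝ => 0 + t • (x - 0)) '' Icc 0 1)
          simp only [zero_add, sub_zero, norm_smul, Real.norm_eq_abs, abs_of_nonneg ht.1]
          exact mul_le_of_le_one_left (norm_nonneg _) ht.2
        gcongr)
    rw [h0 m (by omega), sub_zero, sub_zero] at h1
    refine h1.trans_eq ?_
    rcases eq_or_ne x 0 with rfl | hx0
    · have : (N - m + θ : ℝ) ≠ 0 := by push_cast at he; linarith
      simp [Real.zero_rpow this]
    · rw [mul_assoc, ← Real.rpow_add_one (norm_ne_zero_iff.2 hx0)]
      congr 2
      push_cast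
      ring

/-- Transport of the derivative bounds of a polynomial between points at distance `ρ`. -/
theorem IsPol.norm_iteratedFDeriv_le (hq : IsPol d q) {x y : E} {ρ B : ℝ} (hρ : 0 < ρ)
    (hB : 0 ≤ B) (hxy : ‖y - x‖ ≤ ρ) (h : ∀ m, ‖iteratedFDeriv ℝ m q x‖ ≤ B / ρ ^ m) (m : ℕ) :
    ‖iteratedFDeriv ℝ m q y‖ ≤ (d + 1 : ℕ) * B / ρ ^ m := by
  have key : ∀ i ≤ d + 1, ∀ y : E, ‖y - x‖ ≤ ρ →
      ‖iteratedFDeriv ℝ i q y‖ ≤ (d + 1 - i : ℕ) * B / ρ ^ i := by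
    intro i hi
    induction hi using Nat.decreasingInduction with
    | self => intro y _; simp [hq.zero]
    | of_succ i hi ih =>
      intro y hy
      have hseg : ∀ z ∈ segment ℝ x y, ‖z - x‖ ≤ ρ := fun z hz => by
        obtain ⟨t, ht, rfl⟩ := (segment_eq_image' ℝ x y ▸ hz :
          z ∈ (fun t : ℝ => x + t • (y - x)) '' Icc 0 1)
        simp only [add_sub_cancel_left, norm_smul, Real.norm_eq_abs, abs_of_nonneg ht.1]
        exact (mul_le_of_le_one_left (norm_nonneg _) ht.2).trans hy
      have h1 := norm_iteratedFDeriv_sub_le isOpen_univ (hq.contDiff (i + 1)).contDiffOn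
        (subset_univ (segment ℝ x y)) (fun z hz => ih z (hseg z hz))
      have h2 := norm_le_norm_add_norm_sub' (iteratedFDeriv ℝ i q y) (iteratedFDeriv ℝ i q x)
      have h3 : ((d + 1 - i : ℕ) : ℝ) = (d + 1 - (i + 1) : ℕ) + 1 := by
        rw [← Nat.cast_add_one]; congr 1; omega
      calc _ ≤ B / ρ ^ i + (d + 1 - (i + 1) : ℕ) * B / ρ ^ (i + 1) * ρ := by
            refine h2.trans (add_le_add (h i) (h1.trans ?_))
            gcongr
        _ = _ := by rw [h3]; field_simp; ring
  rcases lt_or_ge (d + 1) m with hm | hm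
  · rw [hq.eq_zero (by omega), norm_zero]
    positivity
  · refine (key m hm y hxy).trans ?_
    gcongr
    omega

end TaylorPolynomials

section PolynomialBounds

variable {U : Set E} {f g : E → ℝ}

theorem norm_iteratedFDeriv_dd_le {m : ℕ} {x : E} (hf : ContDiffAt ℝ (m + 1 : ℕ) f x) (v : E) :
    ‖iteratedFDeriv ℝ m (dd v f) x‖ ≤ ‖v‖ * ‖iteratedFDeriv ℝ (m + 1) f x‖ := by
  rw [← norm_iteratedFDeriv_fderiv]
  exact norm_iteratedFDeriv_clm_apply_const (hf.fderiv_right (m := m) (by norm_cast)) le_rfl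

theorem norm_iteratedFDeriv_lap_le {ι : Type*} [Fintype ι] (b : OrthonormalBasis ι ℝ E) {m : ℕ}
    {x : E} (hf : ContDiffAt ℝ (m + 2 : ℕ) f x) :
    ‖iteratedFDeriv ℝ m (lap b f) x‖ ≤ Fintype.card ι * ‖iteratedFDeriv ℝ (m + 2) f x‖ := by
  have h1 : ∀ v : E, ContDiffAt ℝ (m + 1 : ℕ) (dd v f) x := fun v =>
    (hf.fderiv_right (m := (m + 1 : ℕ)) (by norm_cast)).clm_apply contDiffAt_const
  have h2 : ∀ v : E, ContDiffAt ℝ m (dd v (dd v f)) x := fun v =>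
    ((h1 v).fderiv_right (m := m) (by norm_cast)).clm_apply contDiffAt_const
  have h3 : lap b f = fun x => ∑ i, dd (b i) (dd (b i) f) x := rfl
  rw [h3, iteratedFDeriv_fun_sum_apply fun i _ => h2 _]
  refine (norm_sum_le _ _).trans ((Finset.sum_le_sum fun i _ =>
    (norm_iteratedFDeriv_dd_le (h1 _) _).trans (mul_le_mul_of_nonneg_left
      (norm_iteratedFDeriv_dd_le hf _) (norm_nonneg _))).trans ?_)
  simp

theorem abs_lapI_le {ι : Type*} [Fintype ι] (b : OrthonormalBasis ι ℝ E) (hU : IsOpen U) (j : ℕ)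
    (hf : ContDiffOn ℝ (2 * j : ℕ) f U) {x : E} (hx : x ∈ U) :
    |(lap b)^[j] f x| ≤ (Fintype.card ι : ℝ) ^ j * ‖iteratedFDeriv ℝ (2 * j) f x‖ := by
  induction j generalizing f with
  | zero => simp
  | succ j ih =>
    rw [Function.iterate_succ_apply]
    refine (ih (lap_contDiffOn b hU hf (by norm_cast))).trans ?_
    rw [pow_succ, mul_assoc]
    gcongr
    exact norm_iteratedFDeriv_lap_le b (hf.contDiffAt (hU.mem_nhds hx))

theorem norm_iteratedFDeriv_mul_le_two_pow {N m : ℕ} (hm : m ≤ N) (hf : ContDiff ℝ N f)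
    (hg : ContDiff ℝ N g) {x : E} {a c : ℝ} (ha : ∀ i ≤ m, ‖iteratedFDeriv ℝ i f x‖ ≤ a)
    (hc : ∀ i ≤ m, ‖iteratedFDeriv ℝ i g x‖ ≤ c) :
    ‖iteratedFDeriv ℝ m (fun x => f x * g x) x‖ ≤ 2 ^ m * (a * c) := by
  have ha0 : 0 ≤ a := (norm_nonneg _).trans (ha 0 (by omega))
  refine (norm_iteratedFDeriv_mul_le hf hg x (by exact_mod_cast hm)).trans ?_
  calc _ ≤ ∑ i ∈ Finset.range (m + 1), (m.choose i : ℝ) * (a * c) := by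
        refine Finset.sum_le_sum fun i hi => ?_
        rw [mul_assoc]
        gcongr
        · exact ha i (by simpa [Nat.lt_succ_iff] using hi)
        · exact hc _ (by omega)
    _ = _ := by
      rw [← Finset.sum_mul]
      congr 1
      exact_mod_cast Nat.sum_range_choose m

/-- Functions with a Hölder expansion of order `N + θ` at the origin. -/
def HX (N : ℕ) (θ : ℝ) (K : ℕ) (B : ℝ) (f : E → ℝ) : Prop :=
  ∃ P g : E → ℝ, IsPol K P ∧ ContDiff ℝ N g ∧ (∀ x, f x = P x + g x) ∧
    (∀ m, ∀ x ∈ ball (0:E) 1, ‖iteratedFDeriv ℝ m P x‖ ≤ B) ∧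
    ∀ m ≤ N, ∀ x ∈ ball (0:E) 1, ‖iteratedFDeriv ℝ m g x‖ ≤ B * ‖x‖ ^ (N - m + θ : ℝ)

theorem HX.mul {N K K' : ℕ} {θ B B' : ℝ} (hθ : 0 < θ) (hf : HX N θ K B f) (hg : HX N θ K' B' g) :
    HX N θ (K + K') (3 * 2 ^ (N + K + K') * (B * B')) (fun x => f x * g x) := by
  obtain ⟨P, u, hP, hu, hfe, hPB, huB⟩ := hf
  obtain ⟨Q, w, hQ, hw, hge, hQB, hwB⟩ := hg
  have h01 : (0:E) ∈ ball (0:E) 1 := mem_ball_self one_pos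
  have hB : 0 ≤ B := (norm_nonneg _).trans (hPB 0 0 h01)
  have hB' : 0 ≤ B' := (norm_nonneg _).trans (hQB 0 0 h01)
  have hg' : ContDiff ℝ N g := by
    rw [funext hge]; exact (hQ.contDiff N).add hw
  have hexp : ∀ {m : ℕ}, m ≤ N → (0:ℝ) ≤ N - m + θ := fun {m} hm => by
    have : (m : ℝ) ≤ N := by exact_mod_cast hm
    linarith
  have hgB : ∀ m ≤ N, ∀ x ∈ ball (0:E) 1, ‖iteratedFDeriv ℝ m g x‖ ≤ 2 * B' := by
    intro m hm x hx
    rw [funext hge, fun_iteratedFDeriv_add_apply (hQ.contDiff m).contDiffAt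
      (hw.of_le (by exact_mod_cast hm)).contDiffAt]
    refine (norm_add_le _ _).trans ?_
    have h1 : ‖x‖ ^ (N - m + θ : ℝ) ≤ 1 :=
      Real.rpow_le_one (norm_nonneg _) (by simpa using (mem_ball_zero_iff.1 hx).le) (hexp hm)
    nlinarith [hQB m x hx, hwB m hm x hx]
  have hmono : ∀ {m i : ℕ}, i ≤ m → m ≤ N → ∀ x ∈ ball (0:E) 1,
      ‖x‖ ^ (N - i + θ : ℝ) ≤ ‖x‖ ^ (N - m + θ : ℝ) := by
    intro m i hi hm x hx
    refine Real.rpow_le_rpow_of_exponent_ge' (norm_nonneg _)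
      (by simpa using (mem_ball_zero_iff.1 hx).le) (hexp hm) ?_
    have : (i : ℝ) ≤ m := by exact_mod_cast hi
    linarith
  refine ⟨fun x => P x * Q x, fun x => P x * w x + g x * u x, hP.mul hQ,
    ((hP.contDiff N).mul hw).add (hg'.mul hu), fun x => ?_, fun m x hx => ?_, fun m hm x hx => ?_⟩
  · simp only [hfe, hge]; ring
  · rcases lt_or_ge (K + K') m with h | h
    · rw [(hP.mul hQ).eq_zero h, norm_zero]; positivity
    · refine (norm_iteratedFDeriv_mul_le_two_pow le_rfl (hP.contDiff m) (hQ.contDiff m)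
        (fun i _ => hPB i x hx) (fun i _ => hQB i x hx)).trans ?_
      gcongr
      calc (2:ℝ) ^ m ≤ 2 ^ (N + K + K') := pow_le_pow_right₀ (by norm_num) (by omega)
        _ ≤ _ := by linarith [pow_pos (two_pos (α := ℝ)) (N + K + K')]
  · have hm' : (m : ℕ∞ω) ≤ N := by exact_mod_cast hm
    rw [fun_iteratedFDeriv_add_apply (((hP.contDiff m).mul (hw.of_le hm')).contDiffAt)
      (((hg'.of_le hm').mul (hu.of_le hm')).contDiffAt)]
    refine (norm_add_le _ _).trans ?_
    have h1 := norm_iteratedFDeriv_mul_le_two_pow hm (hP.contDiff N) hw (x := x)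
      (fun i _ => hPB i x hx) (fun i hi => (hwB i (hi.trans hm) x hx).trans
        (mul_le_mul_of_nonneg_left (hmono hi hm x hx) hB'))
    have h2 := norm_iteratedFDeriv_mul_le_two_pow hm hg' hu (x := x)
      (fun i hi => hgB i (hi.trans hm) x hx) (fun i hi => (huB i (hi.trans hm) x hx).trans
        (mul_le_mul_of_nonneg_left (hmono hi hm x hx) hB))
    have h3 : (2:ℝ) ^ m ≤ 2 ^ (N + K + K') := pow_le_pow_right₀ (by norm_num) (by omega)
    have h4 : 0 ≤ B * B' * ‖x‖ ^ (N - m + θ : ℝ) := by positivity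
    calc _ ≤ 2 ^ m * (3 * (B * B' * ‖x‖ ^ (N - m + θ : ℝ))) := by linarith
      _ ≤ 2 ^ (N + K + K') * (3 * (B * B' * ‖x‖ ^ (N - m + θ : ℝ))) := by gcongr
      _ = _ := by ring

theorem IsPol.hx {N d : ℕ} {θ B : ℝ} (hf : IsPol d f)
    (h : ∀ m, ∀ x ∈ ball (0:E) 1, ‖iteratedFDeriv ℝ m f x‖ ≤ B) : HX N θ d B f := by
  have hB : 0 ≤ B := (norm_nonneg _).trans (h 0 0 (mem_ball_self one_pos))
  refine ⟨f, fun _ => 0, hf, contDiff_const, fun x => (add_zero _).symm, h, fun m _ x _ => ?_⟩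
  have : iteratedFDeriv ℝ m (fun _ : E => (0:ℝ)) x = 0 := by
    rw [iteratedFDeriv_fun_zero]; rfl
  rw [this, norm_zero]
  positivity

theorem exists_hx_pow_mul (N : ℕ) {θ : ℝ} (hθ : 0 < θ) (K : ℕ) {A : ℝ} (hA : 0 ≤ A) (d j : ℕ) :
    ∃ C, 0 ≤ C ∧ ∀ (f q : E → ℝ) (B : ℝ), HX N θ K A f → HX N θ d B q →
      HX N θ (j * K + d) (C * B) (fun x => f x ^ j * q x) := by
  induction j with
  | zero => exact ⟨1, zero_le_one, fun f q B _ hq => by simpa using hq⟩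
  | succ j ih =>
    obtain ⟨C, hC, h⟩ := ih
    refine ⟨3 * 2 ^ (N + K + (j * K + d)) * (A * C), by positivity, fun f q B hf hq => ?_⟩
    have h1 := hf.mul hθ (h f q B hf hq)
    have e1 : K + (j * K + d) = (j + 1) * K + d := by ring
    rw [e1] at h1
    convert h1 using 1
    · ring
    · ext x; ring

/-- Defining functions of class `C^{2k,θ}` with quantitative bounds at the boundary point `0`. -/
structure BdryDom (k : ℕ) (θ Λ : ℝ) (σ : E → ℝ) : Prop where
  nice : NiceDef Λ σ
  zero : σ 0 = 0
  smooth : ContDiff ℝ (2 * k : ℕ) σ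
  jets : ∀ m ≤ 2 * k, ‖iteratedFDeriv ℝ m σ 0‖ ≤ Λ
  holder : ∀ x ∈ ball (0:E) 1,
    ‖iteratedFDeriv ℝ (2 * k) σ x - iteratedFDeriv ℝ (2 * k) σ 0‖ ≤ Λ * ‖x‖ ^ θ

variable {k : ℕ} {θ Λ : ℝ} {σ : E → ℝ}

theorem BdryDom.hx (h : BdryDom k θ Λ σ) (hθ : 0 < θ) (hΛ : 0 ≤ Λ) :
    HX (2 * k) θ (2 * k) ((2 * k + 1 : ℕ) * Λ) σ := by
  obtain ⟨P, hP, hj⟩ := exists_taylor isOpen_univ h.smooth.contDiffOn (mem_univ (0:E))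
  have hsub : ∀ m ≤ 2 * k, ∀ x, iteratedFDeriv ℝ m (fun x => σ x - P x) x =
      iteratedFDeriv ℝ m σ x - iteratedFDeriv ℝ m P x := fun m hm x =>
    fun_iteratedFDeriv_sub_apply (h.smooth.of_le (by exact_mod_cast hm)).contDiffAt
      (hP.contDiff m).contDiffAt
  have hΛ' : Λ ≤ (2 * k + 1 : ℕ) * Λ := by
    refine le_mul_of_one_le_left hΛ ?_
    exact_mod_cast Nat.succ_pos _
  refine ⟨P, fun x => σ x - P x, hP, h.smooth.sub (hP.contDiff _), fun x => by ring,
    fun m x hx => ?_, fun m hm x hx => ?_⟩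
  · have := hP.norm_iteratedFDeriv_le one_pos hΛ (x := 0) (y := x)
      (by simpa using (mem_ball_zero_iff.1 hx).le) (fun m => by
        rw [one_pow, div_one]
        rcases lt_or_ge (2 * k) m with hm | hm
        · rw [hP.eq_zero hm, norm_zero]; exact hΛ
        · rw [hj m hm]; exact h.jets m hm) m
    simpa using this
  · refine (norm_iteratedFDeriv_le_rpow hθ hΛ (h.smooth.sub (hP.contDiff _)).contDiffOn
      (fun m hm => by rw [hsub m hm, hj m hm, sub_self]) (fun x hx => ?_) hm x hx).trans
      (by gcongr)
    have h1 := norm_iteratedFDeriv_sub_le isOpen_univ (hP.contDiff (2 * k + 1)).contDiffOn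
      (subset_univ (segment ℝ 0 x)) (B := 0) (fun z _ => by rw [hP.zero, norm_zero])
    rw [zero_mul] at h1
    rw [hsub _ le_rfl, sub_eq_zero.1 (norm_le_zero_iff.1 h1), hj _ le_rfl]
    exact h.holder x hx

variable {ι : Type*} [Fintype ι] (b : OrthonormalBasis ι ℝ E)

theorem exists_inner_eq (ℓ : E →L[ℝ] ℝ) : ∃ a : E, (∀ y, (inner ℝ a y : ℝ) = ℓ y) ∧ ‖a‖ = ‖ℓ‖ :=
  ⟨(InnerProductSpace.toDual ℝ E).symm ℓ, fun _ => InnerProductSpace.toDual_symm_apply,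
    LinearIsometryEquiv.norm_map _ _⟩

theorem NiceDef.exists_ball {Λ ρ : ℝ} {σ : E → ℝ} (hΛ : 1 ≤ Λ) (h : NiceDef Λ σ) (h0 : σ 0 = 0)
    (hρ : 0 < ρ) (hρ1 : ρ ≤ 1) : ∃ x : E, ball x ((32 * Λ ^ 4)⁻¹ * ρ) ⊆ ball 0 ρ ∧
      ∀ y ∈ ball x ((32 * Λ ^ 4)⁻¹ * ρ), (32 * Λ ^ 4)⁻¹ * ρ ≤ σ y := by
  have hΛ0 : 0 < Λ := by linarith
  obtain ⟨ℓ, hℓ⟩ : ∃ ℓ, ℓ = fderiv ℝ σ 0 := ⟨_, rfl⟩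
  obtain ⟨a, hal, han⟩ := exists_inner_eq ℓ
  have hge : Λ⁻¹ ≤ ‖a‖ := by rw [han, hℓ]; exact h.ge 0 (mem_ball_self one_pos)
  have hle : ‖a‖ ≤ Λ := by rw [han, hℓ]; exact h.le 0 (mem_ball_self one_pos)
  have ha0 : 0 < ‖a‖ := (inv_pos.2 hΛ0).trans_le hge
  obtain ⟨c, hc⟩ : ∃ c, c = (32 * Λ ^ 4)⁻¹ := ⟨_, rfl⟩
  obtain ⟨t, ht⟩ : ∃ t, t = (8 * Λ ^ 2)⁻¹ := ⟨_, rfl⟩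
  have hc0 : 0 < c := by rw [hc]; positivity
  have ht0 : 0 < t := by rw [ht]; positivity
  have hct : 4 * c * Λ ^ 2 = t := by rw [hc, ht]; field_simp; norm_num
  have ht8 : 8 * t * Λ ^ 2 = 1 := by rw [ht]; field_simp
  have hΛ2 : 1 ≤ Λ ^ 2 := one_le_pow₀ hΛ
  have hct' : c ≤ t := by nlinarith
  have htu : t ≤ 1/8 := by nlinarith
  rw [← hc]
  have hx : ‖(t * ρ / ‖a‖) • a‖ = t * ρ := by
    rw [norm_smul, Real.norm_eq_abs, abs_of_pos (by positivity)]
    field_simp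
  have hn : ∀ y ∈ ball ((t * ρ / ‖a‖) • a) (c * ρ), ‖y‖ < 2 * t * ρ := fun y hy => by
    rw [mem_ball, dist_eq_norm] at hy
    have := norm_le_norm_add_norm_sub' y ((t * ρ / ‖a‖) • a)
    rw [hx] at this
    nlinarith
  refine ⟨(t * ρ / ‖a‖) • a, fun y hy => ?_, fun y hy => ?_⟩
  · rw [mem_ball_zero_iff]
    nlinarith [hn y hy]
  · have h1 := h.taylor hΛ0.le (mem_ball_self one_pos) (y := y) (by
      rw [mem_ball_zero_iff]
      nlinarith [hn y hy])
    rw [h0, ← hℓ, sub_zero, sub_zero] at h1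
    have h2 : ℓ y = t * ρ * ‖a‖ + ℓ (y - (t * ρ / ‖a‖) • a) := by
      rw [map_sub, map_smul, ← hal a, real_inner_self_eq_norm_sq, smul_eq_mul]
      field_simp
      ring
    have h3 := (abs_le.1 (ℓ.le_opNorm (y - (t * ρ / ‖a‖) • a))).1
    have hn' := hn y hy
    rw [mem_ball, dist_eq_norm] at hy
    have h4 : ‖ℓ‖ * ‖y - (t * ρ / ‖a‖) • a‖ ≤ Λ * (c * ρ) := by
      rw [← han]; gcongr
    have h5 : t * ρ * Λ⁻¹ ≤ t * ρ * ‖a‖ := by gcongr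
    have h6 : Λ * ‖y‖ ^ 2 ≤ Λ * (2 * t * ρ) ^ 2 := by
      gcongr
    have h7 : Λ * (2 * t * ρ) ^ 2 ≤ ρ * (4 * Λ * t ^ 2) := by
      have : 0 ≤ 4 * Λ * t ^ 2 * ρ * (1 - ρ) := by
        have : 0 ≤ 1 - ρ := by linarith
        positivity
      nlinarith
    have h8 : t * Λ⁻¹ = 4 * c * Λ := by rw [← hct]; field_simp
    have h9 : 4 * Λ * t ^ 2 = 2 * c * Λ := by
      have : 4 * Λ * t ^ 2 = 4 * Λ * t * (4 * c * Λ ^ 2) := by rw [hct]; ring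
      rw [this]; linear_combination (2 * c * Λ) * ht8
    have h10 : c * ρ ≤ c * ρ * Λ := le_mul_of_one_le_right (by positivity) hΛ
    have h11 : t * ρ * Λ⁻¹ = 4 * c * Λ * ρ := by rw [← h8]; ring
    have h12 := (abs_le.1 h1).1
    rw [h9] at h7
    linarith

/-- A polynomial is controlled by the values of `σ ^ k * q` on one side of the boundary. -/
theorem exists_pol_bound (k d : ℕ) {Λ : ℝ} (hΛ : 1 ≤ Λ) : ∃ C, 0 ≤ C ∧
    ∀ (σ q : E → ℝ) (ρ S : ℝ), NiceDef Λ σ → σ 0 = 0 → 0 < ρ → ρ ≤ 1 → IsPol d q →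
      (∀ y ∈ ball (0:E) ρ, 0 < σ y → |σ y ^ k * q y| ≤ S) →
      ∀ m, ‖iteratedFDeriv ℝ m q 0‖ ≤ C * (S / ρ ^ k) / ρ ^ m := by
  let b := stdOrthonormalBasis ℝ E
  obtain ⟨D, hD, hint⟩ := exists_interior b (d + 1) (by omega)
  obtain ⟨c, hc⟩ : ∃ c, c = (32 * Λ ^ 4)⁻¹ := ⟨_, rfl⟩
  have hc0 : 0 < c := by rw [hc]; positivity
  obtain ⟨A, hA⟩ : ∃ A, A = ∑ m ∈ Finset.range (d + 1), D m / c ^ m := ⟨_, rfl⟩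
  have hA0 : 0 ≤ A := hA ▸ Finset.sum_nonneg fun m _ => div_nonneg (hD m) (by positivity)
  refine ⟨(d + 1 : ℕ) * (A / c ^ k), by positivity, fun σ q ρ S hσ h0 hρ hρ1 hq hS m => ?_⟩
  obtain ⟨x, hx1, hx2⟩ := hσ.exists_ball hΛ h0 hρ hρ1
  rw [← hc] at hx1 hx2
  have hcρ : 0 < c * ρ := by positivity
  have hqS : ∀ y ∈ ball x (c * ρ), |q y| ≤ S / (c * ρ) ^ k := fun y hy => by
    have h1 := hx2 y hy
    have h2 := hS y (hx1 hy) (hcρ.trans_le h1)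
    rw [abs_mul, abs_of_pos (pow_pos (hcρ.trans_le h1) k)] at h2
    rw [le_div_iff₀ (by positivity), mul_comm]
    refine le_trans ?_ h2
    gcongr
  have hS0 : 0 ≤ S / (c * ρ) ^ k := (abs_nonneg _).trans (hqS x (mem_ball_self hcρ))
  have hxm : ∀ m, ‖iteratedFDeriv ℝ m q x‖ ≤ A * (S / (c * ρ) ^ k) / ρ ^ m := by
    intro m
    rcases lt_or_ge d m with hm | hm
    · rw [hq.eq_zero hm, norm_zero]; positivity
    · refine norm_iteratedFDeriv_le_of_dl isOpen_ball (hq.contDiff m).contDiffOn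
        (mem_ball_self hcρ) (by positivity) (fun L hL => ?_)
      refine (hint m q x (c * ρ) _ hcρ (hq.contDiff _).contDiffOn (fun y hy => ?_) hqS L hL).trans ?_
      · have := abs_lapI_le b isOpen_univ (d + 1) (hq.contDiff _).contDiffOn (mem_univ y)
        rw [hq.eq_zero (by omega), norm_zero, mul_zero] at this
        exact abs_nonpos_iff.1 this
      · refine mul_le_mul_of_nonneg_right ?_ (List.prod_nonneg (by
          intro a ha; obtain ⟨w, -, rfl⟩ := List.mem_map.1 ha; exact norm_nonneg _))
        have h1 : D m / c ^ m ≤ A := hA ▸ Finset.single_le_sum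
          (f := fun m => D m / c ^ m) (fun m _ => div_nonneg (hD m) (by positivity))
          (Finset.mem_range.2 (by omega))
        calc _ = D m / c ^ m * (S / (c * ρ) ^ k / ρ ^ m) := by rw [mul_pow c ρ m]; field_simp
          _ ≤ A * (S / (c * ρ) ^ k / ρ ^ m) := by gcongr
          _ = _ := by ring
  have := hq.norm_iteratedFDeriv_le hρ (by positivity) (x := x) (y := 0) (by
    rw [zero_sub, norm_neg]
    simpa using (mem_ball_zero_iff.1 (hx1 (mem_ball_self hcρ))).le) hxm m
  refine this.trans_eq ?_
  rw [mul_pow]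
  field_simp

end PolynomialBounds

section Telescope

/-- Polynomial approximations at dyadic scales of decreasing error form a Cauchy sequence. -/
theorem exists_telescope (k : ℕ) {θ Λ : ℝ} (hθ : 0 < θ) (hΛ : 1 ≤ Λ) : ∃ K, 1 ≤ K ∧
    ∀ (σ v : E → ℝ) (q : ℕ → E → ℝ) (I : ℕ) (J : ℝ), 0 ≤ J → NiceDef Λ σ → σ 0 = 0 →
      (∀ x ∈ ball (0:E) 1, 0 < σ x → |v x| ≤ J) →
      (∀ i ≤ I, IsPol k (q i) ∧ ∀ x ∈ ball (0:E) ((1/2) ^ i), 0 < σ x →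
        |v x - σ x ^ k * q i x| ≤ J * ((1/2:ℝ) ^ i) ^ (2 * k + θ / 2 : ℝ)) →
      (∀ i ≤ I, ∀ l, ‖iteratedFDeriv ℝ l (fun x => q I x - q i x) 0‖ ≤
        K * J * ((1/2:ℝ) ^ i) ^ (k + θ / 2 : ℝ) / ((1/2) ^ i) ^ l) ∧
      ∀ l, ‖iteratedFDeriv ℝ l (q I) 0‖ ≤ K * J := by
  obtain ⟨C, hC, hpol⟩ := exists_pol_bound (E := E) k k hΛ
  obtain ⟨η, hη⟩ : ∃ η : ℝ, η = (1/2) ^ (θ / 2) := ⟨_, rfl⟩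
  have hη0 : 0 < η := by rw [hη]; positivity
  have hη1 : η < 1 := hη ▸ Real.rpow_lt_one (by norm_num) (by norm_num) (by positivity)
  obtain ⟨A, hA⟩ : ∃ A, A = 2 * 4 ^ k * C := ⟨_, rfl⟩
  have hA0 : 0 ≤ A := by rw [hA]; positivity
  obtain ⟨K₀, hK₀⟩ : ∃ K₀, K₀ = A / (1 - η) := ⟨_, rfl⟩
  have hK0 : 0 ≤ K₀ := hK₀ ▸ div_nonneg hA0 (by linarith)
  have hKA : A + K₀ * η = K₀ := by
    have : 1 - η ≠ 0 := by linarith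
    rw [hK₀]; field_simp; ring
  obtain ⟨β, hβ⟩ : ∃ β : ℝ, β = k + θ / 2 := ⟨_, rfl⟩
  have hs : (2 * k + θ / 2 : ℝ) = k + β := by rw [hβ]; ring
  have hβ0 : 0 < β := by rw [hβ]; positivity
  refine ⟨K₀ + 2 * C + 1, by linarith, fun σ v q I J hJ hσ h0 hv hq => ?_⟩
  rw [hs] at hq
  rw [← hβ]
  have hr : ∀ i : ℕ, (0:ℝ) < (1/2) ^ i := fun i => by positivity
  have hpow : ∀ i : ℕ, ((1/2:ℝ) ^ i) ^ (k + β : ℝ) = ((1/2) ^ i) ^ k * ((1/2:ℝ) ^ i) ^ β :=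
    fun i => by rw [Real.rpow_add (hr i), Real.rpow_natCast]
  have hstep : ∀ i < I, ∀ l ≤ k, ‖iteratedFDeriv ℝ l (fun x => q (i+1) x - q i x) 0‖ ≤
      A * J * ((1/2:ℝ) ^ i) ^ β / ((1/2) ^ i) ^ l := by
    intro i hi l hl
    have hle : (1/2:ℝ) ^ (i+1) ≤ (1/2) ^ i := by rw [pow_succ]; linarith [hr i]
    refine (hpol σ _ ((1/2) ^ (i+1)) (2 * J * ((1/2:ℝ) ^ i) ^ (k + β : ℝ)) hσ h0 (hr _)
      (pow_le_one₀ (by norm_num) (by norm_num)) ((hq (i+1) hi).1.sub (hq i hi.le).1)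
      (fun y hy hy0 => ?_) l).trans ?_
    · have h1 := (hq (i+1) hi).2 y hy hy0
      have h2 := (hq i hi.le).2 y (ball_subset_ball hle hy) hy0
      have h3 : J * ((1/2:ℝ) ^ (i+1)) ^ (k + β : ℝ) ≤ J * ((1/2:ℝ) ^ i) ^ (k + β : ℝ) := by
        gcongr
      rw [abs_le] at h1 h2 ⊢
      constructor <;> linarith
    · have h4 : (2:ℝ) ^ l ≤ 2 ^ k := pow_le_pow_right₀ (by norm_num) hl
      have e : C * (2 * J * ((1/2:ℝ) ^ i) ^ (k + β : ℝ) / ((1/2) ^ (i+1)) ^ k) /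
          ((1/2) ^ (i+1)) ^ l = 2 * 2 ^ k * C * J * ((1/2:ℝ) ^ i) ^ β / ((1/2) ^ i) ^ l * 2 ^ l := by
        rw [hpow, pow_succ (1/2:ℝ) i, mul_pow _ (1/2:ℝ) k, mul_pow _ (1/2:ℝ) l]
        have h5 : ((1/2:ℝ) ^ k) = (2 ^ k)⁻¹ := by rw [one_div, inv_pow]
        have h6 : ((1/2:ℝ) ^ l) = (2 ^ l)⁻¹ := by rw [one_div, inv_pow]
        have h7 := (pow_pos (hr i) k).ne'
        have h8 := (pow_pos (hr i) l).ne'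
        rw [h5, h6]
        field_simp
      rw [e, hA]
      calc _ ≤ 2 * 2 ^ k * C * J * ((1/2:ℝ) ^ i) ^ β / ((1/2) ^ i) ^ l * 2 ^ k := by gcongr
        _ = _ := by
          have : (4:ℝ) ^ k = 2 ^ k * 2 ^ k := by rw [← mul_pow]; norm_num
          rw [this]; ring
  have hmain : ∀ i ≤ I, ∀ l ≤ k, ‖iteratedFDeriv ℝ l (fun x => q I x - q i x) 0‖ ≤
      K₀ * J * ((1/2:ℝ) ^ i) ^ β / ((1/2) ^ i) ^ l := by
    intro i hi
    induction hi using Nat.decreasingInduction with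
    | self =>
      intro l _
      have : (fun x => q I x - q I x) = fun _ : E => (0:ℝ) := by ext x; ring
      rw [this, iteratedFDeriv_fun_zero, Pi.zero_apply, norm_zero]
      positivity
    | of_succ i hi ih =>
      intro l hl
      have e : (fun x => q I x - q i x) = fun x => (q I x - q (i+1) x) + (q (i+1) x - q i x) := by
        ext x; ring
      have hI := (hq I le_rfl).1
      have hi1 := (hq (i+1) hi).1
      rw [e, fun_iteratedFDeriv_add_apply ((hI.sub hi1).contDiff l).contDiffAt
        ((hi1.sub (hq i (Nat.le_of_lt hi)).1).contDiff l).contDiffAt]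
      refine (norm_add_le _ _).trans ((add_le_add (ih l hl) (hstep i hi l hl)).trans ?_)
      have h1 : ((1/2:ℝ) ^ (i+1)) ^ β / ((1/2) ^ (i+1)) ^ l ≤
          η * (((1/2:ℝ) ^ i) ^ β / ((1/2) ^ i) ^ l) := by
        have h2 : (1/2:ℝ) ^ β ≤ η * (1/2) ^ l := by
          rw [hη, hβ, ← Real.rpow_natCast _ l, ← Real.rpow_add (by norm_num)]
          refine Real.rpow_le_rpow_of_exponent_ge (by norm_num) (by norm_num) ?_
          have : (l:ℝ) ≤ k := by exact_mod_cast hl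
          linarith
        rw [pow_succ (1/2:ℝ) i, Real.mul_rpow (hr i).le (by norm_num), mul_pow]
        rw [div_le_iff₀ (by positivity)]
        calc _ ≤ ((1/2:ℝ) ^ i) ^ β * (η * (1/2) ^ l) := by gcongr
          _ = _ := by
            have h8 := (pow_pos (hr i) l).ne'
            field_simp
      calc _ = K₀ * J * (((1/2:ℝ) ^ (i+1)) ^ β / ((1/2) ^ (i+1)) ^ l) +
            A * J * ((1/2:ℝ) ^ i) ^ β / ((1/2) ^ i) ^ l := by ring
        _ ≤ K₀ * J * (η * (((1/2:ℝ) ^ i) ^ β / ((1/2) ^ i) ^ l)) +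
            A * J * ((1/2:ℝ) ^ i) ^ β / ((1/2) ^ i) ^ l := by gcongr
        _ = (A + K₀ * η) * J * ((1/2:ℝ) ^ i) ^ β / ((1/2) ^ i) ^ l := by ring
        _ = _ := by rw [hKA]
  have hmain' : ∀ i ≤ I, ∀ l, ‖iteratedFDeriv ℝ l (fun x => q I x - q i x) 0‖ ≤
      K₀ * J * ((1/2:ℝ) ^ i) ^ β / ((1/2) ^ i) ^ l := fun i hi l => by
    rcases lt_or_ge k l with h | h
    · rw [((hq I le_rfl).1.sub (hq i hi).1).eq_zero h, norm_zero]; positivity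
    · exact hmain i hi l h
  refine ⟨fun i hi l => (hmain' i hi l).trans (by gcongr; linarith), fun l => ?_⟩
  have h1 := hmain' 0 (Nat.zero_le _) l
  have hq0 := (hq 0 (Nat.zero_le _)).1
  have h2 := hpol σ (q 0) 1 (2 * J) hσ h0 one_pos le_rfl hq0 (fun y hy hy0 => by
    have h3 := (hq 0 (Nat.zero_le _)).2 y (by simpa using hy) hy0
    have h4 := hv y hy hy0
    rw [pow_zero, Real.one_rpow, mul_one] at h3
    rw [abs_le] at h3 h4 ⊢
    constructor <;> linarith) l
  have e : q I = fun x => (q I x - q 0 x) + q 0 x := by ext x; ring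
  rw [e, fun_iteratedFDeriv_add_apply
    (((hq I le_rfl).1.sub hq0).contDiff l).contDiffAt (hq0.contDiff l).contDiffAt]
  refine (norm_add_le _ _).trans ((add_le_add h1 h2).trans ?_)
  simp only [pow_zero, one_pow, Real.one_rpow, div_one, mul_one]
  nlinarith

end Telescope

section ModelPolynomials

variable {ι : Type*} [Fintype ι] (b : OrthonormalBasis ι ℝ E)

theorem isPol_linear_pow (ℓ : E →L[ℝ] ℝ) (j : ℕ) : IsPol j (fun y => ℓ y ^ j) := by
  induction j with
  | zero => simpa using IsPol.const (E := E) (1:ℝ)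
  | succ j ih =>
    have h1 : IsPol 1 (fun y => ℓ y) := ⟨ℓ.contDiff, fun x => by
      rw [← norm_eq_zero, ← norm_iteratedFDeriv_fderiv]
      have : fderiv ℝ (fun y => ℓ y) = fun _ => ℓ := by ext1 y; exact ℓ.fderiv
      rw [this, iteratedFDeriv_const_of_ne one_ne_zero, Pi.zero_apply, norm_zero]⟩
    simpa only [pow_succ] using ih.mul h1

theorem dd_linear_pow (ℓ : E →L[ℝ] ℝ) (v : E) (j : ℕ) :
    dd v (fun y => ℓ y ^ (j + 1)) = fun y => ((j + 1 : ℕ) * ℓ v) * ℓ y ^ j := by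
  ext y
  have := (ℓ.hasFDerivAt (x := y)).pow (j + 1)
  simp only [dd]
  rw [this.fderiv]
  simp
  ring

theorem lap_linear_pow (ℓ : E →L[ℝ] ℝ) (j : ℕ) :
    lap b (fun y => ℓ y ^ (j + 2)) = fun y => ((j + 2 : ℕ) * (j + 1 : ℕ) * ‖ℓ‖ ^ 2) * ℓ y ^ j := by
  obtain ⟨a, hal, han⟩ := exists_inner_eq ℓ
  have h1 : ∑ i, ℓ (b i) ^ 2 = ‖ℓ‖ ^ 2 := by
    rw [← han, ← real_inner_self_eq_norm_sq, ← b.sum_inner_mul_inner a a]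
    refine Finset.sum_congr rfl fun i _ => ?_
    rw [real_inner_comm a, hal, sq]
  ext y
  rw [← h1, Finset.mul_sum, Finset.sum_mul]
  refine Finset.sum_congr rfl fun i _ => ?_
  rw [dd_linear_pow]
  have h2 : DifferentiableAt ℝ (fun y => ℓ y ^ (j + 1)) y := by fun_prop
  rw [dd_const_mul, dd_linear_pow]
  · push_cast; ring
  · exact h2

theorem exists_lapI_linear_pow {ℓ : E →L[ℝ] ℝ} (hℓ : ℓ ≠ 0) (j : ℕ) :
    ∃ c : ℝ, (lap b)^[j] (fun y => c * ℓ y ^ (2 * j)) = fun _ => 1 := by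
  have h : ∃ c : ℝ, 0 < c ∧ (lap b)^[j] (fun y => ℓ y ^ (2 * j)) = fun _ => c := by
    induction j with
    | zero => exact ⟨1, one_pos, by simp⟩
    | succ j ih =>
      obtain ⟨c, hc, h⟩ := ih
      have := norm_pos_iff.2 hℓ
      refine ⟨((2 * j + 2 : ℕ) * (2 * j + 1 : ℕ) * ‖ℓ‖ ^ 2) * c, by positivity, ?_⟩
      rw [Function.iterate_succ_apply, show 2 * (j + 1) = 2 * j + 2 by ring, lap_linear_pow,
        lapI_const_mul, h]
  obtain ⟨c, hc, h⟩ := h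
  refine ⟨c⁻¹, ?_⟩
  rw [lapI_const_mul, h]
  ext x
  exact inv_mul_cancel₀ hc.ne'

/-- If `Δ^k V` is nearly constant on a ball, then the constant is controlled by `V`. -/
theorem exists_const_bound [Nontrivial E] (k : ℕ) (hk : 1 ≤ k) {T : ℝ} (hT : 0 < T) :
    ∃ C, 0 ≤ C ∧ ∀ (V : E → ℝ) (x : E) (S F κ : ℝ), ContDiffOn ℝ (2 * k : ℕ) V (ball x T) →
      (∀ y ∈ ball x T, |V y| ≤ S) → (∀ y ∈ ball x T, |(lap b)^[k] V y - κ| ≤ F) →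
      |κ| ≤ C * (S + F) := by
  by_contra hcon
  push Not at hcon
  obtain ⟨a, ha⟩ := exists_ne (0:E)
  obtain ⟨ℓ, hℓ⟩ : ∃ ℓ : E →L[ℝ] ℝ, ℓ = InnerProductSpace.toDual ℝ E a := ⟨_, rfl⟩
  have hℓ0 : ℓ ≠ 0 := by rw [hℓ]; simpa using ha
  obtain ⟨c, hc⟩ := exists_lapI_linear_pow b hℓ0 k
  obtain ⟨p, hp⟩ : ∃ p : E → ℝ, p = fun y => c * ℓ y ^ (2 * k) := ⟨_, rfl⟩
  rw [← hp] at hc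
  have hps : ContDiff ℝ ∞ p := by
    rw [hp]; exact contDiff_const.mul (ℓ.contDiff.pow _)
  have hex : ∀ j : ℕ, ∃ w : E → ℝ, ContDiffOn ℝ (2 * k : ℕ) w (ball 0 T) ∧
      (∀ y ∈ ball (0:E) T, |w y + p y| ≤ 1 / (j + 1 : ℝ)) ∧
      ∀ y ∈ ball (0:E) T, |(lap b)^[k] w y| ≤ 1 / (j + 1 : ℝ) := by
    intro j
    obtain ⟨V, x, S, F, κ, hV, hS, hF, hlt⟩ := hcon (j + 1) (by positivity)
    have hS0 : 0 ≤ S := (abs_nonneg _).trans (hS x (mem_ball_self hT))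
    have hF0 : 0 ≤ F := (abs_nonneg _).trans (hF x (mem_ball_self hT))
    have hκ : 0 < |κ| := lt_of_le_of_lt (by positivity) hlt
    have hκ0 : κ ≠ 0 := abs_pos.1 hκ
    have hmem : ∀ y ∈ ball (0:E) T, x + (1:ℝ) • y ∈ ball x T := fun y hy => by
      rw [mem_ball_iff_norm]; simpa using hy
    have hj : (0:ℝ) < j + 1 := by positivity
    have hV1 : ContDiffOn ℝ (2 * k : ℕ) (fun y => κ⁻¹ * V (x + (1:ℝ) • y)) (ball 0 T) :=
      contDiffOn_const.mul (hV.comp (by fun_prop) hmem)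
    refine ⟨fun y => κ⁻¹ * V (x + (1:ℝ) • y) - p y, hV1.sub (hps.of_le (by
      exact ENat.LEInfty.out)).contDiffOn, fun y hy => ?_, fun y hy => ?_⟩
    · rw [sub_add_cancel, abs_mul, abs_inv, inv_mul_le_iff₀ hκ, mul_one_div, le_div_iff₀ hj]
      have := hS _ (hmem y hy)
      nlinarith
    · have h1 := lapI_sub b isOpen_ball (j := k) hV1
        (hps.of_le (m := (2 * k : ℕ)) ENat.LEInfty.out).contDiffOn hy
      rw [h1, lapI_const_mul, lapI_comp_affine, hc]
      dsimp only
      rw [one_pow, one_mul, show κ⁻¹ * (lap b)^[k] V (x + (1:ℝ) • y) - 1 =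
        κ⁻¹ * ((lap b)^[k] V (x + (1:ℝ) • y) - κ) by field_simp, abs_mul, abs_inv,
        inv_mul_le_iff₀ hκ, mul_one_div, le_div_iff₀ hj]
      have := hF _ (hmem y hy)
      nlinarith
  choose w hw hwp hwl using hex
  let 𝒰 : Ultrafilter ℕ := hyperfilter ℕ
  have h𝒰 : (𝒰 : Filter ℕ) ≤ atTop := Nat.hyperfilter_le_atTop
  have hlim : Tendsto (fun j : ℕ => 1 / (j + 1 : ℝ)) 𝒰 (𝓝 0) :=
    tendsto_one_div_add_atTop_nhds_zero_nat.mono_left h𝒰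
  obtain ⟨M, hM⟩ := (isCompact_closedBall (0:E) T).exists_bound_of_continuousOn
    hps.continuous.continuousOn
  obtain ⟨u, hus, hu0, hut⟩ := exists_limit b k hk 𝒰 (w := w) (isOpen_ball (x := (0:E)) (ε := T))
    (by
      intro x hx
      obtain ⟨T', hT', hsub⟩ := Metric.isOpen_iff.1 isOpen_ball x hx
      refine ⟨T', hT', 1 + M, _, hlim, Eventually.of_forall fun j =>
        ⟨(hw j).mono hsub, fun y hy => ?_, fun y hy => hwl j y (hsub hy)⟩⟩
      have h1 := hwp j y (hsub hy)
      have h2 := hM y (ball_subset_closedBall (hsub hy))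
      have h3 : 1 / (j + 1 : ℝ) ≤ 1 := by
        rw [div_le_one (by positivity)]; linarith [Nat.cast_nonneg (α := ℝ) j]
      rw [Real.norm_eq_abs, abs_le] at h2
      rw [abs_le] at h1 ⊢
      constructor <;> linarith)
  have hup : EqOn u (fun y => (-1:ℝ) * p y) (ball 0 T) := by
    intro y hy
    have h1 := hut y hy (fun _ => y) tendsto_const_nhds
    have h2 : Tendsto (fun j => w j y + p y) 𝒰 (𝓝 0) :=
      squeeze_zero_norm (fun j => hwp j y hy) hlim
    have h3 := h2.sub_const (p y)
    simp only [add_sub_cancel_right, zero_sub] at h3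
    rw [tendsto_nhds_unique h1 h3]
    ring
  have h1 := lapI_congr b isOpen_ball hup k (mem_ball_self hT)
  rw [hu0 0 (mem_ball_self hT), lapI_const_mul, hc] at h1
  norm_num at h1

variable {f q σ : E → ℝ} {θ : ℝ}

theorem IsPol.comp_smul {d : ℕ} (hq : IsPol d q) (t : ℝ) : IsPol d (fun x => q (t • x)) :=
  ⟨hq.smooth.comp (contDiff_const_smul t), fun x => by
    rw [iteratedFDeriv_comp_const_smul _ (hq.contDiff _)]
    dsimp only
    rw [hq.zero, smul_zero]⟩

theorem IsPol.lapI_eq_zero {d j : ℕ} (hq : IsPol d q) (hj : d < 2 * j) (x : E) :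
    (lap b)^[j] q x = 0 := by
  have := abs_lapI_le b isOpen_univ j (hq.contDiff _).contDiffOn (mem_univ x)
  rw [hq.eq_zero hj, norm_zero, mul_zero] at this
  exact abs_nonpos_iff.1 this

theorem abs_lapI_sub_le {j : ℕ} {B : ℝ} (hf : ContDiff ℝ ∞ f) {x : E}
    (hB : ∀ z ∈ segment ℝ 0 x, ‖iteratedFDeriv ℝ (2 * j + 1) f z‖ ≤ B) :
    |(lap b)^[j] f x - (lap b)^[j] f 0| ≤ (Fintype.card ι : ℝ) ^ j * (B * ‖x‖) := by
  have hf' : ∀ m : ℕ, ContDiff ℝ m f := fun m => hf.of_le ENat.LEInfty.out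
  have hg : ContDiff ℝ (2 * j : ℕ) (fun y => f (x + (1:ℝ) • y)) := (hf' _).comp (by fun_prop)
  have h1 := abs_lapI_le b isOpen_univ j (hg.sub (hf' _)).contDiffOn (mem_univ (0:E))
  rw [lapI_sub b isOpen_univ hg.contDiffOn (hf' _).contDiffOn (mem_univ 0),
    lapI_comp_affine] at h1
  have h2 : iteratedFDeriv ℝ (2 * j) (fun y => f (x + (1:ℝ) • y) - f y) 0 =
      iteratedFDeriv ℝ (2 * j) f x - iteratedFDeriv ℝ (2 * j) f 0 := by
    rw [fun_iteratedFDeriv_sub_apply hg.contDiffAt (hf' _).contDiffAt]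
    simp only [one_smul]
    rw [iteratedFDeriv_comp_add_left, add_zero]
  dsimp only at h1
  rw [h2, one_pow, one_mul, smul_zero, add_zero] at h1
  refine h1.trans ?_
  have h3 := norm_iteratedFDeriv_sub_le isOpen_univ (hf' (2 * j + 1)).contDiffOn (subset_univ _) hB
  rw [sub_zero] at h3
  gcongr

theorem HX.exists_lapI {j K : ℕ} {B : ℝ} (hθ1 : θ ≤ 1) (hf : HX (2 * j) θ K B f) :
    ∃ κ, ∀ x ∈ ball (0:E) 1,
      |(lap b)^[j] f x - κ| ≤ 2 * (Fintype.card ι : ℝ) ^ j * B * ‖x‖ ^ θ := by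
  obtain ⟨P, g, hP, hg, hfe, hPB, hgB⟩ := hf
  have hB : 0 ≤ B := (norm_nonneg _).trans (hPB 0 0 (mem_ball_self one_pos))
  refine ⟨(lap b)^[j] P 0, fun x hx => ?_⟩
  have hx1 : ‖x‖ ≤ 1 := (mem_ball_zero_iff.1 hx).le
  have hseg : segment ℝ 0 x ⊆ ball (0:E) 1 :=
    (convex_ball _ _).segment_subset (mem_ball_self one_pos) hx
  have h1 := abs_lapI_sub_le b hP.smooth (x := x) (j := j) (fun z hz => hPB _ z (hseg hz))
  have h2 := abs_lapI_le b isOpen_univ j hg.contDiffOn (mem_univ x)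
  have h3 := hgB (2 * j) le_rfl x hx
  rw [sub_self, zero_add] at h3
  have h4 : (lap b)^[j] f x = (lap b)^[j] P x + (lap b)^[j] g x := by
    rw [show f = fun x => P x + g x from funext hfe]
    exact lapI_add b isOpen_univ (hP.contDiff _).contDiffOn hg.contDiffOn (mem_univ x)
  have h5 : ‖x‖ ≤ ‖x‖ ^ θ := by
    rcases (norm_nonneg x).eq_or_lt with h | h
    · rw [← h]; exact Real.rpow_nonneg le_rfl _
    · simpa using Real.rpow_le_rpow_of_exponent_ge h hx1 hθ1
  have h6 : (Fintype.card ι : ℝ) ^ j * (B * ‖x‖) ≤ (Fintype.card ι : ℝ) ^ j * (B * ‖x‖ ^ θ) := by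
    gcongr
  have h7 : (Fintype.card ι : ℝ) ^ j * ‖iteratedFDeriv ℝ (2 * j) g x‖ ≤
    (Fintype.card ι : ℝ) ^ j * (B * ‖x‖ ^ θ) := by gcongr
  rw [h4, add_sub_right_comm]
  refine (abs_add_le _ _).trans ?_
  linarith

/-- Products `σ ^ k * q` inherit the regularity of the boundary. -/
theorem exists_hx_bdry (k : ℕ) {Λ : ℝ} (hθ : 0 < θ) (hΛ : 0 ≤ Λ) : ∃ C, 0 ≤ C ∧
    ∀ (σ q : E → ℝ) (B : ℝ), BdryDom k θ Λ σ → IsPol k q → 0 ≤ B →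
      (∀ m, ‖iteratedFDeriv ℝ m q 0‖ ≤ B) →
      HX (2 * k) θ (k * (2 * k) + k) (C * B) (fun x => σ x ^ k * q x) := by
  obtain ⟨C, hC, h⟩ := exists_hx_pow_mul (E := E) (2 * k) hθ (2 * k)
    (A := (2 * k + 1 : ℕ) * Λ) (by positivity) k k
  refine ⟨C * (k + 1 : ℕ), by positivity, fun σ q B hσ hq hB0 hB => ?_⟩
  rw [mul_assoc]
  refine h σ q _ (hσ.hx hθ hΛ) (hq.hx fun m x hx => ?_)
  have := hq.norm_iteratedFDeriv_le one_pos hB0 (x := 0) (y := x)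
    (by simpa using (mem_ball_zero_iff.1 hx).le) (fun m => by simpa using hB m) m
  simpa using this

end ModelPolynomials

section BoundaryScales

variable {ι : Type*} [Fintype ι] (b : OrthonormalBasis ι ℝ E)

theorem isOpen_ball_inter_pos {σ : E → ℝ} {R : ℝ} (h : ContinuousOn σ (ball (0:E) R)) :
    IsOpen (ball (0:E) R ∩ {x | 0 < σ x}) :=
  h.isOpen_inter_preimage isOpen_ball isOpen_Ioi

theorem exists_decay_scale (k : ℕ) (hk : 1 ≤ k) {Λ : ℝ} (hΛ : 1 ≤ Λ) :
    ∃ C, 0 ≤ C ∧ ∀ (σ f : E → ℝ) (r S F : ℝ), 0 < r → r ≤ 1 → NiceDef Λ σ →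
      ContDiffOn ℝ (2 * k : ℕ) f (ball (0:E) r ∩ {x | 0 < σ x}) →
      (∀ x ∈ ball (0:E) r, 0 < σ x → |f x| ≤ S) →
      (∀ x ∈ ball (0:E) r, 0 < σ x → |(lap b)^[k] f x| ≤ F) →
      (∃ C, ∀ x ∈ ball (0:E) r, 0 < σ x → |f x| ≤ C * σ x ^ (k - 1/4 : ℝ)) →
      ∀ z ∈ ball (0:E) (r / 2), 0 < σ z →
        |f z| ≤ C * (S + r ^ (2 * k) * F) * (σ z / r) ^ (k - 1/4 : ℝ) := by
  obtain ⟨C, hC, h⟩ := exists_decay b k hk hΛ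
  refine ⟨C, hC, fun σ f r S F hr hr1 hσ hf hS hF ⟨D, hD⟩ z hz hσz => ?_⟩
  have hm : ∀ y ∈ ball (0:E) 1, (0:E) + r • y ∈ ball (0:E) r := fun y hy => by
    rw [mem_ball_zero_iff] at hy ⊢
    rw [zero_add, norm_smul, Real.norm_eq_abs, abs_of_pos hr]
    nlinarith
  have hpos : ∀ y : E, 0 < r⁻¹ * σ (r • y) → 0 < σ ((0:E) + r • y) := fun y hy => by
    rw [zero_add]; exact (pos_iff_pos_of_mul_pos hy).1 (inv_pos.2 hr)
  have hB : BdryFun b k Λ (fun y => r⁻¹ * σ (r • y)) (fun y => f (0 + r • y)) S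
      (r ^ (2 * k) * F) := by
    refine ⟨hσ.scale (by linarith) hr hr1, hf.comp (by fun_prop) fun y hy => ⟨hm y hy.1, hpos y hy.2⟩,
      fun y hy hy0 => hS _ (hm y hy) (hpos y hy0), fun y hy hy0 => ?_, D * r ^ (k - 1/4 : ℝ),
      fun y hy hy0 => ?_⟩
    · rw [lapI_comp_affine, abs_mul, abs_of_pos (by positivity)]
      exact mul_le_mul_of_nonneg_left (hF _ (hm y hy) (hpos y hy0)) (by positivity)
    · refine (hD _ (hm y hy) (hpos y hy0)).trans_eq ?_
      rw [mul_assoc, ← Real.mul_rpow hr.le hy0.le, mul_inv_cancel_left₀ hr.ne', zero_add]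
  have h1 := h _ _ _ _ hB (r⁻¹ • z) (by
    rw [mem_ball_zero_iff] at hz ⊢
    rw [norm_smul, norm_inv, Real.norm_eq_abs, abs_of_pos hr, inv_mul_lt_iff₀ hr]
    linarith) (by rw [smul_inv_smul₀ hr.ne']; positivity)
  rwa [zero_add, smul_inv_smul₀ hr.ne', inv_mul_eq_div] at h1

/-- Polyharmonic functions with Dirichlet data near the boundary point `0`. -/
structure DirFun (k : ℕ) (θ Λ : ℝ) (σ v : E → ℝ) : Prop where
  dom : BdryDom k θ Λ σ
  smooth : ContDiffOn ℝ (2 * k : ℕ) v (ball (0:E) 1 ∩ {x | 0 < σ x})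
  eq_zero : ∀ x ∈ ball (0:E) 1, 0 < σ x → (lap b)^[k] v x = 0
  bound : ∀ x ∈ ball (0:E) 1, 0 < σ x → |v x| ≤ 1
  decay : ∃ C, ∀ x ∈ ball (0:E) 1, 0 < σ x → |v x| ≤ C * σ x ^ (k - 1/4 : ℝ)

variable {b}

theorem NiceDef.abs_le {Λ : ℝ} {σ : E → ℝ} (hΛ : 0 ≤ Λ) (h : NiceDef Λ σ) (h0 : σ 0 = 0) {x : E}
    (hx : x ∈ ball (0:E) 1) : |σ x| ≤ 2 * Λ * ‖x‖ := by
  have h0' := mem_ball_self (x := (0:E)) one_pos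
  have h1 := h.taylor hΛ h0' hx
  have h2 := (fderiv ℝ σ 0).le_of_opNorm_le (h.le 0 h0') x
  rw [Real.norm_eq_abs] at h2
  rw [h0, sub_zero, sub_zero] at h1
  have h3 : Λ * ‖x‖ ^ 2 ≤ Λ * ‖x‖ := by
    have := mem_ball_zero_iff.1 hx
    gcongr
    nlinarith [norm_nonneg x]
  rw [_root_.abs_le] at h1 h2 ⊢
  constructor <;> linarith

theorem exists_scale_bounds [Nontrivial E] (k : ℕ) (hk : 1 ≤ k) {θ Λ : ℝ} (hθ : 0 < θ)
    (hθ1 : θ ≤ 1) (hΛ : 1 ≤ Λ) : ∃ K, 1 ≤ K ∧ ∀ (σ v : E → ℝ) (q : ℕ → E → ℝ) (I : ℕ) (N : ℝ),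
      DirFun b k θ Λ σ v → 1 ≤ N →
      (∀ i ≤ I, IsPol k (q i) ∧ ∀ x ∈ ball (0:E) ((1/2) ^ i), 0 < σ x →
        |v x - σ x ^ k * q i x| ≤ N * ((1/2:ℝ) ^ i) ^ (2 * k + θ / 2 : ℝ)) →
      ∃ κ, |κ| ≤ K * N * ((1/2:ℝ) ^ I) ^ (θ / 2) ∧
        (∀ x ∈ ball (0:E) 1, 0 < σ x →
          |(lap b)^[k] (fun x => v x - σ x ^ k * q I x) x - κ| ≤ K * N * ‖x‖ ^ θ) ∧
        ∀ i ≤ I, (∀ x ∈ ball (0:E) ((1/2) ^ i), 0 < σ x →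
          |v x - σ x ^ k * q I x| ≤ K * N * ((1/2:ℝ) ^ i) ^ (2 * k + θ / 2 : ℝ)) ∧
          ∀ x ∈ ball (0:E) ((1/2) ^ i / 2), 0 < σ x → |v x - σ x ^ k * q I x| ≤
            K * N * ((1/2:ℝ) ^ i) ^ (2 * k + θ / 2 : ℝ) * (σ x / (1/2) ^ i) ^ (k - 1/4 : ℝ) := by
  have hΛ0 : 0 < Λ := by linarith
  obtain ⟨K₁, hK₁, htel⟩ := exists_telescope (E := E) k hθ hΛ
  obtain ⟨K₂, hK₂, hhx⟩ := exists_hx_bdry (E := E) k hθ hΛ0.le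
  obtain ⟨c, hc⟩ : ∃ c, c = (32 * Λ ^ 4)⁻¹ := ⟨_, rfl⟩
  have hc0 : 0 < c := by rw [hc]; positivity
  obtain ⟨K₃, hK₃, hcb⟩ := exists_const_bound b k hk hc0
  obtain ⟨K₄, hK₄, hdec⟩ := exists_decay_scale b k hk hΛ
  obtain ⟨D₁, hD₁⟩ : ∃ D, D = 1 + (2 * Λ) ^ k * ((k + 1 : ℕ) * K₁) := ⟨_, rfl⟩
  obtain ⟨D₂, hD₂⟩ : ∃ D, D = 2 * (Fintype.card ι : ℝ) ^ k * (K₂ * K₁) := ⟨_, rfl⟩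
  obtain ⟨D₃, hD₃⟩ : ∃ D, D = K₃ * (1 + D₂) := ⟨_, rfl⟩
  obtain ⟨D₄, hD₄⟩ : ∃ D, D = K₄ * (D₁ + (D₃ + D₂)) := ⟨_, rfl⟩
  have hD₁0 : 1 ≤ D₁ := by rw [hD₁]; exact le_add_of_nonneg_right (by positivity)
  have hD₂0 : 0 ≤ D₂ := by rw [hD₂]; positivity
  have hD₃0 : 0 ≤ D₃ := by rw [hD₃]; positivity
  have hD₄0 : 0 ≤ D₄ := by rw [hD₄]; positivity
  refine ⟨D₁ + D₂ + D₃ + D₄, by linarith, fun σ v q I N hv hN hq => ?_⟩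
  have hN0 : 0 < N := by linarith
  have hr : ∀ i : ℕ, (0:ℝ) < (1/2) ^ i := fun i => by positivity
  have hr1 : ∀ i : ℕ, ((1/2:ℝ) ^ i) ≤ 1 := fun i => pow_le_one₀ (by norm_num) (by norm_num)
  have hs2 : ∀ i : ℕ, ((1/2:ℝ) ^ i) ^ (2 * k + θ / 2 : ℝ) =
      ((1/2) ^ i) ^ (2 * k) * ((1/2:ℝ) ^ i) ^ (θ / 2) := fun i => by
    rw [Real.rpow_add (hr i), ← Real.rpow_natCast _ (2 * k)]; norm_cast
  have hs1 : ∀ i : ℕ, ((1/2:ℝ) ^ i) ^ (2 * k + θ / 2 : ℝ) =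
      ((1/2) ^ i) ^ k * ((1/2:ℝ) ^ i) ^ (k + θ / 2 : ℝ) := fun i => by
    rw [← Real.rpow_natCast _ k, ← Real.rpow_add (hr i)]; congr 1; ring
  obtain ⟨ht1, ht2⟩ := htel σ v q I N hN0.le hv.dom.nice hv.dom.zero
    (fun x hx h0 => (hv.bound x hx h0).trans hN) hq
  have hqI := (hq I le_rfl).1
  obtain ⟨κ', hκ'⟩ := (hhx σ (q I) (K₁ * N) hv.dom hqI (by positivity) ht2).exists_lapI b hθ1
  have hσc : ContinuousOn σ (ball (0:E) 1) := hv.dom.smooth.continuous.continuousOn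
  have hσq : ContDiff ℝ (2 * k : ℕ) (fun x => σ x ^ k * q I x) :=
    (hv.dom.smooth.pow k).mul (hqI.contDiff _)
  obtain ⟨f, hf⟩ : ∃ f : E → ℝ, f = fun x => v x - σ x ^ k * q I x := ⟨_, rfl⟩
  have hfs : ContDiffOn ℝ (2 * k : ℕ) f (ball (0:E) 1 ∩ {x | 0 < σ x}) :=
    hf ▸ hv.smooth.sub hσq.contDiffOn
  have hfx : ∀ x, v x - σ x ^ k * q I x = f x := fun x => by rw [hf]
  simp only [hfx]
  have hlap : ∀ x ∈ ball (0:E) 1, 0 < σ x → |(lap b)^[k] f x - (-κ')| ≤ D₂ * N * ‖x‖ ^ θ := by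
    intro x hx h0
    rw [hf, lapI_sub b (isOpen_ball_inter_pos hσc) hv.smooth hσq.contDiffOn ⟨hx, h0⟩]
    dsimp only
    rw [hv.eq_zero x hx h0, zero_sub, ← neg_sub', abs_neg]
    refine (hκ' x hx).trans_eq ?_
    rw [hD₂]; ring
  have hbd : ∀ i ≤ I, ∀ x ∈ ball (0:E) ((1/2) ^ i), 0 < σ x →
      |f x| ≤ D₁ * N * ((1/2:ℝ) ^ i) ^ (2 * k + θ / 2 : ℝ) := by
    intro i hi x hx h0
    have h1 := (hq i hi).2 x hx h0
    have hx' := (mem_ball_zero_iff.1 hx).le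
    have h2 := (hqI.sub (hq i hi).1).norm_iteratedFDeriv_le (hr i) (x := 0) (y := x)
      (B := K₁ * N * ((1/2:ℝ) ^ i) ^ (k + θ / 2 : ℝ)) (by positivity) (by simpa using hx')
      (ht1 i hi) 0
    rw [norm_iteratedFDeriv_zero, pow_zero, div_one, Real.norm_eq_abs] at h2
    have h3 : |σ x| ^ k ≤ (2 * Λ) ^ k * ((1/2:ℝ) ^ i) ^ k := by
      rw [← mul_pow]
      refine pow_le_pow_left₀ (abs_nonneg _) ?_ k
      refine (hv.dom.nice.abs_le hΛ0.le hv.dom.zero (ball_subset_ball (hr1 i) hx)).trans ?_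
      gcongr
    have h4 : |σ x ^ k * (q I x - q i x)| ≤ (2 * Λ) ^ k * ((1/2:ℝ) ^ i) ^ k *
        ((k + 1 : ℕ) * (K₁ * N * ((1/2:ℝ) ^ i) ^ (k + θ / 2 : ℝ))) := by
      rw [abs_mul, abs_pow]; gcongr
    have e : f x = (v x - σ x ^ k * q i x) - σ x ^ k * (q I x - q i x) := by rw [hf]; ring
    rw [e]
    refine (abs_sub _ _).trans ((add_le_add h1 h4).trans_eq ?_)
    rw [hD₁, hs1]; ring
  have hκ : |-κ'| ≤ D₃ * N * ((1/2:ℝ) ^ I) ^ (θ / 2) := by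
    obtain ⟨r, hrdef⟩ : ∃ r : ℝ, r = (1/2) ^ I := ⟨_, rfl⟩
    have hr0 : 0 < r := hrdef ▸ hr I
    have hrle : r ≤ 1 := hrdef ▸ hr1 I
    obtain ⟨x, hx1, hx2⟩ := hv.dom.nice.exists_ball hΛ hv.dom.zero hr0 hrle
    rw [← hc] at hx1 hx2
    have hmem : ∀ y ∈ ball (0:E) c, x + r • y ∈ ball x (c * r) := fun y hy => by
      rw [mem_ball_zero_iff] at hy
      rw [mem_ball_iff_norm, add_sub_cancel_left, norm_smul, Real.norm_eq_abs, abs_of_pos hr0]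
      nlinarith
    have hpos : ∀ y ∈ ball (0:E) c, 0 < σ (x + r • y) := fun y hy =>
      lt_of_lt_of_le (by positivity) (hx2 _ (hmem y hy))
    have hin : ∀ y ∈ ball (0:E) c, x + r • y ∈ ball (0:E) r := fun y hy => hx1 (hmem y hy)
    have hin1 : ∀ y ∈ ball (0:E) c, x + r • y ∈ ball (0:E) 1 := fun y hy =>
      ball_subset_ball hrle (hin y hy)
    have hs2' := hs2 I
    have hqb := (hq I le_rfl).2
    rw [← hrdef] at hs2' hqb ⊢
    have h1 := hcb (fun y => f (x + r • y)) 0 (N * r ^ (2 * k + θ / 2 : ℝ))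
      (r ^ (2 * k) * (D₂ * N * r ^ (θ / 2))) (r ^ (2 * k) * -κ')
      (hfs.comp (by fun_prop) fun y hy => ⟨hin1 y hy, hpos y hy⟩)
      (fun y hy => by rw [← hfx]; exact hqb _ (hin y hy) (hpos y hy))
      (fun y hy => by
        rw [lapI_comp_affine, ← mul_sub, abs_mul, abs_of_pos (by positivity)]
        refine mul_le_mul_of_nonneg_left ((hlap _ (hin1 y hy) (hpos y hy)).trans ?_) (by positivity)
        have h2 : ‖x + r • y‖ ^ θ ≤ r ^ θ :=
          Real.rpow_le_rpow (norm_nonneg _) (mem_ball_zero_iff.1 (hin y hy)).le hθ.le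
        have h3 : r ^ θ ≤ r ^ (θ / 2) :=
          Real.rpow_le_rpow_of_exponent_ge hr0 hrle (by linarith)
        have := h2.trans h3
        gcongr)
    rw [abs_mul, abs_of_pos (by positivity), hs2'] at h1
    have hp : 0 < r ^ (2 * k) := by positivity
    refine le_of_mul_le_mul_left (h1.trans_eq ?_) hp
    rw [hD₃]; ring
  refine ⟨-κ', hκ.trans (by gcongr; linarith), fun x hx h0 => (hlap x hx h0).trans (by
    gcongr; linarith), fun i hi => ⟨fun x hx h0 => (hbd i hi x hx h0).trans (by
      gcongr; linarith), fun x hx h0 => ?_⟩⟩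
  have hsub : ball (0:E) ((1/2) ^ i) ⊆ ball 0 1 := ball_subset_ball (hr1 i)
  refine (hdec σ f ((1/2) ^ i) _ ((D₃ + D₂) * N * ((1/2:ℝ) ^ i) ^ (θ / 2)) (hr i) (hr1 i)
    hv.dom.nice (hfs.mono (inter_subset_inter_left _ hsub)) (hbd i hi) (fun y hy hy0 => ?_) ?_
    x hx h0).trans ?_
  · have h1 := hlap y (hsub hy) hy0
    have h2 : ‖y‖ ^ θ ≤ ((1/2:ℝ) ^ i) ^ θ :=
      Real.rpow_le_rpow (norm_nonneg _) (mem_ball_zero_iff.1 hy).le hθ.le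
    have h3 : ((1/2:ℝ) ^ i) ^ θ ≤ ((1/2:ℝ) ^ i) ^ (θ / 2) :=
      Real.rpow_le_rpow_of_exponent_ge (hr i) (hr1 i) (by linarith)
    have h4 : ((1/2:ℝ) ^ I) ^ (θ / 2) ≤ ((1/2:ℝ) ^ i) ^ (θ / 2) :=
      Real.rpow_le_rpow (hr I).le (pow_le_pow_of_le_one (by norm_num) (by norm_num) hi)
        (by positivity)
    have h5 : D₂ * N * ‖y‖ ^ θ ≤ D₂ * N * ((1/2:ℝ) ^ i) ^ (θ / 2) := by
      have := h2.trans h3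
      gcongr
    have h6 : D₃ * N * ((1/2:ℝ) ^ I) ^ (θ / 2) ≤ D₃ * N * ((1/2:ℝ) ^ i) ^ (θ / 2) := by gcongr
    have h7 : (lap b)^[k] f y = ((lap b)^[k] f y - -κ') + -κ' := by ring
    rw [h7]
    refine (abs_add_le _ _).trans ((add_le_add h1 hκ).trans ?_)
    linarith
  · obtain ⟨C, hC⟩ := hv.decay
    obtain ⟨M, hM⟩ := (isCompact_closedBall (0:E) 1).exists_bound_of_continuousOn
      (hqI.smooth.continuous.continuousOn)
    refine ⟨C + (2 * Λ) ^ (1/4 : ℝ) * M, fun y hy hy0 => ?_⟩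
    have h1 := hC y (hsub hy) hy0
    have h2 := hM y (ball_subset_closedBall (hsub hy))
    have h3 : σ y ≤ 2 * Λ := by
      refine (le_abs_self _).trans ((hv.dom.nice.abs_le hΛ0.le hv.dom.zero (hsub hy)).trans ?_)
      have := (mem_ball_zero_iff.1 (hsub hy)).le
      exact mul_le_of_le_one_right (by positivity) this
    have h4 : σ y ^ k = σ y ^ (k - 1/4 : ℝ) * σ y ^ (1/4 : ℝ) := by
      rw [← Real.rpow_add hy0, ← Real.rpow_natCast]; congr 1; ring
    have h5 : |σ y ^ k * q I y| ≤ σ y ^ (k - 1/4 : ℝ) * (2 * Λ) ^ (1/4 : ℝ) * M := by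
      rw [abs_mul, abs_of_pos (pow_pos hy0 k), h4]
      gcongr
      exact h2
    rw [← hfx]
    refine (abs_sub _ _).trans ((add_le_add h1 h5).trans_eq ?_)
    ring
  · have hσ0 : 0 ≤ (σ x / (1/2) ^ i) ^ (k - 1/4 : ℝ) := Real.rpow_nonneg (by positivity) _
    refine mul_le_mul_of_nonneg_right ?_ hσ0
    calc _ = D₄ * N * ((1/2:ℝ) ^ i) ^ (2 * k + θ / 2 : ℝ) := by rw [hs2, hD₄]; ring
      _ ≤ _ := by gcongr; linarith

end BoundaryScales

section BoundaryBlowup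

variable {ι : Type*} [Fintype ι] (b : OrthonormalBasis ι ℝ E)

theorem exists_approx_blowup [Nontrivial E] (k : ℕ) (hk : 1 ≤ k) {θ Λ : ℝ} (hθ : 0 < θ)
    (hθ1 : θ ≤ 1) (hΛ : 1 ≤ Λ) : ∃ K, 1 ≤ K ∧ ∀ (σ v : E → ℝ) (N : ℝ) (i : ℕ),
      DirFun b k θ Λ σ v → 1 ≤ N →
      (∀ q, IsPol k q → ∃ x ∈ ball (0:E) ((1/2) ^ i), 0 < σ x ∧
        N * ((1/2:ℝ) ^ i) ^ (2 * k + θ / 2 : ℝ) < |v x - σ x ^ k * q x|) →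
      ∃ (w σ' : E → ℝ) (ℓ : E →L[ℝ] ℝ) (κ : ℝ) (I : ℕ),
        N < ((2:ℝ) ^ (I + 1)) ^ (2 * k + θ / 2 : ℝ) ∧ |κ| ≤ K ∧ ‖ℓ‖ ≤ Λ ∧ Λ⁻¹ ≤ ‖ℓ‖ ∧
        (∀ y, ‖y‖ < 2 ^ I → |σ' y - ℓ y| ≤ Λ * (1/2) ^ I * ‖y‖ ^ 2) ∧
        ContDiffOn ℝ (2 * k : ℕ) w (ball (0:E) (2 ^ I) ∩ {y | 0 < σ' y}) ∧
        (∀ y, ‖y‖ < 2 ^ I → 0 < σ' y →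
          |(lap b)^[k] w y - κ| ≤ K * ((1/2:ℝ) ^ I) ^ (θ / 2) * ‖y‖ ^ θ) ∧
        (∀ m ≤ I, ∀ y, ‖y‖ < 2 ^ m → 0 < σ' y → |w y| ≤ K * ((2:ℝ) ^ m) ^ (2 * k + θ / 2 : ℝ)) ∧
        (∀ m ≤ I, ∀ y, ‖y‖ < 2 ^ m / 2 → 0 < σ' y →
          |w y| ≤ K * ((2:ℝ) ^ m) ^ (2 * k + θ / 2 : ℝ) * (σ' y / 2 ^ m) ^ (k - 1/4 : ℝ)) ∧
        ∀ q, IsPol k q → ∃ y ∈ ball (0:E) (1/2), 0 < σ' y ∧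
          (1/2:ℝ) ^ (2 * k + θ / 2 : ℝ) < |w y - σ' y ^ k * q y| := by
  have hΛ0 : 0 < Λ := by linarith
  obtain ⟨K, hK, hb⟩ := exists_scale_bounds (b := b) k hk hθ hθ1 hΛ
  refine ⟨K, hK, fun σ v N i hv hN hfail => ?_⟩
  have hN0 : 0 < N := by linarith
  obtain ⟨s, hs⟩ : ∃ s : ℝ, s = 2 * k + θ / 2 := ⟨_, rfl⟩
  rw [← hs] at hfail ⊢
  have hs0 : 0 < s := by rw [hs]; positivity
  have hr1 : ∀ i : ℕ, ((1/2:ℝ) ^ i) ≤ 1 := fun i => pow_le_one₀ (by norm_num) (by norm_num)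
  classical
  obtain ⟨I, hI1, hI2⟩ : ∃ I : ℕ, (∀ q, IsPol k q → ∃ x ∈ ball (0:E) ((1/2) ^ (I + 1)), 0 < σ x ∧
        N * ((1/2:ℝ) ^ (I + 1)) ^ s < |v x - σ x ^ k * q x|) ∧ ∀ i ≤ I, ∃ q, IsPol k q ∧
        ∀ x ∈ ball (0:E) ((1/2) ^ i), 0 < σ x →
          |v x - σ x ^ k * q x| ≤ N * ((1/2:ℝ) ^ i) ^ s := by
    have hex : ∃ i : ℕ, ∀ q, IsPol k q → ∃ x ∈ ball (0:E) ((1/2) ^ i), 0 < σ x ∧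
        N * ((1/2:ℝ) ^ i) ^ s < |v x - σ x ^ k * q x| := ⟨i, hfail⟩
    have h1 := Nat.find_spec hex
    have h2 := fun m => Nat.find_min hex (m := m)
    rcases h : Nat.find hex with _ | I
    · rw [h] at h1
      obtain ⟨x, hx, hx0, hlt⟩ := h1 _ IsPol.zero'
      rw [pow_zero] at hx hlt
      rw [Real.one_rpow, mul_zero, sub_zero] at hlt
      linarith [hv.bound x hx hx0]
    · rw [h] at h1 h2
      refine ⟨I, h1, fun i hi => ?_⟩
      have := h2 i (by omega)
      push Not at this
      exact this
  have hex : ∀ i, ∃ q, i ≤ I → IsPol k q ∧ ∀ x ∈ ball (0:E) ((1/2) ^ i), 0 < σ x →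
      |v x - σ x ^ k * q x| ≤ N * ((1/2:ℝ) ^ i) ^ s := fun i => by
    by_cases hi : i ≤ I
    · obtain ⟨q, hq⟩ := hI2 i hi
      exact ⟨q, fun _ => hq⟩
    · exact ⟨fun _ => 0, fun h => absurd h hi⟩
  choose q hq using hex
  obtain ⟨κ, hκ, hlap, hsc⟩ := hb σ v q I N hv hN (by rw [← hs]; exact hq)
  rw [← hs] at hsc
  have hqI := (hq I le_rfl).1
  obtain ⟨r, hr⟩ : ∃ r : ℝ, r = (1/2) ^ I := ⟨_, rfl⟩
  have hr0 : 0 < r := by rw [hr]; positivity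
  have hrle : r ≤ 1 := hr ▸ hr1 I
  have hr2 : r * 2 ^ I = 1 := by rw [hr, ← mul_pow]; norm_num
  have hrI : ∀ m ≤ I, r * 2 ^ m = (1/2) ^ (I - m) := fun m hm => by
    obtain ⟨j, rfl⟩ := Nat.exists_eq_add_of_le hm
    rw [hr, Nat.add_sub_cancel_left, pow_add, mul_right_comm, ← mul_pow]
    norm_num
  obtain ⟨A, hA⟩ : ∃ A, A = (N * r ^ s)⁻¹ := ⟨_, rfl⟩
  have hA0 : 0 < A := by rw [hA]; positivity
  have hrs : r ^ s = r ^ (2 * k) * r ^ (θ / 2) := by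
    rw [hs, Real.rpow_add hr0, ← Real.rpow_natCast _ (2 * k)]; norm_cast
  have hAr : A * r ^ (2 * k) = (N * r ^ (θ / 2))⁻¹ := by
    have := (pow_pos hr0 (2 * k)).ne'
    rw [hA, hrs]; field_simp
  obtain ⟨f, hf⟩ : ∃ f : E → ℝ, f = fun x => v x - σ x ^ k * q I x := ⟨_, rfl⟩
  have hfs : ContDiffOn ℝ (2 * k : ℕ) f (ball (0:E) 1 ∩ {x | 0 < σ x}) :=
    hf ▸ hv.smooth.sub ((hv.dom.smooth.pow k).mul (hqI.contDiff _)).contDiffOn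
  have hfx : ∀ x, v x - σ x ^ k * q I x = f x := fun x => by rw [hf]
  simp only [hfx] at hlap hsc
  have hmem : ∀ (t : ℝ) (y : E), ‖y‖ < t → (0:E) + r • y ∈ ball (0:E) (r * t) := fun t y hy => by
    rw [zero_add, mem_ball_zero_iff, norm_smul, Real.norm_eq_abs, abs_of_pos hr0]
    exact mul_lt_mul_of_pos_left hy hr0
  have hmem1 : ∀ y : E, ‖y‖ < 2 ^ I → (0:E) + r • y ∈ ball (0:E) 1 := fun y hy => by
    have := hmem _ y hy
    rwa [hr2] at this
  have hpos : ∀ y : E, 0 < r⁻¹ * σ (r • y) → 0 < σ ((0:E) + r • y) := fun y hy => by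
    rw [zero_add]; exact (pos_iff_pos_of_mul_pos hy).1 (inv_pos.2 hr0)
  have hAs : ∀ m ≤ I, A * (K * N * ((1/2:ℝ) ^ (I - m)) ^ s) = K * ((2:ℝ) ^ m) ^ s := by
    intro m hm
    have := (Real.rpow_pos_of_pos hr0 s).ne'
    rw [← hrI m hm, Real.mul_rpow hr0.le (by positivity), hA]
    field_simp
  have h0' := mem_ball_self (x := (0:E)) one_pos
  refine ⟨fun y => A * f (0 + r • y), fun y => r⁻¹ * σ (r • y), fderiv ℝ σ 0,
    A * (r ^ (2 * k) * κ), I, ?_, ?_, hv.dom.nice.le 0 h0', hv.dom.nice.ge 0 h0', fun y hy => ?_,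
    ?_, fun y hy hy0 => ?_, fun m hm y hy hy0 => ?_, fun m hm y hy hy0 => ?_, fun p hp => ?_⟩
  · obtain ⟨x, hx, hx0, hlt⟩ := hI1 _ IsPol.zero'
    rw [mul_zero, sub_zero] at hlt
    have h1 := hlt.trans_le (hv.bound x (ball_subset_ball (hr1 _) hx) hx0)
    rw [one_div, inv_pow, Real.inv_rpow (by positivity), ← div_eq_mul_inv,
      div_lt_one (by positivity)] at h1
    exact h1
  · rw [← mul_assoc, hAr, abs_mul, abs_of_pos (by positivity), inv_mul_le_iff₀ (by positivity)]
    refine hκ.trans_eq ?_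
    rw [hr]; ring
  · have h1 := hv.dom.nice.taylor hΛ0.le h0' (hmem1 y hy)
    rw [hv.dom.zero, sub_zero, sub_zero, zero_add, map_smul, smul_eq_mul, norm_smul,
      Real.norm_eq_abs, abs_of_pos hr0] at h1
    rw [← hr, show r⁻¹ * σ (r • y) - fderiv ℝ σ 0 y =
      r⁻¹ * (σ (r • y) - r * fderiv ℝ σ 0 y) by field_simp, abs_mul, abs_inv, abs_of_pos hr0,
      inv_mul_le_iff₀ hr0]
    refine h1.trans_eq ?_
    ring
  · exact contDiffOn_const.mul (hfs.comp (by fun_prop) fun y hy =>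
      ⟨hmem1 y (mem_ball_zero_iff.1 hy.1), hpos y hy.2⟩)
  · have h1 := hlap _ (hmem1 y hy) (hpos y hy0)
    rw [lapI_const_mul, lapI_comp_affine]
    dsimp only
    rw [← mul_sub, ← mul_sub, ← mul_assoc, hAr, abs_mul, abs_of_pos (by positivity),
      inv_mul_le_iff₀ (by positivity)]
    refine h1.trans_eq ?_
    have h2 : r ^ θ = r ^ (θ / 2) * r ^ (θ / 2) := by rw [← Real.rpow_add hr0]; ring_nf
    rw [zero_add, norm_smul, Real.norm_eq_abs, abs_of_pos hr0,
      Real.mul_rpow hr0.le (norm_nonneg _), ← hr, h2]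
    ring
  · have h1 := (hsc (I - m) (by omega)).1 _ (hrI m hm ▸ hmem _ y hy) (hpos y hy0)
    rw [abs_mul, abs_of_pos hA0, ← hAs m hm]
    gcongr
  · have h1 := (hsc (I - m) (by omega)).2 _ (by
      rw [← hrI m hm, mul_div_assoc]; exact hmem _ y hy) (hpos y hy0)
    rw [abs_mul, abs_of_pos hA0, ← hAs m hm, mul_assoc A]
    refine mul_le_mul_of_nonneg_left (h1.trans_eq ?_) hA0.le
    rw [← hrI m hm, zero_add]
    congr 2
    field_simp
  · have hp' : IsPol k (fun x => q I x + (N * r ^ s * (r⁻¹) ^ k) * p (r⁻¹ • x)) := by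
      refine hqI.add ?_
      have := (IsPol.const (d := 0) (E := E) (N * r ^ s * (r⁻¹) ^ k)).mul (hp.comp_smul r⁻¹)
      rwa [zero_add] at this
    obtain ⟨x, hx, hx0, hlt⟩ := hI1 _ hp'
    have hx' : r • r⁻¹ • x = x := smul_inv_smul₀ hr0.ne' x
    refine ⟨r⁻¹ • x, ?_, ?_, ?_⟩
    · rw [mem_ball_zero_iff] at hx ⊢
      rw [norm_smul, norm_inv, Real.norm_eq_abs, abs_of_pos hr0, inv_mul_lt_iff₀ hr0, hr,
        ← pow_succ]
      exact hx
    · dsimp only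
      rw [hx']; positivity
    · dsimp only
      rw [hx', zero_add, ← hfx]
      have e1 : ((1/2:ℝ) ^ (I + 1)) ^ s = r ^ s * (1/2) ^ s := by
        rw [pow_succ, ← hr, Real.mul_rpow hr0.le (by norm_num)]
      have e2 : A * (v x - σ x ^ k * q I x) - (r⁻¹ * σ x) ^ k * p (r⁻¹ • x) =
          A * (v x - σ x ^ k * (q I x + N * r ^ s * r⁻¹ ^ k * p (r⁻¹ • x))) := by
        have : A * (N * r ^ s) = 1 := by rw [hA]; exact inv_mul_cancel₀ (by positivity)
        rw [mul_pow]
        linear_combination (σ x ^ k * r⁻¹ ^ k * p (r⁻¹ • x)) * this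
      rw [e2, abs_mul, abs_of_pos hA0]
      rw [e1] at hlt
      have : A * (N * (r ^ s * (1/2) ^ s)) < A * _ := mul_lt_mul_of_pos_left hlt hA0
      refine lt_of_eq_of_lt ?_ this
      rw [hA]; field_simp

end BoundaryBlowup

section BoundaryApproximation

variable {ι : Type*} [Fintype ι] (b : OrthonormalBasis ι ℝ E)

theorem exists_pol_of_dl_eq_zero {U : Set E} (hU : IsOpen U) (hc : Convex ℝ U) {x₀ : E}
    (hx₀ : x₀ ∈ U) {d : ℕ} {q : E → ℝ} (hq : ContDiffOn ℝ ∞ q U)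
    (h : ∀ L : List E, L.length = d + 1 → ∀ x ∈ U, dl L q x = 0) :
    ∃ P, IsPol d P ∧ EqOn q P U := by
  have hq' : ∀ m : ℕ, ContDiffOn ℝ m q U := fun m => hq.of_le ENat.LEInfty.out
  obtain ⟨P, hP, hj⟩ := exists_taylor hU (hq' d) hx₀
  have hsub : ∀ (m : ℕ), ∀ x ∈ U, iteratedFDeriv ℝ m (fun x => q x - P x) x =
      iteratedFDeriv ℝ m q x - iteratedFDeriv ℝ m P x := fun m x hx =>
    fun_iteratedFDeriv_sub_apply ((hq' m).contDiffAt (hU.mem_nhds hx)) (hP.contDiff m).contDiffAt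
  have hz : ∀ m ≤ d + 1, ∀ x ∈ U, iteratedFDeriv ℝ m (fun x => q x - P x) x = 0 := by
    intro m hm
    induction hm using Nat.decreasingInduction with
    | self =>
      intro x hx
      have := norm_iteratedFDeriv_le_of_dl hU (hq' (d + 1)) hx le_rfl
        (fun L hL => by rw [h L hL x hx]; simp)
      rw [hsub _ x hx, hP.zero, sub_zero]
      exact norm_le_zero_iff.1 this
    | of_succ m hm ih =>
      intro x hx
      have hseg := hc.segment_subset hx₀ hx
      have := norm_iteratedFDeriv_sub_le hU ((hq' (m + 1)).sub (hP.contDiff _).contDiffOn) hseg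
        (B := 0) (fun z hz => by rw [ih z (hseg hz), norm_zero])
      rw [zero_mul] at this
      rw [sub_eq_zero.1 (norm_le_zero_iff.1 this), hsub _ _ hx₀,
        hj m (by omega), sub_self]
  refine ⟨P, hP, fun x hx => ?_⟩
  have := congrArg norm (hz 0 (Nat.zero_le _) x hx)
  rw [norm_iteratedFDeriv_zero, norm_zero, norm_eq_zero, sub_eq_zero] at this
  exact this

variable {b}

/-- Polyharmonic functions with Dirichlet data are approximated near a boundary point by
`σ ^ k` times polynomials of degree `k`. -/
theorem exists_approx [Nontrivial E] (k : ℕ) (hk : 1 ≤ k) {θ Λ : ℝ} (hθ : 0 < θ)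
    (hθ1 : θ ≤ 1) (hΛ : 1 ≤ Λ) : ∃ N, 1 ≤ N ∧ ∀ (σ v : E → ℝ), DirFun b k θ Λ σ v → ∀ i : ℕ,
      ∃ q, IsPol k q ∧ ∀ x ∈ ball (0:E) ((1/2) ^ i), 0 < σ x →
        |v x - σ x ^ k * q x| ≤ N * ((1/2:ℝ) ^ i) ^ (2 * k + θ / 2 : ℝ) := by
  by_contra hcon
  push Not at hcon
  have hΛ0 : 0 < Λ := by linarith
  obtain ⟨K, hK, hblow⟩ := exists_approx_blowup b k hk hθ hθ1 hΛ
  have hK0 : 0 < K := by linarith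
  obtain ⟨s₂, hs₂⟩ : ∃ s : ℝ, s = 2 * k + θ / 2 := ⟨_, rfl⟩
  obtain ⟨s, hs⟩ : ∃ s : ℝ, s = k - 1/4 := ⟨_, rfl⟩
  have hk1 : (1:ℝ) ≤ k := by exact_mod_cast hk
  have hs20 : 0 < s₂ := by rw [hs₂]; positivity
  have hs0 : 0 < s := by rw [hs]; linarith
  simp only [← hs₂, ← hs] at hcon hblow
  have hj1 : ∀ j : ℕ, (1:ℝ) ≤ j + 1 := fun j => by linarith [Nat.cast_nonneg (α := ℝ) j]
  choose σ v hv i hi using fun j : ℕ => hcon (j + 1) (hj1 j)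
  have hex := fun j : ℕ => hblow (σ j) (v j) (j + 1) (i j) (hv j) (hj1 j) (hi j)
  choose w σ' ℓ κ I hI hκ hℓΛ hℓge hσ hw hlap hwb hwd hbad using hex
  let 𝒰 : Ultrafilter ℕ := hyperfilter ℕ
  have h𝒰 : (𝒰 : Filter ℕ) ≤ atTop := Nat.hyperfilter_le_atTop
  obtain ⟨ℓ₀, hℓt, hlim⟩ := exists_tendsto_linear 𝒰 hℓΛ
  have hℓ0 : Λ⁻¹ ≤ ‖ℓ₀‖ := ge_of_tendsto hℓt.norm (Eventually.of_forall hℓge)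
  have hℓ1 : ‖ℓ₀‖ ≤ Λ := le_of_tendsto hℓt.norm (Eventually.of_forall hℓΛ)
  have hℓne : ℓ₀ ≠ 0 := fun h => by
    rw [h, norm_zero] at hℓ0
    exact absurd hℓ0 (not_le.2 (inv_pos.2 hΛ0))
  obtain ⟨κ₀, hκ₀⟩ := 𝒰.exists_tendsto_of_eventually_abs_le (Eventually.of_forall hκ)
  have hκK : |κ₀| ≤ K := le_of_tendsto hκ₀.abs (Eventually.of_forall hκ)
  have hIt : Tendsto I 𝒰 atTop := by
    refine tendsto_atTop.2 fun m => ?_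
    obtain ⟨j₀, hj₀⟩ := exists_nat_gt (((2:ℝ) ^ (m + 1)) ^ s₂)
    filter_upwards [h𝒰 (eventually_ge_atTop j₀)] with j hj
    by_contra hcon
    have h1 : ((2:ℝ) ^ (I j + 1)) ^ s₂ ≤ ((2:ℝ) ^ (m + 1)) ^ s₂ :=
      Real.rpow_le_rpow (by positivity) (pow_le_pow_right₀ (by norm_num) (by omega)) hs20.le
    have hj' : (j₀:ℝ) ≤ j := by exact_mod_cast hj
    linarith [hI j]
  have hpowt : Tendsto (fun j => (1/2:ℝ) ^ I j) 𝒰 (𝓝 0) :=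
    (tendsto_pow_atTop_nhds_zero_of_lt_one (by norm_num) (by norm_num)).comp hIt
  have h2t : ∀ T : ℝ, ∀ᶠ j in (𝒰 : Filter ℕ), T < 2 ^ I j := fun T =>
    ((tendsto_pow_atTop_atTop_of_one_lt one_lt_two).comp hIt).eventually_gt_atTop T
  have hunif : ∀ (T ε : ℝ), 0 < ε → ∀ᶠ j in (𝒰 : Filter ℕ), T < 2 ^ I j ∧
      ∀ y, ‖y‖ ≤ T → |σ' j y - ℓ₀ y| < ε := by
    simpa using hlim (c := 0) hΛ0.le (fun j => by positivity) hpowt h2t (by simpa using hσ)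
  obtain ⟨c, hc⟩ := exists_lapI_linear_pow b hℓne k
  obtain ⟨p, hp⟩ : ∃ p : E → ℝ, p = fun y => c * ℓ₀ y ^ (2 * k) := ⟨_, rfl⟩
  rw [← hp] at hc
  have hps : ContDiff ℝ ∞ p := by rw [hp]; exact contDiff_const.mul (ℓ₀.contDiff.pow _)
  let H : Set E := {y | 0 < ℓ₀ y}
  have hH : IsOpen H := isOpen_lt continuous_const ℓ₀.continuous
  obtain ⟨u', hus, hu0, hut'⟩ := exists_limit b k hk 𝒰 (w := fun j y => w j y - κ j * p y) hH (by
    intro x hx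
    obtain ⟨ε, hε⟩ : ∃ ε, ε = ℓ₀ x / 2 := ⟨_, rfl⟩
    have hε0 : 0 < ε := by rw [hε]; exact div_pos hx (by norm_num)
    obtain ⟨T, hT, hTb⟩ := Metric.continuousAt_iff.1 (ℓ₀.continuous.continuousAt (x := x)) ε hε0
    obtain ⟨M, hM⟩ := (isCompact_closedBall x T).exists_bound_of_continuousOn
      hps.continuous.continuousOn
    obtain ⟨m, hm⟩ := pow_unbounded_of_one_lt (‖x‖ + T) (one_lt_two (α := ℝ))
    refine ⟨T, hT, K * ((2:ℝ) ^ m) ^ s₂ + K * M,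
      fun j => K * ((1/2:ℝ) ^ I j) ^ (θ / 2) * (‖x‖ + T) ^ θ, ?_, ?_⟩
    · have := (hpowt.rpow_const (p := θ / 2) (Or.inr (by positivity)))
      rw [Real.zero_rpow (by positivity)] at this
      simpa using (this.const_mul K).mul_const ((‖x‖ + T) ^ θ)
    · filter_upwards [hunif (‖x‖ + T) ε hε0, hIt.eventually_ge_atTop m] with j ⟨hj1, hj2⟩ hmj
      have hyn : ∀ y ∈ ball x T, ‖y‖ ≤ ‖x‖ + T := fun y hy => by
        have := norm_le_norm_add_norm_sub' y x
        rw [mem_ball, dist_eq_norm] at hy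
        linarith
      have hy : ∀ y ∈ ball x T, 0 < σ' j y := by
        intro y hy
        have h2 := abs_lt.1 (hj2 y (hyn y hy))
        have h3 := hTb hy
        rw [Real.dist_eq] at h3
        have h4 := abs_lt.1 h3
        linarith
      have hwj : ContDiffOn ℝ (2 * k : ℕ) (w j) (ball x T) := (hw j).mono fun y hyb =>
        ⟨by simpa using (hyn y hyb).trans_lt hj1, hy y hyb⟩
      have hpj : ContDiffOn ℝ (2 * k : ℕ) (fun y => κ j * p y) (ball x T) :=
        (contDiff_const.mul (hps.of_le ENat.LEInfty.out)).contDiffOn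
      refine ⟨hwj.sub hpj, fun y hyb => ?_, fun y hyb => ?_⟩
      · refine (abs_sub _ _).trans (add_le_add (hwb j m hmj y ((hyn y hyb).trans_lt hm)
          (hy y hyb)) ?_)
        rw [abs_mul]
        exact mul_le_mul (hκ j) (hM y (ball_subset_closedBall hyb)) (abs_nonneg _) hK0.le
      · rw [lapI_sub b isOpen_ball hwj hpj hyb, lapI_const_mul, hc]
        dsimp only
        rw [mul_one]
        refine (hlap j y ((hyn y hyb).trans_lt hj1) (hy y hyb)).trans ?_
        have := hyn y hyb
        gcongr)
  obtain ⟨u, hu⟩ : ∃ u : E → ℝ, u = fun y => u' y + κ₀ * p y := ⟨_, rfl⟩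
  have hut : ∀ x ∈ H, ∀ y : ℕ → E, Tendsto y 𝒰 (𝓝 x) →
      Tendsto (fun j => w j (y j)) 𝒰 (𝓝 (u x)) := by
    intro x hx y hy
    have h1 := (hut' x hx y hy).add
      (hκ₀.mul ((hps.continuous.tendsto x).comp hy))
    rw [hu]
    refine h1.congr fun j => ?_
    simp
  have hσt : ∀ (x : E) (y : ℕ → E), Tendsto y 𝒰 (𝓝 x) →
      Tendsto (fun j => σ' j (y j)) 𝒰 (𝓝 (ℓ₀ x)) := by
    intro x y hy
    have h1 : Tendsto (fun j => σ' j (y j) - ℓ₀ (y j)) 𝒰 (𝓝 0) := by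
      refine Metric.tendsto_nhds.2 fun ε hε => ?_
      filter_upwards [hunif (‖x‖ + 1) ε hε, hy.norm.eventually_le_const (lt_add_one ‖x‖)] with j h1 h2
      rw [Real.dist_eq, sub_zero]
      exact h1.2 _ h2
    have h2 := h1.add ((ℓ₀.continuous.tendsto x).comp hy)
    rw [zero_add] at h2
    exact h2.congr fun j => by simp
  have hub : ∀ y ∈ H, |u y| ≤ K * (4 * (1 + ‖y‖)) ^ s₂ ∧
      |u y| ≤ K * (4 * (1 + ‖y‖)) ^ s₂ * ℓ₀ y ^ s := by
    intro y hy
    have hy0 : 0 < ℓ₀ y := hy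
    obtain ⟨m, hm1, hm2⟩ := exists_nat_pow_near (x := 1 + ‖y‖) (by linarith [norm_nonneg y])
      (one_lt_two (α := ℝ))
    have hm3 : (2:ℝ) ^ (m + 2) ≤ 4 * (1 + ‖y‖) := by rw [pow_add]; linarith
    have hm4 : ‖y‖ < 2 ^ (m + 2) / 2 := by rw [pow_succ]; linarith
    have hm5 : (1:ℝ) ≤ 2 ^ (m + 2) := one_le_pow₀ one_le_two
    have h1 := (hut y hy (fun _ => y) tendsto_const_nhds).abs
    have h2 := hσt y (fun _ => y) tendsto_const_nhds
    have hK4 : K * ((2:ℝ) ^ (m + 2)) ^ s₂ ≤ K * (4 * (1 + ‖y‖)) ^ s₂ := by gcongr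
    constructor
    · refine (le_of_tendsto h1 ?_).trans hK4
      filter_upwards [hIt.eventually_ge_atTop (m + 2), h2 (lt_mem_nhds hy0)] with j hj hj2
      exact hwb j (m + 2) hj y (by linarith) hj2
    · have h3 := ((h2.div_const (2 ^ (m + 2))).rpow_const (p := s) (Or.inr hs0.le)).const_mul
        (K * ((2:ℝ) ^ (m + 2)) ^ s₂)
      refine (le_of_tendsto_of_tendsto h1 h3 ?_).trans ?_
      · filter_upwards [hIt.eventually_ge_atTop (m + 2), h2 (lt_mem_nhds hy0)] with j hj hj2
        exact hwd j (m + 2) hj y hm4 hj2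
      · refine mul_le_mul hK4 (Real.rpow_le_rpow (by positivity) ?_ hs0.le)
          (Real.rpow_nonneg (by positivity) _) (by positivity)
        exact div_le_self hy0.le hm5
  have hℓX : ∀ y, ℓ₀ y ≤ Λ * (1 + ‖y‖) := fun y => by
    have h1 := (le_abs_self _).trans (ℓ₀.le_of_opNorm_le hℓ1 y)
    linarith
  have hu'b : ∀ y, |u' y| ≤ |u y| + K * |c| * |ℓ₀ y| ^ (2 * k) := fun y => by
    have e : u' y = u y - κ₀ * (c * ℓ₀ y ^ (2 * k)) := by rw [hu, hp]; ring
    rw [e]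
    refine (abs_sub _ _).trans ?_
    rw [abs_mul, abs_mul, abs_pow, mul_assoc K]
    gcongr
  let a : E := (InnerProductSpace.toDual ℝ E).symm ℓ₀
  have hal : ∀ y, (inner ℝ a y + 0 : ℝ) = ℓ₀ y := fun y => by
    rw [add_zero]; exact InnerProductSpace.toDual_symm_apply
  have ha : a ≠ 0 := fun h0 => hℓne (by simpa [a] using h0)
  obtain ⟨q', hq's, huq, hq'⟩ := liouville_halfspace b k (2 * k + 1) hk ha 0 (u := u')
    (by simp only [hal]; exact hus) (by simp only [hal]; exact hu0)
    (C := K * 4 ^ (2 * k + 1) + K * |c| * Λ ^ (2 * k + 1)) (fun y hy => by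
      rw [hal] at hy ⊢
      rw [← hs]
      have hX : 1 ≤ 1 + ‖y‖ := by linarith [norm_nonneg y]
      have h1 : (4 * (1 + ‖y‖)) ^ s₂ ≤ 4 ^ (2 * k + 1) * (1 + ‖y‖) ^ (2 * k + 1) := by
        rw [← mul_pow, ← Real.rpow_natCast _ (2 * k + 1)]
        refine Real.rpow_le_rpow_of_exponent_le (by linarith) ?_
        rw [hs₂]; push_cast; linarith
      have h2 : |ℓ₀ y| ^ (2 * k) ≤ ℓ₀ y ^ s * (Λ ^ (2 * k + 1) * (1 + ‖y‖) ^ (2 * k + 1)) := by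
        have e : |ℓ₀ y| ^ (2 * k) = ℓ₀ y ^ s * ℓ₀ y ^ (2 * k - s : ℝ) := by
          rw [abs_of_pos hy, ← Real.rpow_add hy, ← Real.rpow_natCast]
          congr 1; push_cast; ring
        rw [e, ← mul_pow]
        refine mul_le_mul_of_nonneg_left ?_ (Real.rpow_nonneg hy.le _)
        calc _ ≤ (Λ * (1 + ‖y‖)) ^ (2 * k - s : ℝ) :=
              Real.rpow_le_rpow hy.le (hℓX y) (by rw [hs]; linarith)
          _ ≤ (Λ * (1 + ‖y‖)) ^ ((2 * k + 1 : ℕ) : ℝ) :=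
              Real.rpow_le_rpow_of_exponent_le (one_le_mul_of_one_le_of_one_le hΛ hX)
                (by push_cast; linarith)
          _ = _ := Real.rpow_natCast _ _
      have hz : 0 ≤ ℓ₀ y ^ s := Real.rpow_nonneg hy.le _
      calc _ ≤ K * (4 * (1 + ‖y‖)) ^ s₂ * ℓ₀ y ^ s + K * |c| * |ℓ₀ y| ^ (2 * k) :=
            (hu'b y).trans (by gcongr; exact (hub y hy).2)
        _ ≤ K * (4 ^ (2 * k + 1) * (1 + ‖y‖) ^ (2 * k + 1)) * ℓ₀ y ^ s + K * |c| *
            (ℓ₀ y ^ s * (Λ ^ (2 * k + 1) * (1 + ‖y‖) ^ (2 * k + 1))) := by gcongr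
        _ = _ := by ring)
    (g := s₂) (l := k + 1) hs20.le (by rw [hs₂]; push_cast; linarith)
    (D := K * 4 ^ s₂ + K * |c| * Λ ^ s₂) (fun y hy => by
      rw [hal] at hy
      have hX : 1 ≤ 1 + ‖y‖ := by linarith [norm_nonneg y]
      have h1 : |ℓ₀ y| ^ (2 * k) ≤ (Λ * (1 + ‖y‖)) ^ s₂ := by
        rw [abs_of_pos hy]
        calc _ ≤ (Λ * (1 + ‖y‖)) ^ (2 * k) := pow_le_pow_left₀ hy.le (hℓX y) _
          _ = (Λ * (1 + ‖y‖)) ^ ((2 * k : ℕ) : ℝ) := (Real.rpow_natCast _ _).symm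
          _ ≤ _ := Real.rpow_le_rpow_of_exponent_le (one_le_mul_of_one_le_of_one_le hΛ hX)
              (by rw [hs₂]; push_cast; linarith)
      calc _ ≤ K * (4 * (1 + ‖y‖)) ^ s₂ + K * |c| * (Λ * (1 + ‖y‖)) ^ s₂ :=
            (hu'b y).trans (by gcongr; exact (hub y hy).1)
        _ = _ := by
          rw [Real.mul_rpow (by norm_num) (by linarith), Real.mul_rpow hΛ0.le (by linarith)]
          ring)
  simp only [hal] at hq's huq hq'
  have haH : a ∈ H := by
    show 0 < ℓ₀ a
    rw [← hal, add_zero, real_inner_self_eq_norm_sq]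
    exact pow_pos (norm_pos_iff.2 ha) 2
  obtain ⟨P, hP, hqP⟩ := exists_pol_of_dl_eq_zero hH
    (convex_halfSpace_gt ℓ₀.toLinearMap.isLinear 0) haH hq's hq'
  obtain ⟨Q, hQ⟩ : ∃ Q : E → ℝ, Q = fun y => P y + (κ₀ * c) * ℓ₀ y ^ k := ⟨_, rfl⟩
  have hQp : IsPol k Q := by
    rw [hQ]
    refine hP.add ?_
    have := (IsPol.const (d := 0) (E := E) (κ₀ * c)).mul (isPol_linear_pow ℓ₀ k)
    rwa [zero_add] at this
  have huQ : ∀ y ∈ H, u y = ℓ₀ y ^ k * Q y := fun y hy => by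
    rw [hu, hQ, hp]
    dsimp only
    rw [huq y hy, hqP hy]
    ring
  have hbad' := fun j => hbad j Q hQp
  choose y hy hy0 hylt using hbad'
  obtain ⟨y₀, -, hy₀⟩ := (isCompact_closedBall (0 : E) (1/2)).ultrafilter_le_nhds
    (𝒰.map y) (by
      rw [le_principal_iff]
      show y ⁻¹' (closedBall 0 (1/2)) ∈ (𝒰 : Filter ℕ)
      exact Eventually.of_forall fun j => ball_subset_closedBall (hy j))
  have hyt : Tendsto y 𝒰 (𝓝 y₀) := hy₀
  have hσy := hσt y₀ y hyt
  have hσQ : Tendsto (fun j => σ' j (y j) ^ k * Q (y j)) 𝒰 (𝓝 (ℓ₀ y₀ ^ k * Q y₀)) :=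
    (hσy.pow k).mul ((hQp.smooth.continuous.tendsto y₀).comp hyt)
  have hwy : Tendsto (fun j => w j (y j)) 𝒰 (𝓝 (ℓ₀ y₀ ^ k * Q y₀)) := by
    have hnn : 0 ≤ ℓ₀ y₀ := ge_of_tendsto hσy (Eventually.of_forall fun j => (hy0 j).le)
    rcases hnn.eq_or_lt with h | h
    · rw [← h, zero_pow (by omega), zero_mul]
      have h3 := ((hσy.div_const (2 ^ 1)).rpow_const (p := s) (Or.inr hs0.le)).const_mul
        (K * ((2:ℝ) ^ 1) ^ s₂)
      rw [← h, zero_div, Real.zero_rpow hs0.ne', mul_zero] at h3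
      refine squeeze_zero_norm' ?_ h3
      filter_upwards [hIt.eventually_ge_atTop 1] with j hj
      exact hwd j 1 hj _ (by
        have := mem_ball_zero_iff.1 (hy j)
        linarith) (hy0 j)
    · rw [← huQ y₀ h]
      exact hut y₀ h y hyt
  have hfin := (hwy.sub hσQ).abs
  rw [sub_self, abs_zero] at hfin
  have := ge_of_tendsto hfin (Eventually.of_forall fun j => (hylt j).le)
  exact absurd this (not_le.2 (by positivity))

end BoundaryApproximation

section LocalBound

variable {ι : Type*} [Fintype ι] (b : OrthonormalBasis ι ℝ E)

theorem exists_interior_norm (k : ℕ) (hk : 1 ≤ k) (M : ℕ) : ∃ C, 0 ≤ C ∧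
    ∀ m ≤ M, ∀ (V : E → ℝ) (x : E) (T S : ℝ), 0 < T → ContDiffOn ℝ (2 * k : ℕ) V (ball x T) →
      (∀ y ∈ ball x T, (lap b)^[k] V y = 0) → (∀ y ∈ ball x T, |V y| ≤ S) →
      ‖iteratedFDeriv ℝ m V x‖ ≤ C * (S / T ^ m) := by
  obtain ⟨C, hC, h⟩ := exists_interior b k hk
  refine ⟨∑ m ∈ Finset.range (M + 1), C m, Finset.sum_nonneg fun m _ => hC m,
    fun m hm V x T S hT hV h0 hS => ?_⟩
  have hS0 : 0 ≤ S := (abs_nonneg _).trans (hS x (mem_ball_self hT))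
  refine (norm_iteratedFDeriv_le_of_dl isOpen_ball
    ((smooth_of_polyharmonic b isOpen_ball hV h0).of_le ENat.LEInfty.out) (mem_ball_self hT)
    (mul_nonneg (hC m) (by positivity)) (h m V x T S hT hV h0 hS)).trans ?_
  gcongr
  exact Finset.single_le_sum (f := C) (fun m _ => hC m) (Finset.mem_range.2 (by omega))

theorem lapI_eq_zero_of_le {U : Set E} (hU : IsOpen U) {v : E → ℝ} {k j : ℕ} (hkj : k < j)
    (h : ∀ x ∈ U, (lap b)^[k] v x = 0) {x : E} (hx : x ∈ U) : (lap b)^[j] v x = 0 := by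
  obtain ⟨m, rfl⟩ := Nat.exists_eq_add_of_lt hkj
  rw [show k + m + 1 = (m + 1) + k by ring, Function.iterate_add_apply,
    lapI_congr b hU (g := fun _ => 0) h (m + 1) hx]
  exact (IsPol.zero' (d := 0)).lapI_eq_zero b (by omega) x

variable {b}

/-- Bound for the derivatives of polyharmonic functions with Dirichlet data at points whose
nearest boundary point is `0`. -/
theorem exists_local_bound [Nontrivial E] (k : ℕ) (hk : 1 ≤ k) {θ Λ : ℝ} (hθ : 0 < θ)
    (hθ1 : θ ≤ 1) (hΛ : 1 ≤ Λ) : ∃ C, 0 ≤ C ∧ ∀ (σ v : E → ℝ), DirFun b k θ Λ σ v →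
      ∀ x ∈ ball (0:E) (1/4), x ≠ 0 → (∀ y ∈ ball x ‖x‖, 0 < σ y) → ∀ r ≤ 2 * k,
        ‖iteratedFDeriv ℝ r v x‖ ≤ C := by
  obtain ⟨N, hN, happ⟩ := exists_approx (b := b) k hk hθ hθ1 hΛ
  obtain ⟨K₁, hK₁, htel⟩ := exists_telescope (E := E) k hθ hΛ
  obtain ⟨K₂, hK₂, hhx⟩ := exists_hx_bdry (E := E) k hθ (zero_le_one.trans hΛ)
  obtain ⟨d, hd⟩ : ∃ d, d = k * (2 * k) + k := ⟨_, rfl⟩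
  obtain ⟨K₃, hK₃, hint⟩ := exists_interior_norm b (d + 1) (by omega) (2 * k)
  have hN0 : 0 < N := by linarith
  have hB0 : 0 ≤ K₂ * (K₁ * N) := by positivity
  obtain ⟨B, hB⟩ : ∃ B, B = K₂ * (K₁ * N) := ⟨_, rfl⟩
  rw [← hB] at hB0
  refine ⟨K₃ * (N * 4 ^ (2 * k) + B * 2 ^ (2 * k)) + B, by positivity,
    fun σ v hv x hx hx0 hpos r hr => ?_⟩
  choose q hq hqv using happ σ v hv
  rw [mem_ball_zero_iff] at hx
  have hρ : 0 < ‖x‖ := norm_pos_iff.2 hx0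
  obtain ⟨i, hi1, hi2⟩ := exists_nat_pow_near_of_lt_one (x := 2 * ‖x‖) (y := (1/2:ℝ))
    (by positivity) (by linarith) (by norm_num) (by norm_num)
  have hi3 : (1/2:ℝ) ^ i < 4 * ‖x‖ := by rw [pow_succ] at hi1; linarith
  have hi0 : (0:ℝ) < (1/2) ^ i := by positivity
  have hi4 : (1/2:ℝ) ^ i ≤ 1 := pow_le_one₀ (by norm_num) (by norm_num)
  obtain ⟨-, hjet⟩ := htel σ v q i N hN0.le hv.dom.nice hv.dom.zero
    (fun y hy h0 => (hv.bound y hy h0).trans hN) fun j _ => ⟨hq j, hqv j⟩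
  obtain ⟨P, g, hP, -, hPg, hPb, hgb⟩ := hhx σ (q i) (K₁ * N) hv.dom (hq i) (by positivity) hjet
  rw [← hd] at hP
  rw [← hB] at hPb hgb
  have hyn : ∀ y ∈ ball x ‖x‖, ‖y‖ < 2 * ‖x‖ := fun y hy => by
    rw [mem_ball, dist_eq_norm] at hy
    have := norm_le_norm_add_norm_sub' y x
    linarith
  have hy1 : ∀ y ∈ ball x ‖x‖, y ∈ ball (0:E) 1 := fun y hy => by
    rw [mem_ball_zero_iff]; linarith [hyn y hy]
  have hvs : ContDiffOn ℝ (2 * k : ℕ) v (ball x ‖x‖) :=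
    hv.smooth.mono fun y hy => ⟨hy1 y hy, hpos y hy⟩
  have hv0 : ∀ y ∈ ball x ‖x‖, (lap b)^[k] v y = 0 := fun y hy =>
    hv.eq_zero y (hy1 y hy) (hpos y hy)
  have hvs' : ContDiffOn ℝ ∞ v (ball x ‖x‖) := smooth_of_polyharmonic b isOpen_ball hvs hv0
  have hdk : k < d + 1 := by rw [hd]; omega
  have hbd : ‖iteratedFDeriv ℝ r (fun y => v y - P y) x‖ ≤
      K₃ * ((N * 4 ^ (2 * k) + B * 2 ^ (2 * k)) * ‖x‖ ^ (2 * k) / ‖x‖ ^ r) := by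
    refine hint r hr _ x ‖x‖ _ hρ ((hvs'.of_le ENat.LEInfty.out).sub (hP.contDiff _).contDiffOn)
      (fun y hy => ?_) fun y hy => ?_
    · rw [lapI_sub b isOpen_ball (hvs'.of_le ENat.LEInfty.out) (hP.contDiff _).contDiffOn hy]
      show _ - _ = _
      rw [lapI_eq_zero_of_le b isOpen_ball hdk hv0 hy, hP.lapI_eq_zero b (by omega), sub_zero]
    · have h1 := hqv i y (by rw [mem_ball_zero_iff]; linarith [hyn y hy]) (hpos y hy)
      have h2 : N * ((1/2:ℝ) ^ i) ^ (2 * k + θ / 2 : ℝ) ≤ N * (4 * ‖x‖) ^ (2 * k) := by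
        gcongr
        calc _ ≤ ((1/2:ℝ) ^ i) ^ ((2 * k : ℕ) : ℝ) :=
              Real.rpow_le_rpow_of_exponent_ge hi0 hi4 (by push_cast; linarith)
          _ = ((1/2:ℝ) ^ i) ^ (2 * k) := Real.rpow_natCast _ _
          _ ≤ _ := by gcongr
      have h3 := hgb 0 (Nat.zero_le _) y (hy1 y hy)
      rw [norm_iteratedFDeriv_zero, Real.norm_eq_abs] at h3
      have h4 : B * ‖y‖ ^ ((2 * k : ℕ) - (0 : ℕ) + θ : ℝ) ≤ B * (2 * ‖x‖) ^ (2 * k) := by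
        gcongr
        have hpos' : ((2 * k : ℕ) - (0 : ℕ) + θ : ℝ) = ((2 * k : ℕ) : ℝ) + θ := by simp
        rw [hpos']
        calc _ ≤ (2 * ‖x‖) ^ (((2 * k : ℕ) : ℝ) + θ) :=
              Real.rpow_le_rpow (norm_nonneg _) (hyn y hy).le (by positivity)
          _ ≤ (2 * ‖x‖) ^ ((2 * k : ℕ) : ℝ) :=
              Real.rpow_le_rpow_of_exponent_ge (by positivity) (by linarith) (by linarith)
          _ = _ := Real.rpow_natCast _ _
      have h5 : v y - P y = (v y - σ y ^ k * q i y) + g y := by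
        linarith [hPg y]
      rw [h5]
      refine (abs_add_le _ _).trans (((add_le_add (h1.trans h2) (h3.trans h4))).trans_eq ?_)
      rw [mul_pow, mul_pow]; ring
  have hsub : iteratedFDeriv ℝ r (fun y => v y - P y) x =
      iteratedFDeriv ℝ r v x - iteratedFDeriv ℝ r P x :=
    fun_iteratedFDeriv_sub_apply
      ((hvs'.of_le ENat.LEInfty.out).contDiffAt (isOpen_ball.mem_nhds (mem_ball_self hρ)))
      (hP.contDiff r).contDiffAt
  have hle : ‖x‖ ^ (2 * k) / ‖x‖ ^ r ≤ 1 :=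
    div_le_one_of_le₀ (pow_le_pow_of_le_one hρ.le (by linarith) hr) (by positivity)
  rw [← sub_add_cancel (iteratedFDeriv ℝ r v x) (iteratedFDeriv ℝ r P x), ← hsub]
  refine (norm_add_le _ _).trans (add_le_add (hbd.trans ?_) (hPb r x (hy1 x (mem_ball_self hρ))))
  gcongr
  rw [mul_div_assoc]
  exact mul_le_of_le_one_right (by positivity) hle

end LocalBound

section Uniqueness

variable {ι : Type*} [Fintype ι] (b : OrthonormalBasis ι ℝ E)

theorem db_one : DB (univ : Set E) 1 (fun _ => 1) (fun _ => 1) := by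
  refine ⟨contDiffOn_const, fun L => ?_⟩
  cases L with
  | nil => exact ⟨1, zero_le_one, fun x _ => by simp [dl]⟩
  | cons v L =>
    refine ⟨0, le_rfl, fun x _ => ?_⟩
    have : dl (v :: L) (fun _ : E => (1:ℝ)) = fun _ => 0 := by
      rw [dl, show dd v (fun _ : E => (1:ℝ)) = fun _ => 0 from funext fun x => by simp [dd],
        dl_zero]
    rw [this]; simp

theorem exists_caccioppoli_bounded (k : ℕ) (hk : 1 ≤ k) : ∃ C, 0 ≤ C ∧ ∀ ρ u : E → ℝ,
    ContDiff ℝ 1 ρ → IsBounded {x | ρ x < 0} → ContDiffOn ℝ (2 * k : ℕ) u {x | ρ x < 0} →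
    (∀ x, ρ x < 0 → (lap b)^[k] u x = 0) → (∃ D, ∀ x, ρ x < 0 → |u x| ≤ D * |ρ x| ^ k) →
    IntegrableOn (BB b 1 u u) {x | ρ x < 0} ∧
      ∫ x in {x | ρ x < 0}, BB b 1 u u x ≤ C * ∫ x in {x | ρ x < 0}, u x * u x := by
  obtain ⟨C, hC, h⟩ := exists_caccioppoli b k hk (fun _ => zero_le_one) db_one
  refine ⟨C, hC, fun ρ u hρ hb hu h0 ⟨D, hD⟩ => ?_⟩
  obtain ⟨G, hG⟩ : ∃ G, G = {x | ρ x < 0} := ⟨_, rfl⟩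
  have hGm : ∀ x, x ∈ G ↔ ρ x < 0 := fun x => by rw [hG]; rfl
  have hGo : IsOpen G := hG ▸ isOpen_lt hρ.continuous continuous_const
  rw [← hG] at hb hu ⊢
  obtain ⟨M, hM⟩ := hb.subset_closedBall 0
  obtain ⟨L, hL⟩ := (isCompact_closedBall (0:E) (M + 1)).exists_bound_of_continuousOn
    (hρ.continuous_fderiv one_ne_zero).continuousOn
  obtain ⟨A, hA⟩ := (isCompact_closedBall (0:E) (M + 1)).exists_bound_of_continuousOn
    hρ.continuous.continuousOn
  have hsub : ∀ x ∈ G, x ∈ closedBall (0:E) (M + 1) := fun x hx =>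
    closedBall_subset_closedBall (by linarith) (hM hx)
  obtain ⟨N, hN⟩ : ∃ N, N = |L| + |A| + 1 := ⟨_, rfl⟩
  have hN1 : 1 ≤ N := by rw [hN]; linarith [abs_nonneg L, abs_nonneg A]
  have hN0 : 0 < N := by linarith
  have hσ : ∀ x ∈ G, 0 < -ρ x := fun x hx => by linarith [(hGm x).1 hx]
  have hd1 : ∀ x ∈ G, -ρ x / N ≤ 1 := fun x hx => by
    have h1 := (neg_le_abs _).trans (hA x (hsub x hx))
    rw [div_le_one hN0]
    linarith [abs_nonneg L, le_abs_self A]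
  have hball : ∀ x ∈ G, ∀ y ∈ ball x (-ρ x / N), |ρ y - ρ x| < -ρ x := by
    intro x hx y hy
    have hyK : y ∈ closedBall (0:E) (M + 1) := by
      have h1 := mem_closedBall_zero_iff.1 (hM hx)
      rw [mem_ball, dist_eq_norm] at hy
      have := norm_le_norm_add_norm_sub' y x
      rw [mem_closedBall_zero_iff]
      linarith [hd1 x hx]
    have h1 := (convex_closedBall (0:E) (M + 1)).norm_image_sub_le_of_norm_fderiv_le
      (fun z _ => (hρ.differentiable one_ne_zero) z) hL (hsub x hx) hyK
    rw [mem_ball, dist_eq_norm, lt_div_iff₀ hN0] at hy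
    rw [Real.norm_eq_abs] at h1
    refine lt_of_le_of_lt (h1.trans ?_) hy
    rw [mul_comm]
    gcongr
    rw [hN]; linarith [le_abs_self L, abs_nonneg A]
  have hball' : ∀ x ∈ G, ∀ y ∈ ball x (-ρ x / N), ρ y < 0 ∧ |ρ y| ≤ 2 * -ρ x := by
    intro x hx y hy
    have := abs_lt.1 (hball x hx y hy)
    refine ⟨by linarith, abs_le.2 ⟨by linarith, by linarith [hσ x hx]⟩⟩
  have h0' : ∀ x ∈ G, (lap b)^[k] u x = 0 := fun x hx => h0 x ((hGm x).1 hx)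
  have hdb : DB G (fun x => (-ρ x / N)⁻¹) (fun x => (-ρ x) ^ k) u :=
    db_of_ball b k hk (fun x hx => div_pos (hσ x hx) hN0)
      (fun x hx y hy => (hGm y).2 (hball' x hx y hy).1) (smooth_of_polyharmonic b hGo hu h0') h0'
      (fun x hx => pow_nonneg (hσ x hx).le k) (c := |D| * 2 ^ k) (fun x hx y hy => by
        obtain ⟨h1, h2⟩ := hball' x hx y hy
        refine (hD y h1).trans ?_
        rw [mul_assoc, ← mul_pow]
        gcongr
        exact le_abs_self D)
  have hadm : Adm k G (fun x => -ρ x) (fun x => (-ρ x / N)⁻¹) (fun x => (-ρ x) ^ k)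
      (fun _ => 1) := by
    refine ⟨hρ.neg, ?_, ⟨L, fun x hx => ?_⟩, fun x hx => ?_, ⟨1, fun x hx => ?_⟩,
      fun x hx => pow_nonneg (hσ x hx).le k, fun _ => zero_le_one, db_one, ?_⟩
    · ext x; rw [hGm]; exact neg_pos.symm
    · rw [fderiv_fun_neg, norm_neg]; exact hL x (hsub x hx)
    · rw [inv_div, div_mul_cancel₀ _ (hσ x hx).ne']; exact hN1
    · rw [one_mul]; exact (one_le_inv₀ (div_pos (hσ x hx) hN0)).2 (hd1 x hx)
    · refine (integrableOn_const (C := N ^ (2 * k)) hb.measure_lt_top.ne).congr_fun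
        (fun x hx => ?_) hGo.measurableSet
      have := (hσ x hx).ne'
      dsimp only
      rw [inv_div, mul_one, ← pow_add, ← two_mul, ← mul_pow, div_mul_cancel₀ _ this]
  obtain ⟨h1, -, h3⟩ := h G _ _ _ hadm u hdb h0'
  simp only [mul_one] at h1 h3
  exact ⟨h1, h3⟩

/-- Uniqueness in the Dirichlet problem, up to constants. -/
theorem dd_eq_zero_of_dirichlet (k : ℕ) (hk : 1 ≤ k) {ρ u : E → ℝ} (hρ : ContDiff ℝ 1 ρ)
    (hb : IsBounded {x | ρ x < 0}) (hu : ContDiffOn ℝ (2 * k : ℕ) u {x | ρ x < 0})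
    (h0 : ∀ x, ρ x < 0 → (lap b)^[k] u x = 0) {D : ℝ}
    (hD : ∀ x, ρ x < 0 → |u x| ≤ D * |ρ x| ^ k) {x : E} (hx : ρ x < 0) (e : E) :
    dd e u x = 0 := by
  classical
  obtain ⟨C, hC, h⟩ := exists_caccioppoli_bounded b k hk
  obtain ⟨G, hG⟩ : ∃ G, G = {x | ρ x < 0} := ⟨_, rfl⟩
  have hGo : IsOpen G := hG ▸ isOpen_lt hρ.continuous continuous_const
  have hGm : ∀ x, x ∈ G ↔ ρ x < 0 := fun x => by rw [hG]; rfl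
  have hscale : ∀ R : ℝ, 0 < R →
      R ^ 2 * ∫ x in G, BB b 1 u u x ≤ C * ∫ x in G, u x * u x := by
    intro R hR
    have hset : R • {y : E | ρ (R • y) < 0} = G := by
      ext z
      rw [Set.mem_smul_set_iff_inv_smul_mem₀ hR.ne', hGm]
      show ρ (R • R⁻¹ • z) < 0 ↔ _
      rw [smul_inv_smul₀ hR.ne']
    have hmap : MapsTo (fun y : E => R • y) {y | ρ (R • y) < 0} {x | ρ x < 0} := fun y hy => hy
    have := (h (fun y => ρ (R • y)) (fun y => u (0 + R • y)) (hρ.comp (by fun_prop)) (by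
      have e : {y : E | ρ (R • y) < 0} = R⁻¹ • G := by rw [← hset, inv_smul_smul₀ hR.ne']
      rw [e]; exact (hG ▸ hb).smul₀ _) (hu.comp (by fun_prop) fun y hy => by
        show ρ (0 + R • y) < 0
        rw [zero_add]; exact hy) (fun y hy => by
      rw [lapI_comp_affine]
      dsimp only
      rw [zero_add, h0 _ hy, mul_zero]) ⟨D, fun y hy => by
        rw [zero_add]; exact hD _ hy⟩).2
    have hBB : ∀ y, BB b 1 (fun y => u (0 + R • y)) (fun y => u (0 + R • y)) y =
        R ^ 2 * BB b 1 u u (R • y) := fun y => by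
      simp only [BB, dd_comp_affine, Finset.mul_sum]
      simp only [zero_add]
      exact Finset.sum_congr rfl fun i _ => by ring
    simp only [hBB] at this
    simp only [zero_add] at this
    rw [Measure.setIntegral_comp_smul_of_pos _ (fun x => R ^ 2 * BB b 1 u u x) _ hR,
      Measure.setIntegral_comp_smul_of_pos _ (fun x => u x * u x) _ hR, hset, integral_const_mul,
      smul_eq_mul, smul_eq_mul, mul_left_comm C] at this
    exact le_of_mul_le_mul_left this (by positivity)
  have hint : IntegrableOn (BB b 1 u u) G := hG ▸ (h ρ u hρ hb hu h0 ⟨D, hD⟩).1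
  have hz : ∫ x in G, BB b 1 u u x = 0 := by
    refine le_antisymm ?_ (setIntegral_nonneg hGo.measurableSet fun x _ => BB_self_nonneg b 1 u x)
    by_contra hpos
    push Not at hpos
    obtain ⟨R, hR⟩ := exists_gt ((C * ∫ x in G, u x * u x) / (∫ x in G, BB b 1 u u x) + 1)
    have h2 : 0 ≤ ∫ x in G, u x * u x := integral_nonneg fun x => mul_self_nonneg _
    have hR1 : 1 < R := lt_of_le_of_lt (le_add_of_nonneg_left (by positivity)) hR
    have h3 := hscale R (by linarith)
    rw [← le_div_iff₀ hpos] at h3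
    nlinarith
  have husm : ContDiffOn ℝ ∞ u G := smooth_of_polyharmonic b hGo (hG ▸ hu)
    fun x hx => h0 x ((hGm x).1 hx)
  have hae := (setIntegral_eq_zero_iff_of_nonneg_ae
    (Eventually.of_forall fun x => BB_self_nonneg b 1 u x) hint).1 hz
  have hcont : ContinuousOn (BB b 1 u u) G := (BB_contDiffOn b hGo husm husm 1).continuousOn
  have heq : EqOn (BB b 1 u u) (fun _ => 0) G :=
    Measure.eqOn_of_ae_eq hae hcont continuousOn_const (by rw [hGo.interior_eq]; exact subset_closure)
  have h1 := sq_dd_le b e u x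
  rw [heq ((hGm x).2 hx)] at h1
  exact pow_eq_zero_iff two_ne_zero |>.1 (le_antisymm (by linarith) (sq_nonneg _))

end Uniqueness

section DefiningFunctions

/-- `ρ` is a defining function of class `C ^ (2 * k, θ)` of the bounded open set `{ρ < 0}`. -/
structure HolderDef (k : ℕ) (θ : ℝ) (ρ : E → ℝ) : Prop where
  smooth : ContDiff ℝ (2 * k : ℕ) ρ
  holder : ∃ C : ℝ, ∀ x y,
    ‖iteratedFDeriv ℝ (2 * k) ρ x - iteratedFDeriv ℝ (2 * k) ρ y‖ ≤ C * ‖x - y‖ ^ θ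
  bdd : IsBounded {x | ρ x < 0}
  frontier_eq : frontier {x | ρ x < 0} = {x | ρ x = 0}
  grad : ∀ x, ρ x = 0 → fderiv ℝ ρ x ≠ 0

variable {k : ℕ} {θ : ℝ} {ρ : E → ℝ}

theorem HolderDef.isBounded_zero (h : HolderDef k θ ρ) : IsBounded {x | ρ x = 0} :=
  h.frontier_eq ▸ h.bdd.closure.subset frontier_subset_closure

theorem HolderDef.isCompact_zero (h : HolderDef k θ ρ) : IsCompact {x | ρ x = 0} :=
  isCompact_of_isClosed_isBounded (h.frontier_eq ▸ isClosed_frontier) h.isBounded_zero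

theorem iteratedFDeriv_rescale {m : ℕ} (hρ : ContDiff ℝ m ρ) (x₀ : E) (c t : ℝ) (y : E) :
    iteratedFDeriv ℝ m (fun y => c * ρ (x₀ + t • y)) y =
      (c * t ^ m) • iteratedFDeriv ℝ m ρ (x₀ + t • y) := by
  have h1 : ContDiff ℝ m (fun z => ρ (x₀ + z)) := hρ.comp (by fun_prop)
  have h2 := iteratedFDeriv_const_smul_apply (a := c) (x := y)
    (h1.comp (contDiff_const_smul t)).contDiffAt
  have h3 := congrFun (iteratedFDeriv_comp_const_smul t h1) y
  rw [iteratedFDeriv_comp_add_left] at h3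
  rw [mul_smul, ← h3]
  exact h2

theorem HolderDef.exists_bdryDom (hk : 1 ≤ k) (hθ : 0 ≤ θ) (h : HolderDef k θ ρ) :
    ∃ R Λ, 0 < R ∧ R ≤ 1 ∧ 1 ≤ Λ ∧ ∀ x₀, ρ x₀ = 0 → ∀ t, 0 < t → t ≤ R →
      BdryDom k θ Λ (fun y => -t⁻¹ * ρ (x₀ + t • y)) := by
  obtain ⟨M, hM⟩ := h.isBounded_zero.subset_closedBall 0
  have hK := isCompact_closedBall (0:E) (M + 1)
  obtain ⟨C, hC⟩ := h.holder
  have h1 : (1 : ℕ∞ω) ≤ (2 * k : ℕ) := by exact_mod_cast (by omega : 1 ≤ 2 * k)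
  have h2 : (1 + 1 : ℕ∞ω) ≤ (2 * k : ℕ) := by exact_mod_cast (by omega : 1 + 1 ≤ 2 * k)
  have hdf : ContDiff ℝ 1 (fderiv ℝ ρ) := h.smooth.fderiv_right h2
  have hdiff : Differentiable ℝ ρ := h.smooth.differentiable (by
    exact_mod_cast (by omega : 2 * k ≠ 0))
  obtain ⟨L, hL⟩ := hdf.contDiffOn.exists_lipschitzOnWith one_ne_zero (convex_closedBall _ _) hK
  obtain ⟨B, hB⟩ := hK.exists_bound_of_continuousOn hdf.continuous.continuousOn
  obtain ⟨B', hB'⟩ := h.isCompact_zero.exists_bound_of_continuousOn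
    (f := fun x => ‖fderiv ℝ ρ x‖⁻¹) (hdf.continuous.norm.continuousOn.inv₀ fun x hx =>
      norm_ne_zero_iff.2 (h.grad x hx))
  have hA' : ∀ m : ℕ, m ≤ 2 * k → ∃ A, ∀ x ∈ closedBall (0:E) (M + 1),
      ‖iteratedFDeriv ℝ m ρ x‖ ≤ A := fun m hm =>
    hK.exists_bound_of_continuousOn
      (h.smooth.continuous_iteratedFDeriv (by exact_mod_cast hm)).continuousOn
  choose! A hA using hA'
  obtain ⟨Λ, hΛ⟩ : ∃ Λ, Λ = 2 * |B'| + |B| + L + ∑ m ∈ Finset.range (2 * k + 1), |A m| + |C| + 1 :=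
    ⟨_, rfl⟩
  have hS : 0 ≤ ∑ m ∈ Finset.range (2 * k + 1), |A m| := Finset.sum_nonneg fun _ _ => abs_nonneg _
  have hL0 : (0:ℝ) ≤ L := L.2
  have hΛ1 : 1 ≤ Λ := by
    rw [hΛ]; linarith [abs_nonneg B', abs_nonneg B, abs_nonneg C]
  have hΛ0 : 0 < Λ := by linarith
  have hR1 : (Λ ^ 2)⁻¹ ≤ 1 := inv_le_one_of_one_le₀ (one_le_pow₀ hΛ1)
  refine ⟨(Λ ^ 2)⁻¹, Λ, by positivity, hR1, hΛ1, fun x₀ hx₀ t ht htR => ?_⟩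
  have ht1 : t ≤ 1 := htR.trans hR1
  have hx₀M : ‖x₀‖ ≤ M := mem_closedBall_zero_iff.1 (hM hx₀)
  have hmem : ∀ y ∈ ball (0:E) 1, x₀ + t • y ∈ closedBall (0:E) (M + 1) := fun y hy => by
    rw [mem_ball_zero_iff] at hy
    rw [mem_closedBall_zero_iff]
    refine (norm_add_le _ _).trans (add_le_add hx₀M ?_)
    rw [norm_smul, Real.norm_eq_abs, abs_of_pos ht]
    nlinarith [norm_nonneg y]
  have hx₀K : x₀ ∈ closedBall (0:E) (M + 1) := by rw [mem_closedBall_zero_iff]; linarith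
  have hder : ∀ y, HasFDerivAt (fun y => -t⁻¹ * ρ (x₀ + t • y)) (-fderiv ℝ ρ (x₀ + t • y)) y := by
    intro y
    have h3 := ((hdiff (x₀ + t • y)).hasFDerivAt.comp y
      (((hasFDerivAt_id y).const_smul t).const_add x₀)).const_mul (-t⁻¹)
    refine h3.congr_fderiv ?_
    ext z
    simp [ht.ne']
  have hlip : ∀ x ∈ ball (0:E) 1, ∀ y ∈ ball (0:E) 1,
      ‖fderiv ℝ ρ (x₀ + t • x) - fderiv ℝ ρ (x₀ + t • y)‖ ≤ L * (t * ‖x - y‖) := fun x hx y hy => by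
    refine (hL.norm_sub_le (hmem x hx) (hmem y hy)).trans_eq ?_
    rw [add_sub_add_left_eq_sub, ← smul_sub, norm_smul, Real.norm_eq_abs, abs_of_pos ht]
  have h0b := mem_ball_self (x := (0:E)) one_pos
  have hsc := fun (m : ℕ) (hm : m ≤ 2 * k) =>
    iteratedFDeriv_rescale (h.smooth.of_le (by exact_mod_cast hm : (m : ℕ∞ω) ≤ (2 * k : ℕ))) x₀
      (-t⁻¹) t
  have hcoef : ∀ m : ℕ, m ≠ 0 → |-t⁻¹ * t ^ m| ≤ 1 := fun m hm => by
    obtain ⟨m, rfl⟩ := Nat.exists_eq_succ_of_ne_zero hm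
    rw [pow_succ', ← mul_assoc, neg_mul, inv_mul_cancel₀ ht.ne', neg_one_mul, abs_neg,
      abs_of_pos (by positivity)]
    exact pow_le_one₀ ht.le ht1
  refine ⟨⟨fun y _ => (hder y).differentiableAt, fun y hy => ?_, fun y hy => ?_,
    fun x hx y hy => ?_⟩, ?_, ?_, fun m hm => ?_, fun y hy => ?_⟩
  · rw [(hder y).fderiv, norm_neg]
    refine (hB _ (hmem y hy)).trans ?_
    rw [hΛ]; linarith [abs_nonneg B', le_abs_self B, abs_nonneg C]
  · rw [(hder y).fderiv, norm_neg]
    have h3 := hlip 0 h0b y hy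
    rw [smul_zero, add_zero, zero_sub, norm_neg] at h3
    have h4 : ‖fderiv ℝ ρ x₀‖⁻¹ ≤ Λ / 2 := by
      have := (le_abs_self _).trans (hB' x₀ hx₀)
      rw [hΛ]; linarith [le_abs_self B', abs_nonneg B, abs_nonneg C]
    have h5 : 2 * Λ⁻¹ ≤ ‖fderiv ℝ ρ x₀‖ := by
      have := inv_anti₀ (inv_pos.2 (norm_pos_iff.2 (h.grad x₀ hx₀))) h4
      rwa [inv_inv, inv_div, div_eq_mul_inv] at this
    have h6 : L * (t * ‖y‖) ≤ Λ⁻¹ := by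
      have hy1 : ‖y‖ ≤ 1 := (mem_ball_zero_iff.1 hy).le
      have hLΛ : (L:ℝ) ≤ Λ := by
        rw [hΛ]; linarith [abs_nonneg B', abs_nonneg B, abs_nonneg C]
      calc L * (t * ‖y‖) ≤ Λ * ((Λ ^ 2)⁻¹ * 1) := by gcongr
        _ = Λ⁻¹ := by field_simp
    have := norm_sub_norm_le (fderiv ℝ ρ x₀) (fderiv ℝ ρ (x₀ + t • y))
    linarith
  · rw [(hder x).fderiv, (hder y).fderiv, neg_sub_neg, norm_sub_rev]
    refine (hlip x hx y hy).trans ?_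
    have : (L:ℝ) ≤ Λ := by rw [hΛ]; linarith [abs_nonneg B', abs_nonneg B, abs_nonneg C]
    calc L * (t * ‖x - y‖) ≤ Λ * (1 * ‖x - y‖) := by gcongr
      _ = _ := by rw [one_mul]
  · simp [hx₀]
  · exact contDiff_const.mul (h.smooth.comp (by fun_prop))
  · rcases Nat.eq_zero_or_pos m with rfl | hm0
    · rw [norm_iteratedFDeriv_zero, smul_zero, add_zero, hx₀, mul_zero, norm_zero]
      exact hΛ0.le
    · rw [hsc m hm, norm_smul, smul_zero, add_zero, Real.norm_eq_abs]
      refine (mul_le_of_le_one_left (norm_nonneg _) (hcoef m hm0.ne')).trans ?_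
      have h3 := Finset.single_le_sum (f := fun m => |A m|) (fun _ _ => abs_nonneg _)
        (Finset.mem_range.2 (by omega : m < 2 * k + 1))
      rw [hΛ]
      linarith [hA m hm x₀ hx₀K, le_abs_self (A m), abs_nonneg B', abs_nonneg B, abs_nonneg C]
  · rw [hsc _ le_rfl, hsc _ le_rfl, ← smul_sub, norm_smul, Real.norm_eq_abs]
    refine (mul_le_of_le_one_left (norm_nonneg _) (hcoef _ (by omega))).trans ((hC _ _).trans ?_)
    rw [add_sub_add_left_eq_sub, smul_zero, sub_zero, norm_smul, Real.norm_eq_abs, abs_of_pos ht]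
    have hCΛ : C ≤ Λ := by
      rw [hΛ]; linarith [abs_nonneg B', abs_nonneg B, le_abs_self C]
    gcongr
    exact mul_le_of_le_one_left (norm_nonneg _) ht1

end DefiningFunctions

section BoundaryDecay

variable {k : ℕ} {θ : ℝ} {ρ : E → ℝ}

theorem NiceDef.dist_le {Λ d : ℝ} {σ : E → ℝ} (hΛ : 1 ≤ Λ) (h : NiceDef Λ σ) {y : E}
    (hy : y ∈ ball (0:E) (1/2)) (hd : 0 ≤ d) (hd1 : d ≤ 1/2) (hpos : ∀ z ∈ ball y d, 0 < σ z)
    (hσ : 0 < σ y) : d ≤ 2 * Λ ^ 3 * σ y := by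
  have hΛ0 : 0 < Λ := by linarith
  rw [mem_ball_zero_iff] at hy
  have hyb : y ∈ ball (0:E) 1 := by rw [mem_ball_zero_iff]; linarith
  obtain ⟨ℓ, hℓ⟩ : ∃ ℓ, ℓ = fderiv ℝ σ y := ⟨_, rfl⟩
  have hge := h.ge y hyb
  rw [← hℓ] at hge
  have hℓ0 : 0 < ‖ℓ‖ := (inv_pos.2 hΛ0).trans_le hge
  obtain ⟨a, hal, han⟩ := exists_inner_eq ℓ
  rcases hd.eq_or_lt with rfl | hd0
  · positivity
  have hΛ1 : (1:ℝ) ≤ Λ ^ 2 := one_le_pow₀ hΛ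
  have hs1 : d / Λ ^ 2 ≤ d := div_le_self hd hΛ1
  have key : ∀ s, 0 < s → s < d / Λ ^ 2 → s / (2 * Λ) ≤ σ y := fun s hs hsd => by
    have hn : ‖(-(s / ‖ℓ‖)) • a‖ = s := by
      rw [norm_smul, han, norm_neg, Real.norm_eq_abs, abs_of_pos (by positivity),
        div_mul_cancel₀ _ hℓ0.ne']
    have hz : y + (-(s / ‖ℓ‖)) • a ∈ ball (0:E) 1 := by
      rw [mem_ball_zero_iff]
      refine (norm_add_le _ _).trans_lt ?_
      rw [hn]; linarith
    have h1 := (_root_.abs_le.1 (h.taylor hΛ0.le hyb hz)).2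
    rw [add_sub_cancel_left, hn, ← hℓ, map_smul, ← hal, real_inner_self_eq_norm_sq, han,
      smul_eq_mul] at h1
    have h2 : s / ‖ℓ‖ * ‖ℓ‖ ^ 2 = s * ‖ℓ‖ := by field_simp
    have h3 := hpos _ (by rw [mem_ball_iff_norm, add_sub_cancel_left, hn]; linarith)
    have h4 : s * Λ⁻¹ ≤ s * ‖ℓ‖ := by gcongr
    have h5 : Λ * s ^ 2 ≤ s * Λ⁻¹ / 2 := by
      have : s ≤ 1 / 2 / Λ ^ 2 := hsd.le.trans (by gcongr)
      calc Λ * s ^ 2 = s * (Λ * s) := by ring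
        _ ≤ s * (Λ * (1 / 2 / Λ ^ 2)) := by gcongr
        _ = _ := by field_simp
    have h6 : s / (2 * Λ) = s * Λ⁻¹ / 2 := by field_simp
    linarith
  have h7 : d / Λ ^ 2 ≤ 2 * Λ * σ y := le_of_forall_lt fun s hs => by
    rcases le_or_gt s 0 with h0 | h0
    · exact h0.trans_lt (by positivity)
    · obtain ⟨s', h1, h2⟩ := exists_between hs
      have := key s' (h0.trans h1) h2
      rw [div_le_iff₀ (by positivity)] at this
      linarith
  rw [div_le_iff₀ (by positivity)] at h7
  linarith

theorem HolderDef.frontier_mem (h : HolderDef k θ ρ) {z : E}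
    (hz : z ∈ closure {x | ρ x < 0}) (hz' : ¬ρ z < 0) : ρ z = 0 := by
  have : z ∈ frontier {x | ρ x < 0} :=
    ⟨hz, fun hi => hz' (interior_subset (s := {x | ρ x < 0}) hi)⟩
  rw [h.frontier_eq] at this
  exact this

theorem HolderDef.isOpen (h : HolderDef k θ ρ) : IsOpen {x | ρ x < 0} :=
  isOpen_lt h.smooth.continuous continuous_const

theorem HolderDef.ball_subset {x : E} :
    ball x (infDist x {x | ρ x < 0}ᶜ) ⊆ {x | ρ x < 0} := fun y hy => by
  by_contra hc
  exact (infDist_le_dist_of_mem (s := {x | ρ x < 0}ᶜ) hc).not_gt (by rwa [dist_comm])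

theorem HolderDef.exists_nearest [Nontrivial E] (h : HolderDef k θ ρ) {x : E} (hx : ρ x < 0) :
    ∃ z, ρ z = 0 ∧ dist x z = infDist x {x | ρ x < 0}ᶜ ∧ 0 < dist x z ∧
      segment ℝ z x ⊆ closure {x | ρ x < 0} ∩ closedBall x (dist x z) := by
  have hne : ({x | ρ x < 0}ᶜ : Set E).Nonempty := by
    by_contra hc
    rw [not_nonempty_iff_eq_empty, compl_empty_iff] at hc
    exact NormedSpace.unbounded_univ ℝ E (hc ▸ h.bdd)
  obtain ⟨z, hz, hd⟩ := h.isOpen.isClosed_compl.exists_infDist_eq_dist hne x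
  have hpos : 0 < dist x z := dist_pos.2 fun hc => hz (hc ▸ hx)
  have hcl : closedBall x (dist x z) ⊆ closure {x | ρ x < 0} := by
    rw [← closure_ball x hpos.ne', ← hd]
    exact closure_mono HolderDef.ball_subset
  have hzb : z ∈ closedBall x (dist x z) := by rw [mem_closedBall, dist_comm]
  have hseg := (convex_closedBall x (dist x z)).segment_subset hzb (mem_closedBall_self hpos.le)
  exact ⟨z, h.frontier_mem (hcl hzb) hz, hd.symm, hpos, subset_inter (hseg.trans hcl) hseg⟩

theorem HolderDef.exists_infDist_le [Nontrivial E] (hk : 1 ≤ k) (hθ : 0 ≤ θ)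
    (h : HolderDef k θ ρ) :
    ∃ C, 0 ≤ C ∧ ∀ x, ρ x < 0 → infDist x {x | ρ x < 0}ᶜ ≤ C * |ρ x| := by
  obtain ⟨R, Λ, hR, -, hΛ, hdom⟩ := h.exists_bdryDom hk hθ
  obtain ⟨G, hG⟩ : ∃ G, G = {x | ρ x < 0} := ⟨_, rfl⟩
  have hcl : IsClosed {x | R / 2 ≤ infDist x Gᶜ} :=
    isClosed_le continuous_const (continuous_infDist_pt _)
  have hsub : {x | R / 2 ≤ infDist x Gᶜ} ⊆ G := fun x hx => by
    by_contra hc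
    have hx' : R / 2 ≤ infDist x Gᶜ := hx
    rw [infDist_zero_of_mem (s := Gᶜ) hc] at hx'
    linarith
  have hcpt : IsCompact {x | R / 2 ≤ infDist x Gᶜ} :=
    isCompact_of_isClosed_isBounded hcl ((hG ▸ h.bdd).subset hsub)
  obtain ⟨B, hB⟩ := hcpt.exists_bound_of_continuousOn (f := fun x => infDist x Gᶜ / ρ x)
    ((continuous_infDist_pt _).continuousOn.div h.smooth.continuous.continuousOn fun x hx => by
      have := hsub hx
      rw [hG] at this
      exact ne_of_lt this)
  have hΛ0 : 0 < Λ := by linarith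
  refine ⟨|B| + 2 * Λ ^ 3, by positivity, fun x hx => ?_⟩
  rw [← hG]
  have hρ0 : 0 < |ρ x| := abs_pos.2 hx.ne
  rcases le_or_gt (R / 2) (infDist x Gᶜ) with h1 | h1
  · have := (hB x h1).trans (le_abs_self B)
    rw [Real.norm_eq_abs, abs_div, abs_of_nonneg infDist_nonneg, div_le_iff₀ hρ0] at this
    refine this.trans ?_
    gcongr
    linarith [pow_pos hΛ0 3]
  · obtain ⟨z, hz, hd, hpos, -⟩ := h.exists_nearest hx
    rw [← hG] at hd
    rw [← hd] at h1 ⊢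
    have hσ := hdom z hz R hR le_rfl
    have hval : ∀ w, -R⁻¹ * ρ (z + R • (R⁻¹ • (w - z))) = R⁻¹ * -ρ w := fun w => by
      rw [smul_smul, mul_inv_cancel₀ hR.ne', one_smul, add_sub_cancel]; ring
    have h2 := hσ.nice.dist_le hΛ (y := R⁻¹ • (x - z)) (d := R⁻¹ * dist x z) ?_ (by positivity) ?_
      (fun w hw => ?_) ?_
    · rw [hval, abs_of_neg hx] at *
      have h3 : dist x z ≤ 2 * Λ ^ 3 * -ρ x := by
        have := mul_le_mul_of_nonneg_left h2 hR.le
        field_simp at this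
        linarith
      refine h3.trans ?_
      gcongr
      linarith [abs_nonneg B]
    · rw [mem_ball_zero_iff, norm_smul, ← dist_eq_norm, Real.norm_eq_abs,
        abs_of_pos (by positivity), inv_mul_lt_iff₀ hR]
      linarith
    · rw [inv_mul_le_iff₀ hR]; linarith
    · have h3 : z + R • w ∈ G := by
        rw [hG]
        refine HolderDef.ball_subset (x := x) ?_
        rw [← hG, ← hd, mem_ball_iff_norm]
        rw [mem_ball_iff_norm] at hw
        have : z + R • w - x = R • (w - R⁻¹ • (x - z)) := by
          rw [smul_sub, smul_smul, mul_inv_cancel₀ hR.ne', one_smul]; abel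
        rw [this, norm_smul, Real.norm_eq_abs, abs_of_pos hR]
        rwa [inv_mul_eq_div, lt_div_iff₀' hR] at hw
      rw [hG] at h3
      have h4 : ρ (z + R • w) < 0 := h3
      have := inv_pos.2 hR
      nlinarith
    · rw [hval]
      have := inv_pos.2 hR
      nlinarith

theorem HolderDef.uniqueDiffOn (hk : 1 ≤ k) (h : HolderDef k θ ρ) {U : Set E} (hU : IsOpen U) :
    UniqueDiffOn ℝ (closure {x | ρ x < 0} ∩ U) := by
  refine UniqueDiffOn.inter (fun z hz => ?_) hU
  by_cases hz0 : ρ z < 0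
  · exact (h.isOpen.uniqueDiffWithinAt hz0).mono subset_closure
  have hz1 := h.frontier_mem hz hz0
  have hder : HasFDerivAt ρ (fderiv ℝ ρ z) z := (h.smooth.differentiable (by
    exact_mod_cast (by omega : 2 * k ≠ 0)) z).hasFDerivAt
  obtain ⟨e, he⟩ : ∃ e, fderiv ℝ ρ z e < 0 := by
    obtain ⟨e, he⟩ : ∃ e, fderiv ℝ ρ z e ≠ 0 := by
      by_contra! hc
      exact h.grad z hz1 (ContinuousLinearMap.ext hc)
    rcases he.lt_or_gt with h1 | h1
    · exact ⟨e, h1⟩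
    · exact ⟨-e, by rw [map_neg]; linarith⟩
  have hmem : {w | fderiv ℝ ρ z w < 0} ⊆ tangentConeAt ℝ (closure {x | ρ x < 0}) z := by
    intro w hw
    refine mem_tangentConeAt_of_add_smul_mem (l := 𝓝[>] (0:ℝ)) (c := id)
      (tendsto_id.mono_left (nhdsWithin_mono _ fun t ht => ne_of_gt ht)) ?_
    have h1 : HasDerivAt (fun t : ℝ => ρ (z + t • w)) (fderiv ℝ ρ z w) 0 := by
      have h2 : HasDerivAt (fun t : ℝ => z + t • w) w 0 := by
        simpa using ((hasDerivAt_id (0:ℝ)).smul_const w).const_add z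
      exact HasFDerivAt.comp_hasDerivAt (0:ℝ) (by simpa using hder) h2
    have h3 := (hasDerivAt_iff_tendsto_slope.1 h1).eventually (gt_mem_nhds hw)
    have h4 : ∀ᶠ t in 𝓝[>] (0:ℝ), slope (fun t : ℝ => ρ (z + t • w)) 0 t < 0 :=
      h3.filter_mono (nhdsWithin_mono _ fun t ht => ne_of_gt ht)
    filter_upwards [h4, self_mem_nhdsWithin] with t ht ht0
    refine subset_closure ?_
    have ht0' : 0 < t := ht0
    rw [slope_def_field, zero_smul, add_zero, hz1, sub_zero, sub_zero, div_lt_iff₀ ht0',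
      zero_mul] at ht
    exact ht
  refine ⟨?_, subset_closure hz⟩
  have htop : Submodule.span ℝ (tangentConeAt ℝ (closure {x | ρ x < 0}) z) = ⊤ := by
    refine Submodule.eq_top_of_nonempty_interior' _ ⟨e, interior_mono
      (hmem.trans Submodule.subset_span) ?_⟩
    rw [(isOpen_lt (fderiv ℝ ρ z).continuous continuous_const).interior_eq]
    exact he
  rw [htop]
  exact dense_univ

/-- Taylor's formula: a function whose derivatives of order less than `k` vanish at `z` is
`O(‖x - z‖ ^ k)`. -/
theorem norm_iteratedFDerivWithin_le_of_zero {T : Set E} (hT : UniqueDiffOn ℝ T) {v : E → ℝ}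
    (hv : ContDiffOn ℝ k v T) {z x : E} (hs : segment ℝ z x ⊆ T)
    (hz : ∀ i < k, iteratedFDerivWithin ℝ i v T z = 0) {M : ℝ}
    (hM : ∀ y ∈ segment ℝ z x, ‖iteratedFDerivWithin ℝ k v T y‖ ≤ M) (j : ℕ) (hj : j ≤ k) :
    ∀ y ∈ segment ℝ z x, ‖iteratedFDerivWithin ℝ (k - j) v T y‖ ≤ M * ‖y - z‖ ^ j := by
  have hM0 : 0 ≤ M := (norm_nonneg _).trans (hM z (left_mem_segment ℝ z x))
  induction j with
  | zero => simpa using hM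
  | succ j ih =>
    intro y hy
    have hzy : segment ℝ z y ⊆ segment ℝ z x :=
      (convex_segment z x).segment_subset (left_mem_segment ℝ z x) hy
    have hlt : ((k - (j + 1) : ℕ) : ℕ∞ω) < k := by exact_mod_cast (by omega : k - (j + 1) < k)
    have h1 := (convex_segment z y).norm_image_sub_le_of_norm_hasFDerivWithin_le
      (f := iteratedFDerivWithin ℝ (k - (j + 1)) v T) (C := M * ‖y - z‖ ^ j)
      (fun w hw => ((hv.differentiableOn_iteratedFDerivWithin hlt hT w
        (hs (hzy hw))).hasFDerivWithinAt).mono (hzy.trans hs))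
      (fun w hw => by
        rw [norm_fderivWithin_iteratedFDerivWithin, show k - (j + 1) + 1 = k - j by omega]
        refine (ih (by omega) w (hzy hw)).trans ?_
        gcongr
        rw [norm_sub_rev, norm_sub_rev y]
        obtain ⟨a, b, ha, hb, hab, rfl⟩ := hw
        have : z - (a • z + b • y) = b • (z - y) := by
          obtain rfl : a = 1 - b := by linarith
          module
        rw [this, norm_smul, Real.norm_eq_abs, abs_of_nonneg hb]
        exact mul_le_of_le_one_left (norm_nonneg _) (by linarith))
      (left_mem_segment ℝ z y) (right_mem_segment ℝ z y)
    rw [hz _ (by omega), sub_zero] at h1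
    refine h1.trans_eq ?_
    rw [pow_succ, mul_assoc]

theorem HolderDef.exists_decay [Nontrivial E] (hk : 1 ≤ k) (hθ : 0 ≤ θ) (h : HolderDef k θ ρ)
    {U K : Set E} (hU : IsOpen U) (hK : IsCompact K) (hKU : K ⊆ U) {v : E → ℝ}
    (hv : ContDiffOn ℝ (2 * k : ℕ) v (closure {x | ρ x < 0} ∩ U))
    (hz : ∀ i < k, ∀ z ∈ U, ρ z = 0 →
      iteratedFDerivWithin ℝ i v (closure {x | ρ x < 0} ∩ U) z = 0) :
    ∃ D, ∀ x, ρ x < 0 → closedBall x (infDist x {x | ρ x < 0}ᶜ) ⊆ K → |v x| ≤ D * |ρ x| ^ k := by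
  obtain ⟨C, hC, hdist⟩ := h.exists_infDist_le hk hθ
  have hT := h.uniqueDiffOn hk hU
  have hv' : ContDiffOn ℝ k v (closure {x | ρ x < 0} ∩ U) :=
    hv.of_le (by exact_mod_cast (by omega : k ≤ 2 * k))
  obtain ⟨M, hM⟩ := (hK.inter_left isClosed_closure).exists_bound_of_continuousOn
    ((hv'.continuousOn_iteratedFDerivWithin le_rfl hT).mono (inter_subset_inter_right _ hKU))
  refine ⟨|M| * C ^ k, fun x hx hxK => ?_⟩
  obtain ⟨z, hz0, hd, -, hseg⟩ := h.exists_nearest hx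
  have hsegK : segment ℝ z x ⊆ closure {x | ρ x < 0} ∩ K :=
    hseg.trans (inter_subset_inter_right _ (hd ▸ hxK))
  have hseg' := hsegK.trans (inter_subset_inter_right _ hKU)
  have h1 := norm_iteratedFDerivWithin_le_of_zero hT hv' hseg'
    (fun i hi => hz i hi z (hseg' (left_mem_segment ℝ z x)).2 hz0)
    (fun y hy => hM y (hsegK hy)) k le_rfl x (right_mem_segment ℝ z x)
  rw [Nat.sub_self, norm_iteratedFDerivWithin_zero, Real.norm_eq_abs, ← dist_eq_norm, hd] at h1
  calc |v x| ≤ |M| * (C * |ρ x|) ^ k := by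
        refine h1.trans (mul_le_mul (le_abs_self M) ?_ (pow_nonneg infDist_nonneg _) (abs_nonneg M))
        exact pow_le_pow_left₀ infDist_nonneg (hdist x hx) _
    _ = _ := by ring

end BoundaryDecay

section LocalEstimate

variable {ι : Type*} [Fintype ι] (b : OrthonormalBasis ι ℝ E)

variable {k : ℕ} {θ : ℝ} {ρ : E → ℝ}

theorem norm_iteratedFDeriv_of_rescale {r : ℕ} {W : Set E} (hW : IsOpen W) {v : E → ℝ}
    (hv : ContDiffOn ℝ r v W) {x₀ y : E} {t c B : ℝ} (ht : 0 < t) (hc : 0 < c)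
    (hy : x₀ + t • y ∈ W) (hB : ‖iteratedFDeriv ℝ r (fun y => c * v (x₀ + t • y)) y‖ ≤ B) :
    ‖iteratedFDeriv ℝ r v (x₀ + t • y)‖ ≤ B / (c * t ^ r) := by
  have hB0 := (norm_nonneg _).trans hB
  refine norm_iteratedFDeriv_le_of_dl hW hv hy (by positivity) fun L hL => ?_
  have hW' : IsOpen ((fun y => x₀ + t • y) ⁻¹' W) := hW.preimage (by fun_prop)
  have hw : ContDiffOn ℝ r (fun y => c * v (x₀ + t • y)) ((fun y => x₀ + t • y) ⁻¹' W) :=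
    contDiffOn_const.mul (hv.comp (by fun_prop : ContDiff ℝ r fun y : E =>
      x₀ + t • y).contDiffOn fun _ hx => hx)
  obtain ⟨m, rfl⟩ : ∃ m : Fin r → E, L = (List.ofFn m).reverse := by
    subst hL
    refine ⟨fun i => L.reverse.get (i.cast (by simp)), ?_⟩
    apply List.reverse_injective
    rw [List.reverse_reverse]
    refine List.ext_getElem (by simp) fun i h1 h2 => by simp
  have h1 := iteratedFDeriv_apply_eq_dl hW' hw m hy
  dsimp only at h1
  rw [dl_const_mul, dl_comp_affine] at h1
  dsimp only at h1
  have h2 := (iteratedFDeriv ℝ r (fun y => c * v (x₀ + t • y)) y).le_of_opNorm_le hB m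
  rw [h1, Real.norm_eq_abs, List.length_reverse, List.length_ofFn, ← mul_assoc, abs_mul,
    abs_of_pos (by positivity : 0 < c * t ^ r)] at h2
  rw [List.map_reverse, List.prod_reverse, List.map_ofFn, List.prod_ofFn, div_mul_eq_mul_div,
    le_div_iff₀' (by positivity)]
  exact h2

theorem HolderDef.exists_boundary_estimate [Nontrivial E] (hk : 1 ≤ k) (hθ : 0 < θ) (hθ1 : θ ≤ 1)
    (h : HolderDef k θ ρ) : ∃ R C, 0 < R ∧ 0 ≤ C ∧ ∀ x₀, ρ x₀ = 0 → ∀ t, 0 < t → t ≤ R →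
      ∀ (v : E → ℝ) (S D : ℝ), 0 < S →
      ContDiffOn ℝ (2 * k : ℕ) v (ball x₀ t ∩ {x | ρ x < 0}) →
      (∀ x ∈ ball x₀ t, ρ x < 0 → (lap b)^[k] v x = 0) →
      (∀ x ∈ ball x₀ t, ρ x < 0 → |v x| ≤ S) →
      (∀ x ∈ ball x₀ t, ρ x < 0 → |v x| ≤ D * |ρ x| ^ k) →
      ∀ x, ρ x < 0 → dist x x₀ < t / 4 → infDist x {x | ρ x < 0}ᶜ = dist x x₀ →
      ∀ r ≤ 2 * k, ‖iteratedFDeriv ℝ r v x‖ ≤ C * (S / t ^ r) := by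
  obtain ⟨R, Λ, hR, -, hΛ, hdom⟩ := h.exists_bdryDom hk hθ.le
  obtain ⟨C, hC, hloc⟩ := exists_local_bound (b := b) k hk hθ hθ1 hΛ
  have hΛ0 : 0 < Λ := by linarith
  refine ⟨R, C, hR, hC, fun x₀ hx₀ t ht htR v S D hS hv h0 hvS hD x hx hxd hxi r hr => ?_⟩
  have hσ := hdom x₀ hx₀ t ht htR
  have hsgn : ∀ y, 0 < -t⁻¹ * ρ (x₀ + t • y) → ρ (x₀ + t • y) < 0 := fun y hy => by
    have := inv_pos.2 ht
    by_contra hc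
    push Not at hc
    nlinarith
  have hmem : ∀ y ∈ ball (0:E) 1, x₀ + t • y ∈ ball x₀ t := fun y hy => by
    rw [mem_ball_zero_iff] at hy
    rw [mem_ball_iff_norm, add_sub_cancel_left, norm_smul, Real.norm_eq_abs, abs_of_pos ht]
    nlinarith
  have hopen : IsOpen (ball x₀ t ∩ {x | ρ x < 0}) := isOpen_ball.inter h.isOpen
  have hw : DirFun b k θ Λ (fun y => -t⁻¹ * ρ (x₀ + t • y)) (fun y => S⁻¹ * v (x₀ + t • y)) := by
    refine ⟨hσ, ?_, fun y hy hy0 => ?_, fun y hy hy0 => ?_, |S⁻¹ * D * t ^ k| * (2 * Λ) ^ (1/4:ℝ),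
      fun y hy hy0 => ?_⟩
    · exact contDiffOn_const.mul (hv.comp (by fun_prop : ContDiff ℝ (2 * k : ℕ) fun y : E =>
        x₀ + t • y).contDiffOn fun y hy => ⟨hmem y hy.1, hsgn y hy.2⟩)
    · rw [lapI_const_mul, lapI_comp_affine]
      dsimp only
      rw [h0 _ (hmem y hy) (hsgn y hy0), mul_zero, mul_zero]
    · rw [abs_mul, abs_of_pos (inv_pos.2 hS), inv_mul_le_iff₀ hS, mul_one]
      exact hvS _ (hmem y hy) (hsgn y hy0)
    · have h1 := hD _ (hmem y hy) (hsgn y hy0)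
      have h2 := hσ.nice.abs_le hΛ0.le hσ.zero hy
      obtain ⟨s, hs⟩ : ∃ s, s = -t⁻¹ * ρ (x₀ + t • y) := ⟨_, rfl⟩
      rw [← hs] at hy0 h2 ⊢
      have h3 : |ρ (x₀ + t • y)| = t * s := by
        rw [abs_of_neg (hsgn y (hs ▸ hy0)), hs]; field_simp
      have h4 : s ≤ 2 * Λ := by
        rw [mem_ball_zero_iff] at hy
        rw [abs_of_pos hy0] at h2
        nlinarith
      have h5 : s ^ k ≤ (2 * Λ) ^ (1/4:ℝ) * s ^ (k - 1/4 : ℝ) := by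
        calc s ^ k = s ^ (1/4:ℝ) * s ^ (k - 1/4 : ℝ) := by
              rw [← Real.rpow_add hy0, ← Real.rpow_natCast]; congr 1; ring
          _ ≤ _ := by gcongr
      rw [h3] at h1
      calc |S⁻¹ * v (x₀ + t • y)| = S⁻¹ * |v (x₀ + t • y)| := by
            rw [abs_mul, abs_of_pos (inv_pos.2 hS)]
        _ ≤ S⁻¹ * (D * (t * s) ^ k) := by gcongr
        _ = S⁻¹ * D * t ^ k * s ^ k := by ring
        _ ≤ |S⁻¹ * D * t ^ k| * ((2 * Λ) ^ (1/4:ℝ) * s ^ (k - 1/4 : ℝ)) :=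
            mul_le_mul (le_abs_self _) h5 (by positivity) (abs_nonneg _)
        _ = _ := by ring
  have hxy : x₀ + t • (t⁻¹ • (x - x₀)) = x := by
    rw [smul_smul, mul_inv_cancel₀ ht.ne', one_smul, add_sub_cancel]
  have hny : ‖t⁻¹ • (x - x₀)‖ = t⁻¹ * dist x x₀ := by
    rw [norm_smul, Real.norm_eq_abs, abs_of_pos (inv_pos.2 ht), dist_eq_norm]
  have hlast := hloc _ _ hw (t⁻¹ • (x - x₀)) ?_ ?_ (fun z hz => ?_) r hr
  · have := norm_iteratedFDeriv_of_rescale hopen (hv.of_le (by exact_mod_cast hr)) ht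
      (inv_pos.2 hS) (by
        rw [hxy]
        exact ⟨by rw [mem_ball]; linarith, hx⟩) hlast
    rw [hxy] at this
    refine this.trans_eq ?_
    field_simp
  · rw [mem_ball_zero_iff, hny, inv_mul_lt_iff₀ ht]; linarith
  · intro hc
    rw [hc, smul_zero, add_zero] at hxy
    rw [← hxy, hx₀] at hx
    exact lt_irrefl _ hx
  · rw [hny, mem_ball_iff_norm, inv_mul_eq_div, lt_div_iff₀' ht, ← hxi] at hz
    have h1 : x₀ + t • z ∈ {x | ρ x < 0} := by
      refine HolderDef.ball_subset (x := x) ?_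
      rw [mem_ball_iff_norm]
      have : x₀ + t • z - x = t • (z - t⁻¹ • (x - x₀)) := by
        rw [smul_sub, smul_smul, mul_inv_cancel₀ ht.ne', one_smul]; abel
      rwa [this, norm_smul, Real.norm_eq_abs, abs_of_pos ht]
    have h2 : ρ (x₀ + t • z) < 0 := h1
    have := inv_pos.2 ht
    nlinarith

/-- A priori bounds at scale `t` for polyharmonic functions that vanish to order `k` on the
boundary. -/
theorem HolderDef.exists_estimate [Nontrivial E] (hk : 1 ≤ k) (hθ : 0 < θ) (hθ1 : θ ≤ 1)
    (h : HolderDef k θ ρ) : ∃ R C, 0 < R ∧ 0 ≤ C ∧ ∀ t, 0 < t → t ≤ R → ∀ x, ρ x < 0 →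
      ∀ (v : E → ℝ) (S D : ℝ), 0 < S →
      ContDiffOn ℝ (2 * k : ℕ) v (ball x (2 * t) ∩ {x | ρ x < 0}) →
      (∀ y ∈ ball x (2 * t), ρ y < 0 → (lap b)^[k] v y = 0) →
      (∀ y ∈ ball x (2 * t), ρ y < 0 → |v y| ≤ S) →
      (∀ y ∈ ball x (2 * t), ρ y < 0 → infDist y {x | ρ x < 0}ᶜ < t → |v y| ≤ D * |ρ y| ^ k) →
      ∀ r ≤ 2 * k, ‖iteratedFDeriv ℝ r v x‖ ≤ C * (S / t ^ r) := by
  obtain ⟨R, C, hR, hC, hbd⟩ := h.exists_boundary_estimate b hk hθ hθ1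
  obtain ⟨C', hC', hint⟩ := exists_interior_norm b k hk (2 * k)
  refine ⟨R, C + C' * 4 ^ (2 * k), hR, by positivity,
    fun t ht htR x hx v S D hS hv h0 hvS hD r hr => ?_⟩
  have hQ : 0 ≤ S / t ^ r := by positivity
  obtain ⟨z, hz, hzd, hpos, -⟩ := h.exists_nearest hx
  rcases lt_or_ge (dist x z) (t / 4) with h1 | h1
  · have hsub : ball z t ⊆ ball x (2 * t) := ball_subset_ball' (by rw [dist_comm]; linarith)
    refine (hbd z hz t ht htR v S D hS (hv.mono (inter_subset_inter_left _ hsub))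
      (fun y hy => h0 y (hsub hy)) (fun y hy => hvS y (hsub hy))
      (fun y hy hy0 => hD y (hsub hy) hy0 ?_) x hx h1 hzd.symm r hr).trans ?_
    · refine (infDist_le_dist_of_mem (s := {x | ρ x < 0}ᶜ) (y := z) ?_).trans_lt hy
      exact fun hc => lt_irrefl (0:ℝ) (hz ▸ hc)
    · gcongr
      exact le_add_of_nonneg_right (by positivity)
  · have hsub : ball x (t / 4) ⊆ {x | ρ x < 0} :=
      (ball_subset_ball (hzd ▸ h1)).trans HolderDef.ball_subset
    have hsub' : ball x (t / 4) ⊆ ball x (2 * t) := ball_subset_ball (by linarith)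
    refine (hint r hr v x (t / 4) S (by positivity) (hv.mono (subset_inter hsub' hsub))
      (fun y hy => h0 y (hsub' hy) (hsub hy)) (fun y hy => hvS y (hsub' hy) (hsub hy))).trans ?_
    have : S / (t / 4) ^ r = 4 ^ r * (S / t ^ r) := by rw [div_pow]; field_simp
    rw [this, ← mul_assoc]
    gcongr
    refine le_add_of_nonneg_of_le hC ?_
    gcongr
    norm_num

theorem polyLap_eqOn {n : ℕ} {U : Set (Euc n)} (hU : IsOpen U) {f : Euc n → ℝ} (k : ℕ)
    (hf : ContDiffOn ℝ (2 * k : ℕ) f U) : EqOn (polyLap k f)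
      (fun x => (-1) ^ k * (lap (EuclideanSpace.basisFun (Fin n) ℝ))^[k] f x) U := by
  induction k with
  | zero => intro x _; simp [polyLap]
  | succ k ih =>
    intro x hx
    have h1 := ih (hf.of_le (by exact_mod_cast (by omega : 2 * k ≤ 2 * (k + 1))))
    have h2 := lapI_contDiffOn (EuclideanSpace.basisFun (Fin n) ℝ) hU (m := 2) (j := k) hf
      (by omega)
    have h3 : polyLap (k + 1) f x = -eucLap (polyLap k f) x := by
      rw [polyLap, Function.iterate_succ_apply']; rfl
    have h4 := (contDiffOn_const (c := (-1:ℝ) ^ k)).mul h2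
    rw [h3]
    dsimp only
    rw [Function.iterate_succ_apply', pow_succ, mul_neg_one, neg_mul, neg_inj]
    have h5 := lap_const_mul (EuclideanSpace.basisFun (Fin n) ℝ) ((-1) ^ k)
      ((lap (EuclideanSpace.basisFun (Fin n) ℝ))^[k] f)
    rw [← congrFun h5 x, eucLap, lap]
    refine Finset.sum_congr rfl fun i _ => ?_
    have h6 := (h1.eventuallyEq_of_mem (hU.mem_nhds hx)).iteratedFDeriv ℝ 2
    rw [h6.eq_of_nhds, iteratedFDeriv_two_apply,
      dd_dd_apply (h4.contDiffAt (hU.mem_nhds hx)), EuclideanSpace.basisFun_apply]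
    rfl

theorem HolderDef.eq_zero_of_dirichlet [Nontrivial E] (hk : 1 ≤ k) (hθ : 0 ≤ θ)
    (h : HolderDef k θ ρ) (hconn : IsConnected {x | ρ x < 0}) {v : E → ℝ}
    (hv : ContDiffOn ℝ (2 * k : ℕ) v (closure {x | ρ x < 0}))
    (h0 : ∀ x, ρ x < 0 → (lap b)^[k] v x = 0)
    (hz : ∀ i < k, ∀ z, ρ z = 0 → iteratedFDerivWithin ℝ i v (closure {x | ρ x < 0}) z = 0) {x : E}
    (hx : ρ x < 0) : v x = 0 := by
  have hG : IsCompact (closure {x | ρ x < 0}) := h.bdd.isCompact_closure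
  obtain ⟨D, hD⟩ := h.exists_decay hk hθ isOpen_univ hG (subset_univ _) (v := v)
    (by rwa [inter_univ]) (fun i hi z _ hz0 => by rw [inter_univ]; exact hz i hi z hz0)
  have hv' := hv.mono (subset_closure (s := {x | ρ x < 0}))
  have hD' : ∀ y, ρ y < 0 → |v y| ≤ D * |ρ y| ^ k := fun y hy => hD y hy (by
    obtain ⟨z, -, hd, hpos, -⟩ := h.exists_nearest hy
    rw [← closure_ball y (hd ▸ hpos).ne']
    exact closure_mono HolderDef.ball_subset)
  have hρ1 : ContDiff ℝ 1 ρ := h.smooth.of_le (by exact_mod_cast (by omega : 1 ≤ 2 * k))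
  obtain ⟨a, ha⟩ := h.isOpen.exists_is_const_of_fderiv_eq_zero hconn.isPreconnected
    (hv'.differentiableOn (by exact_mod_cast (by omega : 2 * k ≠ 0)))
    (fun y hy => ContinuousLinearMap.ext fun e =>
      dd_eq_zero_of_dirichlet b k hk hρ1 h.bdd hv' h0 hD' hy e)
  obtain ⟨z, hz0, -, -, hseg⟩ := h.exists_nearest hx
  have hzc := (hseg (left_mem_segment ℝ z x)).1
  have hcl : EqOn v (fun _ => a) (closure {x | ρ x < 0}) :=
    EqOn.of_subset_closure ha hv.continuousOn continuousOn_const subset_closure subset_rfl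
  have h1 : v z = 0 := by
    rw [← norm_eq_zero, ← norm_iteratedFDerivWithin_zero (𝕜 := ℝ)
      (s := closure {x | ρ x < 0}), hz 0 (by omega) z hz0, norm_zero]
  rw [ha x hx, ← h1, hcl hzc]

end LocalEstimate

end PolyharmonicEstimates

/-- Local Schauder estimate: for a polyharmonic function `v` on `B_{2R} ∩ Ω` with
homogeneous Dirichlet boundary conditions on `B_{2R} ∩ ∂Ω`,
`‖∇^r v‖_{L^∞(B_R ∩ Ω)} ≤ (C/Rʳ) ‖v‖_{L^∞(B_{2R} ∩ Ω)}` with `C` uniform in `R`. -/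
theorem local_schauder_estimate
    (n k : ℕ) (θ : ℝ) (hk : 1 ≤ k) (hn : 2*k < n) (hθ : θ ∈ Ioo (0:ℝ) 1)
    (Ω : Set (Euc n)) (hΩ : IsHolderDomain n (2*k) θ Ω)
    (r : ℕ) (hr : r ≤ 2*k) :
    ∃ C > (0:ℝ), ∀ R : ℝ, 0 < R → ∀ c : Euc n, ∀ v : Euc n → ℝ,
      ContDiffOn ℝ (2*k) v (closure (ball c (2*R) ∩ Ω)) →
      (∀ x ∈ ball c (2*R) ∩ Ω, polyLap k v x = 0) →
      (∀ i : ℕ, i < k → ∀ x ∈ ball c (2*R) ∩ frontier Ω,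
        iteratedFDerivWithin ℝ i v (closure (ball c (2*R) ∩ Ω)) x = 0) →
      ∀ x ∈ ball c R ∩ Ω,
        ‖iteratedFDeriv ℝ r v x‖ ≤
          (C / R ^ r) * sSup ((fun y => |v y|) '' (ball c (2*R) ∩ Ω)) := by
  obtain ⟨hΩo, hΩb, hconn, ρ, hρ, hhol, hΩ, hfr, hgrad⟩ := hΩ
  have h : HolderDef k θ ρ :=
    ⟨hρ, hhol, hΩ ▸ hΩb, hΩ ▸ hfr, fun x hx => hgrad x (by rw [hfr]; exact hx)⟩
  have : Nonempty (Fin n) := ⟨⟨0, by omega⟩⟩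
  have : Nontrivial (Euc n) := inferInstance
  obtain ⟨R₀, C, hR₀, hC, hest⟩ :=
    h.exists_estimate (EuclideanSpace.basisFun (Fin n) ℝ) hk hθ.1 hθ.2.le
  obtain ⟨A, hA⟩ := Metric.isBounded_iff.1 hΩb.closure
  obtain ⟨κ, hκ⟩ : ∃ κ, κ = R₀ / (4 * (|A| + R₀)) := ⟨_, rfl⟩
  have hAR : 0 < |A| + R₀ := by positivity
  have hκ0 : 0 < κ := by rw [hκ]; positivity
  have hκ1 : κ ≤ 1 / 4 := by
    rw [hκ, div_le_iff₀ (by positivity)]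
    linarith [abs_nonneg A]
  refine ⟨C / κ ^ r + 1, by positivity, fun R hR c v hv h0 hz x ⟨hxB, hx⟩ => ?_⟩
  have hv : ContDiffOn ℝ (2 * k : ℕ) v (closure (ball c (2 * R) ∩ Ω)) := by exact_mod_cast hv
  have hsup0 : 0 ≤ sSup ((fun y => |v y|) '' (ball c (2*R) ∩ Ω)) :=
    Real.sSup_nonneg (by rintro _ ⟨y, -, rfl⟩; exact abs_nonneg _)
  have hBΩ : IsOpen (ball c (2 * R) ∩ Ω) := isOpen_ball.inter hΩo
  have hlap : ∀ y ∈ ball c (2 * R) ∩ Ω,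
      (lap (EuclideanSpace.basisFun (Fin n) ℝ))^[k] v y = 0 := fun y hy => by
    have h1 := polyLap_eqOn hBΩ k (hv.mono subset_closure) hy
    rw [h0 y hy] at h1
    exact (mul_eq_zero.1 h1.symm).resolve_left (by positivity)
  rw [mem_ball] at hxB
  rcases le_or_gt R (|A| + R₀) with hRA | hRA
  · have ht : 0 < κ * R := by positivity
    have htR : κ * R ≤ R₀ := by
      calc κ * R ≤ κ * (|A| + R₀) := by gcongr
        _ = R₀ / 4 := by rw [hκ]; field_simp
        _ ≤ R₀ := by linarith
    have htR' : 4 * (κ * R) ≤ R := by nlinarith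
    have hsub : closedBall x (4 * (κ * R)) ⊆ ball c (2 * R) :=
      closedBall_subset_ball' (by linarith)
    have hsub' : ball x (2 * (κ * R)) ⊆ ball c (2 * R) :=
      (ball_subset_closedBall.trans (closedBall_subset_closedBall (by linarith))).trans hsub
    have hT : closure Ω ∩ ball c (2 * R) = closure (ball c (2 * R) ∩ Ω) ∩ ball c (2 * R) := by
      refine Subset.antisymm (fun y hy => ⟨isOpen_ball.inter_closure ⟨hy.2, hy.1⟩, hy.2⟩)
        (inter_subset_inter_left _ (closure_mono inter_subset_right))
    obtain ⟨D, hD⟩ := h.exists_decay hk hθ.1.le isOpen_ball (isCompact_closedBall _ _) hsub (v := v)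
      (by rw [← hΩ, hT]; exact hv.mono inter_subset_left)
      (fun i hi z hzB hz0 => by
        rw [← hΩ, hT, iteratedFDerivWithin_inter_open isOpen_ball hzB]
        exact hz i hi z ⟨hzB, by rw [hfr]; exact hz0⟩)
    rw [← hΩ] at hD
    have hbdd : BddAbove ((fun y => |v y|) '' (ball c (2 * R) ∩ Ω)) := by
      have : IsCompact (closure (ball c (2 * R) ∩ Ω)) :=
        (hΩb.subset inter_subset_right).isCompact_closure
      exact (this.image_of_continuousOn hv.continuousOn.abs).bddAbove.mono
        (image_mono subset_closure)
    have hlt : ∀ S, sSup ((fun y => |v y|) '' (ball c (2*R) ∩ Ω)) < S →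
        ‖iteratedFDeriv ℝ r v x‖ ≤ C * (S / (κ * R) ^ r) := fun S hS => by
      refine hest (κ * R) ht htR x (hΩ ▸ hx :) v S D (hsup0.trans_lt hS) ?_ ?_ ?_ ?_ r hr
      · rw [← hΩ]
        exact hv.mono ((inter_subset_inter_left _ hsub').trans subset_closure)
      · exact fun y hy hy0 => hlap y ⟨hsub' hy, hΩ ▸ hy0⟩
      · exact fun y hy hy0 => (le_csSup hbdd (mem_image_of_mem _ ⟨hsub' hy, hΩ ▸ hy0⟩)).trans hS.le
      · rw [← hΩ]
        exact fun y hy hy0 hyt => hD y hy0 (closedBall_subset_closedBall' (by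
          rw [mem_ball] at hy; linarith))
    have hlim : ‖iteratedFDeriv ℝ r v x‖ ≤
        C * (sSup ((fun y => |v y|) '' (ball c (2*R) ∩ Ω)) / (κ * R) ^ r) :=
      ge_of_tendsto (x := nhdsWithin (sSup ((fun y => |v y|) '' (ball c (2*R) ∩ Ω))) (Ioi _))
        (((continuous_id.div_const _).const_mul C).tendsto _ |>.mono_left nhdsWithin_le_nhds)
        (eventually_mem_nhdsWithin.mono hlt)
    refine hlim.trans ?_
    rw [mul_pow, mul_div_assoc', mul_comm C, mul_div_assoc, mul_comm, ← div_div]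
    gcongr
    linarith
  · have hΩB : closure Ω ⊆ ball c (2 * R) := fun y hy => by
      have h1 := (hA hy (subset_closure hx)).trans (le_abs_self A)
      rw [mem_ball]
      linarith [dist_triangle y x c]
    rw [inter_eq_right.2 (subset_closure.trans hΩB)] at *
    have hzero : EqOn v (fun _ => 0) Ω := fun y hy => by
      rw [hΩ] at hconn hv hy hlap
      refine h.eq_zero_of_dirichlet (EuclideanSpace.basisFun (Fin n) ℝ) hk hθ.1.le hconn hv hlap
        (fun i hi z hz0 => ?_) hy
      have hzf : z ∈ frontier Ω := by rw [hfr]; exact hz0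
      rw [← hΩ]
      exact hz i hi z ⟨hΩB (frontier_subset_closure hzf), hzf⟩
    have h1 := (hzero.eventuallyEq_of_mem (hΩo.mem_nhds hx)).iteratedFDeriv ℝ r
    rw [h1.eq_of_nhds, iteratedFDeriv_fun_zero, Pi.zero_apply, norm_zero]
    positivity
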